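/- Let M ⊂ ℂ³ be a smooth pseudoconvex real hypersurface and p ∈ M. Then the three regular 1-types of M at p agree: t^{(1)}(M,p) = c^{(1)}(M,p) = a^{(1)}(M,p), where t^{(1)}(M,p) is the supremum of the commutator types t_L(M,p) over nowhere-vanishing smooth CR vector fields L near p, c^{(1)}(M,p) is the supremum of the Levi-form types c_L(M,p) over such L, and a^{(1)}(M,p) is the supremum over nonsingular holomorphic curves through p of their order of contact with M at p. -/

import Mathlib

open Topology

/-- ℂⁿ as a Pi type. -/
abbrev Cn (n : ℕ) := Fin n → ℂ

/-- The Wirtinger derivative `∂f/∂z_j` of a (real-)smooth function `f : ℂⁿ → ℂ`. -/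
noncomputable def wz {n : ℕ} (j : Fin n) (f : Cn n → ℂ) (x : Cn n) : ℂ :=
  (fderiv ℝ f x (Pi.single j 1) - Complex.I * fderiv ℝ f x (Pi.single j Complex.I)) / 2

/-- The Wirtinger derivative `∂f/∂z̄_j` of a (real-)smooth function `f : ℂⁿ → ℂ`. -/
noncomputable def wzb {n : ℕ} (j : Fin n) (f : Cn n → ℂ) (x : Cn n) : ℂ :=
  (fderiv ℝ f x (Pi.single j 1) + Complex.I * fderiv ℝ f x (Pi.single j Complex.I)) / 2

/-- The complexification of a real-valued function on ℂⁿ. -/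
def cx {n : ℕ} (ρ : Cn n → ℝ) : Cn n → ℂ := fun x => (ρ x : ℂ)

/-- A complex vector field of mixed type `(1,0) + (0,1)` on ℂⁿ:
`W = Σ_j hol_j ∂/∂z_j + Σ_j anti_j ∂/∂z̄_j`. -/
structure CVF (n : ℕ) where
  hol : Fin n → Cn n → ℂ
  anti : Fin n → Cn n → ℂ

/-- Action of a mixed-type complex vector field on functions, as a derivation. -/
noncomputable def CVF.act {n : ℕ} (W : CVF n) (f : Cn n → ℂ) : Cn n → ℂ :=
  fun x => (∑ j, W.hol j x * wz j f x) + (∑ j, W.anti j x * wzb j f x)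

/-- Lie bracket of two mixed-type complex vector fields (with smooth coefficients the
commutator `[V,W]` of the first–order operators is again first order with these
coefficients). -/
noncomputable def CVF.bracket {n : ℕ} (V W : CVF n) : CVF n where
  hol := fun j x => V.act (W.hol j) x - W.act (V.hol j) x
  anti := fun j x => V.act (W.anti j) x - W.act (V.anti j) x

/-- The `(1,0)` vector field `L = Σ_j a_j ∂/∂z_j`. -/
def LVF {n : ℕ} (a : Fin n → Cn n → ℂ) : CVF n := ⟨a, fun _ _ => 0⟩

/-- The conjugate `(0,1)` vector field `L̄ = Σ_j ā_j ∂/∂z̄_j`. -/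
def LbarVF {n : ℕ} (a : Fin n → Cn n → ℂ) : CVF n :=
  ⟨fun _ _ => 0, fun j x => starRingEnd ℂ (a j x)⟩

/-- `a` is a smooth CR vector field along `M = {ρ = 0}`: smooth coefficients annihilating
`ρ` in the `(1,0)` directions, i.e. `Σ_j a_j ∂ρ/∂z_j = 0` on `M`. -/
def IsCRField {n : ℕ} (ρ : Cn n → ℝ) (M : Set (Cn n)) (a : Fin n → Cn n → ℂ) : Prop :=
  (∀ j, ContDiff ℝ (⊤ : ℕ∞) (a j)) ∧ ∀ x ∈ M, ∑ j, a j x * wz j (cx ρ) x = 0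

/-- Membership in the module `𝓜₁(L)` generated over smooth functions by `L` and `L̄`. -/
def InM1 {n : ℕ} (a : Fin n → Cn n → ℂ) (W : CVF n) : Prop :=
  ∃ c₁ c₂ : Cn n → ℂ, ContDiff ℝ (⊤ : ℕ∞) c₁ ∧ ContDiff ℝ (⊤ : ℕ∞) c₂ ∧
    (∀ j x, W.hol j x = c₁ x * a j x) ∧ (∀ j x, W.anti j x = c₂ x * starRingEnd ℂ (a j x))

/-- `ν_L(f)(p)`: the smallest `m` such that `Y_m(⋯(Y_1 f)⋯)(p) ≠ 0` for some
`Y₁, …, Y_m ∈ 𝓜₁(L)`; `⊤` if no such `m` exists. -/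
noncomputable def nuL {n : ℕ} (a : Fin n → Cn n → ℂ) (f : Cn n → ℂ) (p : Cn n) : ℕ∞ :=
  sInf {m : ℕ∞ | ∃ Ws : List (CVF n), (Ws.length : ℕ∞) = m ∧ (∀ W ∈ Ws, InM1 a W) ∧
    (Ws.foldl (fun g W => W.act g) f) p ≠ 0}

/-- The coefficient `∂²ρ/∂z_j ∂z̄_l` of the Levi form. -/
noncomputable def leviCoeff {n : ℕ} (ρ : Cn n → ℝ) (j l : Fin n) (x : Cn n) : ℂ :=
  wz j (wzb l (cx ρ)) x

/-- The Levi form `λ(X,Y) = Σ_{j,l} (∂²ρ/∂z_j∂z̄_l) ξ_j η̄_l` of the fields with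
coefficients `ξ`, `η`, as a function on ℂⁿ. -/
noncomputable def levi {n : ℕ} (ρ : Cn n → ℝ) (ξ η : Fin n → Cn n → ℂ) (x : Cn n) : ℂ :=
  ∑ j, ∑ l, leviCoeff ρ j l x * ξ j x * starRingEnd ℂ (η l x)

/-- `M = {ρ = 0}` is pseudoconvex: the Levi form is positive semi-definite on the
CR directions at every point of `M`. -/
def Pseudoconvex {n : ℕ} (ρ : Cn n → ℝ) (M : Set (Cn n)) : Prop :=
  ∀ x ∈ M, ∀ ξ : Fin n → ℂ, (∑ j, ξ j * wz j (cx ρ) x) = 0 →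
    0 ≤ (∑ j, ∑ l, leviCoeff ρ j l x * ξ j * starRingEnd ℂ (ξ l)).re

/-- Iterated commutators of length `μ` of elements of `𝓜₁(L)`:
`[Y_μ, [Y_{μ-1}, ⋯ [Y₂, Y₁]⋯]]` with each `Y_i ∈ 𝓜₁(L)`. -/
inductive IsCommOf {n : ℕ} (a : Fin n → Cn n → ℂ) : ℕ → CVF n → Prop
  | one (W : CVF n) : InM1 a W → IsCommOf a 1 W
  | succ {μ : ℕ} (V W : CVF n) : InM1 a V → IsCommOf a μ W → IsCommOf a (μ + 1) (V.bracket W)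

/-- The pairing `⟨∂ρ, G⟩(p)` of a mixed-type field with the `(1,0)` form `∂ρ`. -/
noncomputable def pairDRho {n : ℕ} (ρ : Cn n → ℝ) (G : CVF n) (p : Cn n) : ℂ :=
  ∑ j, G.hol j p * wz j (cx ρ) p

/-- The commutator type `t_L(M,p)`: the smallest `m` such that `⟨∂ρ, G⟩(p) ≠ 0` for some
iterated commutator `G` of length (at most) `m` of elements of `𝓜₁(L)`; `⊤` if none. -/
noncomputable def tType {n : ℕ} (ρ : Cn n → ℝ) (a : Fin n → Cn n → ℂ) (p : Cn n) : ℕ∞ :=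
  sInf {m : ℕ∞ | ∃ μ : ℕ, (μ : ℕ∞) = m ∧ ∃ G : CVF n, IsCommOf a μ G ∧ pairDRho ρ G p ≠ 0}

/-- The Levi-form type `c_L(M,p) = 2 + ν_L(λ(L,L))(p)`. -/
noncomputable def cType {n : ℕ} (ρ : Cn n → ℝ) (a : Fin n → Cn n → ℂ) (p : Cn n) : ℕ∞ :=
  2 + nuL a (levi ρ a a) p

/-- The vanishing order at `0` of a smooth function on a normed space: the smallest `k`
with `iteratedFDeriv ℝ k g 0 ≠ 0` (`⊤` if none). -/
noncomputable def ordAt {E : Type*} [NormedAddCommGroup E] [NormedSpace ℝ E]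
    (g : E → ℝ) : ℕ∞ :=
  sInf {m : ℕ∞ | ∃ k : ℕ, (k : ℕ∞) = m ∧ iteratedFDeriv ℝ k g 0 ≠ 0}

/-- `t^{(1)}(M,p)`: supremum of the commutator types `t_L(M,p)` over smooth CR vector
fields `L` along `M` near `p` that vanish nowhere near `p`. -/
noncomputable def tOne {n : ℕ} (ρ : Cn n → ℝ) (M : Set (Cn n)) (p : Cn n) : ℕ∞ :=
  sSup {t : ℕ∞ | ∃ a : Fin n → Cn n → ℂ, (∀ j, ContDiff ℝ (⊤ : ℕ∞) (a j)) ∧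
    (∀ᶠ x in nhds p, x ∈ M → ∑ j, a j x * wz j (cx ρ) x = 0) ∧
    (∀ᶠ x in nhds p, (fun j => a j x) ≠ 0) ∧ t = tType ρ a p}

/-- `c^{(1)}(M,p)`: supremum of the Levi-form types `c_L(M,p)` over smooth CR vector
fields `L` along `M` near `p` that vanish nowhere near `p`. -/
noncomputable def cOne {n : ℕ} (ρ : Cn n → ℝ) (M : Set (Cn n)) (p : Cn n) : ℕ∞ :=
  sSup {t : ℕ∞ | ∃ a : Fin n → Cn n → ℂ, (∀ j, ContDiff ℝ (⊤ : ℕ∞) (a j)) ∧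
    (∀ᶠ x in nhds p, x ∈ M → ∑ j, a j x * wz j (cx ρ) x = 0) ∧
    (∀ᶠ x in nhds p, (fun j => a j x) ≠ 0) ∧ t = cType ρ a p}

/-- `a^{(1)}(M,p)`: supremum over nonsingular holomorphic curves `φ` through `p`
(`φ(0) = p`, `φ′(0) ≠ 0`) of the order of contact of `φ` with `M` at `p`, i.e. of the
vanishing order of `ρ ∘ φ` at `0`. -/
noncomputable def aOne {n : ℕ} (ρ : Cn n → ℝ) (p : Cn n) : ℕ∞ :=
  sSup {t : ℕ∞ | ∃ φ : ℂ → Cn n, AnalyticAt ℂ φ 0 ∧ φ 0 = p ∧ fderiv ℂ φ 0 ≠ 0 ∧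
    t = ordAt (fun ξ => ρ (φ ξ))}

/-- The algebra of smooth complex-valued functions on `ℂⁿ`, as a subalgebra. -/
def smoothSubalgebra (n : ℕ) : Subalgebra ℂ (Cn n → ℂ) where
  carrier := {f | ContDiff ℝ (⊤ : ℕ∞) f}
  mul_mem' {f g} (ha : ContDiff ℝ (⊤ : ℕ∞) f) (hb : ContDiff ℝ (⊤ : ℕ∞) g) := ha.mul hb
  add_mem' {f g} (ha : ContDiff ℝ (⊤ : ℕ∞) f) (hb : ContDiff ℝ (⊤ : ℕ∞) g) := ha.add hb
  algebraMap_mem' c := (contDiff_const : ContDiff ℝ (⊤ : ℕ∞) (fun _ : Cn n => c))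

/-- The algebra of smooth complex-valued functions on `ℂⁿ`. -/
def SF (n : ℕ) : Type := smoothSubalgebra n

namespace SF

variable {n : ℕ}

noncomputable instance : CommRing (SF n) := inferInstanceAs (CommRing (smoothSubalgebra n))
noncomputable instance : Algebra ℂ (SF n) := inferInstanceAs (Algebra ℂ (smoothSubalgebra n))

instance : FunLike (SF n) (Cn n) ℂ where
  coe f := f.1
  coe_injective _ _ h := Subtype.ext h

/-- Bundle a smooth function. -/
def mk (f : Cn n → ℂ) (h : ContDiff ℝ (⊤ : ℕ∞) f) : SF n := ⟨f, h⟩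

theorem smooth (f : SF n) : ContDiff ℝ (⊤ : ℕ∞) (f : Cn n → ℂ) := f.2

theorem diffAt (f : SF n) (x : Cn n) : DifferentiableAt ℝ (f : Cn n → ℂ) x :=
  (f.smooth.differentiable (by simp)) x

@[simp] theorem coe_mk (f : Cn n → ℂ) (h : ContDiff ℝ (⊤ : ℕ∞) f) :
    (mk f h : Cn n → ℂ) = f := rfl
theorem mk_apply (f : Cn n → ℂ) (h : ContDiff ℝ (⊤ : ℕ∞) f) (x : Cn n) : mk f h x = f x := rfl
@[simp] theorem add_apply (f g : SF n) (x : Cn n) : (f + g) x = f x + g x := rfl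
@[simp] theorem sub_apply (f g : SF n) (x : Cn n) : (f - g) x = f x - g x := rfl
@[simp] theorem neg_apply (f : SF n) (x : Cn n) : (-f) x = -f x := rfl
@[simp] theorem mul_apply (f g : SF n) (x : Cn n) : (f * g) x = f x * g x := rfl
@[simp] theorem smul_apply (c : ℂ) (f : SF n) (x : Cn n) : (c • f) x = c * f x := rfl
@[simp] theorem zero_apply (x : Cn n) : (0 : SF n) x = 0 := rfl
@[simp] theorem one_apply (x : Cn n) : (1 : SF n) x = 1 := rfl
@[simp] theorem algebraMap_apply (c : ℂ) (x : Cn n) : (algebraMap ℂ (SF n) c) x = c := rfl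

@[ext] theorem ext {f g : SF n} (h : ∀ x, f x = g x) : f = g := DFunLike.ext _ _ h

/-- Evaluation at a point. -/
def ev (x : Cn n) : SF n →ₐ[ℂ] ℂ where
  toFun f := f x
  map_one' := rfl
  map_mul' _ _ := rfl
  map_zero' := rfl
  map_add' _ _ := rfl
  commutes' _ := rfl

@[simp] theorem ev_apply (x : Cn n) (f : SF n) : ev x f = f x := rfl

@[simp] theorem sum_apply {ι : Type*} (s : Finset ι) (f : ι → SF n) (x : Cn n) :
    (∑ i ∈ s, f i) x = ∑ i ∈ s, f i x := map_sum (ev x) f s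

/-- Derivative in a constant direction. -/
noncomputable def dir (v : Cn n) : SF n →ₗ[ℂ] SF n where
  toFun f := ⟨fun x => fderiv ℝ f x v,
    (f.smooth.fderiv_right (m := (⊤ : ℕ∞)) (by simp)).clm_apply contDiff_const⟩
  map_add' f g := by
    ext x
    change fderiv ℝ (fun y => f y + g y) x v = fderiv ℝ f x v + fderiv ℝ g x v
    rw [fderiv_fun_add (f.diffAt x) (g.diffAt x)]; rfl
  map_smul' c f := by
    ext x
    change fderiv ℝ (fun y => c * f y) x v = c * fderiv ℝ f x v
    rw [fderiv_const_mul (f.diffAt x)]; rfl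

@[simp] theorem dir_apply (v : Cn n) (f : SF n) (x : Cn n) : dir v f x = fderiv ℝ f x v := rfl

theorem dir_mul (v : Cn n) (f g : SF n) : dir v (f * g) = f * dir v g + g * dir v f := by
  ext x
  change fderiv ℝ (fun y => f y * g y) x v = f x * fderiv ℝ g x v + g x * fderiv ℝ f x v
  rw [fderiv_fun_mul (f.diffAt x) (g.diffAt x)]; rfl

theorem dir_comm (u v : Cn n) (f : SF n) : dir u (dir v f) = dir v (dir u f) := by
  have key : ∀ (u v x : Cn n), dir u (dir v f) x = fderiv ℝ (fderiv ℝ f) x u v := by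
    intro u v x
    have hd : DifferentiableAt ℝ (fderiv ℝ (f : Cn n → ℂ)) x :=
      ((f.smooth.fderiv_right (m := (⊤ : ℕ∞)) (by simp)).differentiable (by simp)) x
    change fderiv ℝ (fun y => fderiv ℝ f y v) x u = _
    rw [fderiv_clm_apply hd (differentiableAt_const v)]
    simp
  ext x
  rw [key, key]
  have := (f.smooth.contDiffAt (x := x)).isSymmSndFDerivAt
    (by simpa using (WithTop.coe_le_coe.2 le_top : ((2 : ℕ∞) : WithTop ℕ∞) ≤ ((⊤ : ℕ∞) : WithTop ℕ∞)))
  exact this.eq u v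

/-- The sign of `I` in the Wirtinger derivatives. -/
def sgnI (b : Bool) : ℂ := if b then Complex.I else -Complex.I

@[simp] theorem sgnI_true : sgnI true = Complex.I := rfl
@[simp] theorem sgnI_false : sgnI false = -Complex.I := rfl

/-- The Wirtinger derivatives: `D (j, false) = ∂/∂z_j` and `D (j, true) = ∂/∂z̄_j`. -/
noncomputable def D (i : Fin n × Bool) : Derivation ℂ (SF n) (SF n) :=
  Derivation.mk'
    ((2⁻¹ : ℂ) • (dir (Pi.single i.1 1)
      + sgnI i.2 • dir (Pi.single i.1 Complex.I)))
    (fun f g => by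
      simp only [LinearMap.smul_apply, LinearMap.add_apply, dir_mul, smul_eq_mul]
      ext x
      simp
      ring)

theorem D_eq (i : Fin n × Bool) (f : SF n) :
    D i f = (2⁻¹ : ℂ) • (dir (Pi.single i.1 1) f
      + sgnI i.2 • dir (Pi.single i.1 Complex.I) f) := rfl

theorem D_false (j : Fin n) (f : SF n) (x : Cn n) : D (j, false) f x = wz j f x := by
  simp [D_eq, wz]; ring

theorem D_true (j : Fin n) (f : SF n) (x : Cn n) : D (j, true) f x = wzb j f x := by
  simp [D_eq, wzb]; ring

theorem D_comm (i j : Fin n × Bool) (f : SF n) : D i (D j f) = D j (D i f) := by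
  simp only [D_eq, map_smul, map_add]
  rw [dir_comm (Pi.single i.1 1) (Pi.single j.1 1), dir_comm (Pi.single i.1 1),
    dir_comm (Pi.single i.1 Complex.I), dir_comm (Pi.single i.1 Complex.I)]
  ext x
  simp
  ring

/-- Complex conjugation of smooth functions. -/
noncomputable def conj : SF n →+* SF n where
  toFun f := ⟨fun x => starRingEnd ℂ (f x), Complex.conjCLE.contDiff.comp f.smooth⟩
  map_one' := by ext x; exact map_one (starRingEnd ℂ)
  map_mul' f g := by
    ext x; exact map_mul (starRingEnd ℂ) (f x) (g x)
  map_zero' := by ext x; exact map_zero (starRingEnd ℂ)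
  map_add' f g := by
    ext x; exact map_add (starRingEnd ℂ) (f x) (g x)

@[simp] theorem conj_apply (f : SF n) (x : Cn n) : conj f x = starRingEnd ℂ (f x) := rfl

@[simp] theorem conj_conj (f : SF n) : conj (conj f) = f := by ext x; simp

theorem conj_smul (c : ℂ) (f : SF n) : conj (c • f) = starRingEnd ℂ c • conj f := by
  ext x; simp

theorem dir_conj (v : Cn n) (f : SF n) : dir v (conj f) = conj (dir v f) := by
  ext x
  change fderiv ℝ (fun y => Complex.conjCLE (f y)) x v = Complex.conjCLE (fderiv ℝ f x v)
  have := (Complex.conjCLE.toContinuousLinearMap.hasFDerivAt.comp x (f.diffAt x).hasFDerivAt).fderiv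
  have h2 := congrArg (fun L => L v) this
  exact h2

/-- The conjugate letter. -/
def bar (i : Fin n × Bool) : Fin n × Bool := (i.1, !i.2)

@[simp] theorem bar_bar (i : Fin n × Bool) : bar (bar i) = i := by simp [bar]
@[simp] theorem bar_mk (j : Fin n) (b : Bool) : bar (j, b) = (j, !b) := rfl

theorem conj_D (i : Fin n × Bool) (f : SF n) : conj (D i f) = D (bar i) (conj f) := by
  obtain ⟨j, b⟩ := i
  rw [D_eq, D_eq, conj_smul, map_add, conj_smul, dir_conj, dir_conj]
  have h2 : (starRingEnd ℂ) (2 : ℂ) = 2 := Complex.conj_ofNat 2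
  cases b <;> simp [h2]

/-- Coordinate functions: `X (j, false) = z_j`, `X (j, true) = z̄_j`. -/
noncomputable def X (i : Fin n × Bool) : SF n :=
  if i.2 then conj (mk (fun x => x i.1) (contDiff_apply ℝ ℂ i.1))
  else (mk (fun x => x i.1) (contDiff_apply ℝ ℂ i.1))

@[simp] theorem X_false (j : Fin n) (x : Cn n) : X (j, false) x = x j := rfl
@[simp] theorem X_true (j : Fin n) (x : Cn n) : X (j, true) x = starRingEnd ℂ (x j) := rfl

theorem conj_X (i : Fin n × Bool) : conj (X i) = X (bar i) := by
  obtain ⟨j, b⟩ := i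
  ext x
  cases b <;> simp

theorem D_X_false (i : Fin n × Bool) (j : Fin n) :
    D i (X (j, false)) = if i = (j, false) then 1 else 0 := by
  obtain ⟨l, b⟩ := i
  have h : ∀ v x : Cn n, fderiv ℝ (X (j, false) : Cn n → ℂ) x v = v j := by
    intro v x
    have : (X (j, false) : Cn n → ℂ) = fun y => (ContinuousLinearMap.proj (R := ℝ) j) y := rfl
    rw [this, ContinuousLinearMap.fderiv]; rfl
  ext x
  simp only [D_eq, smul_apply, add_apply, dir_apply, h]
  by_cases hl : l = j
  · subst hl
    cases b
    · simp; norm_num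
    · simp
  · cases b <;> simp [hl, Ne.symm hl]

theorem D_X (i j : Fin n × Bool) : D i (X j) = if i = j then 1 else 0 := by
  obtain ⟨j, b⟩ := j
  cases b
  · exact D_X_false i j
  · have h1 : (X (j, true) : SF n) = conj (X (j, false)) := rfl
    have h2 := conj_D (bar i) (X (j, false))
    rw [bar_bar] at h2
    rw [h1, ← h2, D_X_false]
    obtain ⟨l, c⟩ := i
    cases c <;> by_cases hl : l = j <;> simp [hl]

/-- The polynomial function attached to a polynomial in the coordinates and their conjugates. -/
noncomputable def hat : MvPolynomial (Fin n × Bool) ℂ →ₐ[ℂ] SF n := MvPolynomial.aeval X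

@[simp] theorem hat_X (i : Fin n × Bool) : hat (MvPolynomial.X i) = (X i : SF n) := by simp [hat]
@[simp] theorem hat_C (c : ℂ) : hat (MvPolynomial.C c) = algebraMap ℂ (SF n) c := by simp [hat]

theorem D_hat (i : Fin n × Bool) (p : MvPolynomial (Fin n × Bool) ℂ) :
    D i (hat p) = hat (MvPolynomial.pderiv i p) := by
  classical
  induction p using MvPolynomial.induction_on with
  | C c => simp
  | add p q hp hq => simp [hp, hq]
  | mul_X p j hp =>
    simp only [map_mul, hat_X, Derivation.leibniz, hp, D_X, smul_eq_mul, map_add,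
      MvPolynomial.pderiv_X]
    congr 2
    by_cases h : i = j
    · subst h; simp
    · simp [h, Ne.symm h]

end SF

namespace SF

variable {n : ℕ}

/-- Iterated Wirtinger derivatives along a list of letters. -/
noncomputable def Dl : List (Fin n × Bool) → SF n → SF n
  | [], f => f
  | i :: l, f => Dl l (D i f)

@[simp] theorem Dl_nil (f : SF n) : Dl [] f = f := rfl
@[simp] theorem Dl_cons (i : Fin n × Bool) (l : List (Fin n × Bool)) (f : SF n) :
    Dl (i :: l) f = Dl l (D i f) := rfl

theorem Dl_add (l : List (Fin n × Bool)) (f g : SF n) : Dl l (f + g) = Dl l f + Dl l g := by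
  induction l generalizing f g with
  | nil => rfl
  | cons i l ih => simp [ih]

theorem Dl_smul (l : List (Fin n × Bool)) (c : ℂ) (f : SF n) : Dl l (c • f) = c • Dl l f := by
  induction l generalizing f with
  | nil => rfl
  | cons i l ih => simp [ih]

theorem conj_Dl (l : List (Fin n × Bool)) (f : SF n) :
    conj (Dl l f) = Dl (l.map bar) (conj f) := by
  induction l generalizing f with
  | nil => rfl
  | cons i l ih => simp [ih, conj_D]

/-- The weight of a word of derivatives. -/
def wt (w : Fin n → ℕ) (l : List (Fin n × Bool)) : ℤ := (l.map fun i => (w i.1 : ℤ)).sum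

@[simp] theorem wt_nil (w : Fin n → ℕ) : wt w [] = 0 := rfl
@[simp] theorem wt_cons (w : Fin n → ℕ) (i : Fin n × Bool) (l : List (Fin n × Bool)) :
    wt w (i :: l) = w i.1 + wt w l := by simp [wt]

theorem wt_nonneg (w : Fin n → ℕ) (l : List (Fin n × Bool)) : 0 ≤ wt w l := by
  induction l with
  | nil => simp
  | cons i l ih => simp; positivity

/-- `f` vanishes to weighted order at least `s` at the origin. -/
def O (w : Fin n → ℕ) (s : ℤ) (f : SF n) : Prop := ∀ l, wt w l < s → Dl l f 0 = 0

variable {w : Fin n → ℕ}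

theorem O.mono {s t : ℤ} {f : SF n} (h : O w s f) (hts : t ≤ s) : O w t f :=
  fun l hl => h l (by omega)

theorem O_iff {s : ℤ} {f : SF n} :
    O w s f ↔ (0 < s → f 0 = 0) ∧ ∀ i, O w (s - w i.1) (D i f) := by
  constructor
  · exact fun h => ⟨fun hs => h [] (by simpa using hs),
      fun i l hl => h (i :: l) (by simp; omega)⟩
  · rintro ⟨h0, h1⟩ l hl
    cases l with
    | nil => exact h0 (by simpa using hl)
    | cons i l => exact h1 i l (by simp at hl; omega)

theorem O.D {s : ℤ} {f : SF n} (h : O w s f) (i : Fin n × Bool) : O w (s - w i.1) (D i f) :=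
  (O_iff.1 h).2 i

theorem O.apply_zero {s : ℤ} {f : SF n} (h : O w s f) (hs : 0 < s) : f 0 = 0 :=
  (O_iff.1 h).1 hs

theorem O_of_nonpos {s : ℤ} (hs : s ≤ 0) (f : SF n) : O w s f :=
  fun l hl => by have := wt_nonneg w l; omega

theorem O_one {f : SF n} (h : f 0 = 0) (hw : ∀ i, 0 < w i) : O w 1 f :=
  O_iff.2 ⟨fun _ => h, fun i => O_of_nonpos (by have := hw i.1; omega) _⟩

theorem O.add {s : ℤ} {f g : SF n} (hf : O w s f) (hg : O w s g) : O w s (f + g) :=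
  fun l hl => by simp [Dl_add, hf l hl, hg l hl]

theorem O.smul {s : ℤ} {f : SF n} (hf : O w s f) (c : ℂ) : O w s (c • f) :=
  fun l hl => by simp [Dl_smul, hf l hl]

theorem O.neg {s : ℤ} {f : SF n} (hf : O w s f) : O w s (-f) := by
  simpa using hf.smul (-1)

theorem O.sub {s : ℤ} {f g : SF n} (hf : O w s f) (hg : O w s g) : O w s (f - g) := by
  rw [sub_eq_add_neg]; exact hf.add hg.neg

theorem O_zero (s : ℤ) : O w s (0 : SF n) := fun l _ => by
  have := Dl_smul l 0 (0 : SF n)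
  rw [zero_smul, zero_smul] at this
  rw [this, zero_apply]

theorem O_sum {ι : Type*} {s : ℤ} {t : Finset ι} {f : ι → SF n} (h : ∀ i ∈ t, O w s (f i)) :
    O w s (∑ i ∈ t, f i) := by
  classical
  induction t using Finset.induction_on with
  | empty => simpa using O_zero s
  | insert a t ha ih =>
    rw [Finset.sum_insert ha]
    exact (h a (by simp)).add (ih fun i hi => h i (by simp [hi]))

theorem O.mul {a b : ℤ} {f g : SF n} (hf : O w a f) (hg : O w b g) : O w (a + b) (f * g) := by
  intro l
  induction l generalizing f g a b with
  | nil =>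
    intro hl
    simp only [wt_nil, Dl_nil, mul_apply] at *
    rcases lt_or_ge 0 a with h | h
    · simp [hf.apply_zero h]
    · simp [hg.apply_zero (show 0 < b by omega)]
  | cons i l ih =>
    intro hl
    simp only [wt_cons] at hl
    rw [Dl_cons, Derivation.leibniz, Dl_add, add_apply, smul_eq_mul, smul_eq_mul,
      ih hf (hg.D i) (by omega), ih hg (hf.D i) (by omega), add_zero]

theorem O.mul_left {b : ℤ} {g : SF n} (hg : O w b g) (f : SF n) : O w b (f * g) := by
  simpa using (O_of_nonpos le_rfl f).mul hg

theorem O.conj {s : ℤ} {f : SF n} (hf : O w s f) : O w s (conj f) := by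
  intro l hl
  have h1 : (l.map bar).map bar = l := by simp [Function.comp_def]
  have h2 : wt w (l.map bar) = wt w l := by simp [wt, Function.comp_def, bar]
  have := congrArg (fun g : SF n => g 0) (conj_Dl (l.map bar) f)
  simp only [h1, conj_apply] at this
  rw [← this, hf _ (by omega), map_zero]

theorem O.weaken {w' : Fin n → ℕ} {s : ℤ} {f : SF n} (h : O w s f) (hw : ∀ i, w i ≤ w' i) :
    O w' s f := by
  intro l hl
  refine h l (lt_of_le_of_lt ?_ hl)
  clear hl
  induction l with
  | nil => simp
  | cons i l ih => simp only [wt_cons]; have := hw i.1; omega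

theorem O_X (w : Fin n → ℕ) (i : Fin n × Bool) : O w (w i.1) (X i) := by
  classical
  rw [O_iff]
  refine ⟨fun _ => by obtain ⟨j, b⟩ := i; cases b <;> simp, fun j => ?_⟩
  rw [D_X]
  split_ifs with h
  · subst h; exact O_of_nonpos (by omega) _
  · exact O_zero _

/-- `p` is weighted homogeneous of weight `s ∈ ℤ`. -/
abbrev WH (w : Fin n → ℕ) (p : MvPolynomial (Fin n × Bool) ℂ) (s : ℤ) : Prop :=
  MvPolynomial.IsWeightedHomogeneous (fun i : Fin n × Bool => (w i.1 : ℤ)) p s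

/-- `p` is the leading weighted homogeneous part of `f` in weight `s`. -/
def Lead (w : Fin n → ℕ) (s : ℤ) (f : SF n) (p : MvPolynomial (Fin n × Bool) ℂ) : Prop :=
  WH w p s ∧ O w (s + 1) (f - hat p)

theorem WH.eq_zero_of_neg {p : MvPolynomial (Fin n × Bool) ℂ} {s : ℤ} (h : WH w p s)
    (hs : s < 0) : p = 0 := by
  by_contra hp
  obtain ⟨d, hd⟩ := MvPolynomial.ne_zero_iff.1 hp
  have h1 := h hd
  have h2 : 0 ≤ Finsupp.weight (fun i : Fin n × Bool => (w i.1 : ℤ)) d := by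
    rw [Finsupp.weight_apply]
    exact Finset.sum_nonneg fun i _ => by simp only [nsmul_eq_mul]; positivity
  omega

theorem WH.D {p : MvPolynomial (Fin n × Bool) ℂ} {s : ℤ} (h : WH w p s) (i : Fin n × Bool) :
    WH w (MvPolynomial.pderiv i p) (s - w i.1) :=
  MvPolynomial.IsWeightedHomogeneous.pderiv (h := h) (by ring)

theorem WH.constCoeff {p : MvPolynomial (Fin n × Bool) ℂ} {s : ℤ} (h : WH w p s) (hs : s ≠ 0) :
    MvPolynomial.constantCoeff p = 0 := by
  by_contra hp
  exact hs (by simpa using (h (d := 0) (by simpa [MvPolynomial.constantCoeff_eq] using hp)).symm)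

theorem hat_zero_apply (p : MvPolynomial (Fin n × Bool) ℂ) :
    hat p 0 = MvPolynomial.constantCoeff p := by
  induction p using MvPolynomial.induction_on with
  | C c => simp
  | add p q hp hq => simp [hp, hq]
  | mul_X p j hp => obtain ⟨j, b⟩ := j; cases b <;> simp

theorem WH.O {p : MvPolynomial (Fin n × Bool) ℂ} {s : ℤ} (h : WH w p s) : O w s (hat p) := by
  intro l
  induction l generalizing p s with
  | nil =>
    intro hl
    simp only [wt_nil, Dl_nil] at *
    rw [hat_zero_apply, h.constCoeff hl.ne']
  | cons i l ih =>
    intro hl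
    rw [Dl_cons, D_hat]
    exact ih (h.D i) (by simp at hl; omega)

theorem euler {p : MvPolynomial (Fin n × Bool) ℂ} {s : ℤ} (h : WH w p s) :
    ∑ i, MvPolynomial.C (w i.1 : ℂ) * (MvPolynomial.X i * MvPolynomial.pderiv i p)
      = MvPolynomial.C (s : ℂ) * p := by
  rcases lt_or_ge s 0 with hs | hs
  · simp [h.eq_zero_of_neg hs]
  obtain ⟨k, rfl⟩ := Int.eq_ofNat_of_zero_le hs
  have h' : MvPolynomial.IsWeightedHomogeneous (fun i : Fin n × Bool => w i.1) p k := by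
    intro d hd
    have := h hd
    simp only [Finsupp.weight_apply, Finsupp.sum, nsmul_eq_mul, smul_eq_mul] at this ⊢
    exact_mod_cast this
  have := h'.sum_weight_X_mul_pderiv
  simpa [nsmul_eq_mul] using this

theorem eq_zero_of_pderiv {p : MvPolynomial (Fin n × Bool) ℂ} {s : ℤ} (h : WH w p s)
    (hw : ∀ i, 0 < w i) (hd : ∀ i, MvPolynomial.pderiv i p = 0)
    (h0 : MvPolynomial.constantCoeff p = 0) : p = 0 := by
  by_cases hs : s = 0
  · by_contra hp
    obtain ⟨d, hd⟩ := MvPolynomial.ne_zero_iff.1 hp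
    have h1 := h hd
    rw [hs, Finsupp.weight_apply, Finsupp.sum, Finset.sum_eq_zero_iff_of_nonneg
      (fun i _ => by simp only [nsmul_eq_mul]; positivity)] at h1
    have : d = 0 := by
      ext i
      by_contra hi
      have := h1 i (by simpa using hi)
      have hwi := hw i.1
      simp only [nsmul_eq_mul, mul_eq_zero, Nat.cast_eq_zero] at this
      rcases this with h | h
      · exact hi h
      · omega
    subst this
    exact hd h0
  · have := euler h
    simp only [hd, mul_zero, Finset.sum_const_zero] at this
    rcases mul_eq_zero.1 this.symm with h | h
    · exact absurd (by simpa using h) hs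
    · exact h

theorem WH.eq_zero {p : MvPolynomial (Fin n × Bool) ℂ} {s : ℤ} (h : WH w p s)
    (hw : ∀ i, 0 < w i) (hO : SF.O w (s + 1) (hat p)) : p = 0 := by
  by_cases hs : s < 0
  · exact h.eq_zero_of_neg hs
  obtain ⟨k, hk⟩ := Int.eq_ofNat_of_zero_le (not_lt.1 hs)
  induction k using Nat.strong_induction_on generalizing s p with
  | _ k ih =>
    refine eq_zero_of_pderiv h hw (fun i => ?_) ?_
    · have h1 := h.D i
      have h2 := hO.D i
      rw [D_hat] at h2
      by_cases hi : s - w i.1 < 0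
      · exact h1.eq_zero_of_neg hi
      · have := hw i.1
        exact ih (s - w i.1).toNat (by omega) h1 (by convert h2 using 1; ring) hi (by omega)
    · rw [← hat_zero_apply]; exact hO.apply_zero (by omega)

theorem Lead.O {s : ℤ} {f : SF n} {p} (h : Lead w s f p) : O w s f := by
  have := (h.2.mono (show s ≤ s + 1 by omega)).add h.1.O
  simpa using this

theorem Lead.unique (hw : ∀ i, 0 < w i) {s : ℤ} {f : SF n} {p q} (hp : Lead w s f p)
    (hq : Lead w s f q) : p = q := by
  have h := hq.2.sub hp.2
  have h1 : f - hat q - (f - hat p) = hat (p - q) := by rw [map_sub]; ring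
  rw [h1] at h
  exact sub_eq_zero.1 (WH.eq_zero (hp.1.sub hq.1) hw h)

theorem Lead_zero_iff {s : ℤ} {f : SF n} : Lead w s f 0 ↔ O w (s + 1) f := by
  simp [Lead, MvPolynomial.isWeightedHomogeneous_zero]

theorem Lead.add {s : ℤ} {f g : SF n} {p q} (hf : Lead w s f p) (hg : Lead w s g q) :
    Lead w s (f + g) (p + q) :=
  ⟨hf.1.add hg.1, by
    have := hf.2.add hg.2
    rwa [show f - hat p + (g - hat q) = f + g - hat (p + q) by rw [map_add]; ring] at this⟩

theorem Lead.smul {s : ℤ} {f : SF n} {p} (hf : Lead w s f p) (c : ℂ) :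
    Lead w s (c • f) (MvPolynomial.C c * p) :=
  ⟨by simpa using (MvPolynomial.isWeightedHomogeneous_C _ c).mul hf.1, by
    have := hf.2.smul c
    rwa [show c • (f - hat p) = c • f - hat (MvPolynomial.C c * p) by
      rw [map_mul, hat_C, smul_sub, Algebra.smul_def c (hat p)]] at this⟩

theorem Lead.neg {s : ℤ} {f : SF n} {p} (hf : Lead w s f p) : Lead w s (-f) (-p) := by
  simpa using hf.smul (-1)

theorem Lead.sub {s : ℤ} {f g : SF n} {p q} (hf : Lead w s f p) (hg : Lead w s g q) :
    Lead w s (f - g) (p - q) := by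
  simpa [sub_eq_add_neg] using hf.add hg.neg

theorem Lead.mul {a b : ℤ} {f g : SF n} {p q} (hf : Lead w a f p) (hg : Lead w b g q) :
    Lead w (a + b) (f * g) (p * q) :=
  ⟨hf.1.mul hg.1, by
    have h1 := hf.2.mul hg.O
    have h2 := hf.1.O.mul hg.2
    have := (h1.mono (show a + b + 1 ≤ _ by omega)).add (h2.mono (show a + b + 1 ≤ _ by omega))
    rwa [show (f - hat p) * g + hat p * (g - hat q) = f * g - hat (p * q) by
      rw [map_mul]; ring] at this⟩

theorem Lead.D {s : ℤ} {f : SF n} {p} (hf : Lead w s f p) (i : Fin n × Bool) :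
    Lead w (s - w i.1) (D i f) (MvPolynomial.pderiv i p) :=
  ⟨hf.1.D i, by
    have := hf.2.D i
    rw [map_sub, D_hat] at this
    exact this.mono (by omega)⟩

theorem Lead_weight_zero (hw : ∀ i, 0 < w i) (f : SF n) :
    Lead w 0 f (MvPolynomial.C (f 0)) :=
  ⟨MvPolynomial.isWeightedHomogeneous_C _ _, by simpa using O_one (by simp) hw⟩

theorem Lead.apply_zero (hw : ∀ i, 0 < w i) {f : SF n} {p} (h : Lead w 0 f p) :
    MvPolynomial.constantCoeff p = f 0 := by
  rw [h.unique hw (Lead_weight_zero hw f)]; simp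

theorem exists_lead (hw : ∀ i, 0 < w i) {s : ℤ} {f : SF n} (hf : O w s f) :
    ∃ p, Lead w s f p := by
  rcases lt_or_ge s 0 with hs | hs
  · exact ⟨0, Lead_zero_iff.2 (O_of_nonpos (by omega) f)⟩
  obtain ⟨k, hk⟩ := Int.eq_ofNat_of_zero_le hs
  induction k using Nat.strong_induction_on generalizing s f with
  | _ k ih =>
    rcases Nat.eq_zero_or_pos k with rfl | hk0
    · obtain rfl : s = 0 := by simpa using hk
      exact ⟨_, Lead_weight_zero hw f⟩
    have hex : ∀ i, ∃ p, Lead w (s - w i.1) (D i f) p := by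
      intro i
      have := hw i.1
      by_cases hi : s - w i.1 < 0
      · exact ⟨0, Lead_zero_iff.2 (O_of_nonpos (by omega) _)⟩
      · exact ih (s - w i.1).toNat (by omega) (hf.D i) (by omega) (by omega)
    choose P hP using hex
    have hclosed : ∀ i j, MvPolynomial.pderiv i (P j) = MvPolynomial.pderiv j (P i) := by
      intro i j
      have h1 := (hP j).D i
      have h2 := (hP i).D j
      rw [D_comm] at h1
      rw [sub_right_comm] at h1
      exact h1.unique hw h2
    have hs0 : (s : ℂ) ≠ 0 := by
      have : s ≠ 0 := by omega
      exact_mod_cast this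
    set p : MvPolynomial (Fin n × Bool) ℂ := MvPolynomial.C (s : ℂ)⁻¹ *
      ∑ i, MvPolynomial.C (w i.1 : ℂ) * (MvPolynomial.X i * P i) with hp
    have hpd : ∀ j, MvPolynomial.pderiv j p = P j := by
      intro j
      classical
      have e := euler (hP j).1
      have h1 : MvPolynomial.pderiv j p = MvPolynomial.C (s : ℂ)⁻¹ *
          (MvPolynomial.C (w j.1 : ℂ) * P j + ∑ i, MvPolynomial.C (w i.1 : ℂ) *
            (MvPolynomial.X i * MvPolynomial.pderiv i (P j))) := by
        rw [hp, MvPolynomial.pderiv_C_mul, map_sum]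
        congr 1
        have hterm : ∀ i, MvPolynomial.pderiv j (MvPolynomial.C (w i.1 : ℂ) *
            (MvPolynomial.X i * P i)) = (if i = j then MvPolynomial.C (w j.1 : ℂ) * P j else 0) +
              MvPolynomial.C (w i.1 : ℂ) * (MvPolynomial.X i * MvPolynomial.pderiv i (P j)) := by
          intro i
          rw [MvPolynomial.pderiv_C_mul, Derivation.leibniz, MvPolynomial.pderiv_X, hclosed j i,
            smul_eq_mul, smul_eq_mul]
          split_ifs with h
          · subst h; simp; ring
          · simp [h]
        rw [Finset.sum_congr rfl fun i _ => hterm i, Finset.sum_add_distrib]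
        simp
      rw [h1, e, ← add_mul, ← mul_assoc, ← MvPolynomial.C_add, ← MvPolynomial.C_mul]
      have : (s : ℂ)⁻¹ * ((w j.1 : ℂ) + ((s - w j.1 : ℤ) : ℂ)) = 1 := by
        push_cast; field_simp; ring
      rw [this]; simp
    have hwh : WH w p s := by
      have h1 : WH w (∑ i, MvPolynomial.C (w i.1 : ℂ) * (MvPolynomial.X i * P i)) s := by
        refine MvPolynomial.IsWeightedHomogeneous.sum _ _ _ fun i _ => ?_
        have := (MvPolynomial.isWeightedHomogeneous_C (fun i : Fin n × Bool => (w i.1 : ℤ))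
          (w i.1 : ℂ)).mul ((MvPolynomial.isWeightedHomogeneous_X ℂ
            (fun i : Fin n × Bool => (w i.1 : ℤ)) i).mul (hP i).1)
        convert this using 1; ring
      have h2 := (MvPolynomial.isWeightedHomogeneous_C (fun i : Fin n × Bool => (w i.1 : ℤ))
          (s : ℂ)⁻¹).mul h1
      rwa [zero_add] at h2
    refine ⟨p, hwh, O_iff.2 ⟨fun _ => ?_, fun i => ?_⟩⟩
    · rw [sub_apply, hat_zero_apply, hwh.constCoeff (by omega), hf.apply_zero (by omega), sub_zero]
    · rw [map_sub, D_hat, hpd]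
      convert (hP i).2 using 1; ring

/-- Conjugation of polynomials in the coordinates and their conjugates. -/
noncomputable def cjp : MvPolynomial (Fin n × Bool) ℂ →+* MvPolynomial (Fin n × Bool) ℂ :=
  MvPolynomial.eval₂Hom (MvPolynomial.C.comp (starRingEnd ℂ)) (fun i => MvPolynomial.X (bar i))

theorem conj_hat (p : MvPolynomial (Fin n × Bool) ℂ) : conj (hat p) = hat (cjp p) := by
  induction p using MvPolynomial.induction_on with
  | C c => ext x; simp [cjp]
  | add p q hp hq => simp [hp, hq]
  | mul_X p j hp => simp only [map_mul, hp, hat_X, conj_X]; simp [cjp]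

theorem WH.cjp {p : MvPolynomial (Fin n × Bool) ℂ} {s : ℤ} (h : WH w p s) :
    WH w (cjp p) s := by
  classical
  rw [p.as_sum, map_sum]
  refine MvPolynomial.IsWeightedHomogeneous.sum _ _ _ fun d hd => ?_
  have hd' := h (MvPolynomial.mem_support_iff.1 hd)
  rw [SF.cjp, MvPolynomial.eval₂Hom_monomial]
  have h1 : WH w ((MvPolynomial.C.comp (starRingEnd ℂ)) (p.coeff d)) 0 :=
    MvPolynomial.isWeightedHomogeneous_C _ _
  have h2 : WH w (d.prod fun i k => MvPolynomial.X (bar i) ^ k) s := by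
    rw [← hd', Finsupp.weight_apply, Finsupp.prod, Finsupp.sum]
    refine MvPolynomial.IsWeightedHomogeneous.prod _ _ _ fun i _ => ?_
    exact (MvPolynomial.isWeightedHomogeneous_X ℂ
            (fun i : Fin n × Bool => (w i.1 : ℤ)) (bar i)).pow _
  simpa using h1.mul h2

theorem Lead.conj {s : ℤ} {f : SF n} {p} (hf : Lead w s f p) : Lead w s (conj f) (cjp p) :=
  ⟨hf.1.cjp, by
    have := hf.2.conj
    rwa [map_sub, conj_hat] at this⟩

end SF

/-- Chain rule for a derivation and a polynomial substitution. -/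
theorem derivation_aeval {σ B : Type*} [Fintype σ] [CommRing B] [Algebra ℂ B]
    (D : Derivation ℂ B B) (b : σ → B) (p : MvPolynomial σ ℂ) :
    D (MvPolynomial.aeval b p)
      = ∑ i, MvPolynomial.aeval b (MvPolynomial.pderiv i p) * D (b i) := by
  classical
  induction p using MvPolynomial.induction_on with
  | C c => simp
  | add p q hp hq => simp only [map_add, hp, hq, add_mul, Finset.sum_add_distrib]
  | mul_X p j hp =>
    simp only [map_mul, MvPolynomial.aeval_X, Derivation.leibniz, hp, smul_eq_mul, map_add,
      MvPolynomial.pderiv_X, add_mul, Finset.sum_add_distrib, Finset.mul_sum]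
    congr 1
    · rw [Finset.sum_eq_single j]
      · simp
      · intro i _ hi; simp [hi.symm]
      · simp
    · exact Finset.sum_congr rfl fun i _ => by ring

theorem isWeightedHomogeneous_aeval {σ τ M : Type*} [AddCommMonoid M] {w : σ → M} {w' : τ → M}
    {b : σ → MvPolynomial τ ℂ} (hb : ∀ i, (b i).IsWeightedHomogeneous w' (w i))
    {p : MvPolynomial σ ℂ} {d : M} (hp : p.IsWeightedHomogeneous w d) :
    (MvPolynomial.aeval b p).IsWeightedHomogeneous w' d := by
  rw [p.as_sum, map_sum]
  refine MvPolynomial.IsWeightedHomogeneous.sum _ _ _ fun e he => ?_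
  have he' := hp (MvPolynomial.mem_support_iff.1 he)
  rw [MvPolynomial.aeval_monomial, ← he', Finsupp.weight_apply, Finsupp.prod, Finsupp.sum,
    MvPolynomial.algebraMap_eq]
  exact (MvPolynomial.IsWeightedHomogeneous.prod _ _ _ fun i _ => (hb i).pow _).C_mul _

/-- Words in a pair of derivations. -/
def lw {B : Type*} [CommRing B] [Algebra ℂ B] (l : Bool → Derivation ℂ B B) : List Bool → B → B
  | [], f => f
  | b :: w, f => l b (lw l w f)

/-- The sequence of transversal components of iterated commutators. -/
def dl {B : Type*} [CommRing B] [Algebra ℂ B] (l : Bool → Derivation ℂ B B)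
    (ξ η u v F : B) : List Bool → B
  | [] => F
  | false :: w => l false (dl l ξ η u v F w) + lw l w η * u
  | true :: w => l true (dl l ξ η u v F w) - lw l w ξ * v

theorem dl_zero {B : Type*} [CommRing B] [Algebra ℂ B] (l : Bool → Derivation ℂ B B)
    (ξ η F : B) (w : List Bool) : dl l ξ η 0 0 F w = lw l w F := by
  induction w with
  | nil => rfl
  | cons b w ih => cases b <;> simp [dl, lw, ih]

theorem lw_zero {B : Type*} [CommRing B] [Algebra ℂ B] (l : Bool → Derivation ℂ B B)
    (w : List Bool) : lw l w 0 = 0 := by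
  induction w with
  | nil => rfl
  | cons b w ih => simp [lw, ih]

theorem lw_sub {B : Type*} [CommRing B] [Algebra ℂ B] (l : Bool → Derivation ℂ B B)
    (w : List Bool) (f g : B) : lw l w (f - g) = lw l w f - lw l w g := by
  induction w with
  | nil => rfl
  | cons b w ih => simp [lw, ih]

theorem lw_neg {B : Type*} [CommRing B] [Algebra ℂ B] (l : Bool → Derivation ℂ B B)
    (w : List Bool) (f : B) : lw l w (-f) = -lw l w f := by
  rw [← zero_sub, lw_sub, lw_zero, zero_sub]

theorem lw_smul {B : Type*} [CommRing B] [Algebra ℂ B] (l : Bool → Derivation ℂ B B)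
    (w : List Bool) (c : ℂ) (f : B) : lw l w (c • f) = c • lw l w f := by
  induction w with
  | nil => rfl
  | cons b w ih => simp [lw, ih]

theorem map_lw {B B' : Type*} [CommRing B] [Algebra ℂ B] [CommRing B'] [Algebra ℂ B']
    {l : Bool → Derivation ℂ B B} {l' : Bool → Derivation ℂ B' B'} (φ : B →ₐ[ℂ] B')
    (h : ∀ b f, φ (l b f) = l' b (φ f)) (w : List Bool) (f : B) :
    φ (lw l w f) = lw l' w (φ f) := by
  induction w with
  | nil => rfl
  | cons b w ih => simp [lw, ih, h]

theorem map_dl {B B' : Type*} [CommRing B] [Algebra ℂ B] [CommRing B'] [Algebra ℂ B']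
    {l : Bool → Derivation ℂ B B} {l' : Bool → Derivation ℂ B' B'} (φ : B →ₐ[ℂ] B')
    (h : ∀ b f, φ (l b f) = l' b (φ f)) (ξ η u v F : B) (w : List Bool) :
    φ (dl l ξ η u v F w) = dl l' (φ ξ) (φ η) (φ u) (φ v) (φ F) w := by
  induction w with
  | nil => rfl
  | cons b w ih => cases b <;> simp [dl, ih, h, map_lw φ h]

/-- A commutative algebra with a grading lowered by two derivations, such that homogeneous
elements killed by both derivations are constants. -/
structure WordAlg (B : Type*) [CommRing B] [Algebra ℂ B] where
  l : Bool → Derivation ℂ B B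
  H : ℤ → Submodule ℂ B
  ε : B →ₗ[ℂ] ℂ
  l_mem : ∀ {d f}, f ∈ H d → ∀ b, l b f ∈ H (d - 1)
  neg : ∀ {d f}, f ∈ H d → d < 0 → f = 0
  kill : ∀ {d f}, f ∈ H d → d ≠ 0 → (∀ b, l b f = 0) → f = 0
  zero : ∀ {f}, f ∈ H 0 → ε f = 0 → f = 0
  mul_mem : ∀ {d e f g}, f ∈ H d → g ∈ H e → f * g ∈ H (d + e)

namespace WordAlg

variable {B : Type*} [CommRing B] [Algebra ℂ B] (W : WordAlg B)

theorem lw_append (w : List Bool) (b : Bool) (f : B) :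
    lw W.l (w ++ [b]) f = lw W.l w (W.l b f) := by
  induction w with
  | nil => rfl
  | cons c w ih => simp [lw, ih]

theorem lw_mem {d : ℤ} {f : B} (hf : f ∈ W.H d) (w : List Bool) :
    lw W.l w f ∈ W.H (d - w.length) := by
  induction w with
  | nil => simpa [lw]
  | cons b w ih =>
    have := W.l_mem ih b
    simpa [lw, sub_sub] using this

/-- A homogeneous element all of whose words of full length vanish at the base point is zero. -/
theorem star {d : ℤ} {f : B} (hf : f ∈ W.H d)
    (h : ∀ w : List Bool, (w.length : ℤ) = d → W.ε (lw W.l w f) = 0) : f = 0 := by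
  rcases lt_or_ge d 0 with hd | hd
  · exact W.neg hf hd
  obtain ⟨k, rfl⟩ := Int.eq_ofNat_of_zero_le hd
  induction k generalizing f with
  | zero => exact W.zero (by simpa using hf) (h [] (by simp))
  | succ k ih =>
    refine W.kill hf (by positivity) fun b => ?_
    refine ih (by have := W.l_mem hf b; simpa using this) (fun w hw => ?_) (by positivity)
    rw [← lw_append]
    exact h _ (by simp at hw ⊢; omega)

/-- If all words of length `j < d` vanish then so does a homogeneous element of weight `d`. -/
theorem eq_zero_of_words {d : ℤ} {f : B} (hf : f ∈ W.H d) (j : ℕ) (hj : (j : ℤ) ≤ d)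
    (h : ∀ w : List Bool, w.length = j → lw W.l w f = 0) : f = 0 := by
  induction j generalizing d f with
  | zero => exact h [] rfl
  | succ j ih =>
    refine W.kill hf (by omega) fun b => ?_
    refine ih (W.l_mem hf b) (by push_cast at hj; omega) fun w hw => ?_
    rw [← lw_append]
    exact h _ (by simp [hw])

variable {W} {m N : ℤ} {ξ η u v F : B}

theorem dl_mem (hξ : ξ ∈ W.H (m - 2)) (hη : η ∈ W.H (m - 2)) (hu : u ∈ W.H (N - m - 1))
    (hv : v ∈ W.H (N - m - 1)) (hF : F ∈ W.H (N - 2)) (w : List Bool) :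
    dl W.l ξ η u v F w ∈ W.H (N - 2 - w.length) := by
  induction w with
  | nil => simpa [dl]
  | cons b w ih =>
    have h1 := W.l_mem ih b
    have hη' := W.mul_mem (W.lw_mem hη w) hu
    have hξ' := W.mul_mem (W.lw_mem hξ w) hv
    rw [show m - 2 - (w.length : ℤ) + (N - m - 1) = N - 2 - (w.length + 1 : ℕ) by
      push_cast; ring] at hη' hξ'
    rw [show N - 2 - (w.length : ℤ) - 1 = N - 2 - (w.length + 1 : ℕ) by push_cast; ring] at h1
    cases b
    · exact add_mem h1 hη'
    · exact sub_mem h1 hξ'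

theorem dl_append (hξ : ξ ∈ W.H (m - 2)) (hη : η ∈ W.H (m - 2)) (w : List Bool)
    (hw : m - 2 < w.length) (w' : List Bool) :
    dl W.l ξ η u v F (w' ++ w) = lw W.l w' (dl W.l ξ η u v F w) := by
  induction w' with
  | nil => rfl
  | cons b w' ih =>
    have h1 : lw W.l (w' ++ w) η = 0 :=
      W.neg (W.lw_mem hη _) (by simp; omega)
    have h2 : lw W.l (w' ++ w) ξ = 0 :=
      W.neg (W.lw_mem hξ _) (by simp; omega)
    cases b <;> simp [dl, lw, ih, h1, h2]

theorem dl_eq_zero (hξ : ξ ∈ W.H (m - 2)) (hη : η ∈ W.H (m - 2))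
    (hu : u ∈ W.H (N - m - 1)) (hv : v ∈ W.H (N - m - 1)) (hF : F ∈ W.H (N - 2))
    (h0 : ∀ w : List Bool, (w.length : ℤ) = N - 2 → W.ε (dl W.l ξ η u v F w) = 0)
    (w : List Bool) (hw : (w.length : ℤ) = m - 1) : dl W.l ξ η u v F w = 0 := by
  refine W.star (dl_mem hξ hη hu hv hF w) fun w' hw' => ?_
  rw [← dl_append hξ hη w (by omega)]
  exact h0 _ (by simp; omega)

theorem dl_words (hξ : ξ ∈ W.H (m - 2)) (hη : η ∈ W.H (m - 2))
    (hu : u ∈ W.H (N - m - 1)) (hv : v ∈ W.H (N - m - 1)) (hF : F ∈ W.H (N - 2))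
    (h0 : ∀ w : List Bool, (w.length : ℤ) = N - 2 → W.ε (dl W.l ξ η u v F w) = 0)
    (w : List Bool) (hw : (w.length : ℤ) = m - 2) :
    W.l false (dl W.l ξ η u v F w) = - (lw W.l w η * u) ∧
      W.l true (dl W.l ξ η u v F w) = lw W.l w ξ * v :=
  ⟨eq_neg_of_add_eq_zero_left
    (dl_eq_zero hξ hη hu hv hF h0 (false :: w) (by simp; omega)),
   sub_eq_zero.1 (dl_eq_zero hξ hη hu hv hF h0 (true :: w) (by simp; omega))⟩

theorem dl_solve (hm : 2 ≤ m) (hmN : m < N) (hξ : ξ ∈ W.H (m - 2)) (hη : η ∈ W.H (m - 2))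
    (hu : u ∈ W.H (N - m - 1)) (hv : v ∈ W.H (N - m - 1)) (hF : F ∈ W.H (N - 2))
    (h0 : ∀ w : List Bool, (w.length : ℤ) = N - 2 → W.ε (dl W.l ξ η u v F w) = 0)
    {f₁ f₂ : B} (hf₁ : f₁ ∈ W.H (N - m)) (hf₂ : f₂ ∈ W.H (N - m))
    (h1 : ∀ w, lw W.l w ξ * W.l false f₁ + lw W.l w η * (W.l false f₂ + u) = 0)
    (h2 : ∀ w, lw W.l w ξ * (W.l true f₁ - v) + lw W.l w η * W.l true f₂ = 0) :
    F = ξ * f₁ + η * f₂ := by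
  set κ : B := F - ξ * f₁ - η * f₂ with hκ
  have hκm : κ ∈ W.H (N - 2) := by
    have e1 := W.mul_mem hξ hf₁
    have e2 := W.mul_mem hη hf₂
    rw [show m - 2 + (N - m) = N - 2 by ring] at e1 e2
    exact sub_mem (sub_mem hF e1) e2
  have hκw : ∀ w, lw W.l w κ = dl W.l ξ η u v F w - lw W.l w ξ * f₁ - lw W.l w η * f₂ := by
    intro w
    induction w with
    | nil => rfl
    | cons b w ih =>
      have a1 := h1 w
      have a2 := h2 w
      cases b
      · simp only [lw, dl, ih, map_sub, Derivation.leibniz, smul_eq_mul]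
        linear_combination -a1
      · simp only [lw, dl, ih, map_sub, Derivation.leibniz, smul_eq_mul]
        linear_combination -a2
  have : κ = 0 := by
    refine W.eq_zero_of_words hκm (m - 1).toNat (by omega) fun w hw => ?_
    have hw' : (w.length : ℤ) = m - 1 := by omega
    rw [hκw, dl_eq_zero hξ hη hu hv hF h0 w hw',
      W.neg (W.lw_mem hξ w) (by omega), W.neg (W.lw_mem hη w) (by omega)]
    ring
  rw [hκ] at this
  linear_combination this

theorem dl_pair (hm : 2 ≤ m) (hmN : m < N) (hξ : ξ ∈ W.H (m - 2)) (hη : η ∈ W.H (m - 2))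
    (hu : u ∈ W.H (N - m - 1)) (hv : v ∈ W.H (N - m - 1)) (hF : F ∈ W.H (N - 2))
    (h0 : ∀ w : List Bool, (w.length : ℤ) = N - 2 → W.ε (dl W.l ξ η u v F w) = 0)
    {w₁ w₂ : List Bool} (hw₁ : (w₁.length : ℤ) = m - 2) (hw₂ : (w₂.length : ℤ) = m - 2)
    {a₁ a₂ b₁ b₂ : ℂ} (ha₁ : lw W.l w₁ ξ = algebraMap ℂ B a₁)
    (ha₂ : lw W.l w₂ ξ = algebraMap ℂ B a₂) (hb₁ : lw W.l w₁ η = algebraMap ℂ B b₁)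
    (hb₂ : lw W.l w₂ η = algebraMap ℂ B b₂) (hdet : a₁ * b₂ - a₂ * b₁ ≠ 0) :
    ∃ f₁ ∈ W.H (N - m), ∃ f₂ ∈ W.H (N - m), W.l false f₁ = 0 ∧ W.l true f₁ = v ∧
      W.l false f₂ = -u ∧ W.l true f₂ = 0 ∧ F = ξ * f₁ + η * f₂ := by
  obtain ⟨e1, e2⟩ := dl_words hξ hη hu hv hF h0 w₁ hw₁
  obtain ⟨e3, e4⟩ := dl_words hξ hη hu hv hF h0 w₂ hw₂
  have m1 := dl_mem hξ hη hu hv hF w₁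
  have m2 := dl_mem hξ hη hu hv hF w₂
  rw [hw₁, show N - 2 - (m - 2) = N - m by ring] at m1
  rw [hw₂, show N - 2 - (m - 2) = N - m by ring] at m2
  rw [hb₁] at e1; rw [ha₁] at e2; rw [hb₂] at e3; rw [ha₂] at e4
  set δ := a₁ * b₂ - a₂ * b₁ with hδ
  set f₁ := δ⁻¹ • (b₂ • dl W.l ξ η u v F w₁ - b₁ • dl W.l ξ η u v F w₂) with hf₁
  set f₂ := δ⁻¹ • (a₁ • dl W.l ξ η u v F w₂ - a₂ • dl W.l ξ η u v F w₁) with hf₂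
  have k : algebraMap ℂ B δ⁻¹ * (algebraMap ℂ B a₁ * algebraMap ℂ B b₂
      - algebraMap ℂ B a₂ * algebraMap ℂ B b₁) = 1 := by
    rw [← map_mul, ← map_mul, ← map_sub, ← map_mul, inv_mul_cancel₀ hdet, map_one]
  have g1 : W.l false f₁ = 0 := by
    rw [hf₁, Derivation.map_smul, map_sub, Derivation.map_smul, Derivation.map_smul, e1, e3]
    simp only [Algebra.smul_def]; ring
  have g2 : W.l true f₁ = v := by
    rw [hf₁, Derivation.map_smul, map_sub, Derivation.map_smul, Derivation.map_smul, e2, e4]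
    simp only [Algebra.smul_def]
    linear_combination v * k
  have g3 : W.l false f₂ = -u := by
    rw [hf₂, Derivation.map_smul, map_sub, Derivation.map_smul, Derivation.map_smul, e1, e3]
    simp only [Algebra.smul_def]
    linear_combination -u * k
  have g4 : W.l true f₂ = 0 := by
    rw [hf₂, Derivation.map_smul, map_sub, Derivation.map_smul, Derivation.map_smul, e2, e4]
    simp only [Algebra.smul_def]; ring
  have hm₁ : f₁ ∈ W.H (N - m) := Submodule.smul_mem _ _
    (sub_mem (Submodule.smul_mem _ _ m1) (Submodule.smul_mem _ _ m2))
  have hm₂ : f₂ ∈ W.H (N - m) := Submodule.smul_mem _ _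
    (sub_mem (Submodule.smul_mem _ _ m2) (Submodule.smul_mem _ _ m1))
  refine ⟨f₁, hm₁, f₂, hm₂, g1, g2, g3, g4, dl_solve hm hmN hξ hη hu hv hF h0 hm₁ hm₂
    (fun w => by rw [g1, g3]; ring) (fun w => by rw [g2, g4]; ring)⟩

/-- The case `ξ = -η`. -/
theorem dl_single (hm : 2 ≤ m) (hmN : m < N) (hη : η ∈ W.H (m - 2))
    (hu : u ∈ W.H (N - m - 1)) (hv : v ∈ W.H (N - m - 1)) (hF : F ∈ W.H (N - 2))
    (h0 : ∀ w : List Bool, (w.length : ℤ) = N - 2 → W.ε (dl W.l (-η) η u v F w) = 0)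
    {w₁ : List Bool} (hw₁ : (w₁.length : ℤ) = m - 2)
    {b₁ : ℂ} (hb₁ : lw W.l w₁ η = algebraMap ℂ B b₁) (hb : b₁ ≠ 0) :
    ∃ f ∈ W.H (N - m), W.l false f = -u ∧ W.l true f = -v ∧ F = η * f := by
  have hξ : -η ∈ W.H (m - 2) := neg_mem hη
  obtain ⟨e1, e2⟩ := dl_words hξ hη hu hv hF h0 w₁ hw₁
  have m1 := dl_mem hξ hη hu hv hF w₁
  rw [hw₁, show N - 2 - (m - 2) = N - m by ring] at m1
  rw [hb₁] at e1
  rw [lw_neg, hb₁] at e2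
  have k : algebraMap ℂ B b₁⁻¹ * algebraMap ℂ B b₁ = 1 := by
    rw [← map_mul, inv_mul_cancel₀ hb, map_one]
  set f := b₁⁻¹ • dl W.l (-η) η u v F w₁ with hf
  have hfm : f ∈ W.H (N - m) := Submodule.smul_mem _ _ m1
  have g1 : W.l false f = -u := by
    rw [hf, Derivation.map_smul, e1]; simp only [Algebra.smul_def]; linear_combination -u * k
  have g2 : W.l true f = -v := by
    rw [hf, Derivation.map_smul, e2]; simp only [Algebra.smul_def]; linear_combination -v * k
  refine ⟨f, hfm, g1, g2, ?_⟩
  have := dl_solve hm hmN hξ hη hu hv hF h0 (zero_mem (W.H (N - m))) hfm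
    (fun w => by rw [g1, map_zero]; ring) (fun w => by rw [g2, map_zero, lw_neg]; ring)
  simpa using this

end WordAlg

/-- Polynomials in `z₁, z̄₁, z₂, z̄₂`. -/
abbrev R2 := MvPolynomial (Fin 2 × Bool) ℂ

namespace Mdl

open MvPolynomial SF

/-- The variables `z₁`, `z̄₁`, `z₂`, `z̄₂`. -/
noncomputable abbrev vx : R2 := X (0, false)
noncomputable abbrev vy : R2 := X (0, true)
noncomputable abbrev vz : R2 := X (1, false)
noncomputable abbrev vt : R2 := X (1, true)

/-- The partial derivatives. -/
noncomputable abbrev dx : Derivation ℂ R2 R2 := pderiv (0, false)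
noncomputable abbrev dy : Derivation ℂ R2 R2 := pderiv (0, true)
noncomputable abbrev dz : Derivation ℂ R2 R2 := pderiv (1, false)
noncomputable abbrev dt : Derivation ℂ R2 R2 := pderiv (1, true)

/-- Four values arranged as an assignment of the variables. -/
def pt {B : Type*} (a b c d : B) (i : Fin 2 × Bool) : B :=
  ![bif i.2 then b else a, bif i.2 then d else c] i.1

@[simp] theorem pt_x {B : Type*} (a b c d : B) : pt a b c d (0, false) = a := rfl
@[simp] theorem pt_y {B : Type*} (a b c d : B) : pt a b c d (0, true) = b := rfl
@[simp] theorem pt_z {B : Type*} (a b c d : B) : pt a b c d (1, false) = c := rfl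
@[simp] theorem pt_t {B : Type*} (a b c d : B) : pt a b c d (1, true) = d := rfl

theorem eq_pt {B : Type*} (f : Fin 2 × Bool → B) :
    f = pt (f (0, false)) (f (0, true)) (f (1, false)) (f (1, true)) := by
  funext ⟨i, b⟩
  fin_cases i <;> cases b <;> rfl

/-- Substitution of values for the four variables. -/
noncomputable def S {B : Type*} [CommRing B] [Algebra ℂ B] (a b c d : B) : R2 →ₐ[ℂ] B :=
  aeval (pt a b c d)

section

variable {B B' : Type*} [CommRing B] [Algebra ℂ B] [CommRing B'] [Algebra ℂ B']

theorem S_X (a b c d : B) (i : Fin 2 × Bool) : S a b c d (X i) = pt a b c d i := by simp [S]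

@[simp] theorem S_x (a b c d : B) : S a b c d vx = a := by simp [S]
@[simp] theorem S_y (a b c d : B) : S a b c d vy = b := by simp [S]
@[simp] theorem S_z (a b c d : B) : S a b c d vz = c := by simp [S]
@[simp] theorem S_t (a b c d : B) : S a b c d vt = d := by simp [S]

@[simp] theorem S_C (a b c d : B) (k : ℂ) : S a b c d (C k) = algebraMap ℂ B k := by
  simp [S]

theorem algHom_eq_S (φ : R2 →ₐ[ℂ] B) (p : R2) :
    φ p = S (φ vx) (φ vy) (φ vz) (φ vt) p := by
  have : φ = S (φ vx) (φ vy) (φ vz) (φ vt) := by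
    refine MvPolynomial.algHom_ext fun i => ?_
    obtain ⟨i, b⟩ := i
    fin_cases i <;> cases b
    · exact (S_x _ _ _ _).symm
    · exact (S_y _ _ _ _).symm
    · exact (S_z _ _ _ _).symm
    · exact (S_t _ _ _ _).symm
  exact congrArg (fun f => f p) this

theorem map_S (φ : B →ₐ[ℂ] B') (a b c d : B) (p : R2) :
    φ (S a b c d p) = S (φ a) (φ b) (φ c) (φ d) p := by
  have := algHom_eq_S (φ.comp (S a b c d)) p
  simpa using this

theorem S_id (p : R2) : S vx vy vz vt p = p := (algHom_eq_S (AlgHom.id ℂ R2) p).symm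

theorem S_deriv (D : Derivation ℂ B B) (a b c d : B) (p : R2) :
    D (S a b c d p) = S a b c d (dx p) * D a + S a b c d (dy p) * D b
      + S a b c d (dz p) * D c + S a b c d (dt p) * D d := by
  rw [S, derivation_aeval, Fintype.sum_prod_type]
  simp only [Fin.sum_univ_two, Fintype.sum_bool, pt_x, pt_y, pt_z, pt_t]
  ring

end

theorem eval_eq_S (f : Fin 2 × Bool → ℂ) (p : R2) :
    eval f p = S (f (0, false)) (f (0, true)) (f (1, false)) (f (1, true)) p := by
  rw [S, ← eq_pt, aeval_eq_eval]

theorem ext_S {p q : R2} (h : ∀ a b c d : ℂ, S a b c d p = S a b c d q) : p = q := by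
  refine MvPolynomial.funext fun f => ?_
  rw [eval_eq_S, eval_eq_S]
  exact h _ _ _ _

theorem eq_zero_of_real {p : R2} (h : ∀ a b c d : ℝ, S (a : ℂ) (b : ℂ) (c : ℂ) (d : ℂ) p = 0) :
    p = 0 := by
  refine MvPolynomial.funext_set (fun _ => Set.range ((↑) : ℝ → ℂ))
    (fun _ => Set.infinite_range_of_injective Complex.ofReal_injective) fun f hf => ?_
  have hf' : ∀ i, f i ∈ Set.range ((↑) : ℝ → ℂ) := fun i => hf i (Set.mem_univ i)
  obtain ⟨a, ha⟩ := hf' (0, false)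
  obtain ⟨b, hb⟩ := hf' (0, true)
  obtain ⟨c, hc⟩ := hf' (1, false)
  obtain ⟨d, hd⟩ := hf' (1, true)
  rw [eval_eq_S, ← ha, ← hb, ← hc, ← hd, h, map_zero]

/-- Evaluation at a point of `ℂ²`. -/
noncomputable def ev (a b : ℂ) : R2 →ₐ[ℂ] ℂ :=
  S a (starRingEnd ℂ a) b (starRingEnd ℂ b)

theorem ev_def (a b : ℂ) (p : R2) :
    ev a b p = S a (starRingEnd ℂ a) b (starRingEnd ℂ b) p := rfl

@[simp] theorem ev_x (a b : ℂ) : ev a b vx = a := by simp [ev]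
@[simp] theorem ev_y (a b : ℂ) : ev a b vy = starRingEnd ℂ a := by simp [ev]
@[simp] theorem ev_z (a b : ℂ) : ev a b vz = b := by simp [ev]
@[simp] theorem ev_t (a b : ℂ) : ev a b vt = starRingEnd ℂ b := by simp [ev]
@[simp] theorem ev_C (a b k : ℂ) : ev a b (C k) = k := by simp [ev]

theorem conj_aux (a b : ℝ) :
    starRingEnd ℂ ((a : ℂ) + Complex.I * b) = (a : ℂ) - Complex.I * b := by
  simp [sub_eq_add_neg]

theorem eq_zero_of_ev {p : R2} (h : ∀ a b, ev a b p = 0) : p = 0 := by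
  set φ : R2 →ₐ[ℂ] R2 := S (vx + C Complex.I * vy) (vx - C Complex.I * vy)
    (vz + C Complex.I * vt) (vz - C Complex.I * vt) with hφ
  have h0 : φ p = 0 := by
    refine eq_zero_of_real fun a b c d => ?_
    have := h (a + Complex.I * b) (c + Complex.I * d)
    rw [ev_def, conj_aux, conj_aux] at this
    rw [hφ, map_S]
    simpa using this
  refine ext_S fun a b c d => ?_
  have := congrArg (S ((a + b) / 2) ((a - b) / (2 * Complex.I)) ((c + d) / 2)
    ((c - d) / (2 * Complex.I))) h0
  rw [hφ, map_S] at this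
  simp only [map_add, map_sub, map_mul, S_x, S_y, S_z, S_t, S_C, map_zero,
    Algebra.algebraMap_self, RingHom.id_apply] at this
  rw [map_zero, ← this]
  have hI := Complex.I_ne_zero
  congr 1
  congr 1 <;> field_simp <;> ring

theorem ev_ext {p q : R2} (h : ∀ a b, ev a b p = ev a b q) : p = q :=
  sub_eq_zero.1 (eq_zero_of_ev fun a b => by rw [map_sub, h, sub_self])

/-! Conjugation. -/

@[simp] theorem cjp_X (i : Fin 2 × Bool) : cjp (X i : R2) = (MvPolynomial.X (bar i) : R2) := by simp [cjp]
@[simp] theorem cjp_C (c : ℂ) : cjp (C c : R2) = C (starRingEnd ℂ c) := by simp [cjp]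

@[simp] theorem cjp_cjp (p : R2) : cjp (cjp p) = p := by
  induction p using MvPolynomial.induction_on with
  | C c => simp
  | add p q hp hq => simp [hp, hq]
  | mul_X p j hp => simp [hp]

theorem cjp_smul (c : ℂ) (p : R2) : cjp (c • p) = starRingEnd ℂ c • cjp p := by
  simp [MvPolynomial.smul_eq_C_mul]

theorem cjp_pderiv (i : Fin 2 × Bool) (p : R2) :
    cjp (pderiv i p) = pderiv (bar i) (cjp p) := by
  classical
  induction p using MvPolynomial.induction_on with
  | C c => simp
  | add p q hp hq => simp [hp, hq]
  | mul_X p j hp =>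
    simp only [Derivation.leibniz, map_add, map_mul, smul_eq_mul, hp, cjp_X, pderiv_X]
    congr 2
    by_cases h : j = i
    · subst h; simp
    · have h' : bar j ≠ bar i := fun h' => h (by simpa using congrArg bar h')
      simp [h, h']

theorem cjp_dx (p : R2) : cjp (dx p) = dy (cjp p) := cjp_pderiv _ p
theorem cjp_dy (p : R2) : cjp (dy p) = dx (cjp p) := cjp_pderiv _ p
theorem cjp_dz (p : R2) : cjp (dz p) = dt (cjp p) := cjp_pderiv _ p
theorem cjp_dt (p : R2) : cjp (dt p) = dz (cjp p) := cjp_pderiv _ p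

theorem S_cjp (a b c d : ℂ) (p : R2) :
    S a b c d (cjp p) = starRingEnd ℂ (S (starRingEnd ℂ b) (starRingEnd ℂ a)
      (starRingEnd ℂ d) (starRingEnd ℂ c) p) := by
  induction p using MvPolynomial.induction_on with
  | C c => simp
  | add p q hp hq => simp [hp, hq]
  | mul_X p j hp =>
    obtain ⟨j, e⟩ := j
    rw [map_mul, map_mul, map_mul, map_mul, hp, cjp_X, S_X, S_X]
    congr 1
    fin_cases j <;> cases e <;> simp [pt]

theorem ev_cjp (a b : ℂ) (p : R2) : ev a b (cjp p) = starRingEnd ℂ (ev a b p) := by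
  rw [ev_def, S_cjp]; simp [ev_def]

theorem cjp_S (a b c d p : R2) :
    cjp (S a b c d p) = S (cjp b) (cjp a) (cjp d) (cjp c) (cjp p) := by
  induction p using MvPolynomial.induction_on with
  | C c => simp
  | add p q hp hq => simp [hp, hq]
  | mul_X p j hp =>
    obtain ⟨j, e⟩ := j
    rw [map_mul, map_mul, map_mul, map_mul, hp, cjp_X, S_X, S_X]
    congr 1
    fin_cases j <;> cases e <;> rfl

theorem pd_comm (i j : Fin 2 × Bool) (p : R2) : pderiv i (pderiv j p) = pderiv j (pderiv i p) := by
  refine MvPolynomial.ext _ _ fun d => ?_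
  rw [coeff_pderiv, coeff_pderiv, coeff_pderiv, coeff_pderiv]
  by_cases h : i = j
  · subst h; rfl
  · rw [add_right_comm]
    simp [h, Ne.symm h]
    ring

/-- Vanishing of a partial derivative means independence of the variable. -/
theorem mem_support_pderiv {i : Fin 2 × Bool} {p : R2} (h : pderiv i p = 0) {e} (he : e ∈ p.support) :
    e i = 0 := by
  by_contra hi
  have h1 := congrArg (coeff (e - Finsupp.single i 1)) h
  rw [coeff_pderiv, coeff_zero] at h1
  have h2 : e - Finsupp.single i 1 + Finsupp.single i 1 = e :=
    tsub_add_cancel_of_le (Finsupp.single_le_iff.2 (Nat.one_le_iff_ne_zero.2 hi))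
  rw [h2] at h1
  rcases mul_eq_zero.1 h1 with h3 | h3
  · exact mem_support_iff.1 he h3
  · exact Nat.cast_add_one_ne_zero _ h3

theorem aeval_congr_of_pderiv {B : Type*} [CommRing B] [Algebra ℂ B] {f g : Fin 2 × Bool → B}
    {p : R2} (h : ∀ i, pderiv i p = 0 ∨ f i = g i) : aeval f p = aeval g p := by
  rw [p.as_sum, map_sum, map_sum]
  refine Finset.sum_congr rfl fun e he => ?_
  rw [aeval_monomial, aeval_monomial]
  congr 1
  refine Finset.prod_congr rfl fun i hi => ?_
  rcases h i with h | h
  · exact absurd (mem_support_pderiv h he) (by simpa using hi)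
  · simp only [h]

theorem S_congr {B : Type*} [CommRing B] [Algebra ℂ B] {a b c d a' b' c' d' : B} {p : R2}
    (h1 : dx p = 0 ∨ a = a') (h2 : dy p = 0 ∨ b = b') (h3 : dz p = 0 ∨ c = c')
    (h4 : dt p = 0 ∨ d = d') : S a b c d p = S a' b' c' d' p := by
  refine aeval_congr_of_pderiv fun i => ?_
  obtain ⟨i, e⟩ := i
  fin_cases i <;> cases e
  exacts [h1, h2, h3, h4]

/-! Weighted homogeneity. -/

/-- The weights. -/
def wm (m : ℕ) : Fin 2 → ℕ := ![1, m]

@[simp] theorem wm_zero (m : ℕ) : wm m 0 = 1 := rfl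
@[simp] theorem wm_one (m : ℕ) : wm m 1 = m := rfl

theorem wm_pos {m : ℕ} (hm : 0 < m) (i : Fin 2) : 0 < wm m i := by
  fin_cases i
  · exact one_pos
  · exact hm

/-- The space of weighted homogeneous polynomials. -/
noncomputable def H (m : ℕ) (s : ℤ) : Submodule ℂ R2 :=
  weightedHomogeneousSubmodule ℂ (fun i : Fin 2 × Bool => (wm m i.1 : ℤ)) s

variable {m : ℕ}

theorem mem_H {s : ℤ} {p : R2} : p ∈ H m s ↔ WH (wm m) p s := Iff.rfl

theorem H_mul {s t : ℤ} {p q : R2} (hp : p ∈ H m s) (hq : q ∈ H m t) : p * q ∈ H m (s + t) :=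
  IsWeightedHomogeneous.mul hp hq

theorem H_C (c : ℂ) : C c ∈ H m 0 := isWeightedHomogeneous_C _ _
theorem H_x : vx ∈ H m 1 := isWeightedHomogeneous_X _ _ _
theorem H_y : vy ∈ H m 1 := isWeightedHomogeneous_X _ _ _
theorem H_z : vz ∈ H m m := isWeightedHomogeneous_X _ _ _
theorem H_t : vt ∈ H m m := isWeightedHomogeneous_X _ _ _

theorem H_dx {s : ℤ} {p : R2} (hp : p ∈ H m s) : dx p ∈ H m (s - 1) := WH.D hp _
theorem H_dy {s : ℤ} {p : R2} (hp : p ∈ H m s) : dy p ∈ H m (s - 1) := WH.D hp _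
theorem H_dz {s : ℤ} {p : R2} (hp : p ∈ H m s) : dz p ∈ H m (s - m) := WH.D hp _
theorem H_dt {s : ℤ} {p : R2} (hp : p ∈ H m s) : dt p ∈ H m (s - m) := WH.D hp _
theorem H_cjp {s : ℤ} {p : R2} (hp : p ∈ H m s) : cjp p ∈ H m s := WH.cjp hp

theorem H_neg {s : ℤ} {p : R2} (hp : p ∈ H m s) (hs : s < 0) : p = 0 := WH.eq_zero_of_neg hp hs

theorem H_S {s : ℤ} {a b c d p : R2} (ha : a ∈ H m 1) (hb : b ∈ H m 1) (hc : c ∈ H m m)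
    (hd : d ∈ H m m) (hp : p ∈ H m s) : S a b c d p ∈ H m s := by
  refine isWeightedHomogeneous_aeval (fun i => ?_) hp
  obtain ⟨i, e⟩ := i
  fin_cases i <;> cases e
  · exact ha
  · exact hb
  · exact hc
  · exact hd

theorem H_const {p : R2} (hp : p ∈ H m 0) (hm : 0 < m) : p = C (constantCoeff p) := by
  refine sub_eq_zero.1 (WH.eq_zero (p := p - C (constantCoeff p)) (w := wm m) (s := 0)
    (sub_mem hp (H_C _) : _ ∈ H m 0) (wm_pos hm) ?_)
  exact O_one (by rw [hat_zero_apply]; simp) (wm_pos hm)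

/-- Scaling of weighted homogeneous polynomials. -/
theorem S_scale {s : ℕ} {p : R2} (hp : p ∈ H m s) (l a b c d : ℂ) :
    S (l * a) (l * b) (l ^ m * c) (l ^ m * d) p = l ^ s * S a b c d p := by
  rw [p.as_sum, map_sum, map_sum, Finset.mul_sum]
  refine Finset.sum_congr rfl fun e he => ?_
  have h := hp (mem_support_iff.1 he)
  have h' : e (0, true) + e (0, false) + (e (1, true) + e (1, false)) * m = s := by
    rw [Finsupp.weight_apply, Finsupp.sum_fintype _ _ (by simp), Fintype.sum_prod_type] at h
    simp only [Fin.sum_univ_two, Fintype.sum_bool, wm_zero, wm_one, nsmul_eq_mul] at h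
    zify; push_cast at h; linarith
  rw [S, S, aeval_monomial, aeval_monomial, Finsupp.prod_fintype _ _ (by simp),
    Finsupp.prod_fintype _ _ (by simp), Fintype.prod_prod_type, Fintype.prod_prod_type]
  simp only [Fin.prod_univ_two, Fintype.prod_bool, pt_x, pt_y, pt_z, pt_t]
  rw [← h']
  ring

theorem euler2 {s : ℤ} {p : R2} (hp : p ∈ H m s) :
    vx * dx p + vy * dy p + C (m : ℂ) * (vz * dz p + vt * dt p) = C (s : ℂ) * p := by
  have := SF.euler (w := wm m) hp
  rw [Fintype.sum_prod_type] at this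
  simp only [Fin.sum_univ_two, Fintype.sum_bool, wm_zero, wm_one, Nat.cast_one, C_1, one_mul] at this
  rw [← this]; ring

/-- Antiderivative. -/
noncomputable def anti (i : Fin 2 × Bool) : R2 →ₗ[ℂ] R2 :=
  (basisMonomials (Fin 2 × Bool) ℂ).constr ℂ fun e =>
    monomial (e + Finsupp.single i 1) (1 / ((e i : ℂ) + 1))

theorem anti_monomial (i : Fin 2 × Bool) (e : Fin 2 × Bool →₀ ℕ) (c : ℂ) :
    anti i (monomial e c) = monomial (e + Finsupp.single i 1) (c / ((e i : ℂ) + 1)) := by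
  have h : (monomial e c : R2) = c • basisMonomials (Fin 2 × Bool) ℂ e := by
    simp [smul_monomial]
  rw [h, map_smul, anti, Module.Basis.constr_basis, smul_monomial]
  simp [div_eq_mul_inv]

theorem pderiv_anti (i : Fin 2 × Bool) (p : R2) : pderiv i (anti i p) = p := by
  induction p using MvPolynomial.induction_on' with
  | add p q hp hq => rw [map_add, map_add, hp, hq]
  | monomial e c =>
    rw [anti_monomial, pderiv_monomial]
    have : (e i : ℂ) + 1 ≠ 0 := Nat.cast_add_one_ne_zero _
    simp [this]

theorem pderiv_anti_ne {i j : Fin 2 × Bool} (h : i ≠ j) (p : R2) :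
    pderiv j (anti i p) = anti i (pderiv j p) := by
  have key : ∀ (e : Fin 2 × Bool →₀ ℕ) (c : ℂ),
      pderiv j (anti i (monomial e c)) = anti i (pderiv j (monomial e c)) := by
    intro e c
    rw [anti_monomial, pderiv_monomial, pderiv_monomial, anti_monomial]
    by_cases hj : e j = 0
    · simp [hj, h]
    · have h1 : e + Finsupp.single i 1 - Finsupp.single j 1
        = e - Finsupp.single j 1 + Finsupp.single i 1 := by
        ext k
        simp only [Finsupp.coe_add, Finsupp.coe_tsub, Pi.add_apply, Pi.sub_apply,
          Finsupp.single_apply]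
        by_cases hk : j = k
        · subst hk; simp [h]
        · simp [hk]
      rw [h1]
      congr 1
      simp [h, h.symm]
      ring
  induction p using MvPolynomial.induction_on' with
  | monomial e c => exact key e c
  | add p q hp hq => simp only [map_add, hp, hq]

theorem anti_mem {i : Fin 2 × Bool} {s : ℤ} {p : R2} (hp : p ∈ H m s) :
    anti i p ∈ H m (s + wm m i.1) := by
  rw [p.as_sum, map_sum]
  refine sum_mem fun e he => ?_
  rw [anti_monomial]
  refine isWeightedHomogeneous_monomial _ _ _ ?_
  rw [map_add, hp (mem_support_iff.1 he), Finsupp.weight_apply]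
  simp

end Mdl

namespace Mdl

open MvPolynomial SF

/-! The model vector field and its Levi form. -/

/-- The model vector field `∂_x + A ∂_z`. -/
noncomputable def Lv (A : R2) : Derivation ℂ R2 R2 := dx + A • dz

/-- The conjugate of the model vector field. -/
noncomputable def Lb (A : R2) : Derivation ℂ R2 R2 := dy + cjp A • dt

/-- The two model vector fields. -/
noncomputable def ld (A : R2) (b : Bool) : Derivation ℂ R2 R2 := bif b then Lb A else Lv A

theorem Lv_apply (A f : R2) : Lv A f = dx f + A * dz f := rfl
theorem Lb_apply (A f : R2) : Lb A f = dy f + cjp A * dt f := rfl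
@[simp] theorem ld_false (A : R2) : ld A false = Lv A := rfl
@[simp] theorem ld_true (A : R2) : ld A true = Lb A := rfl

theorem cjp_Lv (A f : R2) : cjp (Lv A f) = Lb A (cjp f) := by
  rw [Lv_apply, Lb_apply, map_add, map_mul, cjp_dx, cjp_dz]

theorem cjp_Lb (A f : R2) : cjp (Lb A f) = Lv A (cjp f) := by
  rw [Lv_apply, Lb_apply, map_add, map_mul, cjp_dy, cjp_dt, cjp_cjp]

/-- The Levi form of `P` along the model vector field. -/
noncomputable def fL (A P : R2) : R2 :=
  dx (dy P) + A * dz (dy P) + cjp A * dx (dt P) + A * cjp A * dz (dt P)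

noncomputable def uL (A P : R2) : R2 := Lv A (dt P)
noncomputable def vL (A P : R2) : R2 := Lb A (dz P)

/-- The quadratic form with a hermitian matrix of polynomials. -/
def Psd (P : R2) : Prop :=
  ∀ a b s r : ℂ, 0 ≤ (ev a b (dx (dy P)) * s * starRingEnd ℂ s
    + ev a b (dx (dt P)) * s * starRingEnd ℂ r + ev a b (dz (dy P)) * r * starRingEnd ℂ s
    + ev a b (dz (dt P)) * r * starRingEnd ℂ r).re

/-- The Levi form vanishes. -/
def Flat (P : R2) : Prop :=
  dx (dy P) = 0 ∧ dx (dt P) = 0 ∧ dz (dy P) = 0 ∧ dz (dt P) = 0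

/-- The model situation. -/
structure Hyp (m N : ℕ) (A P : R2) : Prop where
  hm : 2 ≤ m
  hmN : m ≤ N
  hA : A ∈ H m (m - 1)
  hP : P ∈ H m N
  real : cjp P = P
  psd : Psd P
  van : (∀ w : List Bool, (w.length : ℤ) = N - 2 →
      constantCoeff (dl (ld A) (-dy A) (cjp (dy A)) (uL A P) (vL A P) (fL A P) w) = 0) ∨
    (∀ w : List Bool, (w.length : ℤ) = N - 2 → constantCoeff (lw (ld A) w (fL A P)) = 0)

section

variable {m N : ℕ} {A P : R2}

theorem dz_A (hA : A ∈ H m (m - 1)) : dz A = 0 := H_neg (H_dz hA) (by omega)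
theorem dt_A (hA : A ∈ H m (m - 1)) : dt A = 0 := H_neg (H_dt hA) (by omega)
theorem dz_cA (hA : A ∈ H m (m - 1)) : dz (cjp A) = 0 := by rw [← cjp_dt, dt_A hA, map_zero]
theorem dt_cA (hA : A ∈ H m (m - 1)) : dt (cjp A) = 0 := by rw [← cjp_dz, dz_A hA, map_zero]

theorem H_g (hA : A ∈ H m (m - 1)) : dy A ∈ H m (m - 2) := by
  have := H_dy hA
  rwa [show (m : ℤ) - 1 - 1 = m - 2 by ring] at this

theorem dz_g (hA : A ∈ H m (m - 1)) : dz (dy A) = 0 := by rw [pd_comm, dz_A hA, map_zero]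
theorem dt_g (hA : A ∈ H m (m - 1)) : dt (dy A) = 0 := by rw [pd_comm, dt_A hA, map_zero]

theorem H_Lv {s : ℤ} (hA : A ∈ H m (m - 1)) {f : R2} (hf : f ∈ H m s) : Lv A f ∈ H m (s - 1) := by
  rw [Lv_apply]
  have := H_mul hA (H_dz hf)
  rw [show (m : ℤ) - 1 + (s - m) = s - 1 by ring] at this
  exact add_mem (H_dx hf) this

theorem H_Lb {s : ℤ} (hA : A ∈ H m (m - 1)) {f : R2} (hf : f ∈ H m s) : Lb A f ∈ H m (s - 1) := by
  have := H_cjp (H_Lv hA (H_cjp hf))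
  rwa [cjp_Lv, cjp_cjp] at this

theorem H_ld {s : ℤ} (hA : A ∈ H m (m - 1)) {f : R2} (hf : f ∈ H m s) (b : Bool) :
    ld A b f ∈ H m (s - 1) := by
  cases b
  exacts [H_Lv hA hf, H_Lb hA hf]

theorem H_fL (hA : A ∈ H m (m - 1)) (hP : P ∈ H m N) : fL A P ∈ H m (N - 2) := by
  have h1 := H_dx (H_dy hP)
  have h2 := H_mul hA (H_dz (H_dy hP))
  have h3 := H_mul (H_cjp hA) (H_dx (H_dt hP))
  have h4 := H_mul (H_mul hA (H_cjp hA)) (H_dz (H_dt hP))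
  ring_nf at h1 h2 h3 h4 ⊢
  exact add_mem (add_mem (add_mem h1 h2) h3) h4

theorem H_uL (hA : A ∈ H m (m - 1)) (hP : P ∈ H m N) : uL A P ∈ H m (N - m - 1) :=
  H_Lv hA (H_dt hP)
theorem H_vL (hA : A ∈ H m (m - 1)) (hP : P ∈ H m N) : vL A P ∈ H m (N - m - 1) :=
  H_Lb hA (H_dz hP)

theorem dz_Lv (hA : A ∈ H m (m - 1)) (f : R2) : dz (Lv A f) = Lv A (dz f) := by
  rw [Lv_apply, Lv_apply, map_add, Derivation.leibniz, dz_A hA, pd_comm]; simp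
theorem dt_Lv (hA : A ∈ H m (m - 1)) (f : R2) : dt (Lv A f) = Lv A (dt f) := by
  rw [Lv_apply, Lv_apply, map_add, Derivation.leibniz, dt_A hA, pd_comm _ (0, false),
    pd_comm _ (1, false)]; simp
theorem dz_Lb (hA : A ∈ H m (m - 1)) (f : R2) : dz (Lb A f) = Lb A (dz f) := by
  rw [Lb_apply, Lb_apply, map_add, Derivation.leibniz, dz_cA hA, pd_comm _ (0, true),
    pd_comm _ (1, true)]; simp
theorem dt_Lb (hA : A ∈ H m (m - 1)) (f : R2) : dt (Lb A f) = Lb A (dt f) := by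
  rw [Lb_apply, Lb_apply, map_add, Derivation.leibniz, dt_cA hA, pd_comm]; simp

theorem Lv_Lb (hA : A ∈ H m (m - 1)) (f : R2) :
    Lv A (Lb A f) = dx (dy f) + A * dz (dy f) + cjp A * dx (dt f) + A * cjp A * dz (dt f)
      + cjp (dy A) * dt f := by
  simp only [Lv_apply, Lb_apply, map_add, Derivation.leibniz, smul_eq_mul, dz_cA hA, cjp_dy]
  ring

theorem comm_L (hA : A ∈ H m (m - 1)) (f : R2) :
    Lv A (Lb A f) = Lb A (Lv A f) + cjp (dy A) * dt f - dy A * dz f := by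
  rw [Lv_Lb hA]
  simp only [Lv_apply, Lb_apply, map_add, Derivation.leibniz, smul_eq_mul, dt_A hA, cjp_dy]
  rw [pd_comm (0, true) (0, false), pd_comm (0, true) (1, false), pd_comm (1, true) (0, false),
    pd_comm (1, true) (1, false)]
  ring

theorem cjp_fL (hr : cjp P = P) : cjp (fL A P) = fL A P := by
  simp only [fL, map_add, map_mul, cjp_dx, cjp_dy, cjp_dz, cjp_dt, hr, cjp_cjp]
  rw [pd_comm (0, true) (0, false), pd_comm (0, true) (1, false), pd_comm (1, true) (0, false),
    pd_comm (1, true) (1, false)]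
  ring

theorem cjp_uL (hr : cjp P = P) : cjp (uL A P) = vL A P := by
  rw [uL, vL, cjp_Lv, cjp_dt, hr]

theorem cjp_vL (hr : cjp P = P) : cjp (vL A P) = uL A P := by
  rw [← cjp_uL hr, cjp_cjp]

theorem cjp_zt (hr : cjp P = P) : cjp (dz (dt P)) = dz (dt P) := by
  rw [cjp_dz, cjp_dt, hr, pd_comm]

end

/-- Discriminant of a hermitian form in two variables. -/
theorem hermitian_disc {α β u v : ℂ} (hv : v = starRingEnd ℂ u) (hα : α.im = 0) (hβ : β.im = 0)
    (h : ∀ s r : ℂ, 0 ≤ (α * s * starRingEnd ℂ s + u * s * starRingEnd ℂ r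
      + v * r * starRingEnd ℂ s + β * r * starRingEnd ℂ r).re) :
    0 ≤ α.re ∧ 0 ≤ β.re ∧ Complex.normSq u ≤ α.re * β.re := by
  have h1 : 0 ≤ α.re := by simpa using h 1 0
  have h2 : 0 ≤ β.re := by simpa using h 0 1
  refine ⟨h1, h2, ?_⟩
  have h3 : ∀ t k : ℝ, 0 ≤ α.re * t ^ 2 - 2 * t * k * Complex.normSq u
      + β.re * k ^ 2 * Complex.normSq u := by
    intro t k
    have := h t (-k * u)
    subst hv
    refine this.trans_eq ?_
    simp [Complex.normSq_apply, hα, hβ]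
    ring
  rcases h2.eq_or_lt with h4 | h4
  · by_contra hc
    rw [← h4, mul_zero, not_le] at hc
    have := h3 1 ((α.re + 1) / (2 * Complex.normSq u))
    rw [← h4] at this
    have e : 2 * 1 * ((α.re + 1) / (2 * Complex.normSq u)) * Complex.normSq u = α.re + 1 := by
      field_simp
    rw [e] at this
    linarith
  · have := h3 β.re 1
    have h5 : 0 ≤ β.re * (α.re * β.re - Complex.normSq u) := by nlinarith
    nlinarith [nonneg_of_mul_nonneg_right h5 h4]

theorem ev_im_of_real {p : R2} (h : cjp p = p) (a b : ℂ) : (ev a b p).im = 0 := by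
  have := ev_cjp a b p
  rw [h] at this
  exact Complex.conj_eq_iff_im.1 this.symm

theorem Psd.disc {A P : R2} (h : Psd P) (hr : cjp P = P) (a b : ℂ) :
    0 ≤ (ev a b (fL A P)).re ∧ 0 ≤ (ev a b (dz (dt P))).re ∧
      Complex.normSq (ev a b (uL A P)) ≤ (ev a b (fL A P)).re * (ev a b (dz (dt P))).re := by
  refine hermitian_disc (v := ev a b (vL A P)) ?_ (ev_im_of_real (cjp_fL hr) a b)
    (ev_im_of_real (cjp_zt hr) a b) fun s r => ?_
  · rw [← cjp_uL hr, ev_cjp]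
  · have := h a b s (ev a b A * s + r)
    refine this.trans_eq (congrArg Complex.re ?_)
    simp only [fL, uL, vL, Lv_apply, Lb_apply, map_add, map_mul, ev_cjp]
    rw [pd_comm (0, true) (1, false), pd_comm (1, true) (1, false)]
    ring

theorem uL_eq_zero {A P : R2} (h : Psd P) (hr : cjp P = P) (hF : fL A P = 0) : uL A P = 0 :=
  eq_zero_of_ev fun a b => by
    have := (h.disc (A := A) hr a b).2.2
    rw [hF] at this
    simp only [map_zero, Complex.zero_re, zero_mul] at this
    exact Complex.normSq_eq_zero.1 (le_antisymm this (Complex.normSq_nonneg _))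

/-- The constant coefficient as a linear map. -/
noncomputable def eps : R2 →ₗ[ℂ] ℂ where
  toFun := constantCoeff
  map_add' := map_add _
  map_smul' c p := by simp [MvPolynomial.smul_eq_C_mul]

@[simp] theorem eps_apply (p : R2) : eps p = constantCoeff p := rfl

theorem H_eps {m : ℕ} {s : ℤ} {p : R2} (hp : p ∈ H m s) (hs : s ≠ 0) : constantCoeff p = 0 := by
  by_contra h
  have := hp (d := 0) h
  simp at this
  exact hs this.symm

theorem H_eq_zero_of_pd {m : ℕ} {s : ℤ} {p : R2} (hm : 0 < m) (hp : p ∈ H m s) (hs : s ≠ 0)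
    (h1 : dx p = 0) (h2 : dy p = 0) (h3 : dz p = 0) (h4 : dt p = 0) : p = 0 := by
  refine eq_zero_of_pderiv (w := wm m) hp (wm_pos hm) (fun i => ?_) (H_eps hp hs)
  obtain ⟨i, e⟩ := i
  fin_cases i <;> cases e
  exacts [h1, h2, h3, h4]

theorem H_eq_zero_of_const {m : ℕ} {p : R2} (hm : 0 < m) (hp : p ∈ H m 0)
    (h : constantCoeff p = 0) : p = 0 := by
  rw [H_const hp hm, h, map_zero]

section

variable {m N : ℕ} {A P : R2}

/-- Words in the model vector fields acting on polynomials in `z₁, z̄₁`. -/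
noncomputable def W0 (hm : 0 < m) (hA : A ∈ H m (m - 1)) : WordAlg R2 where
  l := ld A
  H d := H m d ⊓ LinearMap.ker dz.toLinearMap ⊓ LinearMap.ker dt.toLinearMap
  ε := eps
  l_mem := by
    rintro d f ⟨⟨h1, h2⟩, h3⟩ b
    replace h2 : dz f = 0 := h2
    replace h3 : dt f = 0 := h3
    refine ⟨⟨H_ld hA h1 b, ?_⟩, ?_⟩
    · change dz (ld A b f) = 0
      cases b
      · rw [ld_false, dz_Lv hA, h2, map_zero]
      · rw [ld_true, dz_Lb hA, h2, map_zero]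
    · change dt (ld A b f) = 0
      cases b
      · rw [ld_false, dt_Lv hA, h3, map_zero]
      · rw [ld_true, dt_Lb hA, h3, map_zero]
  neg := fun h hd => H_neg h.1.1 hd
  kill := by
    rintro d f ⟨⟨h1, h2⟩, h3⟩ hd hl
    replace h2 : dz f = 0 := h2
    replace h3 : dt f = 0 := h3
    have e1 := hl false
    have e2 := hl true
    rw [ld_false, Lv_apply, h2, mul_zero, add_zero] at e1
    rw [ld_true, Lb_apply, h3, mul_zero, add_zero] at e2
    exact H_eq_zero_of_pd hm h1 hd e1 e2 h2 h3
  zero := fun h h0 => H_eq_zero_of_const hm h.1.1 h0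
  mul_mem := by
    rintro d e f g ⟨⟨h1, h2⟩, h3⟩ ⟨⟨k1, k2⟩, k3⟩
    replace h2 : dz f = 0 := h2
    replace h3 : dt f = 0 := h3
    replace k2 : dz g = 0 := k2
    replace k3 : dt g = 0 := k3
    refine ⟨⟨H_mul h1 k1, ?_⟩, ?_⟩
    · change dz (f * g) = 0
      rw [Derivation.leibniz, h2, k2]; simp
    · change dt (f * g) = 0
      rw [Derivation.leibniz, h3, k3]; simp

theorem mem_W0 {hm : 0 < m} {hA : A ∈ H m (m - 1)} {d : ℤ} {f : R2} (h1 : f ∈ H m d)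
    (h2 : dz f = 0) (h3 : dt f = 0) : f ∈ (W0 hm hA).H d := ⟨⟨h1, h2⟩, h3⟩

/-- The model theorem when `z₂` has the same weight as the transversal variable. -/
theorem Hyp.flat_of_eq (h : Hyp m m A P) : Flat P := by
  have hm := h.hm
  have hm0 : 0 < m := by omega
  have a1 : dx (dt P) = 0 := H_neg (H_dx (H_dt h.hP)) (by omega)
  have a2 : dz (dy P) = 0 := H_neg (H_dz (H_dy h.hP)) (by omega)
  have a3 : dz (dt P) = 0 := H_neg (H_dz (H_dt h.hP)) (by omega)
  have a4 : uL A P = 0 := by rw [uL, Lv_apply, a1, a3]; simp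
  have a5 : vL A P = 0 := by rw [← cjp_uL h.real, a4, map_zero]
  have a6 : fL A P = dx (dy P) := by rw [fL, a1, a2, a3]; simp
  have h0 : ∀ w : List Bool, (w.length : ℤ) = m - 2 → eps (lw (ld A) w (fL A P)) = 0 := by
    rcases h.van with hv | hv
    · intro w hw
      have := hv w hw
      rwa [a4, a5, dl_zero] at this
    · exact hv
  refine ⟨?_, a1, a2, a3⟩
  rw [← a6]
  refine (W0 hm0 h.hA).star (mem_W0 (H_fL h.hA h.hP) ?_ ?_) h0
  · exact H_neg (H_dz (H_fL h.hA h.hP)) (by omega)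
  · exact H_neg (H_dt (H_fL h.hA h.hP)) (by omega)

theorem g_mem_W0 (hm : 0 < m) (hA : A ∈ H m (m - 1)) : dy A ∈ (W0 hm hA).H (m - 2) :=
  mem_W0 (H_g hA) (dz_g hA) (dt_g hA)

theorem cg_mem_W0 (hm : 0 < m) (hA : A ∈ H m (m - 1)) : cjp (dy A) ∈ (W0 hm hA).H (m - 2) :=
  mem_W0 (H_cjp (H_g hA)) (by rw [← cjp_dt, dt_g hA, map_zero])
    (by rw [← cjp_dz, dz_g hA, map_zero])

theorem W0_const (hm : 0 < m) (hA : A ∈ H m (m - 1)) {f : R2} (hf : f ∈ (W0 hm hA).H (m - 2))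
    {w : List Bool} (hw : (w.length : ℤ) = m - 2) :
    lw (ld A) w f = algebraMap ℂ R2 (constantCoeff (lw (ld A) w f)) := by
  have h := (W0 hm hA).lw_mem hf w
  rw [hw, sub_self] at h
  exact H_const h.1.1 hm

theorem exists_word {hm : 0 < m} {hA : A ∈ H m (m - 1)} {f : R2} (hf : f ∈ (W0 hm hA).H (m - 2))
    (h0 : f ≠ 0) : ∃ w : List Bool, (w.length : ℤ) = m - 2 ∧
      constantCoeff (lw (ld A) w f) ≠ 0 := by
  by_contra hc
  push Not at hc
  exact h0 ((W0 hm hA).star hf hc)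

theorem exists_words (hm : 0 < m) (hA : A ∈ H m (m - 1)) (hg : dy A ≠ 0)
    (hind : ∀ κ : ℂ, cjp (dy A) ≠ C κ * dy A) :
    ∃ w₁ w₂ : List Bool, (w₁.length : ℤ) = m - 2 ∧ (w₂.length : ℤ) = m - 2 ∧
      constantCoeff (lw (ld A) w₁ (dy A)) * constantCoeff (lw (ld A) w₂ (cjp (dy A)))
      - constantCoeff (lw (ld A) w₂ (dy A)) * constantCoeff (lw (ld A) w₁ (cjp (dy A))) ≠ 0 := by
  obtain ⟨w₁, hw₁, h1⟩ := exists_word (g_mem_W0 hm hA) hg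
  by_contra hc
  push Not at hc
  set a := constantCoeff (lw (ld A) w₁ (dy A))
  set b := constantCoeff (lw (ld A) w₁ (cjp (dy A)))
  have h2 : a • cjp (dy A) - b • dy A = 0 := by
    refine (W0 hm hA).star (sub_mem (Submodule.smul_mem _ _ (cg_mem_W0 hm hA))
      (Submodule.smul_mem _ _ (g_mem_W0 hm hA))) fun w hw => ?_
    have := hc w₁ w hw₁ hw
    change constantCoeff (lw (ld A) w _) = 0
    rw [lw_sub, lw_smul, lw_smul]
    simp only [map_sub, constantCoeff_smul, smul_eq_mul]
    linear_combination this
  refine hind (b / a) ?_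
  have h3 : cjp (dy A) = a⁻¹ • (b • dy A) := by
    rw [← sub_eq_zero.1 h2, smul_smul, inv_mul_cancel₀ h1, one_smul]
  rw [h3, smul_smul, MvPolynomial.smul_eq_C_mul, div_eq_mul_inv, mul_comm b]

theorem algebraMap_det {a b c d : ℂ} (h : a * b - c * d ≠ 0) :
    algebraMap ℂ R2 a * algebraMap ℂ R2 b - algebraMap ℂ R2 c * algebraMap ℂ R2 d ≠ 0 := by
  rw [← map_mul, ← map_mul, ← map_sub]
  exact fun hc => h ((map_eq_zero_iff _ (C_injective _ _)).1 hc)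

/-- Words in the model vector fields acting on all polynomials. -/
noncomputable def W1 (hm : 0 < m) (hA : A ∈ H m (m - 1)) (hg : dy A ≠ 0)
    (hind : ∀ κ : ℂ, cjp (dy A) ≠ C κ * dy A) : WordAlg R2 where
  l := ld A
  H d := H m d
  ε := eps
  l_mem := fun h b => H_ld hA h b
  neg := H_neg
  kill := by
    intro d f hf hd hl
    have e1 : Lv A f = 0 := hl false
    have e2 : Lb A f = 0 := hl true
    have e3 := comm_L hA f
    rw [e1, e2, map_zero, map_zero, zero_add] at e3
    have z1 : ∀ b, ld A b (dz f) = 0 := by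
      intro b
      cases b
      · rw [ld_false, ← dz_Lv hA, e1, map_zero]
      · rw [ld_true, ← dz_Lb hA, e2, map_zero]
    have t1 : ∀ b, ld A b (dt f) = 0 := by
      intro b
      cases b
      · rw [ld_false, ← dt_Lv hA, e1, map_zero]
      · rw [ld_true, ← dt_Lb hA, e2, map_zero]
    have key : ∀ w, lw (ld A) w (cjp (dy A)) * dt f - lw (ld A) w (dy A) * dz f = 0 := by
      intro w
      induction w with
      | nil => exact e3.symm
      | cons b w ih =>
        have := congrArg (ld A b) ih
        rw [map_sub, Derivation.leibniz, Derivation.leibniz, z1, t1, map_zero] at this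
        simp only [smul_eq_mul] at this
        rw [← this, lw, lw]
        ring
    obtain ⟨w₁, w₂, hw₁, hw₂, hne⟩ := exists_words hm hA hg hind
    have k1 := key w₁
    have k2 := key w₂
    rw [W0_const hm hA (g_mem_W0 hm hA) hw₁, W0_const hm hA (cg_mem_W0 hm hA) hw₁] at k1
    rw [W0_const hm hA (g_mem_W0 hm hA) hw₂, W0_const hm hA (cg_mem_W0 hm hA) hw₂] at k2
    set a₁ := constantCoeff (lw (ld A) w₁ (dy A))
    set a₂ := constantCoeff (lw (ld A) w₂ (dy A))
    set b₁ := constantCoeff (lw (ld A) w₁ (cjp (dy A)))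
    set b₂ := constantCoeff (lw (ld A) w₂ (cjp (dy A)))
    have hne' : algebraMap ℂ R2 a₁ * algebraMap ℂ R2 b₂ - algebraMap ℂ R2 a₂ * algebraMap ℂ R2 b₁
        ≠ 0 := by
      exact algebraMap_det hne
    have z2 : dz f = 0 := by
      refine (mul_eq_zero.1 (?_ : _ * dz f = 0)).resolve_left hne'
      linear_combination algebraMap ℂ R2 b₁ * k2 - algebraMap ℂ R2 b₂ * k1
    have t2 : dt f = 0 := by
      refine (mul_eq_zero.1 (?_ : _ * dt f = 0)).resolve_left hne'
      linear_combination algebraMap ℂ R2 a₁ * k2 - algebraMap ℂ R2 a₂ * k1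
    rw [Lv_apply, z2, mul_zero, add_zero] at e1
    rw [Lb_apply, t2, mul_zero, add_zero] at e2
    exact H_eq_zero_of_pd hm hf hd e1 e2 z2 t2
  zero := fun h h0 => H_eq_zero_of_const hm h h0
  mul_mem := H_mul

/-- The potential of the Levi form when `g` and its conjugate are independent. -/
theorem Hyp.exists_potential (h : Hyp m N A P) (hN : m < N) (hg : dy A ≠ 0)
    (hind : ∀ κ : ℂ, cjp (dy A) ≠ C κ * dy A) :
    ∃ v₀ ∈ H m (N - m), Lv A v₀ = 0 ∧ Lb A v₀ = vL A P ∧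
      fL A P = - (dy A * v₀) - cjp (dy A) * cjp v₀ ∧ dz (dt P) = dt v₀ + cjp (dt v₀) := by
  have hm := h.hm
  have hm0 : 0 < m := by omega
  have hA := h.hA
  have hr := h.real
  let W := W1 hm0 hA hg hind
  have hv : ∀ w : List Bool, (w.length : ℤ) = N - 2 →
      eps (dl (ld A) (-dy A) (cjp (dy A)) (uL A P) (vL A P) (fL A P) w) = 0 := by
    rcases h.van with hv | hv
    · exact hv
    · have hF : fL A P = 0 := W.star (d := N - 2) (H_fL hA h.hP) hv
      have hu : uL A P = 0 := uL_eq_zero h.psd hr hF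
      have hv' : vL A P = 0 := by rw [← cjp_uL hr, hu, map_zero]
      intro w _
      rw [hF, hu, hv', dl_zero, lw_zero, map_zero]
  obtain ⟨w₁, w₂, hw₁, hw₂, hne⟩ := exists_words hm0 hA hg hind
  obtain ⟨f₁, hf₁, f₂, hf₂, e1, e2, e3, e4, e5⟩ :=
    WordAlg.dl_pair (W := W) (m := m) (N := N) (by omega) (by omega)
      (neg_mem (H_g hA) : -dy A ∈ H m (m - 2))
      (H_cjp (H_g hA) : cjp (dy A) ∈ H m (m - 2)) (H_uL hA h.hP : uL A P ∈ H m (N - m - 1))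
      (H_vL hA h.hP) (H_fL hA h.hP) hv hw₁ hw₂
      (a₁ := -constantCoeff (lw (ld A) w₁ (dy A))) (a₂ := -constantCoeff (lw (ld A) w₂ (dy A)))
      (b₁ := constantCoeff (lw (ld A) w₁ (cjp (dy A))))
      (b₂ := constantCoeff (lw (ld A) w₂ (cjp (dy A))))
      (by rw [map_neg, ← W0_const hm0 hA (g_mem_W0 hm0 hA) hw₁]; exact lw_neg _ _ _)
      (by rw [map_neg, ← W0_const hm0 hA (g_mem_W0 hm0 hA) hw₂]; exact lw_neg _ _ _)
      (by rw [← W0_const hm0 hA (cg_mem_W0 hm0 hA) hw₁]; rfl)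
      (by rw [← W0_const hm0 hA (cg_mem_W0 hm0 hA) hw₂]; rfl)
      (fun hc => hne (by linear_combination -hc))
  replace e1 : Lv A f₁ = 0 := e1
  replace e2 : Lb A f₁ = vL A P := e2
  replace e3 : Lv A f₂ = -uL A P := e3
  replace e4 : Lb A f₂ = 0 := e4
  have c3 : Lb A (cjp f₂) = -vL A P := by rw [← cjp_Lv, e3, map_neg, cjp_uL hr]
  have c4 : Lv A (cjp f₂) = 0 := by rw [← cjp_Lb, e4, map_zero]
  have e5' := congrArg cjp e5
  simp only [cjp_fL hr, map_add, map_mul, map_neg, cjp_cjp] at e5'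
  set v₀ := (1 / 2 : ℂ) • (f₁ - cjp f₂) with hv₀
  have h2 : (C (1 / 2) : R2) * 2 = 1 := by
    rw [← map_ofNat C 2, ← C_mul]; norm_num
  have g1 : Lv A v₀ = 0 := by rw [hv₀, Derivation.map_smul, map_sub, e1, c4]; simp
  have g2 : Lb A v₀ = vL A P := by
    rw [hv₀, Derivation.map_smul, map_sub, e2, c3, MvPolynomial.smul_eq_C_mul]
    linear_combination vL A P * h2
  have g3 : fL A P = - (dy A * v₀) - cjp (dy A) * cjp v₀ := by
    rw [hv₀, cjp_smul, map_sub, cjp_cjp, MvPolynomial.smul_eq_C_mul, MvPolynomial.smul_eq_C_mul]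
    rw [show starRingEnd ℂ (1 / 2) = 1 / 2 by rw [map_div₀, map_one, map_ofNat]]
    linear_combination C (1 / 2) * e5 + C (1 / 2) * e5' - fL A P * h2
  refine ⟨v₀, Submodule.smul_mem _ _ (sub_mem hf₁ (H_cjp hf₂)), g1, g2, g3, ?_⟩
  have k1 := comm_L hA v₀
  rw [g1, g2, map_zero, zero_add, vL, ← dz_Lb hA, ← dz_Lv hA, Lv_Lb hA] at k1
  change dz (fL A P + cjp (dy A) * dt P) = _ at k1
  have hcg : dz (cjp (dy A)) = 0 := by rw [← cjp_dt, dt_g hA, map_zero]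
  rw [g3] at k1
  simp only [map_add, map_sub, map_neg, Derivation.leibniz, dz_g hA, hcg, smul_eq_mul] at k1
  have hcg0 : cjp (dy A) ≠ 0 := fun hc => hg (by rw [← cjp_cjp (dy A), hc, map_zero])
  rw [cjp_dt]
  refine mul_left_cancel₀ hcg0 ?_
  linear_combination k1

end

end Mdl

namespace Mdl

open MvPolynomial SF

/-! Averages over circles. -/

theorem circleAverage_mono_pow (r : ℝ) (i j : ℕ) :
    Real.circleAverage (fun x : ℂ => x ^ i * starRingEnd ℂ x ^ j) 0 r
      = if i = j then ((r : ℂ) ^ 2) ^ i else 0 := by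
  have hs : ∀ x ∈ Metric.sphere (0 : ℂ) |r|, x * starRingEnd ℂ x = (r : ℂ) ^ 2 := by
    intro x hx
    rw [mem_sphere_zero_iff_norm] at hx
    rw [Complex.mul_conj, Complex.normSq_eq_norm_sq, hx, sq_abs]
    push_cast; rfl
  have hpow : ∀ k : ℕ, 0 < k → Real.circleAverage (fun x : ℂ => x ^ k) 0 r = 0 := by
    intro k hk
    have : DiffContOnCl ℂ (fun x : ℂ => x ^ k) (Metric.ball 0 |r|) :=
      (differentiable_pow k).diffContOnCl
    rw [this.circleAverage, zero_pow hk.ne']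
  rcases lt_trichotomy i j with h | rfl | h
  · rw [if_neg h.ne]
    obtain ⟨k, rfl⟩ := Nat.exists_eq_add_of_lt h
    have e : Set.EqOn (fun x : ℂ => x ^ i * starRingEnd ℂ x ^ (i + k + 1))
        (fun x : ℂ => ((r : ℂ) ^ 2) ^ i • (Complex.conjCLE ∘ fun x : ℂ => x ^ (k + 1)) x)
        (Metric.sphere 0 |r|) := by
      intro x hx
      simp only [Function.comp, Complex.conjCLE_apply, map_pow, smul_eq_mul]
      rw [← hs x hx]
      ring
    rw [Real.circleAverage_congr_sphere e, Real.circleAverage_fun_smul]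
    have := ContinuousLinearMap.circleAverage_comp_comm (c := 0) (R := r)
      (Complex.conjCLE : ℂ →L[ℝ] ℂ) (f := fun x : ℂ => x ^ (k + 1))
      (ContinuousOn.circleIntegrable' (by fun_prop))
    rw [hpow _ k.succ_pos, map_zero] at this
    have h2 : Real.circleAverage (Complex.conjCLE ∘ fun x : ℂ => x ^ (k + 1)) 0 r = 0 := this
    rw [h2, smul_zero]
  · rw [if_pos rfl]
    refine Real.circleAverage_const_on_circle fun x hx => ?_
    rw [← mul_pow, hs x hx]
  · rw [if_neg h.ne']
    obtain ⟨k, rfl⟩ := Nat.exists_eq_add_of_lt h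
    have e : Set.EqOn (fun x : ℂ => x ^ (j + k + 1) * starRingEnd ℂ x ^ j)
        (fun x : ℂ => ((r : ℂ) ^ 2) ^ j • x ^ (k + 1)) (Metric.sphere 0 |r|) := by
      intro x hx
      simp only [smul_eq_mul]
      rw [← hs x hx]
      ring
    rw [Real.circleAverage_congr_sphere e, Real.circleAverage_fun_smul, hpow _ k.succ_pos,
      smul_zero]

/-- The diagonal part of a polynomial in `z₁, z̄₁`. -/
noncomputable def dg : R2 →ₗ[ℂ] Polynomial ℂ :=
  (basisMonomials (Fin 2 × Bool) ℂ).constr ℂ fun e =>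
    if e (1, false) = 0 ∧ e (1, true) = 0 ∧ e (0, false) = e (0, true)
      then Polynomial.X ^ e (0, false) else 0

theorem dg_monomial (e : Fin 2 × Bool →₀ ℕ) (c : ℂ) :
    dg (monomial e c) = if e (1, false) = 0 ∧ e (1, true) = 0 ∧ e (0, false) = e (0, true)
      then c • Polynomial.X ^ e (0, false) else 0 := by
  have h : (monomial e c : R2) = c • basisMonomials (Fin 2 × Bool) ℂ e := by
    simp [smul_monomial]
  rw [h, map_smul, dg, Module.Basis.constr_basis, smul_ite, smul_zero]

theorem S_monomial {B : Type*} [CommRing B] [Algebra ℂ B] (a b c d : B) (e : Fin 2 × Bool →₀ ℕ)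
    (k : ℂ) : S a b c d (monomial e k) = algebraMap ℂ B k * (a ^ e (0, false) * b ^ e (0, true)
      * (c ^ e (1, false) * d ^ e (1, true))) := by
  rw [S, aeval_monomial, Finsupp.prod_fintype _ _ (by simp), Fintype.prod_prod_type]
  simp only [Fin.prod_univ_two, Fintype.prod_bool, pt_x, pt_y, pt_z, pt_t]
  ring

theorem continuous_S {T : Type*} [TopologicalSpace T] {a b c d : T → ℂ} (ha : Continuous a)
    (hb : Continuous b) (hc : Continuous c) (hd : Continuous d) (p : R2) :
    Continuous fun x => S (a x) (b x) (c x) (d x) p := by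
  induction p using MvPolynomial.induction_on' with
  | monomial e k => simp only [S_monomial]; fun_prop
  | add p q hp hq => simp only [map_add]; exact hp.add hq

theorem continuous_ev {T : Type*} [TopologicalSpace T] {a b : T → ℂ} (ha : Continuous a)
    (hb : Continuous b) (p : R2) : Continuous fun x => ev (a x) (b x) p :=
  continuous_S ha (Complex.continuous_conj.comp ha) hb (Complex.continuous_conj.comp hb) p

theorem circleIntegrable_ev (p : R2) (r : ℝ) : CircleIntegrable (fun x => ev x 0 p) 0 r :=
  (continuous_ev continuous_id continuous_const p).continuousOn.circleIntegrable'

theorem circleAverage_ev (p : R2) (r : ℝ) :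
    Real.circleAverage (fun x => ev x 0 p) 0 r = (dg p).eval ((r : ℂ) ^ 2) := by
  induction p using MvPolynomial.induction_on' with
  | monomial e k =>
    simp only [dg_monomial, ev_def, S_monomial, map_zero]
    by_cases h1 : e (1, false) = 0
    · by_cases h2 : e (1, true) = 0
      · simp only [h1, h2, true_and, pow_zero, mul_one, Algebra.algebraMap_self, RingHom.id_apply]
        have := Real.circleAverage_fun_smul (a := k) (c := 0) (R := r)
          (f := fun x : ℂ => x ^ e (0, false) * starRingEnd ℂ x ^ e (0, true))
        simp only [smul_eq_mul] at this
        rw [this, circleAverage_mono_pow]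
        split_ifs <;> simp
      · simp [h2, Real.circleAverage_const]
    · simp [h1, Real.circleAverage_const]
  | add p q hp hq =>
    simp only [map_add, Polynomial.eval_add]
    rw [← hp, ← hq]
    exact Real.circleAverage_fun_add (circleIntegrable_ev p r) (circleIntegrable_ev q r)

theorem dg_dx_dy (p : R2) :
    dg (dx (dy p)) = Polynomial.derivative (Polynomial.X * Polynomial.derivative (dg p)) := by
  induction p using MvPolynomial.induction_on' with
  | monomial e k =>
    rw [pderiv_monomial, pderiv_monomial, dg_monomial, dg_monomial]
    simp only [Finsupp.coe_tsub, Pi.sub_apply, Finsupp.single_apply, Prod.mk.injEq, Fin.isValue,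
      zero_ne_one, false_and, if_false, tsub_zero, Bool.true_eq_false, and_false, if_true,
      Bool.false_eq_true, and_self]
    by_cases hc : e (1, false) = 0 ∧ e (1, true) = 0
    · obtain ⟨h1, h2⟩ := hc
      simp only [h1, h2, true_and]
      generalize e (0, false) = i
      generalize e (0, true) = j
      rcases Nat.eq_zero_or_pos i with rfl | hi
      · by_cases hj : 0 = j
        · subst hj; simp
        · simp [hj]
      rcases Nat.eq_zero_or_pos j with rfl | hj
      · have : i ≠ 0 := hi.ne'
        simp [this]
      obtain ⟨i, rfl⟩ := Nat.exists_eq_succ_of_ne_zero hi.ne'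
      obtain ⟨j, rfl⟩ := Nat.exists_eq_succ_of_ne_zero hj.ne'
      by_cases hij : i = j
      · subst hij
        simp only [Nat.succ_eq_add_one, add_tsub_cancel_right, if_true, Polynomial.derivative_smul,
          Polynomial.derivative_X_pow, mul_smul_comm]
        rw [mul_left_comm, ← pow_succ', Polynomial.derivative_C_mul, Polynomial.derivative_X_pow]
        simp only [add_tsub_cancel_right, Polynomial.smul_eq_C_mul, map_mul]
        push_cast
        ring
      · simp [hij]
    · rw [if_neg, if_neg]
      · simp
      · tauto
      · tauto
  | add p q hp hq => simp only [map_add, hp, hq, mul_add]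

theorem dg_x_dx (p : R2) : dg (vx * dx p) = Polynomial.X * Polynomial.derivative (dg p) := by
  induction p using MvPolynomial.induction_on' with
  | monomial e k =>
    rw [X_mul_pderiv_monomial, map_nsmul, dg_monomial]
    split_ifs with h
    · rw [Polynomial.derivative_smul, Polynomial.derivative_X_pow]
      rcases Nat.eq_zero_or_pos (e (0, false)) with h0 | h0
      · simp [h0]
      · obtain ⟨i, hi⟩ := Nat.exists_eq_succ_of_ne_zero h0.ne'
        rw [hi]
        simp only [Polynomial.smul_eq_C_mul, nsmul_eq_mul, Nat.succ_eq_add_one,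
          add_tsub_cancel_right, Nat.cast_add, Nat.cast_one, map_add, map_natCast, map_one]
        ring
    · simp
  | add p q hp hq => simp only [map_add, hp, hq, mul_add]

theorem dg_y_dy (p : R2) : dg (vy * dy p) = Polynomial.X * Polynomial.derivative (dg p) := by
  induction p using MvPolynomial.induction_on' with
  | monomial e k =>
    rw [X_mul_pderiv_monomial, map_nsmul, dg_monomial]
    split_ifs with h
    · rw [Polynomial.derivative_smul, Polynomial.derivative_X_pow, ← h.2.2]
      rcases Nat.eq_zero_or_pos (e (0, false)) with h0 | h0
      · simp [h0]
      · obtain ⟨i, hi⟩ := Nat.exists_eq_succ_of_ne_zero h0.ne'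
        rw [hi]
        simp only [Polynomial.smul_eq_C_mul, nsmul_eq_mul, Nat.succ_eq_add_one,
          add_tsub_cancel_right, Nat.cast_add, Nat.cast_one, map_add, map_natCast, map_one]
        ring
    · simp
  | add p q hp hq => simp only [map_add, hp, hq, mul_add]

/-- The average over the unit circle. -/
noncomputable def av (p : R2) : ℂ := (dg p).eval 1

theorem av_eq (p : R2) : av p = Real.circleAverage (fun x => ev x 0 p) 0 1 := by
  rw [circleAverage_ev, av]; simp

theorem av_add (p q : R2) : av (p + q) = av p + av q := by simp [av]
theorem av_C_mul (c : ℂ) (p : R2) : av (C c * p) = c * av p := by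
  rw [← MvPolynomial.smul_eq_C_mul]; simp [av]

theorem av_congr {p q : R2} (h : ∀ x : ℂ, ‖x‖ = 1 → ev x 0 p = ev x 0 q) : av p = av q := by
  rw [av_eq, av_eq]
  refine Real.circleAverage_congr_sphere fun x hx => h x ?_
  simpa using hx

theorem re_circleAverage_ev (p : R2) (r : ℝ) :
    ((dg p).eval ((r : ℂ) ^ 2)).re = Real.circleAverage (fun x => (ev x 0 p).re) 0 r := by
  rw [← circleAverage_ev]
  exact (ContinuousLinearMap.circleAverage_comp_comm Complex.reCLM
    (circleIntegrable_ev p r)).symm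

theorem re_dg_nonneg {p : R2} (h : ∀ x, 0 ≤ (ev x 0 p).re) {r : ℝ} (hr : 0 ≤ r) :
    0 ≤ ((dg p).eval (r : ℂ)).re := by
  have := re_circleAverage_ev p (Real.sqrt r)
  rw [← Complex.ofReal_pow, Real.sq_sqrt hr] at this
  rw [this]
  exact Real.circleAverage_nonneg_of_nonneg fun x _ => h x

/-- Averages of polynomials in `z̄₁` alone. -/
theorem av_of_dx {p : R2} (h : dx p = 0) : av p = ev 0 0 p := by
  rw [p.as_sum, av, map_sum, Polynomial.eval_finsetSum, map_sum]
  refine Finset.sum_congr rfl fun e he => ?_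
  have := mem_support_pderiv h he
  rw [dg_monomial, ev_def, S_monomial, this]
  rcases eq_or_ne 0 (e (0, true)) with h3 | h3
  · by_cases h1 : e (1, false) = 0 <;> by_cases h2 : e (1, true) = 0 <;> simp [h1, h2, ← h3]
  · rw [if_neg (by tauto)]
    simp [h3.symm]

/-- The submean value property. -/
theorem submean {p : R2} (h : ∀ x, 0 ≤ (ev x 0 (dx (dy p))).re) :
    (ev 0 0 p).re ≤ (av p).re := by
  have e0 : ev 0 0 p = (dg p).eval 0 := by
    have := circleAverage_ev p 0
    simp only [Real.circleAverage_zero] at this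
    simpa using this
  rw [e0, av]
  have hd : ∀ (q : Polynomial ℂ) (x : ℝ), HasDerivAt (fun r : ℝ => (q.eval (r : ℂ)).re)
      ((Polynomial.derivative q).eval (x : ℂ)).re x := by
    intro q x
    exact (q.hasDerivAt (x : ℂ)).real_of_complex
  have m1 : MonotoneOn (fun r : ℝ => ((Polynomial.X * Polynomial.derivative (dg p)).eval
      (r : ℂ)).re) (Set.Ici 0) := by
    refine monotoneOn_of_hasDerivWithinAt_nonneg (convex_Ici 0)
      (fun x _ => (hd _ x).continuousAt.continuousWithinAt)
      (fun x _ => (hd _ x).hasDerivWithinAt) fun x hx => ?_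
    rw [← dg_dx_dy]
    rw [interior_Ici] at hx
    exact re_dg_nonneg h (le_of_lt hx)
  have m2 : MonotoneOn (fun r : ℝ => ((dg p).eval (r : ℂ)).re) (Set.Ici 0) := by
    refine monotoneOn_of_hasDerivWithinAt_nonneg (convex_Ici 0)
      (fun x _ => (hd _ x).continuousAt.continuousWithinAt)
      (fun x _ => (hd _ x).hasDerivWithinAt) fun x hx => ?_
    rw [interior_Ici] at hx
    have := m1 (Set.mem_Ici.2 le_rfl) (Set.mem_Ici.2 (le_of_lt hx)) (le_of_lt hx)
    simp only [Polynomial.eval_mul, Polynomial.eval_X, Complex.ofReal_zero, zero_mul,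
      Complex.zero_re, Complex.re_ofReal_mul] at this
    exact nonneg_of_mul_nonneg_right this hx
  have := m2 (Set.mem_Ici.2 le_rfl) (Set.mem_Ici.2 zero_le_one) zero_le_one
  simpa using this

theorem av_nonneg {p : R2} (h : ∀ x, 0 ≤ (ev x 0 p).re) : 0 ≤ (av p).re := by
  simpa [av] using re_dg_nonneg h zero_le_one

/-- A nonnegative function of average zero vanishes. -/
theorem eq_zero_of_av {p : R2} (h : ∀ x, 0 ≤ (ev x 0 p).re) (h0 : (av p).re = 0) (x : ℂ)
    (hx : ‖x‖ = 1) : (ev x 0 p).re = 0 := by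
  by_contra hne
  have hpos : 0 < (ev x 0 p).re := lt_of_le_of_ne (h x) (Ne.symm hne)
  have h1 := re_circleAverage_ev p 1
  rw [Complex.ofReal_one, one_pow] at h1
  change (av p).re = _ at h1
  rw [h0, Real.circleAverage_eq_integral_add (x.arg - Real.pi), smul_eq_mul] at h1
  have hc : Continuous fun y => (ev y 0 p).re :=
    Complex.continuous_re.comp (continuous_ev continuous_id continuous_const p)
  have h2 : 0 < ∫ θ in (0 : ℝ)..2 * Real.pi, (ev (circleMap 0 1 (θ + (x.arg - Real.pi))) 0 p).re := by
    refine intervalIntegral.integral_pos Real.two_pi_pos ?_ (fun θ _ => h _)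
      ⟨Real.pi, ⟨Real.pi_pos.le, by linarith [Real.pi_pos]⟩, ?_⟩
    · exact (hc.comp ((continuous_circleMap 0 1).comp (by fun_prop))).continuousOn
    · rw [add_sub_cancel, circleMap, Complex.ofReal_one, one_mul, zero_add]
      have := Complex.norm_mul_exp_arg_mul_I x
      rw [hx, Complex.ofReal_one, one_mul] at this
      rwa [this]
  have h3 : 0 < (2 * Real.pi)⁻¹ := inv_pos.2 Real.two_pi_pos
  exact (mul_pos h3 h2).ne h1

/-- Splitting of a polynomial in `z₁, z̄₁` on the unit circle. -/
theorem circ_split (a : R2) : ∃ p q : Polynomial ℂ,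
    p.eval 0 = 0 ∧ q.eval 0 = 0 ∧ ∀ x : ℂ, ‖x‖ = 1 →
      ev x 0 a = p.eval x + q.eval (starRingEnd ℂ x) + av a := by
  induction a using MvPolynomial.induction_on' with
  | monomial e k =>
    by_cases hc : e (1, false) = 0 ∧ e (1, true) = 0
    swap
    · refine ⟨0, 0, by simp, by simp, fun x _ => ?_⟩
      rw [ev_def, S_monomial, av, dg_monomial, if_neg (by tauto), map_zero]
      simp only [Polynomial.eval_zero, add_zero]
      rcases not_and_or.1 hc with h | h <;> simp [h]
    obtain ⟨h1, h2⟩ := hc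
    have hx1 : ∀ x : ℂ, ‖x‖ = 1 → x * starRingEnd ℂ x = 1 := by
      intro x hx
      rw [Complex.mul_conj, Complex.normSq_eq_norm_sq, hx]; simp
    simp only [ev_def, S_monomial, av, dg_monomial, h1, h2, true_and, pow_zero, mul_one,
      Algebra.algebraMap_self, RingHom.id_apply]
    rcases lt_trichotomy (e (0, false)) (e (0, true)) with h | h | h
    · rw [if_neg h.ne]
      obtain ⟨n, hn⟩ := Nat.exists_eq_add_of_lt h
      refine ⟨0, Polynomial.C k * Polynomial.X ^ (n + 1), by simp, by simp, fun x hx => ?_⟩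
      rw [hn]
      simp only [Polynomial.eval_zero, Polynomial.eval_mul, Polynomial.eval_C,
        Polynomial.eval_pow, Polynomial.eval_X]
      linear_combination k * starRingEnd ℂ x ^ (n + 1) * congrArg (· ^ e (0, false)) (hx1 x hx)
    · rw [if_pos h]
      refine ⟨0, 0, by simp, by simp, fun x hx => ?_⟩
      rw [← h, ← mul_pow, hx1 x hx]
      simp
    · rw [if_neg h.ne']
      obtain ⟨n, hn⟩ := Nat.exists_eq_add_of_lt h
      refine ⟨Polynomial.C k * Polynomial.X ^ (n + 1), 0, by simp, by simp, fun x hx => ?_⟩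
      rw [hn]
      simp only [Polynomial.eval_zero, Polynomial.eval_mul, Polynomial.eval_C,
        Polynomial.eval_pow, Polynomial.eval_X]
      linear_combination k * x ^ (n + 1) * congrArg (· ^ e (0, true)) (hx1 x hx)
  | add a b ha hb =>
    obtain ⟨p, q, hp, hq, h⟩ := ha
    obtain ⟨p', q', hp', hq', h'⟩ := hb
    refine ⟨p + p', q + q', by simp [hp, hp'], by simp [hq, hq'], fun x hx => ?_⟩
    rw [map_add, h x hx, h' x hx, av_add]
    simp only [Polynomial.eval_add]
    ring

/-- Averages of the mixed second derivative of a homogeneous polynomial in `z₁, z̄₁`. -/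
theorem av_dx_dy {m : ℕ} {a : R2} (ha : a ∈ H m m) (h1 : dz a = 0) (h2 : dt a = 0) :
    av (dx (dy a)) = ((m : ℂ) / 2) ^ 2 * av a := by
  have E : ∀ b ∈ H m m, dz b = 0 → dt b = 0 → av (vx * dx b) = (m : ℂ) / 2 * av b ∧
      av (vy * dy b) = (m : ℂ) / 2 * av b := by
    intro b hb hz ht
    have := congrArg av (euler2 hb)
    rw [hz, ht, mul_zero, mul_zero, add_zero, mul_zero, add_zero, av_add, av_C_mul] at this
    have e : av (vx * dx b) = av (vy * dy b) := by rw [av, av, dg_x_dx, dg_y_dy]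
    rw [e] at this ⊢
    push_cast at this
    constructor <;> linear_combination this / 2
  have hb : vy * dy a ∈ H m m := by
    have := H_mul (H_y (m := m)) (H_dy ha)
    rwa [show (1 : ℤ) + (m - 1) = m by ring] at this
  have e1 := (E a ha h1 h2).2
  have e2 := (E (vy * dy a) hb (by rw [Derivation.leibniz, pd_comm, h1]; simp)
    (by rw [Derivation.leibniz, pd_comm, h2]; simp)).1
  have e3 : av (vx * dx (vy * dy a)) = av (dx (dy a)) := by
    refine av_congr fun x hx => ?_
    have hx1 : x * starRingEnd ℂ x = 1 := by
      rw [Complex.mul_conj, Complex.normSq_eq_norm_sq, hx]; simp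
    rw [Derivation.leibniz]
    simp only [map_mul, smul_eq_mul, ev_x, ev_y, mul_zero, add_zero,
      pderiv_X_of_ne (show (0, true) ≠ ((0, false) : Fin 2 × Bool) by simp)]
    rw [← mul_assoc, hx1, one_mul]
  rw [← e3, e2, e1]
  ring

/-! Polynomials with nonnegative real part on a half plane. -/

theorem natDegree_le_one_of_halfPlane {q : Polynomial ℂ}
    (h : ∀ τ : ℂ, 0 ≤ τ.re → 0 ≤ (q.eval τ).re) : q.natDegree ≤ 1 := by
  by_contra hn
  push Not at hn
  set n := q.natDegree with hn'
  have hq : q ≠ 0 := by rintro rfl; simp at hn'; omega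
  set l := q.leadingCoeff with hl
  have hl0 : l ≠ 0 := Polynomial.leadingCoeff_ne_zero.2 hq
  have lim : ∀ u : ℂ, u ≠ 0 → 0 ≤ u.re → 0 ≤ (l * u ^ n).re := by
    intro u hu hur
    have hc : Continuous fun ε : ℝ => (q.reverse.eval ((ε : ℂ) * u⁻¹) * u ^ n).re := by
      have : Continuous fun ε : ℝ => (ε : ℂ) * u⁻¹ := by fun_prop
      exact Complex.continuous_re.comp ((q.reverse.continuous.comp this).mul continuous_const)
    have h0 := hc.tendsto 0
    simp only [Complex.ofReal_zero, zero_mul] at h0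
    rw [← Polynomial.coeff_zero_eq_eval_zero, Polynomial.coeff_zero_reverse] at h0
    refine ge_of_tendsto (h0.mono_left (nhdsWithin_le_nhds (s := Set.Ioi 0))) ?_
    filter_upwards [self_mem_nhdsWithin] with ε hε
    have hε' : (ε : ℂ) ≠ 0 := by exact_mod_cast (ne_of_gt hε)
    have hx : u * (ε : ℂ)⁻¹ ≠ 0 := mul_ne_zero hu (inv_ne_zero hε')
    let _ : Invertible (u * (ε : ℂ)⁻¹) := invertibleOfNonzero hx
    have e := Polynomial.eval₂_reverse_mul_pow (RingHom.id ℂ) (u * (ε : ℂ)⁻¹) q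
    rw [invOf_eq_inv, mul_inv, inv_inv, mul_comm u⁻¹] at e
    change q.reverse.eval ((ε : ℂ) * u⁻¹) * _ = q.eval _ at e
    have e2 : q.reverse.eval ((ε : ℂ) * u⁻¹) * u ^ n = ((ε ^ n : ℝ) : ℂ) * q.eval (u * (ε : ℂ)⁻¹) := by
      rw [← e, mul_pow, ← hn', inv_pow]
      push_cast
      field_simp
    rw [e2, Complex.re_ofReal_mul]
    refine mul_nonneg (pow_nonneg (le_of_lt hε) _) (h _ ?_)
    rw [← Complex.ofReal_inv, mul_comm, Complex.re_ofReal_mul]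
    exact mul_nonneg (inv_nonneg.2 (le_of_lt hε)) hur
  obtain ⟨α, h1, h2, h3⟩ : ∃ α : ℝ, -(Real.pi / 2) ≤ α ∧ α ≤ Real.pi / 2 ∧
      Complex.exp ((l.arg + n * α : ℝ) * Complex.I) = -1 := by
    have hn2 : (2 : ℝ) ≤ n := by exact_mod_cast hn
    have hn0 : (0 : ℝ) < n := by linarith
    have p1 := Complex.neg_pi_lt_arg l
    have p2 := Complex.arg_le_pi l
    have p3 := Real.pi_pos
    rcases le_or_gt 0 l.arg with ha | ha
    · refine ⟨(Real.pi - l.arg) / n, ?_, ?_, ?_⟩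
      · have : 0 ≤ (Real.pi - l.arg) / n := div_nonneg (by linarith) hn0.le
        linarith
      · rw [div_le_div_iff₀ hn0 two_pos]; nlinarith
      · rw [mul_div_cancel₀ _ hn0.ne', add_sub_cancel]
        exact Complex.exp_pi_mul_I
    · refine ⟨(-Real.pi - l.arg) / n, ?_, ?_, ?_⟩
      · rw [← neg_div, div_le_div_iff₀ two_pos hn0]; nlinarith
      · have : (-Real.pi - l.arg) / n ≤ 0 := div_nonpos_of_nonpos_of_nonneg (by linarith) hn0.le
        linarith
      · rw [mul_div_cancel₀ _ hn0.ne', add_sub_cancel, Complex.ofReal_neg, neg_mul,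
          Complex.exp_neg, Complex.exp_pi_mul_I]
        norm_num
  have := lim (Complex.exp (α * Complex.I)) (Complex.exp_ne_zero _) (by
    rw [Complex.exp_ofReal_mul_I_re]
    exact Real.cos_nonneg_of_neg_pi_div_two_le_of_le h1 h2)
  have e : l * Complex.exp (α * Complex.I) ^ n = -(‖l‖ : ℂ) := by
    rw [← Complex.exp_nat_mul]
    nth_rw 1 [← Complex.norm_mul_exp_arg_mul_I l]
    rw [mul_assoc, ← Complex.exp_add, ← mul_neg_one, ← h3]
    congr 2
    push_cast
    ring
  rw [e, Complex.neg_re, Complex.ofReal_re] at this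
  have := norm_pos_iff.2 hl0
  linarith

/-! Decomposition of pluriharmonic polynomials. -/

theorem Flat.exists_holomorphic {m N : ℕ} {P : R2} (hf : Flat P) (hm : 0 < m) (hN : 0 < N)
    (hP : P ∈ H m N) (hr : cjp P = P) : ∃ q ∈ H m N, dy q = 0 ∧ dt q = 0 ∧ P = q + cjp q := by
  obtain ⟨h1, h2, h3, h4⟩ := hf
  have hq : S vx 0 vz 0 P ∈ H m N := H_S H_x (zero_mem _) H_z (zero_mem _) hP
  have hcq : cjp (S vx 0 vz 0 P) = S 0 vy 0 vt P := by
    rw [cjp_S, hr]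
    simp [bar]
  have D1 : ∀ (D : Derivation ℂ R2 R2), D (S vx 0 vz 0 P) = S vx 0 vz 0 (dx P) * D vx
      + S vx 0 vz 0 (dz P) * D vz := by
    intro D; rw [S_deriv]; simp
  have D2 : ∀ (D : Derivation ℂ R2 R2), D (S 0 vy 0 vt P) = S 0 vy 0 vt (dy P) * D vy
      + S 0 vy 0 vt (dt P) * D vt := by
    intro D; rw [S_deriv]; simp
  have h1' : dy (dx P) = 0 := by rw [pd_comm, h1]
  have h2' : dt (dx P) = 0 := by rw [pd_comm, h2]
  have h3' : dy (dz P) = 0 := by rw [pd_comm, h3]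
  have h4' : dt (dz P) = 0 := by rw [pd_comm, h4]
  have e1 : S vx 0 vz 0 (dx P) = dx P := by
    conv_rhs => rw [← S_id (dx P)]
    exact S_congr (Or.inr rfl) (Or.inl h1') (Or.inr rfl) (Or.inl h2')
  have e2 : S vx 0 vz 0 (dz P) = dz P := by
    conv_rhs => rw [← S_id (dz P)]
    exact S_congr (Or.inr rfl) (Or.inl h3') (Or.inr rfl) (Or.inl h4')
  have e3 : S 0 vy 0 vt (dy P) = dy P := by
    conv_rhs => rw [← S_id (dy P)]
    exact S_congr (Or.inl h1) (Or.inr rfl) (Or.inl h3) (Or.inr rfl)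
  have e4 : S 0 vy 0 vt (dt P) = dt P := by
    conv_rhs => rw [← S_id (dt P)]
    exact S_congr (Or.inl h2) (Or.inr rfl) (Or.inl h4) (Or.inr rfl)
  refine ⟨S vx 0 vz 0 P, hq, by rw [D1]; simp [pderiv_X], by rw [D1]; simp [pderiv_X], ?_⟩
  rw [hcq]
  refine sub_eq_zero.1 (H_eq_zero_of_pd (s := N) hm (sub_mem hP (add_mem hq ?_)) (by omega)
    ?_ ?_ ?_ ?_)
  · rw [← hcq]; exact H_cjp hq
  all_goals
    rw [map_sub, map_add, D1, D2, e1, e2, e3, e4]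
    simp [pderiv_X]

end Mdl

namespace Mdl

open MvPolynomial SF

theorem nonneg_of_pos {f : ℝ → ℝ} (hf : Continuous f) (h : ∀ ε, 0 < ε → 0 ≤ f ε) : 0 ≤ f 0 :=
  ge_of_tendsto ((hf.tendsto 0).mono_left (nhdsWithin_le_nhds (s := Set.Ioi 0)))
    (Filter.eventually_of_mem self_mem_nhdsWithin h)

theorem av_re_congr {p q : R2} (h : ∀ x : ℂ, ‖x‖ = 1 → (ev x 0 p).re = (ev x 0 q).re) :
    (av p).re = (av q).re := by
  have e : ∀ p, (av p).re = Real.circleAverage (fun x => (ev x 0 p).re) 0 1 := by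
    intro p
    rw [← re_circleAverage_ev, av]; simp
  rw [e, e]
  refine Real.circleAverage_congr_sphere fun x hx => h x ?_
  simpa using hx

theorem Flat.of_zero {A P : R2} (hpsd : Psd P) (hr : cjp P = P) (hF : fL A P = 0)
    (hzt : dz (dt P) = 0) : Flat P := by
  have h1 := uL_eq_zero (A := A) hpsd hr hF
  rw [uL, Lv_apply, hzt, mul_zero, add_zero] at h1
  have h2 : dz (dy P) = 0 := by
    have := congrArg cjp h1
    rw [cjp_dx, cjp_dt, hr, map_zero, pd_comm] at this
    exact this
  refine ⟨?_, h1, h2, hzt⟩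
  rw [fL, h1, h2, hzt] at hF
  simpa using hF

/-- Translation of `z₂`. -/
noncomputable def th (a : R2) : R2 →ₐ[ℂ] R2 := S vx vy (vz + a) vt

theorem th_of_dz {a f : R2} (hf : dz f = 0) : th a f = f := by
  conv_rhs => rw [← S_id f]
  exact S_congr (Or.inr rfl) (Or.inr rfl) (Or.inl hf) (Or.inr rfl)

theorem th_neg_th {a : R2} (ha : dz a = 0) (f : R2) : th (-a) (th a f) = f := by
  have h : th (-a) a = a := th_of_dz ha
  conv_lhs => rw [th.eq_1 a]
  rw [map_S, map_add, h]
  simp [th, S_id]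

theorem th_th_neg {a : R2} (ha : dz a = 0) (f : R2) : th a (th (-a) f) = f := by
  have := th_neg_th (a := -a) (by rw [map_neg, ha, neg_zero]) f
  rwa [neg_neg] at this

theorem th_dx {a : R2} (h1 : dz (dx a) = 0) (f : R2) : dx (th a f) = th a (Lv (dx a) f) := by
  rw [Lv_apply, map_add, map_mul, th_of_dz h1, th, S_deriv]
  simp [pderiv_X]
  ring

theorem th_dz {a : R2} (h1 : dz a = 0) (f : R2) : dz (th a f) = th a (dz f) := by
  rw [th, S_deriv]
  simp [pderiv_X, h1]

theorem H_th {m : ℕ} {s : ℤ} {a f : R2} (ha : a ∈ H m m) (hf : f ∈ H m s) : th a f ∈ H m s :=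
  H_S H_x H_y (add_mem H_z ha) H_t hf

section

variable {m N : ℕ} {A P : R2}

/-- The antiderivative of `A`. -/
noncomputable def pr (A : R2) : R2 := anti (0, false) A

theorem dx_pr (A : R2) : dx (pr A) = A := pderiv_anti _ _

theorem dz_pr (hA : A ∈ H m (m - 1)) : dz (pr A) = 0 := by
  rw [pr, pderiv_anti_ne (by decide), dz_A hA, map_zero]

theorem dt_pr (hA : A ∈ H m (m - 1)) : dt (pr A) = 0 := by
  rw [pr, pderiv_anti_ne (by decide), dt_A hA, map_zero]

theorem H_pr (hA : A ∈ H m (m - 1)) : pr A ∈ H m m := by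
  have := anti_mem (i := (0, false)) hA
  simpa [pr] using this

theorem pr_zero (hm : 0 < m) (hA : A ∈ H m (m - 1)) {B : Type*} [CommRing B] [Algebra ℂ B]
    (c d : B) : S 0 0 c d (pr A) = 0 := by
  have h : S 0 0 c d (pr A) = S 0 0 0 0 (pr A) :=
    S_congr (Or.inr rfl) (Or.inr rfl) (Or.inl (dz_pr hA)) (Or.inl (dt_pr hA))
  rw [h]
  have h0 : constantCoeff (pr A) = 0 := H_eps (H_pr hA) (by omega)
  have : S (0 : B) 0 0 0 = aeval (fun _ => (0 : B)) := by
    refine algHom_ext fun i => ?_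
    obtain ⟨i, e⟩ := i
    fin_cases i <;> cases e <;> simp [S]
  rw [this]
  change aeval (0 : Fin 2 × Bool → B) _ = 0
  rw [aeval_zero, h0, map_zero]

theorem Lv_th_neg (hA : A ∈ H m (m - 1)) {f : R2} (hf : dx f = 0) : Lv A (th (-pr A) f) = 0 := by
  have h := th_dx (a := pr A) (by rw [dx_pr]; exact dz_A hA) (th (-pr A) f)
  rw [th_th_neg (dz_pr hA), dx_pr, hf] at h
  have := congrArg (th (-pr A)) h
  rw [th_neg_th (dz_pr hA), map_zero] at this
  exact this.symm

theorem dx_th (hA : A ∈ H m (m - 1)) {f : R2} (hf : Lv A f = 0) : dx (th (pr A) f) = 0 := by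
  rw [th_dx (by rw [dx_pr]; exact dz_A hA), dx_pr, hf, map_zero]

/-- Restriction to `z₁ = 0`. -/
noncomputable def S00 : R2 →ₐ[ℂ] R2 := S 0 0 vz vt

theorem ev_S00 (a b : ℂ) (f : R2) : ev a b (S00 f) = ev 0 b f := by
  rw [S00, map_S]; simp [ev_def]

theorem S00_eq_zero {f : R2} (h : ∀ b, ev 0 b f = 0) : S00 f = 0 :=
  eq_zero_of_ev fun a b => by rw [ev_S00, h]

theorem S00_th (hm : 0 < m) (hA : A ∈ H m (m - 1)) {B : Type*} [CommRing B] [Algebra ℂ B]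
    (c d : B) (f : R2) : S 0 0 c d (th (pr A) f) = S 0 0 c d f := by
  rw [th, map_S]; simp [pr_zero hm hA]

theorem dvd_sub_S (f : R2) : vy ∣ f - S vx 0 vz vt f := by
  induction f using MvPolynomial.induction_on with
  | C c => simp
  | add p q hp hq =>
    rw [map_add, add_sub_add_comm]
    exact dvd_add hp hq
  | mul_X p i hp =>
    have e : p * MvPolynomial.X i - S vx 0 vz vt (p * MvPolynomial.X i)
        = (p - S vx 0 vz vt p) * MvPolynomial.X i
          + S vx 0 vz vt p * (MvPolynomial.X i - S vx 0 vz vt (MvPolynomial.X i)) := by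
      rw [map_mul]; ring
    rw [e]
    refine dvd_add (hp.mul_right _) (Dvd.dvd.mul_left ?_ _)
    obtain ⟨i, b⟩ := i
    fin_cases i <;> cases b <;> simp

theorem dvd_of_S00 {f : R2} (h1 : dx f = 0) (h : S00 f = 0) : vy ∣ f := by
  have h2 : S vx 0 vz vt f = S00 f := S_congr (Or.inl h1) (Or.inr rfl) (Or.inr rfl) (Or.inr rfl)
  have := dvd_sub_S f
  rwa [h2, h, sub_zero] at this

/-- The restriction of the potential to `z₁ = 0` is nonzero. -/
theorem S00_ne_zero {v₀ : R2} (hm : 0 < m) (hA : A ∈ H m (m - 1)) (hr : cjp P = P) (hpsd : Psd P)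
    (h0 : v₀ ≠ 0) (h1 : Lv A v₀ = 0) (h2 : Lb A v₀ = vL A P)
    (h3 : fL A P = - (dy A * v₀) - cjp (dy A) * cjp v₀)
    (h4 : dz (dt P) = dt v₀ + cjp (dt v₀)) : S00 v₀ ≠ 0 := by
  intro hS
  set ψ := th (pr A) v₀ with hψ
  have hv : v₀ = th (-pr A) ψ := (th_neg_th (dz_pr hA) _).symm
  have hψx : dx ψ = 0 := dx_th hA h1
  have hψ0 : ψ ≠ 0 := by
    intro h; rw [hv, h, map_zero] at h0; exact h0 rfl
  have hy : ¬ IsUnit vy := by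
    intro h
    have := h.map (S (0 : ℂ) 0 0 0)
    simp at this
  obtain ⟨n, ψ', hnd, hn⟩ := WfDvdMonoid.max_power_factor' hψ0 hy
  have hn0 : n ≠ 0 := by
    rintro rfl
    rw [pow_zero, one_mul] at hn
    refine hnd (hn ▸ dvd_of_S00 hψx ?_)
    rw [← hS]
    exact S00_th hm hA _ _ _
  obtain ⟨k, rfl⟩ := Nat.exists_eq_succ_of_ne_zero hn0
  have hy0 : vy ^ (k + 1) ≠ 0 := pow_ne_zero _ (X_ne_zero _)
  have hψ'x : dx ψ' = 0 := by
    rw [hn, Derivation.leibniz, Derivation.leibniz_pow, pderiv_X_of_ne (by decide)] at hψx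
    simpa using hψx
  set v' := th (-pr A) ψ' with hv'
  have hvv : v₀ = vy ^ (k + 1) * v' := by
    rw [hv, hn, map_mul, map_pow, hv']
    simp [th]
  refine hnd (dvd_of_S00 hψ'x ?_)
  have e1 : S00 ψ' = S00 v' := by
    have := S00_th hm hA vz vt v'
    rwa [hv', th_th_neg (dz_pr hA)] at this
  rw [e1]
  refine S00_eq_zero fun b => ?_
  have hLb : Lb A v₀ = vy ^ k * (((k : R2) + 1) * v' + vy * Lb A v') := by
    rw [hvv, Derivation.leibniz, Derivation.leibniz_pow, Lb_apply A vy]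
    rw [pderiv_X_self, pderiv_X_of_ne (by decide)]
    simp only [smul_eq_mul, nsmul_eq_mul, add_tsub_cancel_right, mul_zero, add_zero, mul_one]
    push_cast
    ring
  have hdt : dt v₀ = vy ^ (k + 1) * dt v' := by
    rw [hvv, Derivation.leibniz, Derivation.leibniz_pow, pderiv_X_of_ne (by decide)]
    simp
  set f : ℝ → ℝ := fun ε => -4 * ε ^ 2 * ((ev ε b (dy A) * ev ε b v').re * (ev ε b (dt v')).re)
    - Complex.normSq (((k : ℂ) + 1) * ev ε b v' + ε * ev ε b (Lb A v')) with hf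
  have hc : Continuous f := by
    have c1 : ∀ p, Continuous fun ε : ℝ => ev ε b p := fun p =>
      continuous_ev Complex.continuous_ofReal continuous_const p
    have c2 := c1 (dy A)
    have c3 := c1 v'
    have c4 := c1 (dt v')
    have c5 := c1 (Lb A v')
    refine Continuous.sub ?_ (Complex.continuous_normSq.comp (by fun_prop))
    exact (by fun_prop : Continuous fun ε : ℝ => -4 * ε ^ 2).mul
      ((Complex.continuous_re.comp (c2.mul c3)).mul (Complex.continuous_re.comp c4))
  have hpos : ∀ ε, 0 < ε → 0 ≤ f ε := by
    intro ε hε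
    have hd := (hpsd.disc (A := A) hr ε b).2.2
    have hre : ∀ z w : ℂ, z = starRingEnd ℂ w → z.re = w.re := by rintro z w rfl; simp
    have f1 : (ev ε b (fL A P)).re = ε ^ (k + 1) * (-2 * (ev ε b (dy A) * ev ε b v').re) := by
      rw [h3, ← map_mul cjp, map_sub, map_neg, ev_cjp, hvv]
      simp only [map_mul, map_pow, ev_y, Complex.conj_ofReal, Complex.sub_re, Complex.neg_re]
      have : ev ε b (dy A) * ((ε : ℂ) ^ (k + 1) * ev ε b v')
          = ((ε ^ (k + 1) : ℝ) : ℂ) * (ev ε b (dy A) * ev ε b v') := by push_cast; ring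
      rw [← Complex.ofReal_pow]
      simp only [Complex.mul_re, Complex.ofReal_re, Complex.ofReal_im, Complex.conj_re,
        Complex.conj_im, Complex.mul_im]
      ring
    have f2 : (ev ε b (dz (dt P))).re = ε ^ (k + 1) * (2 * (ev ε b (dt v')).re) := by
      rw [h4, map_add, ev_cjp, Complex.add_re, Complex.conj_re, hdt, map_mul, map_pow, ev_y,
        Complex.conj_ofReal, ← Complex.ofReal_pow, Complex.re_ofReal_mul]
      ring
    have f3 : Complex.normSq (ev ε b (uL A P)) = (ε ^ k) ^ 2 *
        Complex.normSq (((k : ℂ) + 1) * ev ε b v' + ε * ev ε b (Lb A v')) := by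
      rw [← cjp_vL hr, ev_cjp, Complex.normSq_conj, ← h2, hLb]
      simp only [map_mul, map_add, map_pow, map_one, map_natCast, ev_y, Complex.conj_ofReal,
        Complex.normSq_ofReal]
      ring
    rw [f1, f2, f3] at hd
    have hpk : 0 < (ε ^ k) ^ 2 := by positivity
    refine nonneg_of_mul_nonneg_right (a := (ε ^ k) ^ 2) ?_ hpk
    rw [hf]
    simp only [mul_sub]
    rw [sub_nonneg]
    refine hd.trans (le_of_eq ?_)
    ring
  have h5 := nonneg_of_pos hc hpos
  simp only [hf, Complex.ofReal_zero, zero_mul, add_zero, ne_eq, OfNat.ofNat_ne_zero,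
    not_false_eq_true, zero_pow, mul_zero, zero_sub] at h5
  have h6 := Complex.normSq_eq_zero.1 (le_antisymm (by linarith) (Complex.normSq_nonneg _))
  have h7 : ((k : ℂ) + 1) ≠ 0 := by exact_mod_cast k.succ_ne_zero
  exact (mul_eq_zero.1 h6).resolve_left h7

/-- The potential is the derivative of a holomorphic-type antiderivative of `P`. -/
theorem exists_antiderivative {v₀ : R2} (hm : 0 < m) (hN : 0 < N) (hA : A ∈ H m (m - 1))
    (hP : P ∈ H m N) (hr : cjp P = P)
    (h0 : v₀ ∈ H m (N - m)) (h1 : Lv A v₀ = 0) (h2 : Lb A v₀ = vL A P)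
    (h3 : fL A P = - (dy A * v₀) - cjp (dy A) * cjp v₀)
    (h4 : dz (dt P) = dt v₀ + cjp (dt v₀)) :
    ∃ G ∈ H m N, Lv A G = 0 ∧ dz G = v₀ + v₀ ∧ P + P = G + cjp G := by
  set Φ := anti (1, false) (th (pr A) (v₀ + v₀)) with hΦ
  set G := th (-pr A) Φ with hG
  have hvL : Lv A (v₀ + v₀) = 0 := by rw [map_add, h1, add_zero]
  have hGL : Lv A G = 0 := by
    refine Lv_th_neg hA ?_
    rw [hΦ, pderiv_anti_ne (by decide), dx_th hA hvL, map_zero]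
  have hGz : dz G = v₀ + v₀ := by
    rw [hG, th_dz (by rw [map_neg, dz_pr hA, neg_zero]), hΦ, pderiv_anti, th_neg_th (dz_pr hA)]
  have hGH : G ∈ H m N := by
    refine H_th (neg_mem (H_pr hA)) ?_
    have := anti_mem (i := (1, false)) (H_th (H_pr hA) (add_mem h0 h0))
    rwa [show (N : ℤ) - m + wm m ((1, false) : Fin 2 × Bool).1 = N by simp] at this
  have hcGL : Lb A (cjp G) = 0 := by rw [← cjp_Lv, hGL, map_zero]
  have hcGt : dt (cjp G) = cjp v₀ + cjp v₀ := by rw [← cjp_dz, hGz, map_add]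
  set P' := P + P - (G + cjp G) with hP'
  have hr' : cjp P' = P' := by
    rw [hP', map_sub, map_add, map_add, hr, cjp_cjp, add_comm G]
  have hzt : dz (dt P') = 0 := by
    have e1 : dz (dt G) = dt v₀ + dt v₀ := by rw [pd_comm, hGz, map_add]
    have e2 : dz (dt (cjp G)) = cjp (dt v₀) + cjp (dt v₀) := by rw [hcGt, map_add, cjp_dt]
    rw [hP']
    simp only [map_sub, map_add, h4, e1, e2]
    ring
  have hzy : dz (dy P') = 0 := by
    have h5 : Lb A (dz P') = 0 := by
      have h6 : Lb A (dz (cjp G)) = 0 := by rw [← dz_Lb hA, hcGL, map_zero]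
      have h7 : Lb A (dz P) = Lb A v₀ := h2.symm
      rw [hP']
      simp only [map_sub, map_add, h6, hGz, h7]
      ring
    rw [Lb_apply, pd_comm (1, true) (1, false), hzt, mul_zero, add_zero, pd_comm] at h5
    exact h5
  have hxt : dx (dt P') = 0 := by
    have := congrArg cjp hzy
    rw [cjp_dz, cjp_dy, hr', map_zero, pd_comm] at this
    exact this
  have hxy : dx (dy P') = 0 := by
    have e0 : ∀ f, dx (dy f) + A * dz (dy f) + cjp A * dx (dt f) + A * cjp A * dz (dt f)
        = Lv A (Lb A f) - cjp (dy A) * dt f := fun f => by rw [Lv_Lb hA]; ring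
    have e1 := e0 P'
    rw [hzy, hxt, hzt] at e1
    have e2 : Lv A (Lb A G) = cjp (dy A) * dt G - dy A * (v₀ + v₀) := by
      rw [comm_L hA, hGL, map_zero, hGz, zero_add]
    have e3 : Lv A (Lb A P) = fL A P + cjp (dy A) * dt P := by rw [Lv_Lb hA, fL]
    have e4 : Lv A (Lb A P') = fL A P + cjp (dy A) * dt P + (fL A P + cjp (dy A) * dt P)
        - (cjp (dy A) * dt G - dy A * (v₀ + v₀)) := by
      rw [hP']
      simp only [map_sub, map_add, hcGL, e2, e3]
      simp
    have e5 : dt P' = dt P + dt P - (dt G + (cjp v₀ + cjp v₀)) := by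
      rw [hP']
      simp only [map_sub, map_add, hcGt]
    rw [e4, e5, h3] at e1
    linear_combination e1
  have hfl : Flat P' := ⟨hxy, hxt, hzy, hzt⟩
  have hPH : P' ∈ H m N := sub_mem (add_mem hP hP) (add_mem hGH (H_cjp hGH))
  obtain ⟨q, hq, hqy, hqt, hqP⟩ := hfl.exists_holomorphic hm hN hPH hr'
  have hqx : dx (cjp q) = 0 := by rw [← cjp_dy, hqy, map_zero]
  have hqz : dz (cjp q) = 0 := by rw [← cjp_dt, hqt, map_zero]
  have hqL : Lv A (cjp q) = 0 := by rw [Lv_apply, hqx, hqz]; simp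
  refine ⟨G + cjp q, add_mem hGH (H_cjp hq), ?_, ?_, ?_⟩
  · rw [map_add, hGL, hqL, add_zero]
  · rw [map_add, hGz, hqz, add_zero]
  · rw [map_add, cjp_cjp]
    linear_combination hP'.symm.trans hqP

end

end Mdl

namespace Mdl

open MvPolynomial SF

section

variable {m N : ℕ} {A P : R2}

theorem ev_of_dz_dt {p : R2} (h1 : dz p = 0) (h2 : dt p = 0) (a b : ℂ) : ev a b p = ev a 0 p :=
  S_congr (Or.inr rfl) (Or.inr rfl) (Or.inl h1) (Or.inl h2)

theorem ev_g (hA : A ∈ H m (m - 1)) (a b : ℂ) : ev a b (dy A) = ev a 0 (dy A) :=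
  ev_of_dz_dt (dz_g hA) (dt_g hA) a b

theorem ev_scale {s : ℕ} {p : R2} (hp : p ∈ H m s) (l : ℝ) (a b : ℂ) :
    ev (l * a) ((l : ℂ) ^ m * b) p = (l : ℂ) ^ s * ev a b p := by
  have := S_scale hp l a (starRingEnd ℂ a) b (starRingEnd ℂ b)
  rw [ev_def a b, ← this, ev_def]
  simp

theorem ev_g_scale (hm : 2 ≤ m) (hA : A ∈ H m (m - 1)) (l : ℝ) (a : ℂ) :
    ev (l * a) 0 (dy A) = (l : ℂ) ^ (m - 2) * ev a 0 (dy A) := by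
  have h : dy A ∈ H m ((m - 2 : ℕ) : ℤ) := by
    have := H_g hA
    rwa [Nat.cast_sub hm]
  simpa using ev_scale h l a 0

theorem const_eq_zero_of_re (hA : A ∈ H m (m - 1)) (hind : ∀ κ : ℂ, cjp (dy A) ≠ C κ * dy A)
    {c : ℂ} (h : ∀ x, (c * ev x 0 (dy A)).re = 0) : c = 0 := by
  by_contra hc
  refine hind (-c / starRingEnd ℂ c) (ev_ext fun a b => ?_)
  have hc' : starRingEnd ℂ c ≠ 0 := (map_ne_zero _).2 hc
  have h1 : c * ev a 0 (dy A) + starRingEnd ℂ (c * ev a 0 (dy A)) = 0 := by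
    rw [Complex.add_conj, h]; simp
  rw [ev_cjp, map_mul, ev_C, ev_g hA a b]
  rw [map_mul] at h1
  field_simp
  linear_combination h1

theorem const_eq_zero_of_av (hm : 2 ≤ m) (hA : A ∈ H m (m - 1))
    (hind : ∀ κ : ℂ, cjp (dy A) ≠ C κ * dy A)
    {c : ℂ} (h : ∀ x, (c * ev x 0 (dy A)).re ≤ 0) (hc : (c * av (pr A)).re = 0) : c = 0 := by
  have hav : av (dy A) = ((m : ℂ) / 2) ^ 2 * av (pr A) := by
    rw [← av_dx_dy (H_pr hA) (dz_pr hA) (dt_pr hA), pd_comm, dx_pr]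
  have e : ∀ x, ev x 0 (C (-c) * dy A) = -(c * ev x 0 (dy A)) := by
    intro x; rw [map_mul, ev_C]; ring
  have h0 : ∀ x : ℂ, ‖x‖ = 1 → (ev x 0 (C (-c) * dy A)).re = 0 := by
    refine eq_zero_of_av (fun x => ?_) ?_
    · rw [e, Complex.neg_re]; linarith [h x]
    · rw [av_C_mul, hav]
      have : -c * (((m : ℂ) / 2) ^ 2 * av (pr A))
          = ((-((m : ℝ) / 2) ^ 2 : ℝ) : ℂ) * (c * av (pr A)) := by push_cast; ring
      rw [this, Complex.re_ofReal_mul, hc, mul_zero]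
  refine const_eq_zero_of_re hA hind fun x => ?_
  have h1 : ∀ x : ℂ, ‖x‖ = 1 → (c * ev x 0 (dy A)).re = 0 := by
    intro x hx
    have := h0 x hx
    rw [e, Complex.neg_re] at this
    linarith
  have h2 : ∀ (l : ℝ) (x : ℂ), ‖x‖ = 1 → (c * ev (l * x) 0 (dy A)).re = 0 := by
    intro l x hx
    rw [ev_g_scale hm hA, mul_left_comm, ← Complex.ofReal_pow, Complex.re_ofReal_mul, h1 x hx,
      mul_zero]
  by_cases hx : x = 0
  · subst hx
    simpa using h2 0 1 (by simp)
  · have hn : (‖x‖ : ℂ) ≠ 0 := by simpa using hx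
    have := h2 ‖x‖ ((‖x‖ : ℂ)⁻¹ * x) (by simp [hx])
    rwa [mul_inv_cancel_left₀ hn] at this

/-- The sub-mean value property along the analytic disc with second component `β`. -/
theorem Psd.submean (hpsd : Psd P) (β : Polynomial ℂ) :
    ∃ Q : R2, (ev 0 (β.eval 0) P).re ≤ (av Q).re ∧ ∀ x, ev x 0 Q = ev x (β.eval x) P := by
  set b : R2 := Polynomial.aeval vx β with hb
  have hdb : ∀ i, i ≠ (0, false) → pderiv i b = 0 := by
    intro i hi
    rw [hb, Derivation.map_aeval, pderiv_X_of_ne hi.symm, smul_zero]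
  have evb : ∀ x, ev x 0 b = β.eval x := by
    intro x
    rw [hb, ← Polynomial.aeval_algHom_apply, ev_x, Polynomial.coe_aeval_eq_eval]
  set Q : R2 := S vx vy b (cjp b) P with hQ
  have evS : ∀ x f, ev x 0 (S vx vy b (cjp b) f) = ev x (β.eval x) f := by
    intro x f
    rw [map_S, ev_x, ev_y, ev_cjp, evb, ev_def]
  have dby : dy b = 0 := hdb _ (by decide)
  have dcbx : dx (cjp b) = 0 := by rw [← cjp_dy, dby, map_zero]
  have dcby : dy (cjp b) = cjp (dx b) := (cjp_dx b).symm
  have hdQ : dx (dy Q) = S vx vy b (cjp b) (dx (dy P)) * 1 * cjp 1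
      + S vx vy b (cjp b) (dx (dt P)) * 1 * cjp (dx b)
      + S vx vy b (cjp b) (dz (dy P)) * dx b * cjp 1
      + S vx vy b (cjp b) (dz (dt P)) * dx b * cjp (dx b) := by
    have e1 : dy Q = S vx vy b (cjp b) (dy P) + S vx vy b (cjp b) (dt P) * cjp (dx b) := by
      rw [hQ, S_deriv, dby, dcby]; simp [pderiv_X]
    have e2 : dx (cjp (dx b)) = 0 := by
      rw [← cjp_dy, pd_comm, dby]; simp
    rw [e1, map_add, Derivation.leibniz, e2, S_deriv, S_deriv, dcbx]
    simp [pderiv_X]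
    ring
  have hsub := Mdl.submean (p := Q) fun x => by
    rw [hdQ]
    have := hpsd x (β.eval x) 1 (ev x 0 (dx b))
    simp only [map_add, map_mul, map_one, ev_cjp, evS] at this ⊢
    exact this
  have h0 : ev 0 0 Q = ev 0 (β.eval 0) P := evS 0 P
  exact ⟨Q, h0 ▸ hsub, fun x => evS x P⟩

/-- Comparison with the values of a holomorphic-type function along analytic discs. -/
theorem disc_comparison {G : R2} (hA : A ∈ H m (m - 1)) (hpsd : Psd P)
    (hG : Lv A G = 0) (hP : P + P = G + cjp G) (c : ℂ) :
    (ev 0 c P).re ≤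
      (S 0 0 (c - av (pr A)) (starRingEnd ℂ c) (th (pr A) G)).re := by
  obtain ⟨p, q, hp0, hq0, hpq⟩ := circ_split (pr A)
  set Φ := th (pr A) G with hΦ
  have hΦx : dx Φ = 0 := dx_th hA hG
  have hGΦ : G = th (-pr A) Φ := (th_neg_th (dz_pr hA) _).symm
  obtain ⟨Q, hsub, hQ⟩ := hpsd.submean (Polynomial.C c + p)
  simp only [Polynomial.eval_add, Polynomial.eval_C, hp0, add_zero] at hsub hQ
  set pp : R2 := Polynomial.aeval vx p with hpp
  set qq : R2 := Polynomial.aeval vy q with hqq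
  have hqx : dx (C (c - av (pr A)) - qq) = 0 := by
    rw [Derivation.map_sub, hqq, Derivation.map_aeval, pderiv_X_of_ne (by decide)]
    simp
  have evp : ∀ x, ev x 0 pp = p.eval x := by
    intro x
    rw [hpp, ← Polynomial.aeval_algHom_apply, ev_x, Polynomial.coe_aeval_eq_eval]
  have evq : ∀ x, ev x 0 qq = q.eval (starRingEnd ℂ x) := by
    intro x
    rw [hqq, ← Polynomial.aeval_algHom_apply, ev_y, Polynomial.coe_aeval_eq_eval]
  set b : R2 := C c + pp with hb
  have evb : ∀ x, ev x 0 b = c + p.eval x := by intro x; rw [hb, map_add, ev_C, evp]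
  have dcbx : dx (cjp b) = 0 := by
    rw [← cjp_dy, hb, map_add, hpp, Derivation.map_aeval, pderiv_X_of_ne (by decide)]
    simp
  refine hsub.trans (le_of_eq ?_)
  set E : R2 := S 0 vy (C (c - av (pr A)) - qq) (cjp b) Φ with hE
  have hEx : dx E = 0 := by
    rw [hE, S_deriv, hΦx, dcbx, hqx]
    simp [pderiv_X]
  have hE0 : ev 0 0 E = S 0 0 (c - av (pr A)) (starRingEnd ℂ c) Φ := by
    rw [hE, map_S, map_sub, ev_C, evq, ev_cjp, evb, hp0]
    simp [hq0]
  rw [← hE0, ← av_of_dx hEx]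
  refine av_re_congr fun x hx => ?_
  rw [hQ]
  have h2 : (ev x (c + p.eval x) P).re = (ev x (c + p.eval x) G).re := by
    have := congrArg (fun f => (ev x (c + p.eval x) f).re) hP
    simp only [map_add, ev_cjp, Complex.add_re, Complex.conj_re] at this
    linarith
  have h3 : ev x (c + p.eval x) (pr A) = p.eval x + q.eval (starRingEnd ℂ x) + av (pr A) := by
    rw [ev_of_dz_dt (dz_pr hA) (dt_pr hA), hpq x hx]
  rw [h2, hGΦ, th, map_S, map_add, map_neg, h3, ev_x, ev_y, ev_z, ev_t, hE, map_S, map_sub, ev_C,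
    evq, ev_cjp, evb, ev_y, map_zero]
  congr 1
  refine (S_congr (Or.inl hΦx) (Or.inr rfl) (Or.inr ?_) (Or.inr rfl))
  ring

end

end Mdl

namespace Mdl

open MvPolynomial SF

section

variable {m N : ℕ} {A P : R2}

theorem S0_scale (hm : 0 < m) {s e : ℕ} (he : s = m * e) {p : R2} (hp : p ∈ H m s) (l c d : ℂ) :
    S 0 0 (l * c) (l * d) p = l ^ e * S 0 0 c d p := by
  obtain ⟨k, rfl⟩ := IsAlgClosed.exists_pow_nat_eq l hm
  have := S_scale hp k 0 0 c d
  rwa [mul_zero, he, pow_mul] at this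

theorem ev0_scale (hm : 0 < m) {s e : ℕ} (he : s = m * e) {p : R2} (hp : p ∈ H m s) (l : ℝ)
    (b : ℂ) : ev 0 (l * b) p = (l : ℂ) ^ e * ev 0 b p := by
  simpa [ev_def] using S0_scale hm he hp l b (starRingEnd ℂ b)

theorem ev0_neg (hm : 0 < m) {s e : ℕ} (he : s = m * e) {p : R2} (hp : p ∈ H m s) (b : ℂ) :
    ev 0 (-b) p = (-1) ^ e * ev 0 b p := by
  simpa using ev0_scale hm he hp (-1) b

theorem dvd_of_ev0_ne_zero (hm : 0 < m) {s : ℕ} {p : R2} (hp : p ∈ H m s) {b : ℂ}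
    (hb : ev 0 b p ≠ 0) : m ∣ s := by
  have hz := Complex.isPrimitiveRoot_exp m hm.ne'
  have h := S_scale hp (Complex.exp (2 * Real.pi * Complex.I / m)) 0 0 b (starRingEnd ℂ b)
  rw [hz.pow_eq_one, mul_zero, one_mul, one_mul] at h
  refine hz.dvd_of_pow_eq_one _ (mul_right_cancel₀ hb ?_)
  rw [one_mul, ev_def]
  simpa using h.symm

theorem Psd.fL_nonneg (hpsd : Psd P) (a b : ℂ) : 0 ≤ (ev a b (fL A P)).re := by
  have := hpsd a b 1 (ev a b A)
  simp only [fL, map_add, map_mul, ev_cjp]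
  convert this using 2
  simp
  ring

theorem re_g_mul_nonpos (hm : 2 ≤ m) (hA : A ∈ H m (m - 1)) (hpsd : Psd P) {v₀ : R2}
    (h3 : fL A P = - (dy A * v₀) - cjp (dy A) * cjp v₀) (x b : ℂ) :
    (ev x 0 (dy A) * ev 0 b v₀).re ≤ 0 := by
  have h1 : ∀ a, (ev a 0 (dy A) * ev a b v₀).re ≤ 0 := by
    intro a
    have := hpsd.fL_nonneg (A := A) a b
    rw [h3] at this
    rw [map_sub, map_neg, ← map_mul cjp, ev_cjp, map_mul, ev_g hA a b, Complex.sub_re,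
      Complex.neg_re, Complex.conj_re] at this
    linarith
  have hc : Continuous fun ε : ℝ => -(ev x 0 (dy A) * ev (ε * x) b v₀).re :=
    (Complex.continuous_re.comp (continuous_const.mul
      (continuous_ev (by fun_prop) continuous_const _))).neg
  have h2 := nonneg_of_pos hc fun ε hε => by
    have := h1 (ε * x)
    rw [ev_g_scale hm hA, mul_assoc, ← Complex.ofReal_pow, Complex.re_ofReal_mul] at this
    have hp : 0 < ε ^ (m - 2) := by positivity
    nlinarith
  simpa using h2

/-- A real form of odd degree with nonnegative mixed derivative on the second axis is harmonic
there. -/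
theorem exists_harmonic (hm : 0 < m) {e : ℕ} (he : Even e) (he0 : 0 < e) (hN : N = m * (e + 1))
    (hP : P ∈ H m N) (hr : cjp P = P) (hpsd : Psd P) :
    ∃ c : ℂ, ∀ b, (ev 0 b P).re = (c * b ^ (e + 1)).re := by
  have hzt : dz (dt P) ∈ H m ((m * (e - 1) : ℕ) : ℤ) := by
    have := H_dz (H_dt hP)
    obtain ⟨k, rfl⟩ : ∃ k, e = k + 1 := ⟨e - 1, by omega⟩
    convert this using 1
    rw [hN, Nat.add_sub_cancel]; push_cast; ring
  have ho : Odd (e - 1) := Nat.Even.sub_odd (by omega) he odd_one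
  have hnn : ∀ b, 0 ≤ (ev 0 b (dz (dt P))).re := fun b => by simpa using hpsd 0 b 0 1
  have hz : ∀ b, ev 0 b (dz (dt P)) = 0 := by
    intro b
    have h1 := hnn b
    have h2 := hnn (-b)
    rw [ev0_neg hm rfl hzt, ho.neg_one_pow, neg_one_mul, Complex.neg_re] at h2
    refine Complex.ext (by simp; linarith) ?_
    rw [ev_im_of_real]
    · simp
    · rw [cjp_dz, cjp_dt, hr, pd_comm]
  have hS : ∀ f : R2, dx (S00 f) = 0 ∧ dy (S00 f) = 0 ∧ dz (S00 f) = S00 (dz f)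
      ∧ dt (S00 f) = S00 (dt f) := by
    intro f
    refine ⟨?_, ?_, ?_, ?_⟩ <;> rw [S00, S_deriv] <;> simp [pderiv_X]
  have hflat : Flat (S00 P) := by
    obtain ⟨-, h2, -, h4⟩ := hS P
    refine ⟨by rw [h2, map_zero], ?_, by rw [h2, map_zero], ?_⟩
    · rw [h4]; exact (hS _).1
    · rw [h4, (hS _).2.2.1]; exact S00_eq_zero hz
  have hr0 : cjp (S00 P) = S00 P := by
    refine ev_ext fun a b => ?_
    rw [ev_cjp, ev_S00, ← ev_cjp, hr]
  obtain ⟨q, hq, hqy, hqt, hPq⟩ := hflat.exists_holomorphic hm (by rw [hN]; positivity)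
    (H_S (zero_mem _) (zero_mem _) H_z H_t hP) hr0
  refine ⟨S 0 0 1 0 q + S 0 0 1 0 q, fun b => ?_⟩
  have h1 : ev 0 b q = b ^ (e + 1) * S 0 0 1 0 q := by
    have := S0_scale hm hN hq b 1 0
    rw [← this, ev_def]
    exact S_congr (Or.inr rfl) (Or.inl hqy) (Or.inr (by ring)) (Or.inl hqt)
  have h2 := congrArg (ev 0 b) hPq
  rw [ev_S00, map_add, ev_cjp, h1] at h2
  rw [h2, Complex.add_re, Complex.conj_re]
  simp only [add_mul, Complex.add_re]
  rw [mul_comm]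

/-- If the shifted antiderivative dominates a harmonic form, the restriction of its derivative is
affine along a line. -/
theorem exists_affine (hm : 0 < m) {e : ℕ} (hN : N = m * (e + 1)) {Φ v₀ : R2}
    (hΦ : Φ ∈ H m N) (hΦx : dx Φ = 0)
    (hΦz : ∀ c d : Polynomial ℂ, S 0 0 c d (dz Φ) = 2 * S 0 0 c d v₀)
    {e₀ κ : ℂ} (hle : ∀ c, (e₀ * c ^ (e + 1)).re ≤ (S 0 0 (c - κ) (starRingEnd ℂ c) Φ).re)
    (heq : ∀ c, (e₀ * c ^ (e + 1)).re = (S 0 0 c (starRingEnd ℂ c) Φ).re) :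
    ∃ a₀ : ℂ, ∃ a₁ : ℝ, a₀.re = 0 ∧ ∀ τ : ℂ,
      4 * κ * S 0 0 (κ * (1 + τ)) (starRingEnd ℂ κ * (1 - τ)) v₀ =
        (e + 1) * a₀ + a₁ * (1 + e * τ) := by
  set k' := starRingEnd ℂ κ with hk'
  set u : Polynomial ℂ := Polynomial.C κ * (1 + Polynomial.X) with hu
  set v : Polynomial ℂ := Polynomial.C k' * (1 - Polynomial.X) with hv
  set q₀ : Polynomial ℂ := S 0 0 u v Φ with hq₀
  set c₁ := starRingEnd ℂ (e₀ * κ ^ (e + 1)) with hc₁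
  set q : Polynomial ℂ := q₀ - Polynomial.C c₁ * (1 - Polynomial.X) ^ (e + 1) with hq
  have evS : ∀ τ : ℂ, ∀ f, (S 0 0 u v f).eval τ = S 0 0 (κ * (1 + τ)) (k' * (1 - τ)) f := by
    intro τ f
    have := map_S (Polynomial.aeval τ : Polynomial ℂ →ₐ[ℂ] ℂ) 0 0 u v f
    simpa [hu, hv, Polynomial.coe_aeval_eq_eval] using this
  have hre : ∀ τ : ℂ, (q.eval τ).re = (S 0 0 (κ * (1 + τ)) (k' * (1 - τ)) Φ).re
      - (e₀ * (κ * (1 - starRingEnd ℂ τ)) ^ (e + 1)).re := by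
    intro τ
    have h1 : starRingEnd ℂ (e₀ * (κ * (1 - starRingEnd ℂ τ)) ^ (e + 1))
        = c₁ * (1 - τ) ^ (e + 1) := by
      rw [hc₁]; simp [mul_pow]; ring
    rw [← Complex.conj_re (e₀ * (κ * (1 - starRingEnd ℂ τ)) ^ (e + 1)), h1, hq]
    simp [hq₀, evS]
  have him : ∀ y : ℝ, (q.eval (y * Complex.I)).re = 0 := by
    intro y
    rw [hre, heq]
    have : (starRingEnd ℂ) (κ * (1 - (starRingEnd ℂ) (y * Complex.I)))
        = k' * (1 - y * Complex.I) := by simp [hk', sub_eq_add_neg]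
    rw [this]
    simp [sub_eq_add_neg]
  have hneg : ∀ τ : ℂ, 0 ≤ τ.re → 0 ≤ ((q.comp (-Polynomial.X)).eval τ).re := by
    intro τ hτ
    rw [Polynomial.eval_comp, Polynomial.eval_neg, Polynomial.eval_X]
    rcases hτ.eq_or_lt with h0 | h0
    · have : -τ = ((-τ.im : ℝ) : ℂ) * Complex.I := by
        apply Complex.ext <;> simp [← h0]
      rw [this, him]
    · rw [hre]
      set s : ℝ := 2 * τ.re with hs
      have hs0 : 0 < s := by positivity
      have hsc : (s : ℂ) ≠ 0 := by exact_mod_cast hs0.ne'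
      have hss : (s : ℂ) = τ + starRingEnd ℂ τ := by rw [Complex.add_conj, hs]
      set c := (s : ℂ)⁻¹ * (κ * (1 + starRingEnd ℂ τ)) with hc
      have h1 := hle c
      have h2 := S0_scale hm hN hΦ (s : ℂ) (c - κ) (starRingEnd ℂ c)
      have e1 : (s : ℂ) * (c - κ) = κ * (1 + -τ) := by
        rw [mul_sub, hc, mul_inv_cancel_left₀ hsc, hss]; ring
      have e2 : (s : ℂ) * starRingEnd ℂ c = k' * (1 - -τ) := by
        rw [hc, map_mul, map_inv₀, Complex.conj_ofReal, mul_inv_cancel_left₀ hsc]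
        simp [hk']
      rw [e1, e2] at h2
      have e3 : e₀ * (κ * (1 - starRingEnd ℂ (-τ))) ^ (e + 1)
          = ((s ^ (e + 1) : ℝ) : ℂ) * (e₀ * c ^ (e + 1)) := by
        have : κ * (1 - starRingEnd ℂ (-τ)) = s * c := by
          rw [hc, mul_inv_cancel_left₀ hsc]; simp
        rw [this]; push_cast; ring
      rw [h2, e3, ← Complex.ofReal_pow, Complex.re_ofReal_mul, Complex.re_ofReal_mul, ← mul_sub]
      exact mul_nonneg (by positivity) (by linarith)
  have hdeg : q.natDegree ≤ 1 := by
    have := natDegree_le_one_of_halfPlane hneg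
    rwa [Polynomial.natDegree_comp, Polynomial.natDegree_neg, Polynomial.natDegree_X, mul_one]
      at this
  obtain ⟨a₁, a₀, hqa⟩ := Polynomial.exists_eq_X_add_C_of_natDegree_le_one hdeg
  have ha0 : a₀.re = 0 := by simpa [hqa] using him 0
  have ha1 : a₁.im = 0 := by simpa [hqa, ha0] using him 1
  refine ⟨a₀, a₁.re, ha0, fun τ => ?_⟩
  have hEul : u * S 0 0 u v (dz Φ) + v * S 0 0 u v (dt Φ) = ((e : Polynomial ℂ) + 1) * q₀ := by
    have h := congrArg (S 0 0 u v) (euler2 hΦ)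
    rw [hΦx] at h
    simp only [map_add, map_mul, S_x, S_y, S_z, S_t, S_C, hN] at h
    have hmC : (algebraMap ℂ (Polynomial ℂ)) (m : ℂ) ≠ 0 := by
      simpa using hm.ne'
    refine mul_left_cancel₀ hmC ?_
    rw [hq₀]
    push_cast at h
    simp only [map_natCast] at h ⊢
    linear_combination h
  have hder : Polynomial.derivative q₀
      = S 0 0 u v (dz Φ) * Polynomial.C κ - S 0 0 u v (dt Φ) * Polynomial.C k' := by
    have := S_deriv (Polynomial.derivative' : Derivation ℂ (Polynomial ℂ) (Polynomial ℂ)) 0 0 u v Φ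
    simp only [Polynomial.derivative', Derivation.mk_coe] at this
    rw [hq₀]
    simpa [hu, hv, sub_eq_add_neg] using this
  have hder2 : Polynomial.derivative q = Polynomial.derivative q₀
      + Polynomial.C c₁ * ((e : Polynomial ℂ) + 1) * (1 - Polynomial.X) ^ e := by
    rw [hq]
    simp [Polynomial.derivative_pow]
    ring
  have key : Polynomial.C (4 * κ) * S 0 0 u v v₀
      = (1 - Polynomial.X) * Polynomial.derivative q + ((e : Polynomial ℂ) + 1) * q := by
    have h2 := hΦz u v
    rw [hder2, hder, hq]
    rw [h2] at hEul ⊢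
    simp only [map_mul, map_ofNat]
    rw [mul_sub, ← hEul, hu, hv]
    ring
  have := congrArg (Polynomial.eval τ) key
  rw [Polynomial.eval_mul, evS, Polynomial.eval_C] at this
  rw [this, hqa]
  have e1 : ((a₁.re : ℝ) : ℂ) = a₁ := Complex.ext (by simp) (by simp [ha1])
  simp [e1]
  ring

theorem Hyp.flat_of_indep (h : Hyp m N A P) (hN : m < N) (hg : dy A ≠ 0)
    (hind : ∀ κ : ℂ, cjp (dy A) ≠ C κ * dy A) : Flat P := by
  obtain ⟨v₀, hv, h1, h2, h3, h4⟩ := h.exists_potential hN hg hind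
  have hm := h.hm
  have hm0 : 0 < m := by omega
  have hA := h.hA
  have hP := h.hP
  by_cases h0 : v₀ = 0
  · subst h0
    refine Flat.of_zero h.psd h.real (A := A) (by simpa using h3) (by simpa using h4)
  exfalso
  have hS := S00_ne_zero hm0 hA h.real h.psd h0 h1 h2 h3 h4
  obtain ⟨b₀, hb₀⟩ : ∃ b, ev 0 b v₀ ≠ 0 := by
    by_contra hc
    push Not at hc
    exact hS (S00_eq_zero hc)
  have hv' : v₀ ∈ H m ((N - m : ℕ) : ℤ) := by rwa [Nat.cast_sub hN.le]
  obtain ⟨e, he⟩ := dvd_of_ev0_ne_zero hm0 hv' hb₀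
  have hNe : N = m * (e + 1) := by rw [mul_add, ← he]; omega
  have he0 : 0 < e := by
    rcases Nat.eq_zero_or_pos e with rfl | h
    · simp at he; omega
    · exact h
  have hre := re_g_mul_nonpos hm hA h.psd h3
  have hev : Even e := by
    by_contra hodd
    rw [Nat.not_even_iff_odd] at hodd
    refine hb₀ (const_eq_zero_of_re hA hind fun x => ?_)
    have h1 := hre x b₀
    have h2 := hre x (-b₀)
    rw [ev0_neg hm0 he hv', hodd.neg_one_pow, neg_one_mul, mul_neg, Complex.neg_re] at h2
    rw [mul_comm]
    linarith
  obtain ⟨e₀, he₀⟩ := exists_harmonic hm0 hev he0 hNe hP h.real h.psd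
  obtain ⟨G, hG, hG1, hG2, hG3⟩ :=
    exists_antiderivative hm0 (by omega) hA hP h.real hv h1 h2 h3 h4
  have hk : av (pr A) ≠ 0 := by
    intro hk
    refine hb₀ (const_eq_zero_of_av hm hA hind (fun x => ?_) (by simp [hk]))
    rw [mul_comm]
    exact hre x b₀
  set κ := av (pr A) with hκ
  obtain ⟨a₀, a₁, ha₀, haff⟩ := exists_affine hm0 hNe (H_th (H_pr hA) hG) (dx_th hA hG1)
    (v₀ := v₀) (e₀ := e₀) (κ := κ) (fun c d => by
      rw [th_dz (dz_pr hA), hG2, S00_th hm0 hA, map_add, two_mul])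
    (fun c => by
      rw [← he₀]; exact disc_comparison hA h.psd hG1 hG3 c)
    (fun c => by
      have := congrArg (fun f => (ev 0 c f).re) hG3
      simp only [map_add, ev_cjp, Complex.add_re, Complex.conj_re] at this
      rw [← he₀, S00_th hm0 hA]
      have h5 : (ev 0 c G).re = (S 0 0 c (starRingEnd ℂ c) G).re := by rw [ev_def, map_zero]
      linarith)
  have hline : ∀ (x : ℂ) (y : ℝ),
      (ev x 0 (dy A) * (κ⁻¹ * ((e + 1) * a₀ + a₁ * (1 + e * (y * Complex.I))))).re ≤ 0 := by
    intro x y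
    have h5 := haff (y * Complex.I)
    have h6 := hre x (κ * (1 + y * Complex.I))
    have h7 : ev 0 (κ * (1 + y * Complex.I)) v₀
        = S 0 0 (κ * (1 + y * Complex.I)) (starRingEnd ℂ κ * (1 - y * Complex.I)) v₀ := by
      rw [ev_def]; simp [sub_eq_add_neg]
    rw [h7] at h6
    have h8 : ev x 0 (dy A) * (κ⁻¹ * ((e + 1) * a₀ + a₁ * (1 + e * (y * Complex.I))))
        = ((4 : ℝ) : ℂ) * (ev x 0 (dy A) *
          S 0 0 (κ * (1 + y * Complex.I)) (starRingEnd ℂ κ * (1 - y * Complex.I)) v₀) := by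
      rw [← h5]; field_simp; push_cast; ring
    rw [h8, Complex.re_ofReal_mul]
    linarith
  have ha1 : a₁ = 0 := by
    have h5 : (a₁ : ℂ) * e * Complex.I * κ⁻¹ = 0 := by
      refine const_eq_zero_of_re hA hind fun x => ?_
      set t := ((a₁ : ℂ) * e * Complex.I * κ⁻¹ * ev x 0 (dy A)).re with ht
      set r := (ev x 0 (dy A) * (κ⁻¹ * ((e + 1) * a₀ + a₁))).re with hr
      have h6 : ∀ y : ℝ, r + y * t ≤ 0 := by
        intro y
        refine le_trans (le_of_eq ?_) (hline x y)
        rw [hr, ht, ← Complex.re_ofReal_mul, ← Complex.add_re]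
        congr 1
        ring
      by_contra hne
      have := h6 ((1 - r) / t)
      rw [div_mul_cancel₀ _ hne] at this
      linarith
    have hee : (e : ℂ) ≠ 0 := by exact_mod_cast he0.ne'
    have h6 := (mul_eq_zero.1 h5).resolve_right (inv_ne_zero hk)
    have h7 := (mul_eq_zero.1 h6).resolve_right Complex.I_ne_zero
    exact_mod_cast (mul_eq_zero.1 h7).resolve_right hee
  have ha0 : a₀ = 0 := by
    have h5 : ((e : ℂ) + 1) * a₀ * κ⁻¹ = 0 := by
      refine const_eq_zero_of_av hm hA hind (fun x => ?_) ?_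
      · have := hline x 0
        rw [ha1] at this
        refine le_trans (le_of_eq ?_) this
        congr 1
        push_cast
        ring
      · rw [inv_mul_cancel_right₀ hk]
        have : ((e : ℂ) + 1) = ((e + 1 : ℝ) : ℂ) := by push_cast; ring
        rw [this, Complex.re_ofReal_mul, ha₀, mul_zero]
    have hee : (e : ℂ) + 1 ≠ 0 := by exact_mod_cast Nat.succ_ne_zero e
    exact (mul_eq_zero.1 ((mul_eq_zero.1 h5).resolve_right (inv_ne_zero hk))).resolve_left hee
  have hzero : ∀ τ : ℂ, S 0 0 (κ * (1 + τ)) (starRingEnd ℂ κ * (1 - τ)) v₀ = 0 := by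
    intro τ
    have := haff τ
    rw [ha0, ha1, mul_zero, Complex.ofReal_zero, zero_mul, add_zero] at this
    exact (mul_eq_zero.1 this).resolve_left (mul_ne_zero (by norm_num) hk)
  have hgood : ∀ u : ℂ, u.re ≠ 0 → ev 0 (κ * u) v₀ = 0 := by
    intro u hu
    have hu' : (u.re : ℂ) ≠ 0 := by exact_mod_cast hu
    have h5 := S0_scale hm0 he hv' (u.re : ℂ) (κ * (1 + u.im * Complex.I / u.re))
      (starRingEnd ℂ κ * (1 - u.im * Complex.I / u.re))
    rw [hzero, mul_zero] at h5
    rw [ev_def, map_zero]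
    refine Eq.trans ?_ h5
    congr 2
    · rw [mul_left_comm, mul_add, mul_div_cancel₀ _ hu', mul_one, Complex.re_add_im]
    · rw [mul_left_comm, mul_sub, mul_div_cancel₀ _ hu', mul_one, map_mul]
      congr 1
      apply Complex.ext <;> simp
  refine hb₀ ?_
  set u := κ⁻¹ * b₀ with hu
  have hbu : b₀ = κ * u := by rw [hu, mul_inv_cancel_left₀ hk]
  by_cases hur : u.re = 0
  · have hc : Continuous fun ε : ℝ => -‖ev 0 (κ * (u + ε)) v₀‖ :=
      (continuous_norm.comp (continuous_ev continuous_const (by fun_prop) _)).neg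
    have := nonneg_of_pos hc fun ε hε => by
      rw [hgood _ (by simp [hur, hε.ne'])]; simp
    simpa [← hbu] using this
  · rw [hbu, hgood u hur]

end

end Mdl

namespace Mdl

open MvPolynomial SF
open scoped Nat

/-! One-variable positivity. -/

theorem nonneg_coeff_of_nonneg {G : Polynomial ℂ} {J : ℕ} (hJ : ∀ n, J < n → G.coeff n = 0)
    (h : ∀ r : ℝ, 0 ≤ (G.eval (r : ℂ)).re) : 0 ≤ (G.coeff J).re := by
  have hd : G.natDegree ≤ J := Polynomial.natDegree_le_iff_coeff_eq_zero.2 fun n hn => hJ n hn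
  set k : ℝ → ℝ := fun ε => (∑ j ∈ Finset.range (J + 1), G.coeff j * (ε : ℂ) ^ (J - j)).re with hk
  have hc : Continuous k := Complex.continuous_re.comp (by fun_prop)
  have := nonneg_of_pos hc fun ε hε => by
    have h1 := h ε⁻¹
    rw [Polynomial.eval_eq_sum_range' (Nat.lt_succ_of_le hd)] at h1
    have hε' : (ε : ℂ) ≠ 0 := by exact_mod_cast hε.ne'
    have h2 : ∑ j ∈ Finset.range (J + 1), G.coeff j * (ε : ℂ) ^ (J - j)
        = ((ε ^ J : ℝ) : ℂ) * ∑ j ∈ Finset.range (J + 1), G.coeff j * ((ε⁻¹ : ℝ) : ℂ) ^ j := by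
      rw [Finset.mul_sum]
      refine Finset.sum_congr rfl fun j hj => ?_
      rw [pow_sub₀ _ hε' (Nat.lt_succ_iff.1 (Finset.mem_range.1 hj))]
      push_cast
      ring
    rw [hk]
    simp only
    rw [h2, Complex.re_ofReal_mul]
    exact mul_nonneg (by positivity) h1
  have e : k 0 = (G.coeff J).re := by
    rw [hk]
    simp only
    rw [Finset.sum_eq_single J]
    · simp
    · intro j hj hne
      have := Finset.mem_range.1 hj
      have h0 : J - j ≠ 0 := by omega
      simp [h0]
    · simp
  rwa [e] at this

theorem coeff_comp_neg_X {B : Type*} [CommRing B] (p : Polynomial B) (n : ℕ) :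
    (p.comp (-Polynomial.X)).coeff n = (-1) ^ n * p.coeff n := by
  have := Polynomial.comp_C_mul_X_coeff (p := p) (r := -1) (n := n)
  rw [map_neg, map_one, neg_one_mul] at this
  rw [this, mul_comm]

theorem nonpos_coeff_of_nonneg {G : Polynomial ℂ} {J : ℕ} (hJ : ∀ n, J < n → G.coeff n = 0)
    (h : ∀ r : ℝ, 0 ≤ (G.eval (r : ℂ)).re) (hodd : Odd J) : (G.coeff J).re ≤ 0 := by
  have := nonneg_coeff_of_nonneg (G := G.comp (-Polynomial.X)) (J := J)
    (fun n hn => by rw [coeff_comp_neg_X, hJ n hn, mul_zero])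
    (fun r => by
      have := h (-r)
      rw [Polynomial.eval_comp]
      simpa using this)
  rw [coeff_comp_neg_X, hodd.neg_one_pow, neg_one_mul, Complex.neg_re] at this
  linarith

theorem coeff_eq_zero_of_odd {G : Polynomial ℂ} {n : ℕ} (hn : Odd n) (h0 : ∀ i < n, G.coeff i = 0)
    (h : ∀ r : ℝ, 0 ≤ (G.eval (r : ℂ)).re) : (G.coeff n).re = 0 := by
  obtain ⟨K, rfl⟩ := Polynomial.X_pow_dvd_iff.2 h0
  have hK : (Polynomial.X ^ n * K).coeff n = K.eval 0 := by
    rw [Polynomial.coeff_X_pow_mul', if_pos le_rfl, Nat.sub_self, Polynomial.coeff_zero_eq_eval_zero]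
  have hev : ∀ r : ℝ, ((Polynomial.X ^ n * K).eval (r : ℂ)).re = r ^ n * (K.eval (r : ℂ)).re := by
    intro r
    simp only [Polynomial.eval_mul, Polynomial.eval_pow, Polynomial.eval_X]
    rw [← Complex.ofReal_pow, Complex.re_ofReal_mul]
  have hc : Continuous fun r : ℝ => (K.eval (r : ℂ)).re :=
    Complex.continuous_re.comp (K.continuous.comp Complex.continuous_ofReal)
  have h1 := nonneg_of_pos hc fun r hr => by
    have := h r
    rw [hev] at this
    exact nonneg_of_mul_nonneg_right this (pow_pos hr n)
  have h2 := nonneg_of_pos (f := fun r : ℝ => -(K.eval ((-r : ℝ) : ℂ)).re)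
    (hc.comp continuous_neg).neg fun r hr => by
    have := h (-r)
    rw [hev, hn.neg_pow] at this
    have hp := pow_pos hr n
    by_contra hcon
    push Not at hcon
    nlinarith
  rw [hK]
  simp at h1 h2
  linarith

theorem factorial_mul_coeff {B : Type*} [CommRing B] {I : Type*} (F : I → Polynomial B)
    (d : I → I) (h : ∀ i, Polynomial.derivative (F i) = F (d i)) (n : ℕ) (i : I) :
    (n ! : B) * (F i).coeff n = (F (d^[n] i)).coeff 0 := by
  have e : Polynomial.derivative^[n] (F i) = F (d^[n] i) := by
    induction n with
    | zero => rfl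
    | succ n ih => rw [Function.iterate_succ_apply', Function.iterate_succ_apply', ih, h]
  rw [← e, Polynomial.coeff_iterate_derivative, zero_add, Nat.descFactorial_self, nsmul_eq_mul]

/-! Translations in the imaginary direction. -/

/-- The derivative in the direction of imaginary translations. -/
noncomputable def tt : Derivation ℂ R2 R2 := Complex.I • (dz - dt)

theorem tt_apply (f : R2) : tt f = C Complex.I * (dz f - dt f) := by
  simp [tt, MvPolynomial.smul_eq_C_mul]

theorem tt_pd (i : Fin 2 × Bool) (f : R2) : tt (pderiv i f) = pderiv i (tt f) := by
  simp only [tt_apply, Derivation.leibniz, map_sub, pd_comm i (1, false), pd_comm i (1, true),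
    pderiv_C]
  simp

theorem tt_pd_iter (n : ℕ) (i : Fin 2 × Bool) (f : R2) :
    tt^[n] (pderiv i f) = pderiv i (tt^[n] f) := by
  induction n with
  | zero => rfl
  | succ n ih => rw [Function.iterate_succ_apply', Function.iterate_succ_apply', ih, tt_pd]

theorem cjp_tt (f : R2) : cjp (tt f) = tt (cjp f) := by
  rw [tt_apply, tt_apply, map_mul, map_sub, cjp_C, cjp_dz, cjp_dt]
  simp
  ring_nf

theorem cjp_tt_iter {f : R2} (hf : cjp f = f) (n : ℕ) : cjp (tt^[n] f) = tt^[n] f := by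
  induction n with
  | zero => exact hf
  | succ n ih => rw [Function.iterate_succ_apply', cjp_tt, ih]

section

variable {m N : ℕ} {h P : R2}

theorem H_tt {s : ℤ} {f : R2} (hf : f ∈ H m s) : tt f ∈ H m (s - m) :=
  Submodule.smul_mem _ _ (sub_mem (H_dz hf) (H_dt hf))

theorem H_tt_iter {s : ℤ} {f : R2} (hf : f ∈ H m s) (n : ℕ) : tt^[n] f ∈ H m (s - n * m) := by
  induction n with
  | zero => simpa using hf
  | succ n ih =>
    rw [Function.iterate_succ_apply']
    convert H_tt ih using 1
    push_cast
    ring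

theorem exists_last_tt (hm : 0 < m) (hP : P ∈ H m N) (h0 : P ≠ 0) :
    ∃ J : ℕ, tt^[J] P ≠ 0 ∧ ∀ n, J < n → tt^[n] P = 0 := by
  classical
  have hex : ∃ n, tt^[n] P = 0 := ⟨N + 1, H_neg (H_tt_iter hP _) (by
    have : (1 : ℤ) ≤ m := by exact_mod_cast hm
    push_cast
    nlinarith)⟩
  obtain ⟨J, hJ⟩ : ∃ J, Nat.find hex = J + 1 :=
    Nat.exists_eq_succ_of_ne_zero fun hz => h0 ((Nat.find_eq_zero hex).1 hz)
  refine ⟨J, Nat.find_min hex (by omega), fun n hn => ?_⟩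
  obtain ⟨k, rfl⟩ := Nat.exists_eq_add_of_le' hn
  have := Nat.find_spec hex
  rw [hJ] at this
  rw [Function.iterate_add_apply, show tt^[J.succ] P = 0 from this]
  induction k with
  | zero => rfl
  | succ k ih => rw [Function.iterate_succ_apply, map_zero, ih (by omega)]

noncomputable def tl (a b : ℂ) : R2 →ₐ[ℂ] Polynomial ℂ :=
  S (Polynomial.C a) (Polynomial.C (starRingEnd ℂ a))
    (Polynomial.C b + Polynomial.C Complex.I * Polynomial.X)
    (Polynomial.C (starRingEnd ℂ b) - Polynomial.C Complex.I * Polynomial.X)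

theorem eval_tl (a b : ℂ) (q : ℝ) (f : R2) :
    (tl a b f).eval (q : ℂ) = ev a (b + Complex.I * q) f := by
  have := map_S (Polynomial.aeval (q : ℂ) : Polynomial ℂ →ₐ[ℂ] ℂ) (Polynomial.C a)
    (Polynomial.C (starRingEnd ℂ a)) (Polynomial.C b + Polynomial.C Complex.I * Polynomial.X)
    (Polynomial.C (starRingEnd ℂ b) - Polynomial.C Complex.I * Polynomial.X) f
  rw [Polynomial.coe_aeval_eq_eval] at this
  rw [tl, this, ev_def]
  congr 2 <;> simp [sub_eq_add_neg]

theorem derivative_tl (a b : ℂ) (f : R2) :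
    Polynomial.derivative (tl a b f) = tl a b (tt f) := by
  have := S_deriv (Polynomial.derivative' : Derivation ℂ (Polynomial ℂ) (Polynomial ℂ))
    (Polynomial.C a) (Polynomial.C (starRingEnd ℂ a))
    (Polynomial.C b + Polynomial.C Complex.I * Polynomial.X)
    (Polynomial.C (starRingEnd ℂ b) - Polynomial.C Complex.I * Polynomial.X) f
  have e : ∀ q : Polynomial ℂ, Polynomial.derivative' q = Polynomial.derivative q := fun _ => rfl
  simp only [e] at this
  rw [tl, this, tt_apply, map_mul, S_C, map_sub]
  simp
  ring

theorem coeff_tl (a b : ℂ) (n : ℕ) (f : R2) :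
    (n ! : ℂ) * (tl a b f).coeff n = ev a b (tt^[n] f) := by
  rw [factorial_mul_coeff (tl a b) tt (derivative_tl a b) n f,
    Polynomial.coeff_zero_eq_eval_zero]
  simpa using eval_tl a b 0 (tt^[n] f)

theorem Psd.lead (hpsd : Psd P) {J : ℕ} (hJ : ∀ n, J < n → tt^[n] P = 0) :
    Psd (tt^[J] P) ∧ (Odd J → Psd (-tt^[J] P)) := by
  have key : ∀ a b s r : ℂ, ∃ G : Polynomial ℂ, (∀ q : ℝ, 0 ≤ (G.eval (q : ℂ)).re) ∧
      ∀ n, (n ! : ℂ) * G.coeff n = ev a b (dx (dy (tt^[n] P))) * s * starRingEnd ℂ s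
    + ev a b (dx (dt (tt^[n] P))) * s * starRingEnd ℂ r
    + ev a b (dz (dy (tt^[n] P))) * r * starRingEnd ℂ s
    + ev a b (dz (dt (tt^[n] P))) * r * starRingEnd ℂ r := by
    intro a b s r
    refine ⟨tl a b (dx (dy P)) * Polynomial.C (s * starRingEnd ℂ s)
      + tl a b (dx (dt P)) * Polynomial.C (s * starRingEnd ℂ r)
      + tl a b (dz (dy P)) * Polynomial.C (r * starRingEnd ℂ s)
      + tl a b (dz (dt P)) * Polynomial.C (r * starRingEnd ℂ r), fun q => ?_, fun n => ?_⟩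
    · have := hpsd a (b + Complex.I * q) s r
      simp only [Polynomial.eval_add, Polynomial.eval_mul, Polynomial.eval_C, eval_tl, ← mul_assoc]
      simpa only [mul_assoc] using this
    · simp only [Polynomial.coeff_add, Polynomial.coeff_mul_C, mul_add]
      simp only [← mul_assoc, coeff_tl, tt_pd_iter]
  have hJ0 : ∀ a b s r : ℂ, ∃ G : Polynomial ℂ, (∀ q : ℝ, 0 ≤ (G.eval (q : ℂ)).re) ∧
      (∀ n, J < n → G.coeff n = 0) ∧
      (J ! : ℂ) * G.coeff J = ev a b (dx (dy (tt^[J] P))) * s * starRingEnd ℂ s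
    + ev a b (dx (dt (tt^[J] P))) * s * starRingEnd ℂ r
    + ev a b (dz (dy (tt^[J] P))) * r * starRingEnd ℂ s
    + ev a b (dz (dt (tt^[J] P))) * r * starRingEnd ℂ r := by
    intro a b s r
    obtain ⟨G, h1, h2⟩ := key a b s r
    refine ⟨G, h1, fun n hn => ?_, h2 J⟩
    have := h2 n
    rw [hJ n hn] at this
    simpa [Nat.factorial_ne_zero] using this
  have hf : ∀ z : ℂ, ((J ! : ℂ) * z).re = J ! * z.re := fun z => by
    rw [← Complex.re_ofReal_mul]; simp
  refine ⟨fun a b s r => ?_, fun ho a b s r => ?_⟩ <;> obtain ⟨G, h1, h2, h3⟩ := hJ0 a b s r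
  · rw [← h3, hf]
    exact mul_nonneg (by positivity) (nonneg_coeff_of_nonneg h2 h1)
  · have h4 := nonpos_coeff_of_nonneg h2 h1 ho
    have h5 : ev a b (dx (dy (-tt^[J] P))) * s * starRingEnd ℂ s
        + ev a b (dx (dt (-tt^[J] P))) * s * starRingEnd ℂ r
        + ev a b (dz (dy (-tt^[J] P))) * r * starRingEnd ℂ s
        + ev a b (dz (dt (-tt^[J] P))) * r * starRingEnd ℂ r = -((J ! : ℂ) * G.coeff J) := by
      rw [h3]; simp only [map_neg]; ring
    rw [h5, Complex.neg_re, hf]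
    have : (0 : ℝ) ≤ J ! := by positivity
    nlinarith

/-! Rigid polynomials. -/

theorem S_rigid {B : Type*} [CommRing B] [Algebra ℂ B] {p : R2} (hp : dz p = dt p) (a b c d : B) :
    S a b c d p = S a b (c + d) 0 p := by
  set f : R2 := S vx vy vz (vt - vz) p with hf
  have hfz : dz f = 0 := by
    rw [hf, S_deriv, hp]
    simp [pderiv_X]
  have e : ∀ c e : B, S a b c e f = S a b c (e - c) p := by
    intro c e
    rw [hf, map_S]; simp
  have h1 := e c (c + d)
  have h2 := e (c + d) (c + d)
  rw [add_sub_cancel_left] at h1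
  rw [sub_self] at h2
  rw [← h1, ← h2]
  exact S_congr (Or.inr rfl) (Or.inr rfl) (Or.inl hfz) (Or.inr rfl)

/-- Expansion in powers of `z + t - h`. -/
noncomputable def Fr (h : R2) : R2 →ₐ[ℂ] Polynomial R2 :=
  S (Polynomial.C vx) (Polynomial.C vy) (Polynomial.C h + Polynomial.X) 0

noncomputable def qc (h : R2) (n : ℕ) (p : R2) : R2 := S vx vy h 0 (dz^[n] p)

theorem derivative_Fr (p : R2) : Polynomial.derivative (Fr h p) = Fr h (dz p) := by
  have := S_deriv ((Polynomial.derivative' :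
    Derivation R2 (Polynomial R2) (Polynomial R2)).restrictScalars ℂ)
    (Polynomial.C vx) (Polynomial.C vy) (Polynomial.C h + Polynomial.X) 0 p
  have e : ∀ q : Polynomial R2, Polynomial.derivative' q = Polynomial.derivative q := fun _ => rfl
  simp only [Derivation.restrictScalars_apply, e] at this
  rw [Fr, this]
  simp

theorem map_S_eval₂ {B : Type*} [CommRing B] [Algebra ℂ B] (e : R2 →ₐ[ℂ] B) (r : B) (p : R2) :
    (Fr h p).eval₂ (e : R2 →+* B) r = S (e vx) (e vy) (e h + r) 0 p := by
  have := map_S (((Polynomial.aeval r).restrictScalars ℂ).comp (Polynomial.mapAlgHom e)) (Polynomial.C vx)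
    (Polynomial.C vy) (Polynomial.C h + Polynomial.X) 0 p
  simpa [Polynomial.eval_map, Fr] using this

theorem coeff_Fr (n : ℕ) (p : R2) : (n ! : R2) * (Fr h p).coeff n = qc h n p := by
  rw [factorial_mul_coeff (Fr h) dz derivative_Fr n p, Polynomial.coeff_zero_eq_eval_zero]
  have := map_S_eval₂ (h := h) (AlgHom.id ℂ R2) 0 (dz^[n] p)
  simpa [qc, Polynomial.eval] using this

theorem coeff_Fr_eq_zero {n : ℕ} {p : R2} : (Fr h p).coeff n = 0 ↔ qc h n p = 0 := by
  rw [← coeff_Fr]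
  have : ((n ! : ℕ) : R2) ≠ 0 := by exact_mod_cast n.factorial_ne_zero
  simp [this]

theorem eq_zero_of_qc {p : R2} (hp : dz p = dt p) (h0 : ∀ n, qc h n p = 0) : p = 0 := by
  have h1 : Fr h p = 0 := Polynomial.ext fun n => by
    rw [coeff_Fr_eq_zero.2 (h0 n), Polynomial.coeff_zero]
  have h2 := map_S_eval₂ (h := h) (AlgHom.id ℂ R2) (vz + vt - h) p
  rw [h1] at h2
  simp only [Polynomial.eval₂_zero, AlgHom.coe_id, id_eq, add_sub_cancel] at h2
  rw [← S_rigid hp, S_id] at h2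
  exact h2.symm

theorem dz_qc (hz : dz h = 0) (n : ℕ) (p : R2) : dz (qc h n p) = 0 := by
  rw [qc, S_deriv, hz]; simp [pderiv_X]

theorem dt_qc (ht : dt h = 0) (n : ℕ) (p : R2) : dt (qc h n p) = 0 := by
  rw [qc, S_deriv, ht]; simp [pderiv_X]

theorem rigid_iter {p : R2} (hp : dz p = dt p) (n : ℕ) : dz (dz^[n] p) = dt (dz^[n] p) := by
  induction n with
  | zero => exact hp
  | succ n ih => rw [Function.iterate_succ_apply', pd_comm (1, true), ← ih]

theorem cjp_dz_iter {p : R2} (hr : cjp p = p) (hp : dz p = dt p) (n : ℕ) :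
    cjp (dz^[n] p) = dz^[n] p := by
  induction n with
  | zero => exact hr
  | succ n ih => rw [Function.iterate_succ_apply', cjp_dz, ih, ← rigid_iter hp]

theorem H_dz_iter {s : ℤ} {f : R2} (hf : f ∈ H m s) (n : ℕ) : dz^[n] f ∈ H m (s - n * m) := by
  induction n with
  | zero => simpa using hf
  | succ n ih =>
    rw [Function.iterate_succ_apply']
    convert H_dz ih using 1
    push_cast
    ring

theorem H_qc {s : ℤ} (hh : h ∈ H m m) {p : R2} (hp : p ∈ H m s) (n : ℕ) :
    qc h n p ∈ H m (s - n * m) :=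
  H_S H_x H_y hh (zero_mem _) (H_dz_iter hp n)

theorem cjp_qc (hr : cjp h = h) {p : R2} (hc : cjp p = p) (hp : dz p = dt p) (n : ℕ) :
    cjp (qc h n p) = qc h n p := by
  rw [qc, cjp_S, cjp_dz_iter hc hp, hr]
  simp only [cjp_X, map_zero]
  rw [S_rigid (rigid_iter hp n), zero_add]
  rfl

theorem exists_ev (hr : cjp h = h) {p : R2} (hp : dz p = dt p) (a : ℂ) (r : ℝ) :
    ∃ b, ev a b p = ((Fr h p).map (ev a 0 : R2 →+* ℂ)).eval (r : ℂ) := by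
  refine ⟨(ev a 0 h + r) / 2, ?_⟩
  rw [Polynomial.eval_map, map_S_eval₂, ev_def, S_rigid hp]
  have him : starRingEnd ℂ (ev a 0 h) = ev a 0 h := by rw [← ev_cjp, hr]
  congr 2
  · simp
  · simp
  · simp only [map_div₀, map_add, him, Complex.conj_ofReal, map_ofNat]
    ring_nf

theorem qc_eq_zero_of_odd (hr : cjp h = h) (hz : dz h = 0) (ht : dt h = 0) {p : R2}
    (hc : cjp p = p) (hp : dz p = dt p) (hnn : ∀ a b, 0 ≤ (ev a b p).re) {n : ℕ} (hn : Odd n)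
    (h0 : ∀ i < n, qc h i p = 0) : qc h n p = 0 := by
  refine eq_zero_of_ev fun a b => ?_
  have h1 := coeff_eq_zero_of_odd (G := (Fr h p).map (ev a 0 : R2 →+* ℂ)) hn
    (fun i hi => by rw [Polynomial.coeff_map, coeff_Fr_eq_zero.2 (h0 i hi), map_zero])
    (fun r => by
      obtain ⟨b, hb⟩ := exists_ev hr hp a r
      rw [← hb]
      exact hnn a b)
  rw [ev_of_dz_dt (dz_qc hz n p) (dt_qc ht n p), ← coeff_Fr, map_mul, map_natCast]
  have h2 : (ev a 0 (qc h n p)).im = 0 := ev_im_of_real (cjp_qc hr hc hp n) a 0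
  rw [← coeff_Fr, map_mul, map_natCast] at h2
  rw [Polynomial.coeff_map] at h1
  have h3 : (ev a 0 ((Fr h p).coeff n)).im = 0 := by
    rw [← Complex.ofReal_natCast, Complex.im_ofReal_mul] at h2
    exact (mul_eq_zero.1 h2).resolve_left (by exact_mod_cast n.factorial_ne_zero)
  rw [Complex.ext (z := ev a 0 ((Fr h p).coeff n)) (w := 0) h1 h3, mul_zero]

end

end Mdl

namespace Mdl

open MvPolynomial SF
open scoped Nat

section

variable {m N : ℕ} {h A P : R2}

theorem S_fL_rigid (hz : dz h = 0) (ht : dt h = 0) (hr : cjp h = h) {f : R2} (hf : dz f = dt f) :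
    S vx vy h 0 (fL (dx h) f) = dx (dy (S vx vy h 0 f)) - dx (dy h) * S vx vy h 0 (dz f) := by
  have hx : ∀ q : R2, dx (S vx vy h 0 q) = S vx vy h 0 (dx q) + S vx vy h 0 (dz q) * dx h := by
    intro q; rw [S_deriv]; simp [pderiv_X]
  have hy : ∀ q : R2, dy (S vx vy h 0 q) = S vx vy h 0 (dy q) + S vx vy h 0 (dz q) * dy h := by
    intro q; rw [S_deriv]; simp [pderiv_X]
  have e : ∀ i, S vx vy h 0 (pderiv i h) = pderiv i h := fun i => by
    conv_rhs => rw [← S_id (pderiv i h)]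
    exact S_congr (Or.inr rfl) (Or.inr rfl) (Or.inl (by rw [pd_comm, hz, map_zero]))
      (Or.inl (by rw [pd_comm, ht, map_zero]))
  rw [hy, map_add, hx, Derivation.leibniz, hx]
  simp only [fL, map_add, map_mul, e, cjp_dx, hr, ← hf, smul_eq_mul]
  rw [pd_comm (1, false) (0, true)]
  ring

theorem fL_pd {i : Fin 2 × Bool} (h1 : pderiv i A = 0) (h2 : pderiv i (cjp A) = 0) (f : R2) :
    pderiv i (fL A f) = fL A (pderiv i f) := by
  simp only [fL, map_add, Derivation.leibniz, h1, h2, smul_eq_mul, mul_zero, add_zero]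
  simp only [pd_comm i]

theorem H_dxh (hh : h ∈ H m m) : dx h ∈ H m (m - 1) := H_dx hh

theorem qc_fL (hh : h ∈ H m m) (hz : dz h = 0) (ht : dt h = 0) (hr : cjp h = h) {p : R2}
    (hp : dz p = dt p) (n : ℕ) :
    qc h n (fL (dx h) p) = dx (dy (qc h n p)) - dx (dy h) * qc h (n + 1) p := by
  have e : ∀ n, dz^[n] (fL (dx h) p) = fL (dx h) (dz^[n] p) := by
    intro n
    induction n with
    | zero => rfl
    | succ n ih =>
      rw [Function.iterate_succ_apply', Function.iterate_succ_apply', ih,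
        fL_pd (dz_A (H_dxh hh)) (dz_cA (H_dxh hh))]
  rw [qc, e, S_fL_rigid hz ht hr (rigid_iter hp n), qc, qc, Function.iterate_succ_apply']

theorem fL_rigid (hh : h ∈ H m m) {p : R2} (hp : dz p = dt p) :
    dz (fL (dx h) p) = dt (fL (dx h) p) := by
  rw [fL_pd (dz_A (H_dxh hh)) (dz_cA (H_dxh hh)), fL_pd (dt_A (H_dxh hh)) (dt_cA (H_dxh hh)), hp]

theorem av_nonneg_of_eval {q r : R2} {K : Polynomial R2}
    (h : ∀ ε : ℝ, 0 < ε → 0 ≤ (-av (r * K.eval (C (-ε : ℂ) * q))).re) :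
    0 ≤ (-av (r * K.eval 0)).re := by
  have hc : Continuous fun ε : ℝ => av (r * K.eval (C (-ε : ℂ) * q)) := by
    clear h
    induction K using Polynomial.induction_on' with
    | add p q hp hq => simp only [Polynomial.eval_add, mul_add, av_add]; fun_prop
    | monomial n a =>
      have : ∀ ε : ℝ, r * (Polynomial.monomial n a).eval (C (-ε : ℂ) * q)
          = C ((-ε : ℂ) ^ n) * (r * (a * q ^ n)) := by
        intro ε
        rw [Polynomial.eval_monomial, mul_pow, C_pow]; ring
      simp only [this, av_C_mul]
      fun_prop
  have := nonneg_of_pos (Complex.continuous_re.comp hc.neg) h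
  simpa using this

theorem eq_zero_of_circle {s : ℤ} {q : R2} (hq : q ∈ H m s) (hz : dz q = 0) (ht : dt q = 0)
    (h0 : ∀ x : ℂ, ‖x‖ = 1 → ev x 0 q = 0) : q = 0 := by
  rcases lt_or_ge s 0 with hs | hs
  · exact H_neg hq hs
  lift s to ℕ using hs
  refine eq_zero_of_ev fun a b => ?_
  rw [ev_of_dz_dt hz ht]
  obtain ⟨u, hu, ha⟩ : ∃ u : ℂ, ‖u‖ = 1 ∧ a = (‖a‖ : ℂ) * u := by
    by_cases ha : a = 0
    · exact ⟨1, by simp, by simp [ha]⟩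
    · have : (‖a‖ : ℂ) ≠ 0 := by simpa using ha
      exact ⟨a / ‖a‖, by simp [ha], by field_simp⟩
  have := ev_scale hq ‖a‖ u 0
  rwa [mul_zero, ← ha, h0 u hu, mul_zero] at this

/-- A real function on the unit circle is twice the real part of an analytic disc. -/
theorem exists_disc {a : R2} (ha : cjp a = a) : ∃ β : Polynomial ℂ,
    β.eval 0 = av a / 2 ∧
      ∀ x : ℂ, ‖x‖ = 1 → β.eval x + starRingEnd ℂ (β.eval x) = ev x 0 a := by
  obtain ⟨p, q, hp, hq, h⟩ := circ_split a
  refine ⟨Polynomial.C (1 / 2) * (p + q.map (starRingEnd ℂ) + Polynomial.C (av a)), ?_, ?_⟩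
  · have : (q.map (starRingEnd ℂ)).eval 0 = 0 := by
      have := Polynomial.eval_map_apply (f := starRingEnd ℂ) (p := q) 0
      rwa [map_zero, hq, map_zero] at this
    simp only [Polynomial.eval_mul, Polynomial.eval_C, Polynomial.eval_add, hp, this]
    ring
  · intro x hx
    have h1 : starRingEnd ℂ (ev x 0 a) = ev x 0 a := by rw [← ev_cjp, ha]
    have h2 : (q.map (starRingEnd ℂ)).eval x = starRingEnd ℂ (q.eval (starRingEnd ℂ x)) := by
      have := Polynomial.eval_map_apply (f := starRingEnd ℂ) (p := q) (starRingEnd ℂ x)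
      rwa [Complex.conj_conj] at this
    have h3 := h x hx
    simp only [Polynomial.eval_mul, Polynomial.eval_C, Polynomial.eval_add, h2, map_mul, map_add,
      Complex.conj_conj]
    rw [h3] at h1
    simp only [map_add] at h1
    rw [h3, map_div₀, map_one, map_ofNat]
    linear_combination (1 / 2 : ℂ) * h1

theorem Psd.of_disc (hpsd : Psd P) {a Q : R2} (ha : cjp a = a) {τ : ℝ}
    (hQ : ∀ x b : ℂ, ‖x‖ = 1 → b + starRingEnd ℂ b = ev x 0 a → ev x b P = ev x 0 Q) :
    (ev 0 (av a / 2 + τ * Complex.I) P).re ≤ (av Q).re := by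
  obtain ⟨β, h1, h2⟩ := exists_disc ha
  obtain ⟨Q', h3, h4⟩ := hpsd.submean (β + Polynomial.C (τ * Complex.I))
  rw [Polynomial.eval_add, h1, Polynomial.eval_C] at h3
  refine h3.trans (le_of_eq (congrArg _ (av_congr fun x hx => ?_)))
  rw [h4]
  refine hQ _ _ hx ?_
  rw [← h2 x hx]
  simp
  ring

theorem av_real {a : R2} (ha : cjp a = a) : (av a).im = 0 := by
  obtain ⟨β, h1, h2⟩ := exists_disc ha
  have : av (cjp a) = starRingEnd ℂ (av a) := by
    rw [av_eq, av_eq]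
    have := ContinuousLinearMap.circleAverage_comp_comm (Complex.conjCLE : ℂ →L[ℝ] ℂ)
      (circleIntegrable_ev a 1)
    simp only [ev_cjp]
    exact this
  rw [ha] at this
  exact Complex.conj_eq_iff_im.1 this.symm

theorem rigid_center_nonneg {M : ℕ} {p : R2} (hM : m < M) (hpM : p ∈ H m M)
    (hp : dz p = dt p) (hpsd : Psd p) (b : ℂ) : 0 ≤ (ev 0 b p).re := by
  have h1 := congrArg (ev 0 b) (euler2 hpM)
  have h2 := congrArg (ev 0 b) (euler2 (H_dz hpM))
  rw [← hp] at h1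
  rw [show dt (dz p) = dz (dz p) by rw [pd_comm, ← hp]] at h2
  simp only [map_add, map_mul, ev_x, ev_y, map_zero, zero_mul, zero_add, ev_C, ev_z, ev_t] at h1 h2
  have h3 := hpsd 0 b 0 1
  simp only [mul_zero, zero_add, mul_one, map_one, ← hp, map_zero] at h3
  push_cast at h1 h2
  have hb : b + starRingEnd ℂ b = ((2 * b.re : ℝ) : ℂ) := Complex.add_conj b
  have h4 : (M : ℂ) * ((M : ℂ) - m) * ev 0 b p
      = (m : ℂ) ^ 2 * (b + starRingEnd ℂ b) ^ 2 * ev 0 b (dz (dz p)) := by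
    linear_combination -((M : ℂ) - m) * h1 - (m : ℂ) * (b + starRingEnd ℂ b) * h2
  rw [hb] at h4
  have h5 := congrArg Complex.re h4
  have e1 : (M : ℂ) * ((M : ℂ) - m) = ((M * (M - m) : ℝ) : ℂ) := by push_cast; ring
  have e2 : (m : ℂ) ^ 2 * ((2 * b.re : ℝ) : ℂ) ^ 2 = ((m ^ 2 * (2 * b.re) ^ 2 : ℝ) : ℂ) := by
    push_cast; ring
  rw [e1, e2, Complex.re_ofReal_mul, Complex.re_ofReal_mul] at h5
  have hM' : (m : ℝ) < M := by exact_mod_cast hM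
  have hm' : (0 : ℝ) ≤ m := by positivity
  have : 0 < (M : ℝ) * (M - m) := mul_pos (by linarith) (by linarith)
  by_contra hc
  push Not at hc
  have h6 : 0 ≤ (m : ℝ) ^ 2 * (2 * b.re) ^ 2 * (ev 0 b (dz (dz p))).re :=
    mul_nonneg (by positivity) h3
  nlinarith

theorem ev_S_rigid {p : R2} (hp : dz p = dt p) (x b : ℂ) {r : ℂ}
    (hb : b + starRingEnd ℂ b = ev x 0 h + r) :
    ev x b p = (Fr h p).eval₂ (ev x 0 : R2 →+* ℂ) r := by
  rw [map_S_eval₂, ev_def, S_rigid hp, hb]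
  simp

theorem rigid_false (hh : h ∈ H m m) (hz : dz h = 0) (ht : dt h = 0) (hr : cjp h = h)
    (hR : dx (dy h) ≠ 0) {M : ℕ} {p : R2} (hM : m < M) (hpM : p ∈ H m M) (hc : cjp p = p)
    (hp : dz p = dt p) (hpsd : Psd p) (h0 : qc h 0 p = 0) : p = 0 := by
  classical
  by_contra hne
  have hex : ∃ n, qc h n p ≠ 0 := by
    by_contra hcon
    push Not at hcon
    exact hne (eq_zero_of_qc hp hcon)
  obtain ⟨j, hj⟩ : ∃ j, j = Nat.find hex := ⟨_, rfl⟩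
  have hj1 : qc h j p ≠ 0 := hj ▸ Nat.find_spec hex
  have hj2 : ∀ i < j, qc h i p = 0 := fun i hi => by
    have := Nat.find_min hex (hj ▸ hi)
    simpa using this
  have hj0 : j ≠ 0 := by rintro rfl; exact hj1 h0
  rcases Nat.even_or_odd j with he | ho
  · obtain ⟨n, rfl⟩ := Nat.exists_eq_succ_of_ne_zero hj0
    have hn : Odd n := by
      rcases Nat.even_or_odd n with h | h
      · exact absurd he (by simpa [Nat.even_add_one] using h)
      · exact h
    have h1 : qc h n (fL (dx h) p) = 0 :=
      qc_eq_zero_of_odd hr hz ht (cjp_fL hc) (fL_rigid hh hp) (hpsd.fL_nonneg) hn fun i hi => by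
        rw [qc_fL hh hz ht hr hp, hj2 i (by omega), hj2 (i + 1) (by omega)]; simp
    rw [qc_fL hh hz ht hr hp, hj2 n (by omega)] at h1
    simp [hR] at h1
    exact hj1 h1
  · set q := qc h j p with hq
    have hqr : cjp q = q := cjp_qc hr hc hp j
    obtain ⟨K, hK⟩ := Polynomial.X_pow_dvd_iff.2 fun i hi => coeff_Fr_eq_zero.2 (hj2 i hi)
    have hK0 : (j ! : R2) * K.eval 0 = q := by
      rw [hq, ← coeff_Fr, hK, Polynomial.coeff_X_pow_mul', if_pos le_rfl, Nat.sub_self,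
        Polynomial.coeff_zero_eq_eval_zero]
    have h1 := av_nonneg_of_eval (q := q) (r := q ^ j) (K := K) fun ε hε => by
      have h2 := hpsd.of_disc (a := h + C (-ε : ℂ) * q)
        (Q := (C (-ε : ℂ) * q) ^ j * K.eval (C (-ε : ℂ) * q)) (τ := 0)
        (by rw [map_add, map_mul, hr, hqr, cjp_C]; simp) fun x b hx hb => by
          rw [map_add] at hb
          have e : (C (-ε : ℂ) * q) ^ j * K.eval (C (-ε : ℂ) * q)
              = (Polynomial.X ^ j * K).eval₂ (RingHom.id R2) (C (-ε : ℂ) * q) := by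
            rw [Polynomial.eval₂_mul, Polynomial.eval₂_X_pow]; rfl
          rw [ev_S_rigid hp x b hb, hK, e]
          exact (Polynomial.hom_eval₂ _ (RingHom.id R2) (ev x 0 : R2 →+* ℂ) _).symm
      have h3 := (rigid_center_nonneg hM hpM hp hpsd _).trans h2
      have h4 : (C (-ε : ℂ) * q) ^ j * K.eval (C (-ε : ℂ) * q)
          = C (-(ε : ℂ) ^ j) * (q ^ j * K.eval (C (-ε : ℂ) * q)) := by
        rw [mul_pow, ← C_pow, ho.neg_pow]; ring
      rw [h4, av_C_mul, neg_mul, ← mul_neg, ← Complex.ofReal_pow, Complex.re_ofReal_mul] at h3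
      exact nonneg_of_mul_nonneg_right h3 (pow_pos hε j)
    have h5 : av (q ^ (j + 1)) = (j ! : ℂ) * av (q ^ j * K.eval 0) := by
      rw [← av_C_mul, map_natCast, pow_succ]
      congr 1
      conv_lhs => rw [← hK0, hK0]
      nth_rewrite 2 [← hK0]
      ring
    have h6 : (av (q ^ (j + 1))).re ≤ 0 := by
      rw [h5, ← Complex.ofReal_natCast, Complex.re_ofReal_mul]
      rw [Complex.neg_re] at h1
      exact mul_nonpos_of_nonneg_of_nonpos (by positivity) (by linarith)
    have h7 : ∀ x, 0 ≤ (ev x 0 (q ^ (j + 1))).re := fun x => by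
      have : ev x 0 q = ((ev x 0 q).re : ℂ) := Complex.ext rfl (by simp [ev_im_of_real hqr])
      rw [map_pow, this, ← Complex.ofReal_pow, Complex.ofReal_re]
      exact ho.add_one.pow_nonneg _
    refine hj1 (eq_zero_of_circle (H_qc hh hpM j) (dz_qc hz j p) (dt_qc ht j p) fun x hx => ?_)
    have h8 := eq_zero_of_av h7 (le_antisymm h6 (av_nonneg h7)) x hx
    have : ev x 0 q = ((ev x 0 q).re : ℂ) := Complex.ext rfl (by simp [ev_im_of_real hqr])
    rw [map_pow, this, ← Complex.ofReal_pow, Complex.ofReal_re] at h8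
    rw [this, pow_eq_zero_iff (by omega) |>.1 h8, Complex.ofReal_zero]

end

end Mdl

namespace Mdl

open MvPolynomial SF

section

variable {m N : ℕ} {h A P : R2}

/-- Restriction to the hypersurface `z + t = h`. -/
noncomputable def Ss (h : R2) : R2 →ₐ[ℂ] R2 := S vx vy vz (h - vz)

theorem dz_Ss (hz : dz h = 0) (f : R2) : dz (Ss h f) = Ss h (dz f) - Ss h (dt f) := by
  rw [Ss, S_deriv, map_sub, hz]; simp [pderiv_X]; ring

theorem Ss_tt (hz : dz h = 0) {f : R2} (hf : Ss h f = 0) : Ss h (tt f) = 0 := by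
  have := dz_Ss hz f
  rw [hf, map_zero, ← map_sub] at this
  rw [tt_apply, map_mul, ← this, mul_zero]

theorem Ss_tt_iter (hz : dz h = 0) {f : R2} (hf : Ss h f = 0) (n : ℕ) : Ss h (tt^[n] f) = 0 := by
  induction n with
  | zero => exact hf
  | succ n ih => rw [Function.iterate_succ_apply']; exact Ss_tt hz ih

theorem Ss_rigid {p : R2} (hp : dz p = dt p) : Ss h p = qc h 0 p := by
  rw [Ss, S_rigid hp, add_sub_cancel]; rfl

theorem ev_Ss {x b : ℂ} (hb : b + starRingEnd ℂ b = ev x 0 h) (hz : dz h = 0) (ht : dt h = 0)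
    (f : R2) : ev x b (Ss h f) = ev x b f := by
  rw [Ss, map_S, map_sub, ev_of_dz_dt hz ht, ← hb]
  simp [ev_def]

theorem S00_tt (f : R2) : S00 (tt f) = tt (S00 f) := by
  have h1 : dz (S00 f) = S00 (dz f) := by rw [S00, S_deriv]; simp [pderiv_X]
  have h2 : dt (S00 f) = S00 (dt f) := by rw [S00, S_deriv]; simp [pderiv_X]
  rw [tt_apply, tt_apply, h1, h2, map_mul, map_sub]
  simp [S00]

theorem coeff_eq_zero_of_halfPlane {c : ℂ} {s : ℝ} {e : ℕ} (hs : s ≠ 0)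
    (he2 : 2 ≤ e) (h : ∀ τ : ℝ, (c * (s / 2 + τ * Complex.I) ^ (e + 1)).re ≤ 0) : c = 0 := by
  set q : Polynomial ℂ := Polynomial.C (-(c * (s : ℂ) ^ (e + 1))) * Polynomial.X ^ (e + 1) with hq
  have ev : ∀ τ : ℂ, q.eval τ = -(c * (s * τ) ^ (e + 1)) := fun τ => by
    rw [hq]
    simp only [Polynomial.eval_mul, Polynomial.eval_C, Polynomial.eval_pow, Polynomial.eval_X]
    ring
  have h1 : ∀ τ : ℂ, 0 < τ.re → 0 ≤ (q.eval τ).re := by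
    intro τ hτ
    obtain ⟨t, ht⟩ : ∃ t : ℝ, 2 * τ.re * t = s * τ.im :=
      ⟨s * τ.im / (2 * τ.re), by field_simp⟩
    have e1 : (s : ℂ) * τ = ((2 * τ.re : ℝ) : ℂ) * (s / 2 + (t : ℂ) * Complex.I) := by
      apply Complex.ext
      · rw [Complex.re_ofReal_mul, Complex.re_ofReal_mul]; simp; ring
      · rw [Complex.im_ofReal_mul, Complex.im_ofReal_mul]; simp [ht]
    have := h t
    rw [ev, e1, mul_pow, mul_left_comm, ← Complex.ofReal_pow, Complex.neg_re,
      Complex.re_ofReal_mul]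
    have h2 : 0 < (2 * τ.re) ^ (e + 1) := by positivity
    nlinarith
  have h2 : q.natDegree ≤ 1 := natDegree_le_one_of_halfPlane fun τ hτ => by
    have hc : Continuous fun ε : ℝ => (q.eval (τ + ε)).re :=
      Complex.continuous_re.comp (q.continuous.comp (by fun_prop))
    have := nonneg_of_pos hc fun ε hε => h1 _ (by simp; linarith)
    simpa using this
  by_contra hc
  have hne : -(c * (s : ℂ) ^ (e + 1)) ≠ 0 := by
    simp [hc, hs]
  rw [hq, Polynomial.natDegree_C_mul_X_pow _ _ hne] at h2
  omega

theorem real_of_sign {R : R2} {c : ℂ} (h1 : ∀ a, ((ev a 0 R) * c).re = 0)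
    (hz : dz R = 0) (ht : dt R = 0) (hr : cjp R = R) (hcr : starRingEnd ℂ c = c) (hc : c ≠ 0) :
    R = 0 := by
  refine eq_zero_of_ev fun a b => ?_
  rw [ev_of_dz_dt hz ht]
  have hi := ev_im_of_real hr a 0
  have hci := Complex.conj_eq_iff_im.1 hcr
  refine (mul_eq_zero.1 (Complex.ext (z := ev a 0 R * c) (w := 0) (h1 a) ?_)).resolve_right hc
  rw [Complex.mul_im, hi, hci]; simp

theorem Psd.eq_zero_of_Ss (hm : 2 ≤ m) (hN : m < N) (hh : h ∈ H m m) (hz : dz h = 0)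
    (ht : dt h = 0) (hr : cjp h = h) (hR : dx (dy h) ≠ 0) (hP : P ∈ H m N) (hrP : cjp P = P)
    (hpsd : Psd P) (h0 : Ss h P = 0) : P = 0 := by
  by_contra hne
  have hm0 : 0 < m := by omega
  obtain ⟨J, hJ, hJ'⟩ := exists_last_tt hm0 hP hne
  obtain ⟨hp1, hp2⟩ := hpsd.lead hJ'
  set p := tt^[J] P with hpdef
  have hprig : dz p = dt p := by
    have := hJ' (J + 1) (by omega)
    rw [Function.iterate_succ_apply', ← hpdef, tt_apply] at this
    simpa [sub_eq_zero, Complex.I_ne_zero] using this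
  have hpr : cjp p = p := cjp_tt_iter hrP J
  have hpH : p ∈ H m (N - J * m) := H_tt_iter hP J
  have hp0 : qc h 0 p = 0 := by rw [← Ss_rigid hprig]; exact Ss_tt_iter hz h0 J
  have hdz : dz p ≠ 0 := by
    intro hd
    refine hJ (eq_zero_of_qc (h := h) hprig fun n => ?_)
    cases n with
    | zero => exact hp0
    | succ n =>
      rw [qc, Function.iterate_succ_apply, hd]
      have : dz^[n] (0 : R2) = 0 := by
        induction n with
        | zero => rfl
        | succ n ih => rw [Function.iterate_succ_apply', ih, map_zero]
      rw [this, map_zero]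
  have hM : (m : ℤ) ≤ N - J * m := by
    by_contra hlt
    exact hdz (H_neg (H_dz hpH) (by omega))
  obtain ⟨M, hMe⟩ : ∃ M : ℕ, (M : ℤ) = N - J * m := ⟨((N : ℤ) - J * m).toNat, by omega⟩
  rw [← hMe] at hpH
  rcases lt_or_eq_of_le (show m ≤ M by omega) with hlt | heq
  · exact hJ (rigid_false hh hz ht hr hR hlt hpH hpr hprig hp1 hp0)
  obtain ⟨c, hc⟩ : ∃ c, dz p = C c := by
    have := H_dz hpH
    rw [← heq, sub_self] at this
    exact ⟨_, H_const this hm0⟩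
  have hc0 : c ≠ 0 := by rintro rfl; exact hdz (by rw [hc, map_zero])
  have hcr : starRingEnd ℂ c = c := by
    have := congrArg cjp hc
    rw [cjp_dz, hpr, ← hprig, hc, cjp_C] at this
    exact (C_injective _ _ this).symm
  set R := dx (dy h) with hRdef
  have hRr : cjp R = R := by rw [hRdef, cjp_dx, cjp_dy, hr, pd_comm]
  have hRz : dz R = 0 := by rw [hRdef, pd_comm, pd_comm (1, false), hz]; simp
  have hRt : dt R = 0 := by rw [hRdef, pd_comm, pd_comm (1, true), ht]; simp
  have hq : qc h 0 (fL (dx h) p) = -(R * C c) := by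
    rw [qc_fL hh hz ht hr hprig, hp0]
    have : qc h (0 + 1) p = C c := by
      rw [qc, zero_add, Function.iterate_one, hc]; simp [algebraMap_eq]
    rw [this]; simp [← hRdef]
  have hevq : ∀ x, ev x (ev x 0 h / 2) (fL (dx h) p) = -(ev x 0 R * c) := by
    intro x
    have him : starRingEnd ℂ (ev x 0 h) = ev x 0 h := by rw [← ev_cjp, hr]
    have hb : ev x 0 h / 2 + starRingEnd ℂ (ev x 0 h / 2) = ev x 0 h := by
      rw [map_div₀, him, map_ofNat]; ring
    rw [← ev_Ss hb hz ht, Ss_rigid (fL_rigid hh hprig), hq, map_neg, map_mul, ev_C,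
      ev_of_dz_dt hRz hRt]
  have hsgn : ∀ x, (ev x 0 R * c).re ≤ 0 := by
    intro x
    have := hp1.fL_nonneg (A := dx h) x (ev x 0 h / 2)
    rw [hevq, Complex.neg_re] at this
    linarith
  rcases Nat.even_or_odd J with he | ho
  · have hNe : N = m * (J + 1) := by
      zify; rw [mul_add, mul_one]; rw [← heq] at hMe; linarith
    have hJ2 : 2 ≤ J := by
      rcases Nat.lt_or_ge J 2 with h | h
      · obtain rfl : J = 0 := by
          obtain ⟨k, rfl⟩ := he; omega
        omega
      · exact h
    obtain ⟨c', hc'⟩ := exists_harmonic hm0 he (by omega) hNe hP hrP hpsd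
    have hav0 : av h ≠ 0 := by
      intro hav
      have h1 := av_dx_dy hh hz ht
      rw [hav, mul_zero] at h1
      have e : ∀ x, ev x 0 (C (-c) * R) = -(ev x 0 R * c) := by
        intro x; rw [map_mul, ev_C]; ring
      have h2 := eq_zero_of_av (p := C (-c) * R)
        (fun x => by rw [e, Complex.neg_re]; linarith [hsgn x]) (by rw [av_C_mul, h1]; simp)
      have hRH : R ∈ H m (m - 1 - 1) := by
        rw [hRdef, pd_comm]; exact H_dy (H_dx hh)
      refine hR (eq_zero_of_circle hRH hRz hRt fun x hx => ?_)
      have h3 := h2 x hx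
      have hci := Complex.conj_eq_iff_im.1 hcr
      refine (mul_eq_zero.1 (Complex.ext (z := ev x 0 R * c) (w := 0) ?_ ?_)).resolve_right hc0
      · rw [e, Complex.neg_re] at h3
        have : (ev x 0 R * c).re = 0 := by linarith
        simpa using this
      · rw [Complex.mul_im, ev_im_of_real hRr, hci]; simp
    have havr : av h = ((av h).re : ℂ) := Complex.ext rfl (by simp [av_real hr])
    have hle : ∀ τ : ℝ, (c' * ((av h).re / 2 + τ * Complex.I) ^ (J + 1)).re ≤ 0 := by
      intro τ
      have := hpsd.of_disc (a := h) (Q := 0) (τ := τ) hr fun x b _ hb => by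
        rw [← ev_Ss hb hz ht, h0, map_zero, map_zero]
      rw [hc', havr] at this
      simpa [av] using this
    have hc0' : c' = 0 := coeff_eq_zero_of_halfPlane
      (fun h1 => hav0 (by rw [havr, h1, Complex.ofReal_zero])) hJ2 hle
    have hS : S00 P = 0 := S00_eq_zero fun b => Complex.ext
      (by rw [hc' b, hc0']; simp) (by rw [ev_im_of_real hrP]; simp)
    have hSp : S00 p = 0 := by
      have : ∀ n, S00 (tt^[n] P) = 0 := by
        intro n
        induction n with
        | zero => exact hS
        | succ n ih => rw [Function.iterate_succ_apply', S00_tt, ih, map_zero]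
      exact this J
    have h3 : dz (S00 p) = S00 (dz p) := by rw [S00, S_deriv]; simp [pderiv_X]
    rw [hSp, map_zero, hc] at h3
    refine hc0 ?_
    simpa [S00] using h3.symm
  · refine hR (real_of_sign (c := c) (fun x => le_antisymm (hsgn x) ?_) hRz hRt hRr hcr hc0)
    have := (hp2 ho).fL_nonneg (A := dx h) x (ev x 0 h / 2)
    have e : fL (dx h) (-p) = -fL (dx h) p := by simp only [fL, map_neg]; ring
    rwa [e, map_neg, hevq, neg_neg] at this

end

end Mdl

namespace Mdl

open MvPolynomial SF

section

variable {m N : ℕ} {h A P : R2}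

theorem Ss_of_dt {f : R2} (hf : dt f = 0) : Ss h f = f := by
  conv_rhs => rw [← S_id f]
  exact S_congr (Or.inr rfl) (Or.inr rfl) (Or.inr rfl) (Or.inl hf)

theorem H_Ss {s : ℤ} (hh : h ∈ H m m) {f : R2} (hf : f ∈ H m s) : Ss h f ∈ H m s :=
  H_S H_x H_y H_z (sub_mem hh H_z) hf

theorem dt_Ss (ht : dt h = 0) (f : R2) : dt (Ss h f) = 0 := by
  rw [Ss, S_deriv, map_sub, ht]; simp [pderiv_X]

theorem dx_Ss (f : R2) : dx (Ss h f) = Ss h (dx f) + Ss h (dt f) * dx h := by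
  rw [Ss, S_deriv, map_sub]; simp [pderiv_X]

theorem dy_Ss (f : R2) : dy (Ss h f) = Ss h (dy f) + Ss h (dt f) * dy h := by
  rw [Ss, S_deriv, map_sub]; simp [pderiv_X]

theorem constantCoeff_S {a b c d : R2} (ha : constantCoeff a = 0) (hb : constantCoeff b = 0)
    (hc : constantCoeff c = 0) (hd : constantCoeff d = 0) (p : R2) :
    constantCoeff (S a b c d p) = constantCoeff p := by
  induction p using MvPolynomial.induction_on with
  | C c => simp
  | add p q hp hq => rw [map_add, map_add, map_add, hp, hq]
  | mul_X p i _ =>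
    obtain ⟨i, e⟩ := i
    rw [map_mul, map_mul, map_mul, constantCoeff_X, mul_zero]
    have : constantCoeff (S a b c d (MvPolynomial.X (i, e))) = 0 := by
      fin_cases i <;> cases e
      exacts [by simp [ha], by simp [hb], by simp [hc], by simp [hd]]
    rw [this, mul_zero]

theorem Lv_Ss (hz : dz h = 0) (ht : dt h = 0) (f : R2) :
    Lv (dx h) (Ss h f) = Ss h (Lv (dx h) f) := by
  have : Ss h (dx h) = dx h := Ss_of_dt (by rw [pd_comm, ht, map_zero])
  rw [Lv_apply, Lv_apply, map_add, map_mul, this, dx_Ss, dz_Ss hz]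
  ring

theorem dy_Ss_Lb (ht : dt h = 0) (hr : cjp h = h) (f : R2) :
    dy (Ss h f) = Ss h (Lb (dx h) f) := by
  have h1 : cjp (dx h) = dy h := by rw [cjp_dx, hr]
  have : Ss h (dy h) = dy h := Ss_of_dt (by rw [pd_comm, ht, map_zero])
  rw [Lb_apply, map_add, map_mul, h1, this, dy_Ss]
  ring

/-- A polynomial vanishing at the points of the real hypersurface `z + z̄ = h`. -/
theorem Ss_eq_zero (hz : dz h = 0) (ht : dt h = 0) (hr : cjp h = h) {f : R2}
    (hf : ∀ a b, b + starRingEnd ℂ b = ev a 0 h → ev a b f = 0) : Ss h f = 0 := by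
  have h2 : (C (1 / 2) : R2) * 2 = 1 := by
    rw [← map_ofNat C 2, ← C_mul]; norm_num
  have h3 : S vx vy (C (1 / 2) * (h + vz - vt)) vt (Ss h f) = 0 := by
    refine eq_zero_of_ev fun a b => ?_
    set b' := (ev a 0 h + b - starRingEnd ℂ b) / 2 with hb'
    have him : starRingEnd ℂ (ev a 0 h) = ev a 0 h := by rw [← ev_cjp, hr]
    have hb : b' + starRingEnd ℂ b' = ev a 0 h := by
      rw [hb', map_div₀, map_sub, map_add, him, map_ofNat, Complex.conj_conj]; ring
    rw [map_S]
    have e : ev a b (C (1 / 2) * (h + vz - vt)) = b' := by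
      rw [map_mul, map_sub, map_add, ev_of_dz_dt hz ht, hb']
      simp; ring
    rw [e, ← hf a b' hb, ← ev_Ss hb hz ht, ev_def]
    exact S_congr (Or.inr (by simp)) (Or.inr (by simp)) (Or.inr rfl) (Or.inl (dt_Ss ht f))
  have h4 := congrArg (Ss h) h3
  rw [map_zero, map_S] at h4
  rw [← h4]
  conv_lhs => rw [← S_id (Ss h f)]
  have hhs : Ss h h = h := Ss_of_dt ht
  refine S_congr (Or.inr (by simp [Ss])) (Or.inr (by simp [Ss])) (Or.inr ?_) (Or.inl (dt_Ss ht f))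
  rw [map_mul, map_sub, map_add, hhs]
  have e1 : Ss h vz = vz := by simp [Ss]
  have e2 : Ss h vt = h - vz := by simp [Ss]
  have e3 : Ss h (C (1 / 2)) = C (1 / 2) := by simp [Ss]
  rw [e1, e2, e3]
  linear_combination -(vz * h2)

/-- Words in the two vector fields tangent to `z + t = h`, in the coordinates `x, y, z`. -/
noncomputable def W2 (hm : 0 < m) (hh : h ∈ H m m) (hR : dx (dy h) ≠ 0) :
    WordAlg R2 where
  l b := bif b then dy else Lv (dx h)
  H d := H m d ⊓ LinearMap.ker dt.toLinearMap
  ε := eps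
  l_mem := by
    rintro d f ⟨h1, h3⟩ b
    replace h3 : dt f = 0 := h3
    have hA : dx h ∈ H m (m - 1) := H_dx hh
    cases b
    · refine ⟨H_Lv hA h1, ?_⟩
      change dt (Lv _ f) = 0
      rw [dt_Lv hA, h3, map_zero]
    · refine ⟨H_dy h1, ?_⟩
      change dt (dy f) = 0
      rw [pd_comm, h3, map_zero]
  neg := fun h hd => H_neg h.1 hd
  kill := by
    rintro d f ⟨h1, h3⟩ hd hl
    replace h3 : dt f = 0 := h3
    have e1 : dx f + dx h * dz f = 0 := hl false
    have e2 : dy f = 0 := hl true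
    have e3 := congrArg dy e1
    rw [map_add, Derivation.leibniz, pd_comm, e2, pd_comm (0, true) (1, false), e2,
      pd_comm (0, true)] at e3
    simp only [map_zero, mul_zero, zero_add, smul_eq_mul] at e3
    have e4 : dz f = 0 := (mul_eq_zero.1 e3).resolve_right hR
    rw [e4, mul_zero, add_zero] at e1
    exact H_eq_zero_of_pd hm h1 hd e1 e2 e4 h3
  zero := fun h h0 => H_eq_zero_of_const hm h.1 h0
  mul_mem := by
    rintro d e f g ⟨h1, h3⟩ ⟨k1, k3⟩
    replace h3 : dt f = 0 := h3
    replace k3 : dt g = 0 := k3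
    refine ⟨H_mul h1 k1, ?_⟩
    change dt (f * g) = 0
    rw [Derivation.leibniz, h3, k3]; simp

theorem Psd.of_eq {Q : R2} (hP : Psd P) (h1 : dx (dy Q) = dx (dy P)) (h2 : dx (dt Q) = dx (dt P))
    (h3 : dz (dy Q) = dz (dy P)) (h4 : dz (dt Q) = dz (dt P)) : Psd Q := by
  intro a b s r
  rw [h1, h2, h3, h4]
  exact hP a b s r

/-- The potential of the Levi form on the hypersurface `z + t = h`. -/
theorem exists_potential_Ss (hm : 2 ≤ m) (hN : m < N) (hh : h ∈ H m m) (hz : dz h = 0)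
    (ht : dt h = 0) (hr : cjp h = h) (hR : dx (dy h) ≠ 0) (hyp : Hyp m N (dx h) P) :
    ∃ f ∈ H m (N - m), dt f = 0 ∧ Lv (dx h) f = -Ss h (uL (dx h) P) ∧
      dy f = -Ss h (vL (dx h) P) ∧ Ss h (fL (dx h) P) = dx (dy h) * f := by
  have hm0 : 0 < m := by omega
  have hA := hyp.hA
  have hl : ∀ b f, Ss h (ld (dx h) b f) = (W2 hm0 hh hR).l b (Ss h f) := by
    intro b f
    cases b
    · exact (Lv_Ss hz ht f).symm
    · exact (dy_Ss_Lb ht hr f).symm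
  have hcc : ∀ f, constantCoeff (Ss h f) = constantCoeff f := fun f =>
    constantCoeff_S (by simp) (by simp) (by simp)
      (by rw [map_sub, H_eps hh (by omega)]; simp) f
  have hmem : ∀ {s : ℤ} {f : R2}, f ∈ H m s → Ss h f ∈ (W2 hm0 hh hR).H s :=
    fun hf => ⟨H_Ss hh hf, dt_Ss ht _⟩
  have hRH : dx (dy h) ∈ H m (m - 2) := by
    have := H_dx (H_dy hh)
    rwa [show (m : ℤ) - 1 - 1 = m - 2 by ring] at this
  have hRr : cjp (dx (dy h)) = dx (dy h) := by rw [cjp_dx, cjp_dy, hr, pd_comm]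
  have hRt : dt (dx (dy h)) = 0 := by rw [pd_comm, pd_comm (1, true), ht]; simp
  have hRW : dx (dy h) ∈ (W2 hm0 hh hR).H (m - 2) := ⟨hRH, hRt⟩
  rcases hyp.van with hv | hv
  · obtain ⟨w₁, hw₁, hne⟩ : ∃ w : List Bool, (w.length : ℤ) = m - 2 ∧
        eps (lw (W2 hm0 hh hR).l w (dx (dy h))) ≠ 0 := by
      by_contra hc
      push Not at hc
      exact hR ((W2 hm0 hh hR).star hRW hc)
    have hconst : lw (W2 hm0 hh hR).l w₁ (dx (dy h)) = algebraMap ℂ R2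
        (eps (lw (W2 hm0 hh hR).l w₁ (dx (dy h)))) := by
      have h1 := (W2 hm0 hh hR).lw_mem hRW w₁
      rw [hw₁, sub_self] at h1
      exact H_const h1.1 hm0
    have hg : dy (dx h) = dx (dy h) := pd_comm _ _ _
    obtain ⟨f, hf, e1, e2, e3⟩ := WordAlg.dl_single (W := W2 hm0 hh hR) (m := m) (N := N)
      (by omega) (by omega) hRW (hmem (H_uL hA hyp.hP) : _ ∈ _)
      (hmem (H_vL hA hyp.hP)) (hmem (H_fL hA hyp.hP)) (fun w hw => by
        have h1 := hv w hw
        rw [← hcc, map_dl (Ss h) hl, hg, hRr, map_neg, Ss_of_dt hRt] at h1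
        exact h1) hw₁ hconst hne
    exact ⟨f, hf.1, hf.2, e1, e2, e3⟩
  · have hF : Ss h (fL (dx h) P) = 0 := by
      refine (W2 hm0 hh hR).star (hmem (H_fL hA hyp.hP)) fun w hw => ?_
      have h1 := hv w hw
      rw [← hcc, map_lw (Ss h) hl] at h1
      exact h1
    have hu0 : ∀ a b, b + starRingEnd ℂ b = ev a 0 h → ev a b (uL (dx h) P) = 0 := by
      intro a b hb
      have h1 := (hyp.psd.disc (A := dx h) hyp.real a b).2.2
      have h2 := ev_Ss hb hz ht (fL (dx h) P)
      rw [hF, map_zero] at h2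
      rw [← h2, Complex.zero_re, zero_mul] at h1
      exact Complex.normSq_eq_zero.1 (le_antisymm h1 (Complex.normSq_nonneg _))
    have hu := Ss_eq_zero hz ht hr hu0
    have hv' : Ss h (vL (dx h) P) = 0 := Ss_eq_zero hz ht hr fun a b hb => by
      rw [← cjp_uL hyp.real, ev_cjp, hu0 a b hb, map_zero]
    exact ⟨0, zero_mem _, map_zero _, by rw [hu, map_zero, neg_zero],
      by rw [hv', map_zero, neg_zero], by rw [hF, mul_zero]⟩

/-- The model theorem when the Levi form of the model vector field is real. -/
theorem Hyp.flat_of_hamiltonian (hm : 2 ≤ m) (hN : m < N) (hh : h ∈ H m m) (hz : dz h = 0)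
    (ht : dt h = 0) (hr : cjp h = h) (hR : dx (dy h) ≠ 0) (hyp : Hyp m N (dx h) P) : Flat P := by
  have hA := hyp.hA
  have hcA : cjp (dx h) = dy h := by rw [cjp_dx, hr]
  obtain ⟨f, hf, hft, hf1, hf2, hf3⟩ := exists_potential_Ss hm hN hh hz ht hr hR hyp
  have hAt : dt (dx h) = 0 := dt_A hA
  have hAz : dz (dx h) = 0 := dz_A hA
  have hPt := H_dt hyp.hP
  have hPz := H_dz hyp.hP
  set ψ₁ := -f - Ss h (dt P) with hψ₁
  have hψ₁H : ψ₁ ∈ H m (N - m) := sub_mem (neg_mem hf) (H_Ss hh hPt)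
  have hψ₁t : dt ψ₁ = 0 := by rw [hψ₁, map_sub, map_neg, hft, dt_Ss ht]; simp
  have hψ₁L : Lv (dx h) ψ₁ = 0 := by
    rw [hψ₁, map_sub, map_neg, hf1, Lv_Ss hz ht, uL]; simp
  set χ := S vx vy (h - vt) 0 ψ₁ with hχ
  have hχH : χ ∈ H m (N - m) := H_S H_x H_y (sub_mem hh H_t) (zero_mem _) hψ₁H
  have hχx : dx χ = 0 := by
    have e : S vx vy (h - vt) 0 (dx h) = dx h := by
      conv_rhs => rw [← S_id (dx h)]
      exact S_congr (Or.inr rfl) (Or.inr rfl) (Or.inl hAz) (Or.inl hAt)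
    have := congrArg (S vx vy (h - vt) 0) hψ₁L
    rw [Lv_apply, map_add, map_mul, e, map_zero] at this
    have e1 : dx (h - vt) = dx h := by rw [map_sub]; simp [pderiv_X]
    rw [hχ, S_deriv, e1]
    refine Eq.trans ?_ this
    simp [pderiv_X]
    ring
  have hχz : dz χ = 0 := by 
    have e1 : dz (h - vt) = 0 := by rw [map_sub, hz]; simp [pderiv_X]
    rw [hχ, S_deriv, e1]; simp [pderiv_X]
  have hSχ : Ss h χ = ψ₁ := by
    have hhs : Ss h h = h := Ss_of_dt ht
    rw [hχ, map_S]
    conv_rhs => rw [← S_id ψ₁]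
    refine S_congr (Or.inr (by simp [Ss])) (Or.inr (by simp [Ss])) (Or.inr ?_) (Or.inl hψ₁t)
    rw [map_sub, hhs]; simp [Ss]
  set ψ₂ := -f - Ss h (dz P) with hψ₂
  have hψ₂H : ψ₂ ∈ H m (N - m) := sub_mem (neg_mem hf) (H_Ss hh hPz)
  have hψ₂t : dt ψ₂ = 0 := by rw [hψ₂, map_sub, map_neg, hft, dt_Ss ht]; simp
  have hψ₂y : dy ψ₂ = 0 := by
    rw [hψ₂, map_sub, map_neg, hf2, dy_Ss_Lb ht hr, vL]; simp
  set a₁ := anti (1, true) χ with ha₁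
  have ha₁t : dt a₁ = χ := pderiv_anti _ _
  have ha₁x : dx a₁ = 0 := by rw [ha₁, pderiv_anti_ne (by decide), hχx, map_zero]
  have ha₁z : dz a₁ = 0 := by rw [ha₁, pderiv_anti_ne (by decide), hχz, map_zero]
  have ha₁H : a₁ ∈ H m N := by
    have : a₁ ∈ H m ((N : ℤ) - m + m) := anti_mem hχH
    rwa [sub_add_cancel] at this
  set a₂ := anti (1, false) ψ₂ with ha₂
  have ha₂z : dz a₂ = ψ₂ := pderiv_anti _ _
  have ha₂y : dy a₂ = 0 := by rw [ha₂, pderiv_anti_ne (by decide), hψ₂y, map_zero]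
  have ha₂t : dt a₂ = 0 := by rw [ha₂, pderiv_anti_ne (by decide), hψ₂t, map_zero]
  have ha₂H : a₂ ∈ H m N := by
    have : a₂ ∈ H m ((N : ℤ) - m + m) := anti_mem hψ₂H
    rwa [sub_add_cancel] at this
  set p := Ss h (P + a₁ + a₂) with hp
  have hpt : dt p = 0 := dt_Ss ht _
  have hpz : dz p = 0 := by
    rw [hp, dz_Ss hz]
    simp only [map_add, ha₁t, ha₁z, ha₂z, ha₂t, hSχ, Ss_of_dt hψ₂t, map_zero]
    rw [hψ₁, hψ₂]; ring
  have hpxy : dx (dy p) = 0 := by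
    have e1 : dz (dy p) = 0 := by rw [pd_comm, hpz, map_zero]
    have e2 : dx (dy p) = Lv (dx h) (dy p) := by rw [Lv_apply, e1, mul_zero, add_zero]
    have e3 : fL (dx h) (P + a₁ + a₂) = fL (dx h) P := by
      simp only [fL, map_add, ha₂y, ha₂t, add_zero]
      rw [pd_comm (0, false) (0, true), pd_comm (0, false) (0, true),
        pd_comm (1, false) (0, true) a₁, pd_comm (0, false) (1, true) a₁,
        pd_comm (1, false) (1, true) a₁, ha₁x, ha₁z]
      simp
    have hRt : dt (dx (dy h)) = 0 := by rw [pd_comm, pd_comm (1, true), ht]; simp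
    have hRr : cjp (dx (dy h)) = dx (dy h) := by rw [cjp_dx, cjp_dy, hr, pd_comm]
    have e4 : cjp (dy (dx h)) = dx (dy h) := by rw [pd_comm, hRr]
    have e5 : Lv (dx h) (Lb (dx h) (P + a₁ + a₂)) = fL (dx h) (P + a₁ + a₂)
        + dx (dy h) * dt (P + a₁ + a₂) := by rw [Lv_Lb hA, e4]; rfl
    rw [e2, hp, dy_Ss_Lb ht hr, Lv_Ss hz ht, e5, e3, map_add, map_mul, hf3, Ss_of_dt hRt]
    simp only [map_add, ha₁t, ha₂t, hSχ, add_zero]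
    rw [hψ₁]; ring
  have hpH : p ∈ H m N := H_Ss hh (add_mem (add_mem hyp.hP ha₁H) ha₂H)
  set p₂ := S 0 vy 0 0 p with hp₂
  have hp₂H : p₂ ∈ H m N := H_S (zero_mem _) H_y (zero_mem _) (zero_mem _) hpH
  have hp₂x : dx p₂ = 0 := by rw [hp₂, S_deriv]; simp [pderiv_X]
  have hp₂z : dz p₂ = 0 := by rw [hp₂, S_deriv]; simp [pderiv_X]
  have hp₂t : dt p₂ = 0 := by rw [hp₂, S_deriv]; simp [pderiv_X]
  have hp₂y : dy p₂ = dy p := by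
    have : dy p₂ = S 0 vy 0 0 (dy p) := by rw [hp₂, S_deriv]; simp [pderiv_X]
    rw [this]
    conv_rhs => rw [← S_id (dy p)]
    exact S_congr (Or.inl hpxy) (Or.inr rfl) (Or.inl (by rw [pd_comm, hpz, map_zero]))
      (Or.inl (by rw [pd_comm, hpt, map_zero]))
  set q₁ := a₂ - (p - p₂) with hq₁
  set q₂ := a₁ - p₂ with hq₂
  have hq₁H : q₁ ∈ H m N := sub_mem ha₂H (sub_mem hpH hp₂H)
  have hq₂H : q₂ ∈ H m N := sub_mem ha₁H hp₂H
  have hq₁y : dy q₁ = 0 := by rw [hq₁, map_sub, map_sub, ha₂y, hp₂y]; simp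
  have hq₁t : dt q₁ = 0 := by rw [hq₁, map_sub, map_sub, ha₂t, hpt, hp₂t]; simp
  have hq₂x : dx q₂ = 0 := by rw [hq₂, map_sub, ha₁x, hp₂x]; simp
  have hq₂z : dz q₂ = 0 := by rw [hq₂, map_sub, ha₁z, hp₂z]; simp
  have hSP : Ss h (P + q₁ + q₂) = 0 := by
    have e : P + q₁ + q₂ = P + a₁ + a₂ - p := by rw [hq₁, hq₂]; ring
    rw [e, map_sub, ← hp, Ss_of_dt hpt, sub_self]
  have hScP : Ss h (cjp (P + q₁ + q₂)) = 0 := by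
    have e1 := congrArg (S vx vy (h - vt) vt) hSP
    rw [map_zero, Ss, map_S] at e1
    have e2 := congrArg cjp e1
    rw [cjp_S, map_zero] at e2
    rw [← e2, Ss]
    have e3 : S vx vy (h - vt) vt h = h := by
      conv_rhs => rw [← S_id h]
      exact S_congr (Or.inr rfl) (Or.inr rfl) (Or.inl hz) (Or.inl ht)
    refine S_congr (Or.inr (by simp)) (Or.inr (by simp)) (Or.inr ?_) (Or.inr ?_)
    · rw [map_sub (S vx vy (h - vt) vt), e3]; simp
    · simp [hr]
  set e := C (1 / 2) * (q₁ + cjp q₂) with he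
  have h2 : (C (1 / 2) : R2) * 2 = 1 := by
    rw [← map_ofNat C 2, ← C_mul]; norm_num
  have hC : cjp (C (1 / 2) : R2) = C (1 / 2) := by
    rw [cjp_C, map_div₀, map_one, map_ofNat]
  have hcq₂y : dy (cjp q₂) = 0 := by rw [← cjp_dx, hq₂x, map_zero]
  have hcq₂t : dt (cjp q₂) = 0 := by rw [← cjp_dz, hq₂z, map_zero]
  have hey : dy e = 0 := by rw [he, Derivation.leibniz, map_add, hq₁y, hcq₂y]; simp
  have het : dt e = 0 := by rw [he, Derivation.leibniz, map_add, hq₁t, hcq₂t]; simp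
  have heH : e ∈ H m N := by
    have := H_mul (H_C (m := m) (1 / 2)) (add_mem hq₁H (H_cjp hq₂H))
    rwa [zero_add] at this
  have hce : cjp e = C (1 / 2) * (cjp q₁ + q₂) := by rw [he, map_mul, hC, map_add, cjp_cjp]
  have hcex : dx (cjp e) = 0 := by rw [← cjp_dy, hey, map_zero]
  have hcez : dz (cjp e) = 0 := by rw [← cjp_dt, het, map_zero]
  set Q := P + e + cjp e with hQ
  have hQ0 : Ss h Q = 0 := by
    have : Q = C (1 / 2) * ((P + q₁ + q₂) + cjp (P + q₁ + q₂)) := by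
      rw [hQ, hce, he]
      simp only [map_add, hyp.real]
      linear_combination -(P * h2)
    rw [this, map_mul, map_add, hSP, hScP]; simp
  have g1 : dx (dy Q) = dx (dy P) := by
    rw [hQ]; simp only [map_add, hey, add_zero]
    rw [pd_comm _ _ (cjp e), hcex, map_zero, add_zero]
  have g2 : dx (dt Q) = dx (dt P) := by
    rw [hQ]; simp only [map_add, het, add_zero]
    rw [pd_comm _ _ (cjp e), hcex, map_zero, add_zero]
  have g3 : dz (dy Q) = dz (dy P) := by
    rw [hQ]; simp only [map_add, hey, add_zero]
    rw [pd_comm _ _ (cjp e), hcez, map_zero, add_zero]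
  have g4 : dz (dt Q) = dz (dt P) := by
    rw [hQ]; simp only [map_add, het, add_zero]
    rw [pd_comm _ _ (cjp e), hcez, map_zero, add_zero]
  have hQz : Q = 0 := by
    refine (hyp.psd.of_eq g1 g2 g3 g4).eq_zero_of_Ss hm hN hh hz ht hr hR
      (add_mem (add_mem hyp.hP heH) (H_cjp heH)) ?_ hQ0
    rw [hQ, map_add, map_add, hyp.real, cjp_cjp]; ring
  rw [hQz] at g1 g2 g3 g4
  simp only [map_zero] at g1 g2 g3 g4
  exact ⟨g1.symm, g2.symm, g3.symm, g4.symm⟩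

end

end Mdl

theorem dl_smul {B : Type*} [CommRing B] [Algebra ℂ B] (l : Bool → Derivation ℂ B B)
    {a b : ℂ} (hab : a * b = 1) (ξ η u v F : B) (w : List Bool) :
    dl l (a • ξ) (b • η) (a • u) (b • v) F w = dl l ξ η u v F w := by
  have hba : b * a = 1 := by rw [mul_comm, hab]
  induction w with
  | nil => rfl
  | cons c w ih => cases c <;> simp only [dl, ih, lw_smul, smul_mul_smul_comm, hab, hba, one_smul]

namespace Mdl

open MvPolynomial SF

section

variable {m N : ℕ} {A P : R2} {μ : ℂ}

theorem Hyp.flat_of_real (hyp : Hyp m N A P) (hN : m < N) (hg : dy A ≠ 0)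
    (hr : cjp (dy A) = dy A) : Flat P := by
  have hm := hyp.hm
  have hA := hyp.hA
  have hm' : (m : ℂ) ≠ 0 := by
    have : m ≠ 0 := by omega
    exact_mod_cast this
  have hc : (C (m : ℂ)⁻¹ : R2) * C (m : ℂ) = 1 := by
    rw [← C_mul, inv_mul_cancel₀ hm', C_1]
  set h := C (m : ℂ)⁻¹ * (vx * A + vy * cjp A) with hh
  have hhr : cjp h = h := by
    rw [hh, map_mul, map_add, map_mul, map_mul, cjp_cjp, cjp_C, map_inv₀]
    simp only [map_natCast, cjp_X]
    change C (m : ℂ)⁻¹ * (vy * cjp A + vx * A) = _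
    ring
  have hx : dx h = A := by
    have h1 := euler2 hA
    rw [dz_A hA, dt_A hA] at h1
    have h2 : dx (cjp A) = dy A := by rw [← cjp_dy, hr]
    have h3 : (C (((m : ℤ) - 1 : ℤ) : ℂ) : R2) = C (m : ℂ) - 1 := by
      push_cast
      rw [map_sub, C_1]
    rw [h3] at h1
    have h4 : dx h = C (m : ℂ)⁻¹ * (A + vx * dx A + vy * dx (cjp A)) := by
      rw [hh, Derivation.leibniz, map_add, Derivation.leibniz, Derivation.leibniz]
      simp only [pderiv_X, derivation_C, smul_eq_mul]
      simp
      exact Or.inl (by ring)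
    rw [h4, h2]
    simp only [mul_zero, add_zero] at h1
    linear_combination C (m : ℂ)⁻¹ * h1 + A * hc
  have hz : dz h = 0 := by
    rw [hh, Derivation.leibniz, map_add, Derivation.leibniz, Derivation.leibniz, dz_A hA,
      dz_cA hA]
    simp [pderiv_X]
  have ht : dt h = 0 := by
    rw [hh, Derivation.leibniz, map_add, Derivation.leibniz, Derivation.leibniz, dt_A hA,
      dt_cA hA]
    simp [pderiv_X]
  have hH : h ∈ H m m := by
    have h1 := H_mul (H_C (m := m) (m : ℂ)⁻¹) (add_mem (H_mul H_x hA) (H_mul H_y (H_cjp hA)))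
    rwa [zero_add, add_sub_cancel] at h1
  rw [← hx] at hyp
  refine Hyp.flat_of_hamiltonian hm hN hH hz ht hhr ?_ hyp
  rw [pd_comm, hx]
  exact hg

/-- Rotation of the second variable. -/
noncomputable def rot (μ : ℂ) : R2 →ₐ[ℂ] R2 :=
  S vx vy (C μ * vz) (C (starRingEnd ℂ μ) * vt)

theorem rot_of {f : R2} (hz : dz f = 0) (ht : dt f = 0) : rot μ f = f := by
  conv_rhs => rw [← S_id f]
  exact S_congr (Or.inr rfl) (Or.inr rfl) (Or.inl hz) (Or.inl ht)

theorem dx_rot (f : R2) : dx (rot μ f) = rot μ (dx f) := by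
  rw [rot, S_deriv]; simp [pderiv_X]

theorem dy_rot (f : R2) : dy (rot μ f) = rot μ (dy f) := by
  rw [rot, S_deriv]; simp [pderiv_X]

theorem dz_rot (f : R2) : dz (rot μ f) = C μ * rot μ (dz f) := by
  rw [rot, S_deriv]; simp [pderiv_X]; ring

theorem dt_rot (f : R2) : dt (rot μ f) = C (starRingEnd ℂ μ) * rot μ (dt f) := by
  rw [rot, S_deriv]; simp [pderiv_X]; ring

theorem rot_rot (hμ : starRingEnd ℂ μ * μ = 1) (f : R2) :
    rot (starRingEnd ℂ μ) (rot μ f) = f := by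
  conv_rhs => rw [← S_id f]
  rw [rot, rot, map_S]
  have e : (C μ : R2) * C (starRingEnd ℂ μ) = 1 := by rw [← C_mul, mul_comm, hμ, C_1]
  refine S_congr (Or.inr (by simp)) (Or.inr (by simp)) (Or.inr ?_) (Or.inr ?_)
  · simp only [map_mul, S_C, S_z, algebraMap_eq]
    linear_combination vz * e
  · simp only [map_mul, S_C, S_t, Complex.conj_conj, algebraMap_eq]
    linear_combination vt * e

theorem ev_rot (a b : ℂ) (f : R2) : ev a b (rot μ f) = ev a (μ * b) f := by
  rw [rot, map_S, ev_def]
  exact S_congr (Or.inr (by simp)) (Or.inr (by simp)) (Or.inr (by simp)) (Or.inr (by simp))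

theorem cjp_rot (f : R2) : cjp (rot μ f) = rot μ (cjp f) := by
  rw [rot, cjp_S]
  exact S_congr (Or.inr (by simp)) (Or.inr (by simp)) (Or.inr (by simp)) (Or.inr (by simp))

theorem Hyp.rot (hyp : Hyp m N A P) (hμ : starRingEnd ℂ μ * μ = 1) :
    Hyp m N (C (starRingEnd ℂ μ) * A) (rot μ P) := by
  have hA := hyp.hA
  have e : (C (starRingEnd ℂ μ) : R2) * C μ = 1 := by rw [← C_mul, hμ, C_1]
  have hcA : cjp (C (starRingEnd ℂ μ) * A) = C μ * cjp A := by
    rw [map_mul, cjp_C, Complex.conj_conj]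
  have rA : Mdl.rot μ A = A := rot_of (dz_A hA) (dt_A hA)
  have rcA : Mdl.rot μ (cjp A) = cjp A := rot_of (dz_cA hA) (dt_cA hA)
  have hL : ∀ f, Lv (C (starRingEnd ℂ μ) * A) (Mdl.rot μ f) = Mdl.rot μ (Lv A f) := fun f => by
    rw [Lv_apply, Lv_apply, map_add, map_mul, rA, dx_rot, dz_rot]
    linear_combination A * Mdl.rot μ (dz f) * e
  have hLb : ∀ f, Lb (C (starRingEnd ℂ μ) * A) (Mdl.rot μ f) = Mdl.rot μ (Lb A f) := fun f => by
    rw [Lb_apply, Lb_apply, hcA, map_add, map_mul (Mdl.rot μ), rcA, dy_rot, dt_rot]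
    linear_combination cjp A * Mdl.rot μ (dt f) * e
  have hl : ∀ b f, Mdl.rot μ (ld A b f) = ld (C (starRingEnd ℂ μ) * A) b (Mdl.rot μ f) := by
    intro b f
    cases b
    exacts [(hL f).symm, (hLb f).symm]
  have hF : fL (C (starRingEnd ℂ μ) * A) (Mdl.rot μ P) = Mdl.rot μ (fL A P) := by
    simp only [fL, map_add, map_mul, rA, rcA, hcA, dx_rot, dy_rot, dz_rot, dt_rot,
      Derivation.leibniz, derivation_C, smul_eq_mul]
    linear_combination (A * Mdl.rot μ (dz (dy P)) + cjp A * Mdl.rot μ (dx (dt P))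
      + A * cjp A * Mdl.rot μ (dz (dt P)) * (1 + C μ * C (starRingEnd ℂ μ))) * e
  have hcc : ∀ f, constantCoeff (Mdl.rot μ f) = constantCoeff f := fun f =>
    constantCoeff_S (by simp) (by simp) (by simp) (by simp) f
  refine ⟨hyp.hm, hyp.hmN, ?_, ?_, ?_, ?_, ?_⟩
  · have := H_mul (H_C (m := m) (starRingEnd ℂ μ)) hA
    rwa [zero_add] at this
  · refine H_S H_x H_y ?_ ?_ hyp.hP
    · simpa using H_mul (H_C (m := m) μ) H_z
    · simpa using H_mul (H_C (m := m) (starRingEnd ℂ μ)) H_t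
  · rw [cjp_rot, hyp.real]
  · intro a b s r
    refine (hyp.psd a (μ * b) s (μ * r)).trans_eq (congrArg Complex.re ?_)
    have k1 : dz (dy (Mdl.rot μ P)) = C μ * Mdl.rot μ (dz (dy P)) := by rw [dy_rot, dz_rot]
    have k2 : dx (dt (Mdl.rot μ P)) = C (starRingEnd ℂ μ) * Mdl.rot μ (dx (dt P)) := by
      rw [dt_rot, Derivation.leibniz, derivation_C, dx_rot]; simp
    have k3 : dz (dt (Mdl.rot μ P))
        = C (starRingEnd ℂ μ) * C μ * Mdl.rot μ (dz (dt P)) := by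
      rw [dt_rot, Derivation.leibniz, derivation_C, dz_rot]; simp [mul_assoc]
    rw [dy_rot, dx_rot, ← dy_rot, k1, k2, k3]
    simp only [map_mul, ev_rot, ev_C]
    ring
  · rcases hyp.van with hv | hv
    · left
      intro w hw
      have h1 := hv w hw
      rw [← hcc, map_dl (Mdl.rot μ) hl, ← dl_smul _ hμ] at h1
      rw [← h1]
      have e1 : -dy (C (starRingEnd ℂ μ) * A) = starRingEnd ℂ μ • Mdl.rot μ (-dy A) := by
        rw [Derivation.leibniz, derivation_C, map_neg, rot_of (dz_g hA) (dt_g hA),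
          MvPolynomial.smul_eq_C_mul]
        simp
      have e2 : cjp (dy (C (starRingEnd ℂ μ) * A)) = μ • Mdl.rot μ (cjp (dy A)) := by
        rw [Derivation.leibniz, derivation_C, ← cjp_rot, rot_of (dz_g hA) (dt_g hA),
          MvPolynomial.smul_eq_C_mul]
        simp
      have e3 : uL (C (starRingEnd ℂ μ) * A) (Mdl.rot μ P)
          = starRingEnd ℂ μ • Mdl.rot μ (uL A P) := by
        rw [uL, uL, dt_rot, Derivation.leibniz, hL, derivation_C,
          MvPolynomial.smul_eq_C_mul]
        simp
      have e4 : vL (C (starRingEnd ℂ μ) * A) (Mdl.rot μ P) = μ • Mdl.rot μ (vL A P) := by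
        rw [vL, vL, dz_rot, Derivation.leibniz, hLb, derivation_C,
          MvPolynomial.smul_eq_C_mul]
        simp
      rw [e1, e2, e3, e4, hF]
    · right
      intro w hw
      rw [hF, ← map_lw (Mdl.rot μ) hl, hcc, hv w hw]

theorem Flat.of_rot (hμ : starRingEnd ℂ μ * μ = 1) (h : Flat (rot μ P)) : Flat P := by
  have e : (C (starRingEnd ℂ μ) : R2) * C μ = 1 := by rw [← C_mul, hμ, C_1]
  have h0 : ∀ f : R2, Mdl.rot μ f = 0 → f = 0 := fun f hf => by
    rw [← rot_rot hμ f, hf, map_zero]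
  have h1 : (C μ : R2) ≠ 0 := right_ne_zero_of_mul_eq_one e
  have h2 : (C (starRingEnd ℂ μ) : R2) ≠ 0 := left_ne_zero_of_mul_eq_one e
  obtain ⟨a, b, c, d⟩ := h
  simp only [dx_rot, dy_rot, dz_rot, dt_rot, Derivation.leibniz, derivation_C, mul_zero,
    add_zero, smul_eq_mul, mul_eq_zero, h1, h2, false_or] at a b c d
  exact ⟨h0 _ a, h0 _ b, h0 _ c, h0 _ d⟩

/-- The model theorem: the weighted leading part of the defining function is pluriharmonic. -/
theorem Hyp.flat (hyp : Hyp m N A P) (h : m < N → dy A ≠ 0) : Flat P := by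
  rcases hyp.hmN.eq_or_lt with rfl | hN
  · exact hyp.flat_of_eq
  have hg := h hN
  by_cases hind : ∀ κ : ℂ, cjp (dy A) ≠ C κ * dy A
  · exact hyp.flat_of_indep hN hg hind
  push Not at hind
  obtain ⟨κ, hκ⟩ := hind
  have h1 : starRingEnd ℂ κ * κ = 1 := by
    have h2 := congrArg cjp hκ
    rw [cjp_cjp, map_mul, cjp_C, hκ, ← mul_assoc, ← C_mul] at h2
    have h3 : (C (starRingEnd ℂ κ * κ) - 1 : R2) * dy A = 0 := by linear_combination -h2
    have h4 := (mul_eq_zero.1 h3).resolve_right hg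
    rw [← C_1, ← C_sub] at h4
    exact sub_eq_zero.1 ((map_eq_zero_iff _ (C_injective _ _)).1 h4)
  obtain ⟨μ, hμ⟩ := IsAlgClosed.exists_pow_nat_eq (starRingEnd ℂ κ) (n := 2) (by norm_num)
  have hμ1 : starRingEnd ℂ μ * μ = 1 := by
    have h2 : ‖μ‖ ^ 2 = 1 := by
      rw [← norm_pow, hμ, RCLike.norm_conj]
      have : ‖κ‖ ^ 2 = 1 := by
        have := congrArg norm h1
        rw [norm_mul, RCLike.norm_conj, norm_one] at this
        rw [sq, this]
      nlinarith [norm_nonneg κ]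
    rw [Complex.conj_mul', ← Complex.ofReal_pow, h2, Complex.ofReal_one]
  refine Flat.of_rot hμ1 (Hyp.flat_of_real (hyp.rot hμ1) hN ?_ ?_)
  · rw [Derivation.leibniz, derivation_C, smul_zero, add_zero, smul_eq_mul]
    refine mul_ne_zero ?_ hg
    exact (map_ne_zero_iff _ (C_injective _ _)).2 (left_ne_zero_of_mul_eq_one hμ1)
  · rw [Derivation.leibniz, derivation_C, smul_zero, add_zero, smul_eq_mul, map_mul, cjp_C,
      Complex.conj_conj, hκ, ← mul_assoc, ← C_mul]
    congr 2
    have hκ' : κ = starRingEnd ℂ μ ^ 2 := by rw [← map_pow, hμ, Complex.conj_conj]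
    rw [hκ']
    linear_combination starRingEnd ℂ μ * hμ1

end

end Mdl

namespace SF

variable {n m : ℕ}

/-- The map `ℂᵐ → ℂⁿ` with the given smooth components. -/
def tup (c : Fin n → SF m) (x : Cn m) : Cn n := fun j => c j x

theorem tup_smooth (c : Fin n → SF m) : ContDiff ℝ (⊤ : ℕ∞) (tup c) :=
  contDiff_pi.2 fun j => (c j).smooth

/-- Pullback of smooth functions under a smooth map. -/
def pull (c : Fin n → SF m) : SF n →ₐ[ℂ] SF m where
  toFun f := mk (fun x => f (tup c x)) (f.smooth.comp (tup_smooth c))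
  map_one' := rfl
  map_mul' _ _ := rfl
  map_zero' := rfl
  map_add' _ _ := rfl
  commutes' _ := rfl

@[simp] theorem pull_apply (c : Fin n → SF m) (f : SF n) (x : Cn m) :
    pull c f x = f (tup c x) := rfl

theorem pull_conj (c : Fin n → SF m) (f : SF n) : pull c (conj f) = conj (pull c f) := rfl

@[simp] theorem pull_X_false (c : Fin n → SF m) (j : Fin n) : pull c (X (j, false)) = c j := rfl
@[simp] theorem pull_X_true (c : Fin n → SF m) (j : Fin n) :
    pull c (X (j, true)) = conj (c j) := rfl

theorem fderiv_eq (f : SF n) (x u : Cn n) :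
    fderiv ℝ f x u = ∑ j, (u j * D (j, false) f x + starRingEnd ℂ (u j) * D (j, true) f x) := by
  have h : u = ∑ j, ((u j).re • (Pi.single j (1 : ℂ) : Cn n)
      + (u j).im • (Pi.single j Complex.I : Cn n)) := by
    ext i
    rw [Finset.sum_apply, Finset.sum_eq_single i]
    · simp
    · intro b _ hb; simp [hb.symm]
    · simp
  conv_lhs => rw [h, map_sum]
  refine Finset.sum_congr rfl fun j _ => ?_
  rw [map_add, map_smul, map_smul, D_false, D_true, wz, wzb]
  set a := fderiv ℝ f x (Pi.single j 1)
  set b := fderiv ℝ f x (Pi.single j Complex.I)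
  have h1 : u j = (u j).re + (u j).im * Complex.I := (Complex.re_add_im _).symm
  have h2 : starRingEnd ℂ (u j) = (u j).re - (u j).im * Complex.I := by
    apply Complex.ext <;> simp
  simp only [Complex.real_smul]
  generalize (u j).re = r at *
  generalize (u j).im = s at *
  rw [h2, h1]
  linear_combination (s * b) * Complex.I_sq

/-- The Wirtinger chain rule. -/
theorem D_pull (c : Fin n → SF m) (i : Fin m × Bool) (f : SF n) :
    D i (pull c f) = ∑ j, pull c (D j f) * D i (pull c (X j)) := by
  have key : ∀ v x, dir v (pull c f) x = ∑ j, (pull c (D j f) * dir v (pull c (X j))) x := by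
    intro v x
    have h1 : fderiv ℝ (fun y => f (tup c y)) x = (fderiv ℝ f (tup c x)).comp
        (fderiv ℝ (tup c) x) :=
      fderiv_comp x (f.diffAt _) (((tup_smooth c).differentiable (by simp)) x)
    have h2 : ∀ j, fderiv ℝ (tup c) x v j = fderiv ℝ (c j) x v := by
      intro j
      have : fderiv ℝ (tup c) x = ContinuousLinearMap.pi fun j => fderiv ℝ (c j) x :=
        fderiv_pi fun j => (c j).diffAt x
      rw [this]; rfl
    change fderiv ℝ (fun y => f (tup c y)) x v = _
    rw [h1, ContinuousLinearMap.comp_apply, fderiv_eq, Fintype.sum_prod_type]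
    refine Finset.sum_congr rfl fun j _ => ?_
    rw [Fintype.sum_bool, pull_X_false, pull_X_true, dir_conj]
    simp [h2]
    ring
  ext x
  rw [D_eq]
  simp only [smul_apply, add_apply, key, sum_apply, mul_apply, D_eq i]
  rw [Finset.mul_sum, ← Finset.sum_add_distrib, Finset.mul_sum]
  refine Finset.sum_congr rfl fun j _ => ?_
  ring

theorem O.pull {w : Fin n → ℕ} {w' : Fin m → ℕ} (hw : ∀ j, 0 < w j) {c : Fin n → SF m}
    (hc : ∀ j, O w' (w j) (c j)) {s : ℤ} {f : SF n} (hf : O w s f) : O w' s (pull c f) := by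
  obtain ⟨N, hN⟩ : ∃ N : ℕ, s ≤ N := ⟨s.toNat, by omega⟩
  induction N generalizing s f with
  | zero => exact O_of_nonpos (by simpa using hN) _
  | succ N ih =>
    rw [O_iff]
    constructor
    · intro hs
      have h0 : tup c 0 = 0 := by
        ext j
        exact (hc j).apply_zero (by exact_mod_cast hw j)
      rw [pull_apply, h0]
      exact hf.apply_zero hs
    · intro i
      rw [D_pull]
      refine O_sum fun j _ => ?_
      have hj := hw j.1
      have h1 := ih (hf.D j) (by push_cast at hN; omega)
      have h2 : O w' (w j.1) (SF.pull c (X j)) := by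
        obtain ⟨j, b⟩ := j
        cases b
        · exact hc j
        · exact (hc j).conj
      have := h1.mul (h2.D i)
      exact this.mono (by omega)

theorem O.of_mul {w : Fin n → ℕ} (hw : ∀ j, 0 < w j) {g : SF n} (hg : g 0 ≠ 0) {s : ℤ} {f : SF n}
    (hf : O w s (g * f)) : O w s f := by
  obtain ⟨N, hN⟩ : ∃ N : ℕ, s ≤ N := ⟨s.toNat, by omega⟩
  induction N generalizing s f with
  | zero => exact O_of_nonpos (by simpa using hN) _
  | succ N ih =>
    rw [O_iff]
    constructor
    · intro hs
      exact (mul_eq_zero.1 (hf.apply_zero hs)).resolve_left hg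
    · intro i
      have hi := hw i.1
      push_cast at hN
      have h1 : O w (s - 1) f := ih (hf.mono (by omega)) (by omega)
      refine ih ?_ (by omega)
      have h2 : g * SF.D i f = SF.D i (g * f) - SF.D i g * f := by
        rw [Derivation.leibniz]; simp [mul_comm]
      rw [h2]
      exact (hf.D i).sub ((h1.mul_left _).mono (by omega))

/-- The anisotropic dilation with weights `w`. -/
def dil (w : Fin n → ℕ) (ε : ℝ) (y : Cn n) : Cn n := fun j => (ε : ℂ) ^ w j * y j

theorem O.bound {w : Fin n → ℕ} (hw : ∀ j, 0 < w j) (R : ℝ) {s : ℤ} {f : SF n} (hf : O w s f) :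
    ∃ C : ℝ, 0 ≤ C ∧ ∀ ε : ℝ, 0 < ε → ε ≤ 1 → ∀ y : Cn n, ‖y‖ ≤ R →
      ‖f (dil w ε y)‖ ≤ C * ε ^ s := by
  obtain ⟨N, hN⟩ : ∃ N : ℕ, s ≤ N := ⟨s.toNat, by omega⟩
  have hdil : ∀ ε : ℝ, 0 < ε → ε ≤ 1 → ∀ y : Cn n, ‖y‖ ≤ R → ‖dil w ε y‖ ≤ R := by
    intro ε h0 h1 y hy
    refine (pi_norm_le_iff_of_nonneg ((norm_nonneg y).trans hy)).2 fun j => ?_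
    rw [dil, norm_mul, norm_pow, Complex.norm_real, Real.norm_of_nonneg h0.le]
    calc _ ≤ 1 * ‖y j‖ := by gcongr; exact pow_le_one₀ h0.le h1
      _ ≤ R := by rw [one_mul]; exact (norm_le_pi_norm y j).trans hy
  induction N generalizing s f with
  | zero =>
    obtain ⟨C, hC⟩ := (isCompact_closedBall (0 : Cn n) R).exists_bound_of_continuousOn
      f.smooth.continuous.continuousOn
    refine ⟨max C 0, le_max_right _ _, fun ε h0 h1 y hy => ?_⟩
    refine (hC _ (by simpa using hdil ε h0 h1 y hy)).trans ?_
    have : 1 ≤ ε ^ s := one_le_zpow_of_nonpos₀ h0 h1 (by simpa using hN)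
    nlinarith [le_max_left C 0, le_max_right C 0]
  | succ N ih =>
    by_cases hs : s ≤ N
    · exact ih hf hs
    push_cast at hN
    have h1 : ∀ i : Fin n × Bool, ∃ C : ℝ, 0 ≤ C ∧ ∀ ε : ℝ, 0 < ε → ε ≤ 1 → ∀ y : Cn n, ‖y‖ ≤ R →
      ‖SF.D i f (dil w ε y)‖ ≤ C * ε ^ (s - w i.1) := fun i =>
        ih (hf.D i) (by have := hw i.1; omega)
    choose C hC0 hC using h1
    refine ⟨∑ j, (C (j, false) + C (j, true)) * |R|,
      Finset.sum_nonneg fun j _ => mul_nonneg (add_nonneg (hC0 _) (hC0 _)) (abs_nonneg _), ?_⟩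
    intro ε h0 h1 y hy
    set p := dil w ε y with hp
    have hg : ∀ t : ℝ, HasDerivAt (fun t : ℝ => f (t • p)) (fderiv ℝ f (t • p) p) t := by
      intro t
      have h2 : HasDerivAt (fun t : ℝ => t • p) ((1 : ℝ) • p) t := (hasDerivAt_id t).smul_const p
      rw [one_smul] at h2
      exact (f.diffAt (t • p)).hasFDerivAt.comp_hasDerivAt t h2
    have hb : ∀ t ∈ Set.Ico (0 : ℝ) 1, ‖fderiv ℝ f (t • p) p‖
        ≤ (∑ j, (C (j, false) + C (j, true)) * |R|) * ε ^ s := by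
      intro t ht
      have e1 : t • p = dil w ε (t • y) := by
        ext j; simp [hp, dil]; ring
      have e2 : ‖t • y‖ ≤ R := by
        rw [norm_smul, Real.norm_of_nonneg ht.1]
        nlinarith [norm_nonneg y, ht.2]
      rw [fderiv_eq, Finset.sum_mul]
      refine (norm_sum_le _ _).trans (Finset.sum_le_sum fun j _ => ?_)
      have e3 : ‖p j‖ ≤ ε ^ w j * |R| := by
        rw [hp, dil, norm_mul, norm_pow, Complex.norm_real, Real.norm_of_nonneg h0.le]
        gcongr
        exact ((norm_le_pi_norm y j).trans hy).trans (le_abs_self R)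
      have e4 : ∀ b, ‖SF.D (j, b) f (t • p)‖ ≤ C (j, b) * ε ^ (s - w j) := fun b => by
        rw [e1]; exact hC (j, b) ε h0 h1 _ e2
      have e5 : ε ^ s = ε ^ (s - w j) * ε ^ w j := by
        rw [← zpow_natCast, ← zpow_add₀ h0.ne']; congr 1; ring
      calc _ ≤ ‖p j‖ * ‖SF.D (j, false) f (t • p)‖ + ‖p j‖ * ‖SF.D (j, true) f (t • p)‖ := by
            refine (norm_add_le _ _).trans_eq ?_
            rw [norm_mul, norm_mul, RCLike.norm_conj]
        _ ≤ (ε ^ w j * |R|) * (C (j, false) * ε ^ (s - w j))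
            + (ε ^ w j * |R|) * (C (j, true) * ε ^ (s - w j)) := by
            gcongr <;> exact e4 _
        _ = _ := by rw [e5]; ring
    have := norm_image_sub_le_of_norm_deriv_le_segment_01' (fun t _ => (hg t).hasDerivWithinAt) hb
    simp only [one_smul, zero_smul] at this
    rwa [hf.apply_zero (by omega), sub_zero] at this

/-- Vanishing of all derivatives at the origin of order less than `k`. -/
def Van (k : ℕ) (f : SF n) : Prop := ∀ i < k, iteratedFDeriv ℝ i f 0 = 0

theorem iteratedFDeriv_dir (f : SF n) (i : ℕ) (x v : Cn n) (u : Fin i → Cn n) :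
    iteratedFDeriv ℝ i (dir v f) x u = iteratedFDeriv ℝ (i + 1) f x (Fin.snoc u v) := by
  rw [iteratedFDeriv_succ_apply_right, Fin.init_snoc, Fin.snoc_last]
  have h1 : (dir v f : Cn n → ℂ) = (ContinuousLinearMap.apply ℝ ℂ v) ∘ fderiv ℝ f := rfl
  have h2 : ContDiff ℝ (⊤ : ℕ∞) (fderiv ℝ (f : Cn n → ℂ)) := f.smooth.fderiv_right (by simp)
  rw [h1, ContinuousLinearMap.iteratedFDeriv_comp_left _ h2.contDiffAt
    (by exact_mod_cast le_top)]
  rfl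

theorem Van_succ {k : ℕ} {f : SF n} : Van (k + 1) f ↔ f 0 = 0 ∧ ∀ v, Van k (dir v f) := by
  constructor
  · intro h
    refine ⟨?_, fun v i hi => ?_⟩
    · have := congrArg (fun T => T 0) (h 0 (by omega))
      simpa using this
    · ext u
      rw [iteratedFDeriv_dir, h _ (by omega)]; rfl
  · rintro ⟨h0, h⟩ i hi
    cases i with
    | zero => ext u; simpa using h0
    | succ i =>
      ext u
      have := congrArg (fun T => T (Fin.init u)) (h (u (Fin.last i)) i (by omega))
      rw [iteratedFDeriv_dir, Fin.snoc_init_self] at this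
      exact this

theorem O_one_iff {k : ℕ} {f : SF n} : O (fun _ => 1) k f ↔ Van k f := by
  induction k generalizing f with
  | zero => exact ⟨fun _ i hi => by omega, fun _ => O_of_nonpos (by simp) _⟩
  | succ k ih =>
    rw [Van_succ, O_iff]
    have e : ((k + 1 : ℕ) : ℤ) - ((1 : ℕ) : ℤ) = k := by push_cast; ring
    simp only [e]
    constructor
    · rintro ⟨h1, h2⟩
      refine ⟨h1 (by omega), fun v => ?_⟩
      have h3 : dir v f = ∑ j, (v j • D (j, false) f + starRingEnd ℂ (v j) • D (j, true) f) := by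
        ext x
        rw [dir_apply, fderiv_eq]; simp
      rw [← ih, h3]
      exact O_sum fun j _ => ((h2 _).smul _).add ((h2 _).smul _)
    · rintro ⟨h1, h2⟩
      refine ⟨fun _ => h1, fun i => ?_⟩
      rw [D_eq]
      exact ((ih.2 (h2 _)).add ((ih.2 (h2 _)).smul _)).smul _

end SF

namespace SF

variable {n : ℕ}

/-- First-order operators, determined by their values on the coordinate functions. -/
def IsField (V : Derivation ℂ (SF n) (SF n)) : Prop := ∀ f, V f = ∑ i, V (X i) * D i f

theorem IsField.lie {V W : Derivation ℂ (SF n) (SF n)} (hV : IsField V) (hW : IsField W) :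
    IsField ⁅V, W⁆ := by
  intro f
  have h1 : ∑ i, W (X i) * V (D i f) = ∑ i, V (X i) * W (D i f) := by
    have e : ∀ i, W (X i) * V (D i f) = ∑ j, W (X i) * (V (X j) * D j (D i f)) := fun i => by
      rw [hV, Finset.mul_sum]
    have e' : ∀ i, V (X i) * W (D i f) = ∑ j, V (X i) * (W (X j) * D j (D i f)) := fun i => by
      rw [hW, Finset.mul_sum]
    simp only [e, e']
    rw [Finset.sum_comm]
    refine Finset.sum_congr rfl fun j _ => Finset.sum_congr rfl fun i _ => ?_
    rw [D_comm]; ring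
  simp only [Derivation.commutator_apply]
  rw [hW f, hV f, map_sum, map_sum]
  simp only [Derivation.leibniz, smul_eq_mul, Finset.sum_add_distrib, sub_mul,
    Finset.sum_sub_distrib, mul_comm (D _ f)]
  linear_combination h1

theorem IsField.ext {V W : Derivation ℂ (SF n) (SF n)} (hV : IsField V) (hW : IsField W)
    (h : ∀ i, V (X i) = W (X i)) : V = W := by
  ext1 f
  rw [hV, hW]
  simp only [h]

/-- The field `L = Σ α_j ∂/∂z_j` (for `false`) and its conjugate (for `true`). -/
noncomputable def fld (α : Fin n → SF n) : Bool → Derivation ℂ (SF n) (SF n)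
  | false => ∑ j, α j • D (j, false)
  | true => ∑ j, conj (α j) • D (j, true)

theorem derivation_sum_apply {ι : Type*} (t : Finset ι) (F : ι → Derivation ℂ (SF n) (SF n))
    (f : SF n) : (∑ j ∈ t, F j) f = ∑ j ∈ t, F j f := by
  have := map_sum (Derivation.coeFnAddMonoidHom (R := ℂ) (A := SF n) (M := SF n)) F t
  rw [Derivation.coeFnAddMonoidHom_apply] at this
  exact (congrFun this f).trans (Finset.sum_apply _ _ _)

theorem fld_false (α : Fin n → SF n) (f : SF n) :
    fld α false f = ∑ j, α j * D (j, false) f := by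
  simp [fld, derivation_sum_apply]

theorem fld_true (α : Fin n → SF n) (f : SF n) :
    fld α true f = ∑ j, conj (α j) * D (j, true) f := by
  simp [fld, derivation_sum_apply]

@[simp] theorem fld_ff (α : Fin n → SF n) (j : Fin n) : fld α false (X (j, false)) = α j := by
  simp [fld_false, D_X]

@[simp] theorem fld_ft (α : Fin n → SF n) (j : Fin n) : fld α false (X (j, true)) = 0 := by
  simp [fld_false, D_X]

@[simp] theorem fld_tf (α : Fin n → SF n) (j : Fin n) : fld α true (X (j, false)) = 0 := by
  simp [fld_true, D_X]

@[simp] theorem fld_tt (α : Fin n → SF n) (j : Fin n) :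
    fld α true (X (j, true)) = conj (α j) := by
  simp [fld_true, D_X]

theorem conj_fld (α : Fin n → SF n) (b : Bool) (f : SF n) :
    conj (fld α b f) = fld α (!b) (conj f) := by
  cases b <;> simp [fld_false, fld_true, conj_D]

theorem isField_fld (α : Fin n → SF n) (b : Bool) : IsField (fld α b) := by
  intro f
  rw [Fintype.sum_prod_type]
  cases b
  · simp [fld_false α f]
  · simp [fld_true α f]

/-- Iterated commutators of `L` and its conjugate. -/
noncomputable def Zw (α : Fin n → SF n) : List Bool → Derivation ℂ (SF n) (SF n)
  | [] => ⁅fld α false, fld α true⁆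
  | b :: w => ⁅fld α b, Zw α w⁆

theorem isField_Zw (α : Fin n → SF n) (w : List Bool) : IsField (Zw α w) := by
  induction w with
  | nil => exact (isField_fld α _).lie (isField_fld α _)
  | cons b w ih => exact (isField_fld α _).lie ih

/-- The pairing of a field with `∂ρ`. -/
noncomputable def pair (ρ : SF n) (V : Derivation ℂ (SF n) (SF n)) : SF n :=
  ∑ j, V (X (j, false)) * D (j, false) ρ

variable {ρ : SF n} {α : Fin n → SF n}

theorem pair_lie_false (h : fld α false ρ = 0) {W : Derivation ℂ (SF n) (SF n)}
    (hW : IsField W) : pair ρ ⁅fld α false, W⁆ = fld α false (pair ρ W)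
      + ∑ j, ∑ k, D (j, false) (D (k, true) ρ) * (α j * W (X (k, true))) := by
  have h0 : W (fld α false ρ) = 0 := by rw [h, map_zero]
  rw [fld_false, map_sum] at h0
  simp only [Derivation.leibniz, smul_eq_mul, Finset.sum_add_distrib] at h0
  have h1 : ∀ j, W (D (j, false) ρ) = ∑ k, W (X (k, false)) * D (k, false) (D (j, false) ρ)
      + ∑ k, W (X (k, true)) * D (j, false) (D (k, true) ρ) := by
    intro j
    rw [hW, Fintype.sum_prod_type, ← Finset.sum_add_distrib]
    refine Finset.sum_congr rfl fun k _ => ?_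
    rw [Fintype.sum_bool, D_comm (k, true)]; ring
  have h2 : ∑ j, W (X (j, false)) * fld α false (D (j, false) ρ)
      = ∑ j, α j * ∑ k, W (X (k, false)) * D (k, false) (D (j, false) ρ) := by
    simp only [fld_false, Finset.mul_sum]
    rw [Finset.sum_comm]
    refine Finset.sum_congr rfl fun j _ => Finset.sum_congr rfl fun k _ => ?_
    rw [D_comm]; ring
  have h3 : ∑ j, ∑ k, D (j, false) (D (k, true) ρ) * (α j * W (X (k, true)))
      = ∑ j, α j * ∑ k, W (X (k, true)) * D (j, false) (D (k, true) ρ) := by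
    simp only [Finset.mul_sum]
    refine Finset.sum_congr rfl fun j _ => Finset.sum_congr rfl fun k _ => ?_
    ring
  simp only [h1, mul_add, Finset.sum_add_distrib] at h0
  simp only [pair, Derivation.commutator_apply, map_sum, Derivation.leibniz, smul_eq_mul,
    Finset.sum_add_distrib, sub_mul, Finset.sum_sub_distrib, fld_ff]
  rw [h2, h3]
  have h4 : ∑ j, D (j, false) ρ * W (α j) = ∑ j, W (α j) * D (j, false) ρ :=
    Finset.sum_congr rfl fun j _ => mul_comm _ _
  have h5 : ∑ j, D (j, false) ρ * fld α false (W (X (j, false)))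
      = ∑ j, fld α false (W (X (j, false))) * D (j, false) ρ :=
    Finset.sum_congr rfl fun j _ => mul_comm _ _
  rw [h5]
  linear_combination -h0 + h4

theorem pair_lie_true (W : Derivation ℂ (SF n) (SF n)) :
    pair ρ ⁅fld α true, W⁆ = fld α true (pair ρ W)
      - ∑ j, ∑ k, D (j, false) (D (k, true) ρ) * (W (X (j, false)) * conj (α k)) := by
  have h2 : ∑ j, W (X (j, false)) * fld α true (D (j, false) ρ)
      = ∑ j, ∑ k, D (j, false) (D (k, true) ρ) * (W (X (j, false)) * conj (α k)) := by
    simp only [fld_true, Finset.mul_sum]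
    refine Finset.sum_congr rfl fun j _ => Finset.sum_congr rfl fun k _ => ?_
    rw [D_comm]; ring
  simp only [pair, Derivation.commutator_apply, map_sum, Derivation.leibniz, smul_eq_mul,
    Finset.sum_add_distrib, fld_tf, map_zero, sub_zero]
  rw [h2]
  have h5 : ∑ j, D (j, false) ρ * fld α true (W (X (j, false)))
      = ∑ j, fld α true (W (X (j, false))) * D (j, false) ρ :=
    Finset.sum_congr rfl fun j _ => mul_comm _ _
  rw [h5]
  ring

theorem pair_Zw_nil (h : fld α false ρ = 0) : pair ρ (Zw α [])
    = ∑ j, ∑ k, D (j, false) (D (k, true) ρ) * (α j * conj (α k)) := by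
  have h0 : pair ρ (fld α true) = 0 := by simp [pair]
  rw [Zw, pair_lie_false h (isField_fld α _), h0]
  simp

/-- A global biholomorphic change of coordinates with smooth components. -/
structure BiHol (n : ℕ) where
  c : Fin n → SF n
  d : Fin n → SF n
  hc : ∀ i j, D (i, true) (c j) = 0
  hd : ∀ i j, D (i, true) (d j) = 0
  cd : ∀ j, pull c (d j) = X (j, false)
  dc : ∀ j, pull d (c j) = X (j, false)

namespace BiHol

variable (σ : BiHol n)

theorem tup_d_c (x : Cn n) : tup σ.d (tup σ.c x) = x := by
  ext j
  exact congrArg (fun f : SF n => f x) (σ.cd j)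

theorem tup_c_d (x : Cn n) : tup σ.c (tup σ.d x) = x := by
  ext j
  exact congrArg (fun f : SF n => f x) (σ.dc j)

theorem pull_c_d (f : SF n) : pull σ.c (pull σ.d f) = f := by
  ext x; simp [tup_d_c]

theorem pull_d_c (f : SF n) : pull σ.d (pull σ.c f) = f := by
  ext x; simp [tup_c_d]

/-- Transport of a derivation. -/
noncomputable def trans (V : Derivation ℂ (SF n) (SF n)) : Derivation ℂ (SF n) (SF n) :=
  Derivation.mk' ((pull σ.c).toLinearMap ∘ₗ V.toLinearMap ∘ₗ (pull σ.d).toLinearMap)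
    (fun f g => by simp [pull_c_d])

theorem trans_apply (V : Derivation ℂ (SF n) (SF n)) (f : SF n) :
    σ.trans V f = pull σ.c (V (pull σ.d f)) := rfl

theorem trans_pull (V : Derivation ℂ (SF n) (SF n)) (f : SF n) :
    σ.trans V (pull σ.c f) = pull σ.c (V f) := by rw [trans_apply, pull_d_c]

theorem isField_trans {V : Derivation ℂ (SF n) (SF n)} (hV : IsField V) :
    IsField (σ.trans V) := by
  intro f
  simp only [trans_apply]
  have e : ∀ g, V (pull σ.d g) = ∑ j, pull σ.d (D j g) * V (pull σ.d (X j)) := fun g => by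
    rw [hV]
    have e1 : ∀ i, V (X i) * D i (pull σ.d g)
        = ∑ j, V (X i) * (pull σ.d (D j g) * D i (pull σ.d (X j))) := fun i => by
      rw [D_pull, Finset.mul_sum]
    simp only [e1]
    rw [Finset.sum_comm]
    refine Finset.sum_congr rfl fun j _ => ?_
    rw [hV (pull σ.d (X j)), Finset.mul_sum]
    refine Finset.sum_congr rfl fun i _ => ?_
    ring
  rw [e f, map_sum]
  refine Finset.sum_congr rfl fun j _ => ?_
  rw [map_mul, pull_c_d, mul_comm]

/-- The coefficients of the transported field. -/
noncomputable def coef (α : Fin n → SF n) (j : Fin n) : SF n := pull σ.c (fld α false (σ.d j))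

theorem trans_fld (b : Bool) : σ.trans (fld α b) = fld (σ.coef α) b := by
  have hD : ∀ i j, D (i, false) (conj (σ.d j)) = 0 := fun i j => by
    have := congrArg conj (σ.hd i j)
    rwa [conj_D, map_zero] at this
  refine (σ.isField_trans (isField_fld α b)).ext (isField_fld _ b) fun ⟨j, b'⟩ => ?_
  rw [trans_apply]
  cases b <;> cases b'
  · rw [fld_ff, pull_X_false]; rfl
  · rw [fld_ft, pull_X_true, fld_false]; simp [hD]
  · rw [fld_tf, pull_X_false, fld_true]; simp [σ.hd]
  · rw [fld_tt, pull_X_true, coef, ← pull_conj, conj_fld]; rfl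

theorem pull_fld (b : Bool) (f : SF n) :
    pull σ.c (fld α b f) = fld (σ.coef α) b (pull σ.c f) := by
  rw [← trans_fld, trans_pull]

theorem trans_lie (V W : Derivation ℂ (SF n) (SF n)) :
    σ.trans ⁅V, W⁆ = ⁅σ.trans V, σ.trans W⁆ := by
  ext1 f
  simp only [Derivation.commutator_apply, trans_apply, pull_d_c, map_sub]

theorem trans_Zw (w : List Bool) : σ.trans (Zw α w) = Zw (σ.coef α) w := by
  induction w with
  | nil => rw [Zw, Zw, trans_lie, trans_fld, trans_fld]
  | cons b w ih => rw [Zw, Zw, trans_lie, trans_fld, ih]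

theorem D_conj_c (i j : Fin n) : D (i, false) (conj (σ.c j)) = 0 := by
  have := congrArg conj (σ.hc i j)
  rwa [conj_D, map_zero] at this

theorem pair_trans {V : Derivation ℂ (SF n) (SF n)} (hV : IsField V) :
    pair (pull σ.c ρ) (σ.trans V) = pull σ.c (pair ρ V) := by
  have h1 : ∀ j, D (j, false) (pull σ.c ρ)
      = ∑ k, pull σ.c (D (k, false) ρ) * D (j, false) (σ.c k) := fun j => by
    rw [D_pull, Fintype.sum_prod_type]
    simp [σ.D_conj_c]
  have h2 : ∀ k, pull σ.c (V (X (k, false)))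
      = ∑ j, σ.trans V (X (j, false)) * D (j, false) (σ.c k) := fun k => by
    rw [← trans_pull, σ.isField_trans hV, Fintype.sum_prod_type]
    simp [σ.hc]
  simp only [pair, h1, map_sum, map_mul, h2, Finset.mul_sum, Finset.sum_mul]
  rw [Finset.sum_comm]
  refine Finset.sum_congr rfl fun j _ => Finset.sum_congr rfl fun k _ => ?_
  ring

end BiHol

/-- A pseudoconvex hypersurface through `p` with a tangential field, having type at least `k`
in one of the two senses. -/
structure Dat (k : ℕ) (ρ : SF n) (α : Fin n → SF n) (p : Cn n) : Prop where
  real : conj ρ = ρ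
  zero : ρ p = 0
  psc : ∀ x, ρ x = 0 → ∀ ξ : Fin n → ℂ, ∑ j, ξ j * D (j, false) ρ x = 0 →
    0 ≤ (∑ j, ∑ l, D (j, false) (D (l, true) ρ) x * ξ j * starRingEnd ℂ (ξ l)).re
  tan : fld α false ρ = 0
  van : (∀ w, w.length + 3 ≤ k → pair ρ (Zw α w) p = 0) ∨
    ∀ w, w.length + 3 ≤ k → lw (fld α) w (pair ρ (Zw α [])) p = 0

theorem Dat.pull {k : ℕ} {p q : Cn n} (h : Dat k ρ α p) (σ : BiHol n) (hq : tup σ.c q = p) :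
    Dat k (SF.pull σ.c ρ) (σ.coef α) q := by
  refine ⟨?_, ?_, ?_, ?_, ?_⟩
  · rw [← pull_conj, h.real]
  · rw [pull_apply, hq, h.zero]
  · intro x hx ξ hξ
    have h1 : ∀ j, D (j, false) (SF.pull σ.c ρ)
        = ∑ k, SF.pull σ.c (D (k, false) ρ) * D (j, false) (σ.c k) := fun j => by
      rw [D_pull, Fintype.sum_prod_type]
      simp [σ.D_conj_c]
    have h2 : ∀ l, D (l, true) (SF.pull σ.c ρ)
        = ∑ b, SF.pull σ.c (D (b, true) ρ) * conj (D (l, false) (σ.c b)) := fun j => by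
      rw [D_pull, Fintype.sum_prod_type]
      simp [σ.hc, conj_D]
    have h3 : ∀ j l, D (j, false) (D (l, true) (SF.pull σ.c ρ))
        = ∑ b, ∑ a, SF.pull σ.c (D (a, false) (D (b, true) ρ)) * D (j, false) (σ.c a)
          * conj (D (l, false) (σ.c b)) := fun j l => by
      rw [h2, map_sum]
      refine Finset.sum_congr rfl fun b _ => ?_
      have e : D (j, false) (conj (D (l, false) (σ.c b))) = 0 := by
        rw [conj_D, bar_mk, D_comm, Bool.not_false, σ.D_conj_c, map_zero]
      rw [Derivation.leibniz, e, D_pull, Fintype.sum_prod_type]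
      simp [σ.D_conj_c, Finset.mul_sum]
      refine Finset.sum_congr rfl fun a _ => ?_
      ring
    have key := h.psc (tup σ.c x) hx (fun a => ∑ j, ξ j * D (j, false) (σ.c a) x) ?_
    · convert key using 2
      simp only [h3, sum_apply, mul_apply, pull_apply, conj_apply, map_sum, map_mul,
        Finset.mul_sum, Finset.sum_mul]
      have comm4 : ∀ F : Fin n → Fin n → Fin n → Fin n → ℂ,
          ∑ j, ∑ l, ∑ b, ∑ a, F j l b a = ∑ a, ∑ b, ∑ l, ∑ j, F j l b a := fun F => by
        simp only [← Fintype.sum_prod_type']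
        exact Fintype.sum_equiv
          ⟨fun t => (t.2.2.2, t.2.2.1, t.2.1, t.1), fun t => (t.2.2.2, t.2.2.1, t.2.1, t.1),
            fun _ => rfl, fun _ => rfl⟩ _ _ fun _ => rfl
      rw [comm4]
      refine Finset.sum_congr rfl fun a _ => Finset.sum_congr rfl fun b _ =>
        Finset.sum_congr rfl fun l _ => Finset.sum_congr rfl fun j _ => ?_
      ring
    · rw [← hξ]
      simp only [h1, sum_apply, mul_apply, pull_apply, Finset.mul_sum, Finset.sum_mul]
      rw [Finset.sum_comm]
      refine Finset.sum_congr rfl fun j _ => Finset.sum_congr rfl fun k _ => ?_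
      ring
  · rw [← σ.pull_fld, h.tan, map_zero]
  · have e : ∀ w, pair (SF.pull σ.c ρ) (Zw (σ.coef α) w) q = pair ρ (Zw α w) p := fun w => by
      rw [← σ.trans_Zw, σ.pair_trans (isField_Zw α w), pull_apply, hq]
    rcases h.van with hv | hv
    · exact Or.inl fun w hw => by rw [e, hv w hw]
    · refine Or.inr fun w hw => ?_
      rw [← σ.trans_Zw, σ.pair_trans (isField_Zw α _), ← map_lw (SF.pull σ.c) (fun b f =>
        σ.pull_fld b f), pull_apply, hq, hv w hw]

end SF

namespace Mdl

open MvPolynomial SF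

/-- The weights of the coordinates of `ℂ³`. -/
def W (m N : ℕ) : Fin 3 → ℕ := ![1, m, N]

@[simp] theorem W_zero (m N : ℕ) : W m N 0 = 1 := rfl
@[simp] theorem W_one (m N : ℕ) : W m N 1 = m := rfl
@[simp] theorem W_two (m N : ℕ) : W m N 2 = N := rfl

theorem W_pos {m N : ℕ} (hm : 0 < m) (hN : 0 < N) (i : Fin 3) : 0 < W m N i := by
  fin_cases i
  · exact one_pos
  · exact hm
  · exact hN

/-- The inclusion of the first two coordinates. -/
def emb (i : Fin 2 × Bool) : Fin 3 × Bool := (i.1.castSucc, i.2)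

theorem emb_injective : Function.Injective emb := by
  rintro ⟨i, b⟩ ⟨j, c⟩ h
  simpa [emb] using h

/-- Polynomials in the first two coordinates. -/
noncomputable def up : R2 →ₐ[ℂ] MvPolynomial (Fin 3 × Bool) ℂ := rename emb

theorem up_X (i : Fin 2 × Bool) : up (MvPolynomial.X i) = MvPolynomial.X (emb i) := rename_X _ _

theorem cjp_up (q : R2) : cjp (up q) = up (cjp q) := by
  induction q using MvPolynomial.induction_on with
  | C c => simp [up, cjp]
  | add p q hp hq => simp [hp, hq]
  | mul_X p j hp =>
    rw [map_mul, map_mul, hp, up_X, map_mul, map_mul, cjp_X, up_X]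
    simp [cjp, emb, bar]

theorem pderiv_up (i : Fin 2 × Bool) (q : R2) : pderiv (emb i) (up q) = up (pderiv i q) :=
  pderiv_rename emb_injective _ _

theorem hat_up_apply (q : R2) (x : Cn 3) : hat (up q) x = ev (x 0) (x 1) q := by
  induction q using MvPolynomial.induction_on with
  | C c => simp [up]
  | add p q hp hq => simp [hp, hq]
  | mul_X p j hp =>
    rw [map_mul, map_mul, mul_apply, hp, map_mul, up_X, hat_X]
    congr 1
    obtain ⟨j, b⟩ := j
    fin_cases j <;> cases b <;> simp [emb]

variable {m N : ℕ}

theorem WH_up {q : R2} {s : ℤ} (h : q ∈ H m s) : WH (W m N) (up q) s := by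
  have e : up q = aeval (fun i => MvPolynomial.X (emb i)) q :=
    congrFun (congrArg DFunLike.coe (MvPolynomial.algHom_ext (fun i => by
      rw [up_X, aeval_X]) : up = aeval (R := ℂ) fun i => MvPolynomial.X (emb i))) q
  rw [e]
  refine isWeightedHomogeneous_aeval (w := fun i : Fin 2 × Bool => (wm m i.1 : ℤ))
    (w' := fun i : Fin 3 × Bool => (W m N i.1 : ℤ))
    (b := fun i => MvPolynomial.X (emb i)) (fun i => ?_) (mem_H.1 h)
  obtain ⟨i, b⟩ := i
  fin_cases i
  · exact isWeightedHomogeneous_X ℂ (fun i : Fin 3 × Bool => (W m N i.1 : ℤ)) (0, b)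
  · exact isWeightedHomogeneous_X ℂ (fun i : Fin 3 × Bool => (W m N i.1 : ℤ)) (1, b)

theorem exists_up {p : MvPolynomial (Fin 3 × Bool) ℂ} {s : ℤ} (h : WH (W m N) p s)
    (hp : ∀ b, pderiv (2, b) p = 0) : ∃ q ∈ H m s, p = up q := by
  classical
  have hv : ∀ b, (2, b) ∉ p.vars := by
    intro b hb
    obtain ⟨d, hd, hd'⟩ := mem_vars_iff_mem_support _ |>.1 hb
    have hd2 : d (2, b) ≠ 0 := Finsupp.mem_support_iff.1 hd'
    have h1 := coeff_pderiv (i := (2, b)) p (d - Finsupp.single (2, b) 1)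
    rw [hp, coeff_zero, tsub_add_cancel_of_le (by
      rw [Finsupp.single_le_iff]; omega)] at h1
    rcases mul_eq_zero.1 h1.symm with h2 | h2
    · exact mem_support_iff.1 hd h2
    · norm_cast at h2
  obtain ⟨q, hq⟩ := exists_rename_eq_of_vars_subset_range p emb emb_injective (by
    rintro ⟨i, b⟩ hi
    fin_cases i
    · exact ⟨(0, b), rfl⟩
    · exact ⟨(1, b), rfl⟩
    · exact absurd hi (hv b))
  refine ⟨q, ?_, hq.symm⟩
  let pv : Fin 3 × Bool → R2 := fun i => ![MvPolynomial.X (0, i.2), MvPolynomial.X (1, i.2), 0] i.1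
  have e : aeval pv p = q := by
    rw [← hq, aeval_rename]
    have : pv ∘ emb = MvPolynomial.X := by
      funext ⟨i, b⟩
      fin_cases i <;> rfl
    rw [this]; simp
  rw [← e]
  refine isWeightedHomogeneous_aeval (fun i => ?_) h
  obtain ⟨i, b⟩ := i
  fin_cases i
  · exact isWeightedHomogeneous_X ℂ _ ((0, b) : Fin 2 × Bool)
  · exact isWeightedHomogeneous_X ℂ _ ((1, b) : Fin 2 × Bool)
  · exact isWeightedHomogeneous_zero ℂ _ _

/-- A hypersurface with a tangential field in weighted normal form. -/
structure St (k m N : ℕ) (ρ : SF 3) (α : Fin 3 → SF 3) (A : R2) : Prop where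
  dat : Dat k ρ α 0
  hm : 2 ≤ m
  hmN : m ≤ N
  a0 : α 0 0 = 1
  d2 : D (2, false) ρ 0 = 1
  r : O (W m N) N (ρ - SF.X (2, false) - SF.X (2, true))
  hA : A ∈ H m (m - 1)
  a1 : O (W m N) m (α 1 - hat (up A))

/-- The leading part in the first two coordinates. -/
abbrev Ld (m N : ℕ) (s : ℤ) (f : SF 3) (q : R2) : Prop := Lead (W m N) s f (up q)

theorem Ld.D {s : ℤ} {f : SF 3} {q : R2} (h : Ld m N s f q) (i : Fin 2 × Bool) :
    Ld m N (s - W m N (emb i).1) (D (emb i) f) (pderiv i q) := by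
  rw [Ld, ← pderiv_up]; exact Lead.D h _

theorem Ld.mul {s t : ℤ} {f g : SF 3} {p q : R2} (h : Ld m N s f p) (h' : Ld m N t g q) :
    Ld m N (s + t) (f * g) (p * q) := by
  rw [Ld, map_mul]; exact Lead.mul h h'

theorem Ld.add {s : ℤ} {f g : SF 3} {p q : R2} (h : Ld m N s f p) (h' : Ld m N s g q) :
    Ld m N s (f + g) (p + q) := by
  rw [Ld, map_add]; exact Lead.add h h'

theorem Ld.sub {s : ℤ} {f g : SF 3} {p q : R2} (h : Ld m N s f p) (h' : Ld m N s g q) :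
    Ld m N s (f - g) (p - q) := by
  rw [Ld, map_sub]; exact Lead.sub h h'

theorem Ld.conj {s : ℤ} {f : SF 3} {q : R2} (h : Ld m N s f q) :
    Ld m N s (conj f) (cjp q) := by
  rw [Ld, ← cjp_up]; exact Lead.conj h

theorem Ld.add_O {s : ℤ} {f g : SF 3} {q : R2} (h : Ld m N s f q)
    (hg : O (W m N) (s + 1) g) : Ld m N s (f + g) q := by
  have := Lead.add h (Lead_zero_iff.2 hg)
  rwa [add_zero] at this

theorem Ld.sub_O {s : ℤ} {f g : SF 3} {q : R2} (h : Ld m N s f q)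
    (hg : O (W m N) (s + 1) g) : Ld m N s (f - g) q := by
  rw [sub_eq_add_neg]; exact h.add_O hg.neg

theorem Ld_zero {s : ℤ} {f : SF 3} (h : O (W m N) (s + 1) f) : Ld m N s f 0 := by
  rw [Ld, map_zero]; exact Lead_zero_iff.2 h

/-- Fields lowering the weight by at most `a`. -/
def FO (m N : ℕ) (a : ℤ) (V : Derivation ℂ (SF 3) (SF 3)) : Prop :=
  IsField V ∧ ∀ i, O (W m N) (W m N i.1 - a) (V (SF.X i))

theorem FO.apply {a s : ℤ} {V : Derivation ℂ (SF 3) (SF 3)} (h : FO m N a V) {f : SF 3}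
    (hf : O (W m N) s f) : O (W m N) (s - a) (V f) := by
  rw [h.1]
  exact O_sum fun i _ => ((h.2 i).mul (hf.D i)).mono (by omega)

theorem FO.lie {a b : ℤ} {V V' : Derivation ℂ (SF 3) (SF 3)} (h : FO m N a V)
    (h' : FO m N b V') : FO m N (a + b) ⁅V, V'⁆ := by
  refine ⟨h.1.lie h'.1, fun i => ?_⟩
  rw [Derivation.commutator_apply]
  exact ((h.apply (h'.2 i)).mono (by omega)).sub ((h'.apply (h.2 i)).mono (by omega))

theorem D_D_normal (ρ : SF 3) (i j : Fin 3 × Bool) :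
    D i (D j ρ) = D i (D j (ρ - SF.X (2, false) - SF.X (2, true))) := by
  simp only [map_sub, D_X]
  split_ifs <;> simp

theorem D_normal (ρ : SF 3) {i : Fin 3 × Bool} (hi : i.1 ≠ 2) :
    D i ρ = D i (ρ - SF.X (2, false) - SF.X (2, true)) := by
  obtain ⟨i, b⟩ := i
  have h1 : ∀ c, ((i, b) : Fin 3 × Bool) ≠ (2, c) := fun c hc => hi (congrArg Prod.fst hc)
  simp [D_X, h1]

namespace St

variable {k : ℕ} {ρ : SF 3} {α : Fin 3 → SF 3} {A P : R2} (h : St k m N ρ α A)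
include h

theorem posW (i : Fin 3) : 0 < W m N i := W_pos (by have := h.hm; omega)
  (by have := h.hm; have := h.hmN; omega) i

theorem lead_a1 : Ld m N (m - 1) (α 1) A :=
  ⟨WH_up h.hA, by simpa using h.a1⟩

theorem lead_a0 : Ld m N 0 (α 0) 1 := by
  have := Lead_weight_zero h.posW (α 0)
  rw [h.a0] at this
  simpa [Ld] using this

theorem O_a2 : O (W m N) (N - 1) (α 2) := by
  refine O.of_mul h.posW (g := D (2, false) ρ) (by rw [h.d2]; exact one_ne_zero) ?_
  have h1 := h.dat.tan
  rw [fld_false, Fin.sum_univ_three] at h1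
  have h2 : D (2, false) ρ * α 2 = -(α 0 * D (0, false) ρ) - α 1 * D (1, false) ρ := by
    linear_combination h1
  rw [h2, D_normal ρ (by decide), D_normal ρ (by decide)]
  refine O.sub ?_ ?_
  · exact ((h.r.D (0, false)).mul_left _).neg
  · exact (h.lead_a1.O.mul (h.r.D (1, false))).mono (by simp)

theorem FO_fld (b : Bool) : FO m N 1 (fld α b) := by
  have key : ∀ j, O (W m N) (W m N j - 1) (α j) := by
    intro j
    fin_cases j
    · exact O_of_nonpos (by simp) _
    · exact h.lead_a1.O
    · exact h.O_a2
  refine ⟨isField_fld α b, fun ⟨j, c⟩ => ?_⟩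
  cases b <;> cases c <;> simp only [fld_ff, fld_ft, fld_tf, fld_tt]
  · exact key j
  · exact O_zero _
  · exact O_zero _
  · exact (key j).conj

theorem Ld_false {s : ℤ} (hs : s < N) {f : SF 3} {q : R2} (hf : Ld m N s f q) :
    Ld m N (s - 1) (fld α false f) (Lv A q) := by
  rw [fld_false, Fin.sum_univ_three]
  have h0 := h.lead_a0.mul (hf.D (0, false))
  have h1 := h.lead_a1.mul (hf.D (1, false))
  have h2 : Lead (W m N) (s - N) (D (2, false) f) 0 := by
    have := Lead.D hf (2, false)
    rw [WH.eq_zero_of_neg this.1 (by simp; omega)] at this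
    exact this
  have h3 := h.O_a2.mul (Lead_zero_iff.1 h2)
  refine Ld.add_O ?_ (h3.mono (by omega))
  rw [Lv_apply, ← one_mul (dx q)]
  refine Ld.add ?_ ?_
  · have e : (0 : ℤ) + (s - ((1 : ℕ) : ℤ)) = s - 1 := by push_cast; ring
    simp only [emb, Fin.castSucc_zero, W_zero] at h0
    rw [e] at h0
    exact h0
  · have e : (m : ℤ) - 1 + (s - (m : ℤ)) = s - 1 := by ring
    simp only [emb, Fin.castSucc_one, W_one] at h1
    rw [e] at h1
    exact h1

theorem Ld_fld {s : ℤ} (hs : s < N) {f : SF 3} {q : R2} (hf : Ld m N s f q) (b : Bool) :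
    Ld m N (s - 1) (fld α b f) (ld A b q) := by
  cases b
  · exact h.Ld_false hs hf
  · have := (h.Ld_false hs hf.conj).conj
    rw [conj_fld, conj_conj, cjp_Lv, cjp_cjp] at this
    exact this

theorem Ld_lw {s : ℤ} (hs : s < N) {f : SF 3} {q : R2} (hf : Ld m N s f q) (w : List Bool) :
    Ld m N (s - w.length) (lw (fld α) w f) (lw (ld A) w q) := by
  induction w with
  | nil => simpa [lw] using hf
  | cons b w ih =>
    have := h.Ld_fld (by omega) ih b
    rwa [show s - w.length - 1 = s - ((b :: w).length : ℤ) by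
      rw [List.length_cons]; push_cast; ring] at this

theorem FO_Zw (w : List Bool) : FO m N (2 + w.length) (Zw α w) := by
  induction w with
  | nil =>
    have := (h.FO_fld false).lie (h.FO_fld true)
    simpa [Zw] using this
  | cons b w ih =>
    have := (h.FO_fld b).lie ih
    rw [Zw, List.length_cons]
    convert this using 1
    push_cast; ring

theorem Ld_Zw (w : List Bool) :
    Ld m N (m - 2 - w.length) (Zw α w (SF.X (1, false))) (lw (ld A) w (-dy A)) ∧
    Ld m N (m - 2 - w.length) (Zw α w (SF.X (1, true))) (lw (ld A) w (cjp (dy A))) := by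
  have hm := h.hm
  have hmN := h.hmN
  induction w with
  | nil =>
    simp only [Zw, Derivation.commutator_apply, fld_ff, fld_ft, fld_tf, fld_tt, map_zero, lw,
      List.length_nil, zero_sub, sub_zero]
    have h1 := h.Ld_fld (by omega) h.lead_a1 true
    have h2 := h.Ld_fld (by omega) h.lead_a1.conj false
    rw [ld_true, Lb_apply, dt_A h.hA, mul_zero, add_zero] at h1
    rw [ld_false, Lv_apply, dz_cA h.hA, mul_zero, add_zero, ← cjp_dy] at h2
    have e : (m : ℤ) - 2 - ((0 : ℕ) : ℤ) = m - 1 - 1 := by push_cast; ring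
    rw [e]
    refine ⟨?_, h2⟩
    rw [Ld, map_neg]
    exact Lead.neg h1
  | cons b w ih =>
    have key : ∀ β : SF 3, O (W m N) (m - 1) β → O (W m N) (m - 2 - w.length) (Zw α w β) := by
      intro β hβ
      have hF := h.FO_Zw w
      rw [hF.1, Fintype.sum_prod_type]
      refine O_sum fun i _ => O_sum fun c _ => ?_
      have h1 := hF.2 (i, c)
      have h2 := hβ.D (i, c)
      fin_cases i
      · exact (h2.mul_left _).mono (by simp; omega)
      · exact (h1.mul (O_of_nonpos le_rfl _)).mono (by simp; omega)
      · exact (h1.mul (O_of_nonpos le_rfl _)).mono (by simp; omega)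
    have key2 : ∀ c, O (W m N) (m - 2 - w.length) (Zw α w (fld α b (SF.X (1, c)))) := by
      intro c
      refine key _ ?_
      have := (h.FO_fld b).2 (1, c)
      exact this
    have e : (m : ℤ) - 2 - ((b :: w).length : ℤ) = m - 2 - w.length - 1 := by
      rw [List.length_cons]; push_cast; ring
    rw [e]
    simp only [Zw, Derivation.commutator_apply, lw]
    exact ⟨(h.Ld_fld (by omega) ih.1 b).sub_O ((key2 _).mono (by omega)),
      (h.Ld_fld (by omega) ih.2 b).sub_O ((key2 _).mono (by omega))⟩

theorem exists_P : ∃ P ∈ H m N, Ld m N N (ρ - SF.X (2, false) - SF.X (2, true)) P ∧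
    cjp P = P := by
  obtain ⟨p, hp⟩ := exists_lead h.posW h.r
  have hreal : conj (ρ - SF.X (2, false) - SF.X (2, true))
      = ρ - SF.X (2, false) - SF.X (2, true) := by
    rw [map_sub, map_sub, h.dat.real, conj_X, conj_X]
    simp only [bar, Bool.not_false, Bool.not_true]
    ring
  have hc : cjp p = p := by
    have := hp.conj
    rw [hreal] at this
    exact this.unique h.posW hp
  have h2 : D (2, false) (ρ - SF.X (2, false) - SF.X (2, true)) 0 = 0 := by
    simp [D_X, h.d2]
  have h2' : D (2, true) (ρ - SF.X (2, false) - SF.X (2, true)) 0 = 0 := by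
    have e : D (2, true) (ρ - SF.X (2, false) - SF.X (2, true))
        = conj (D (2, false) (ρ - SF.X (2, false) - SF.X (2, true))) := by
      rw [conj_D, hreal]; rfl
    rw [e, conj_apply, h2, map_zero]
  have h3 : ∀ b, pderiv (2, b) p = 0 := by
    intro b
    have := Lead.D hp (2, b)
    rw [W_two, sub_self] at this
    rw [this.unique h.posW (Lead_weight_zero h.posW _)]
    cases b
    · rw [h2, map_zero]
    · rw [h2', map_zero]
  obtain ⟨P, hP, rfl⟩ := exists_up hp.1 h3
  refine ⟨P, hP, hp, ?_⟩
  rw [cjp_up] at hc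
  exact rename_injective _ emb_injective hc

variable (hP : Ld m N N (ρ - SF.X (2, false) - SF.X (2, true)) P)
include hP

omit h in
theorem Ld_DD (i j : Fin 2 × Bool) : Ld m N (N - W m N (emb j).1 - W m N (emb i).1)
    (D (emb i) (D (emb j) ρ)) (pderiv i (pderiv j P)) := by
  rw [D_D_normal ρ]; exact (hP.D j).D i

theorem Ld_form {a b : ℤ} {f g : Fin 3 → SF 3} {p0 p1 q0 q1 : R2}
    (f0 : Ld m N (1 - a) (f 0) p0) (f1 : Ld m N (m - a) (f 1) p1) (f2 : O (W m N) (N - a) (f 2))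
    (g0 : Ld m N (1 - b) (g 0) q0) (g1 : Ld m N (m - b) (g 1) q1)
    (g2 : O (W m N) (N - b) (g 2)) :
    Ld m N (N - a - b) (∑ j, ∑ k, D (j, false) (D (k, true) ρ) * (f j * g k))
      (dx (dy P) * (p0 * q0) + dx (dt P) * (p0 * q1) + (dz (dy P) * (p1 * q0)
        + dz (dt P) * (p1 * q1))) := by
  have hm := h.hm
  have hmN := h.hmN
  have h00 := (Ld_DD hP (0, false) (0, true)).mul (f0.mul g0)
  have h01 := (Ld_DD hP (0, false) (1, true)).mul (f0.mul g1)
  have h10 := (Ld_DD hP (1, false) (0, true)).mul (f1.mul g0)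
  have h11 := (Ld_DD hP (1, false) (1, true)).mul (f1.mul g1)
  simp only [emb, Fin.castSucc_zero, Fin.castSucc_one, W_zero, W_one] at h00 h01 h10 h11
  have e00 : (N : ℤ) - ((1 : ℕ) : ℤ) - ((1 : ℕ) : ℤ) + (1 - a + (1 - b)) = N - a - b := by
    push_cast; ring
  have e01 : (N : ℤ) - (m : ℤ) - ((1 : ℕ) : ℤ) + (1 - a + (m - b)) = N - a - b := by
    push_cast; ring
  have e10 : (N : ℤ) - ((1 : ℕ) : ℤ) - (m : ℤ) + (m - a + (1 - b)) = N - a - b := by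
    push_cast; ring
  have e11 : (N : ℤ) - (m : ℤ) - (m : ℤ) + (m - a + (m - b)) = N - a - b := by
    ring
  rw [e00] at h00
  rw [e01] at h01
  rw [e10] at h10
  rw [e11] at h11
  have hO : ∀ j k, (j = 2 ∨ k = 2) → O (W m N) (N - a - b + 1)
      (D (j, false) (D (k, true) ρ) * (f j * g k)) := by
    have hf : ∀ j, O (W m N) (W m N j - a) (f j) := by
      intro j
      fin_cases j
      · exact f0.O
      · exact f1.O
      · exact f2
    have hg : ∀ j, O (W m N) (W m N j - b) (g j) := by
      intro j
      fin_cases j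
      · exact g0.O
      · exact g1.O
      · exact g2
    intro j k hjk
    refine O.mul_left (((hf j).mul (hg k)).mono ?_) _
    have := h.posW j
    have := h.posW k
    rcases hjk with rfl | rfl <;> simp only [W_two] at * <;> omega
  simp only [Fin.sum_univ_three]
  refine Ld.add_O (Ld.add ?_ ?_) (((hO 2 0 (Or.inl rfl)).add (hO 2 1 (Or.inl rfl))).add
    (hO 2 2 (Or.inl rfl)))
  · exact Ld.add_O (Ld.add h00 h01) (hO 0 2 (Or.inr rfl))
  · exact Ld.add_O (Ld.add h10 h11) (hO 1 2 (Or.inr rfl))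

theorem Ld_pair_nil : Ld m N (N - 2) (pair ρ (Zw α [])) (fL A P) := by
  rw [pair_Zw_nil h.dat.tan]
  have a0 : Ld m N (1 - 1) (α 0) 1 := by simpa using h.lead_a0
  have c0 := a0.conj
  rw [map_one] at c0
  have := h.Ld_form hP (a := 1) (b := 1) (f := α) (g := fun k => conj (α k)) a0
    h.lead_a1 h.O_a2 c0 h.lead_a1.conj h.O_a2.conj
  have e : (N : ℤ) - 1 - 1 = N - 2 := by ring
  rw [e] at this
  convert this using 1
  rw [fL]; ring

theorem Ld_pair (w : List Bool) : Ld m N (N - 2 - w.length) (pair ρ (Zw α w))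
    (dl (ld A) (-dy A) (cjp (dy A)) (uL A P) (vL A P) (fL A P) w) := by
  induction w with
  | nil => simpa [dl] using h.Ld_pair_nil hP
  | cons b w ih =>
    have e : (N : ℤ) - 2 - ((b :: w).length : ℤ) = N - 2 - w.length - 1 := by
      rw [List.length_cons]; push_cast; ring
    have e' : (N : ℤ) - 2 - w.length - 1 = N - 1 - (2 + w.length) := by ring
    have e'' : (N : ℤ) - 2 - w.length - 1 = N - (2 + w.length) - 1 := by ring
    have em : (m : ℤ) - 2 - w.length = m - (2 + w.length) := by ring
    have a0 : Ld m N (1 - 1) (α 0) 1 := by simpa using h.lead_a0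
    have hZ := h.Ld_Zw w
    rw [em] at hZ
    have hF := (h.FO_Zw w).2
    have hz : ∀ c, Ld m N (1 - (2 + w.length)) (Zw α w (SF.X (0, c))) 0 := fun c =>
      Ld_zero (O_of_nonpos (by omega) _)
    have hL := h.Ld_fld (by omega) ih b
    rw [e, Zw]
    cases b
    · rw [pair_lie_false h.dat.tan (isField_Zw α w), dl]
      refine Ld.add hL ?_
      rw [e']
      convert h.Ld_form hP (g := fun k => Zw α w (SF.X (k, true))) a0 h.lead_a1 h.O_a2
        (hz true) hZ.2 (hF (2, true)) using 1
      rw [uL, Lv_apply]; ring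
    · have c0 := a0.conj
      rw [map_one] at c0
      rw [pair_lie_true, dl]
      refine Ld.sub hL ?_
      rw [e'']
      convert h.Ld_form hP (f := fun k => Zw α w (SF.X (k, false)))
        (g := fun k => conj (α k)) (hz false) hZ.1 (hF (2, false)) c0 h.lead_a1.conj
        h.O_a2.conj using 1
      rw [vL, Lb_apply, pd_comm (0, true), pd_comm (1, true)]; ring

theorem van (hN : N < k) :
    (∀ w : List Bool, (w.length : ℤ) = N - 2 → constantCoeff
      (dl (ld A) (-dy A) (cjp (dy A)) (uL A P) (vL A P) (fL A P) w) = 0) ∨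
    ∀ w : List Bool, (w.length : ℤ) = N - 2 → constantCoeff (lw (ld A) w (fL A P)) = 0 := by
  have hc : ∀ q : R2, constantCoeff q = constantCoeff (up q) := fun q => by
    rw [up, constantCoeff_rename]
  rcases h.dat.van with hv | hv
  · refine Or.inl fun w hw => ?_
    have := h.Ld_pair hP w
    rw [show (N : ℤ) - 2 - w.length = 0 by omega] at this
    rw [hc, this.apply_zero h.posW, hv w (by omega)]
  · refine Or.inr fun w hw => ?_
    have := h.Ld_lw (by omega) (h.Ld_pair_nil hP) w
    rw [show (N : ℤ) - 2 - w.length = 0 by omega] at this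
    rw [hc, this.apply_zero h.posW, hv w (by omega)]

end St

end Mdl

namespace Mdl

open MvPolynomial SF

variable {m N k : ℕ}

theorem pderiv_two_up (b : Bool) (q : R2) : pderiv (2, b) (up q) = 0 := by
  induction q using MvPolynomial.induction_on with
  | C c => simp [up]
  | add p q hp hq => simp [hp, hq]
  | mul_X p j hp =>
    have : emb j ≠ (2, b) := by
      obtain ⟨i, c⟩ := j
      fin_cases i <;> simp [emb]
    rw [map_mul, Derivation.leibniz, hp, up_X, pderiv_X_of_ne this, smul_zero, smul_zero,
      add_zero]

theorem Ld.mem {s : ℤ} {f : SF 3} {q : R2} (h : Ld m N s f q) : q ∈ H m s := by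
  obtain ⟨q', hq', e⟩ := exists_up h.1 fun b => pderiv_two_up b q
  rwa [rename_injective _ emb_injective e]

theorem Ld.bound {s : ℤ} {f : SF 3} {q : R2} (hW : ∀ i, 0 < W m N i) (h : Ld m N s f q) (R : ℝ) :
    ∃ C : ℝ, 0 ≤ C ∧ ∀ ε : ℝ, 0 < ε → ε ≤ 1 → ∀ y : Cn 3, ‖y‖ ≤ R →
      ‖f (dil (W m N) ε y) - (ε : ℂ) ^ s * ev (y 0) (y 1) q‖ ≤ C * ε ^ (s + 1) := by
  obtain ⟨C, hC, hb⟩ := O.bound hW R h.2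
  refine ⟨C, hC, fun ε h0 h1 y hy => ?_⟩
  have h2 := hb ε h0 h1 y hy
  have h3 : ev ((ε : ℂ) * y 0) ((ε : ℂ) ^ m * y 1) q = (ε : ℂ) ^ s * ev (y 0) (y 1) q := by
    by_cases hs : s < 0
    · rw [H_neg h.mem hs]; simp
    · lift s to ℕ using not_lt.1 hs
      have := S_scale h.mem (ε : ℂ) (y 0) (starRingEnd ℂ (y 0)) (y 1) (starRingEnd ℂ (y 1))
      rw [zpow_natCast, ev, ev, ← this, map_mul, map_mul, map_pow, Complex.conj_ofReal]
  rw [SF.sub_apply, hat_up_apply] at h2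
  rw [← h3]
  simpa [dil] using h2

namespace St

variable {ρ : SF 3} {α : Fin 3 → SF 3} {A P : R2} (h : St k m N ρ α A)
include h

/-- The coefficients of the Levi form in the first two coordinates. -/
noncomputable def _root_.Mdl.Qf (ρ : SF 3) (i j : Fin 2) : SF 3 :=
  D (2, false) ρ * D (2, true) ρ * D (emb (i, false)) (D (emb (j, true)) ρ)
    - (D (2, false) ρ * D (emb (j, true)) ρ * D (emb (i, false)) (D (2, true) ρ)
    + D (2, true) ρ * D (emb (i, false)) ρ * D (2, false) (D (emb (j, true)) ρ)
    - D (emb (i, false)) ρ * D (emb (j, true)) ρ * D (2, false) (D (2, true) ρ))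

theorem d2' : D (2, true) ρ 0 = 1 := by
  have e : D (2, true) ρ = SF.conj (D (2, false) ρ) := by rw [conj_D, h.dat.real]; rfl
  rw [e, conj_apply, h.d2, map_one]

variable (hP : Ld m N N (ρ - SF.X (2, false) - SF.X (2, true)) P)
include hP

theorem Ld_Qf (i j : Fin 2) : Ld m N (N - W m N (emb (j, true)).1 - W m N (emb (i, true)).1)
    (Qf ρ i j) (pderiv (i, false) (pderiv (j, true) P)) := by
  have hm := h.hm
  have hmN := h.hmN
  have h1 : ∀ b, Ld m N 0 (D (2, b) ρ) 1 := fun b => by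
    have := Lead_weight_zero h.posW (D (2, b) ρ)
    have e : D (2, b) ρ 0 = 1 := by
      cases b
      · exact h.d2
      · exact h.d2'
    rw [e] at this
    simpa [Ld] using this
  have h2 := ((h1 false).mul (h1 true)).mul (Ld_DD hP (i, false) (j, true))
  have hfst : ∀ (i : Fin 2) (b : Bool), (emb (i, b)).1 ≠ 2 := by decide
  have hO : ∀ (i : Fin 2) (b : Bool), O (W m N) (N - W m N (emb (i, true)).1) (D (emb (i, b)) ρ) := by
    intro i b
    rw [D_normal ρ (hfst i b)]
    exact h.r.D (emb (i, b))
  have hO2 : ∀ (i : Fin 2) (b c : Bool), O (W m N) (1 - W m N (emb (i, true)).1)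
      (D (emb (i, b)) (D (2, c) ρ)) := by
    intro i b c
    rw [D_D_normal ρ]
    have h3 := Lead.D hP (2, c)
    rw [pderiv_two_up] at h3
    refine ((Lead_zero_iff.1 h3).D (emb (i, b))).mono ?_
    simp only [W_two, emb]; omega
  rw [zero_add, zero_add, one_mul, one_mul] at h2
  refine Ld.sub_O h2 (O.sub (O.add ?_ ?_) ?_)
  · rw [mul_assoc]
    refine ((((hO j true).mul (hO2 i false true))).mul_left _).mono ?_
    omega
  · rw [mul_assoc, D_comm (2, false)]
    refine ((((hO i false).mul (hO2 j true false))).mul_left _).mono ?_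
    omega
  · refine (((hO i false).mul (hO j true)).mul (O_of_nonpos le_rfl _)).mono ?_
    omega

/-- Points of the hypersurface near given points of the first two coordinate directions. -/
theorem exists_points (a b : ℂ) : ∃ R δ : ℝ, 0 < δ ∧ ∀ ε : ℝ, 0 < ε → ε < δ → ε ≤ 1 →
    ∃ y : Cn 3, ‖y‖ ≤ R ∧ y 0 = a ∧ y 1 = b ∧ ρ (dil (W m N) ε y) = 0 := by
  set S : ℝ := |(ev a b P).re| + 1 with hS
  obtain ⟨C, hC, hb⟩ := Ld.bound h.posW hP (‖a‖ + ‖b‖ + S)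
  have hS0 : 0 < S := by positivity
  have hPabs := abs_le.1 (le_refl |(ev a b P).re|)
  refine ⟨‖a‖ + ‖b‖ + S, 1 / (C + 1), by positivity, fun ε h0 h1 h2 => ?_⟩
  have hCε : C * ε < 1 := by
    have : ε * (C + 1) < 1 := by rwa [lt_div_iff₀ (by positivity)] at h1
    nlinarith
  let y : ℝ → Cn 3 := fun t => ![a, b, (t : ℂ)]
  have hy : ∀ t ∈ Set.Icc (-S) S, ‖y t‖ ≤ ‖a‖ + ‖b‖ + S := by
    intro t ht
    have ht' : |t| ≤ S := abs_le.2 ht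
    have := norm_nonneg a
    have := norm_nonneg b
    rw [pi_norm_le_iff_of_nonneg (by positivity)]
    intro i
    fin_cases i <;> simp [y] <;> linarith
  have him : ∀ x, (ρ x).im = 0 := fun x => by
    have := congrArg (fun f : SF 3 => f x) h.dat.real
    rw [conj_apply] at this
    exact Complex.conj_eq_iff_im.1 this
  have key : ∀ t ∈ Set.Icc (-S) S,
      |(ρ (dil (W m N) ε (y t))).re - ε ^ N * ((ev a b P).re + 2 * t)| ≤ C * ε * ε ^ N := by
    intro t ht
    have h3 := hb ε h0 h2 (y t) (hy t ht)
    have h4 := (Complex.abs_re_le_norm _).trans h3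
    rw [SF.sub_apply, SF.sub_apply, X_false, X_true] at h4
    have e1 : dil (W m N) ε (y t) 2 = ((ε ^ N * t : ℝ) : ℂ) := by simp [dil, y]
    have e2 : (ε : ℂ) ^ (N : ℤ) = ((ε ^ N : ℝ) : ℂ) := by push_cast; rw [zpow_natCast]
    rw [e1, e2, Complex.conj_ofReal, Complex.sub_re, Complex.sub_re, Complex.sub_re,
      Complex.re_ofReal_mul, Complex.ofReal_re] at h4
    have e3 : ε ^ ((N : ℤ) + 1) = ε ^ N * ε := by
      rw [zpow_add_one₀ h0.ne', zpow_natCast]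
    rw [e3] at h4
    refine le_trans (le_of_eq ?_) (h4.trans (le_of_eq (by ring)))
    congr 1
    simp only [y, Matrix.cons_val_zero, Matrix.cons_val_one]
    ring
  have hεN : 0 < ε ^ N := by positivity
  have hcont : ContinuousOn (fun t => (ρ (dil (W m N) ε (y t))).re) (Set.Icc (-S) S) := by
    refine Continuous.continuousOn (Complex.continuous_re.comp (ρ.smooth.continuous.comp ?_))
    refine continuous_pi fun i => continuous_const.mul ?_
    fin_cases i
    · exact continuous_const
    · exact continuous_const
    · exact Complex.continuous_ofReal
  have hneg : (ρ (dil (W m N) ε (y (-S)))).re ≤ 0 := by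
    have := (abs_le.1 (key (-S) ⟨le_rfl, by linarith⟩)).2
    have h5 : C * ε * ε ^ N ≤ 1 * ε ^ N := by gcongr
    nlinarith
  have hpos : 0 ≤ (ρ (dil (W m N) ε (y S))).re := by
    have := (abs_le.1 (key S ⟨by linarith, le_rfl⟩)).1
    have h5 : C * ε * ε ^ N ≤ 1 * ε ^ N := by gcongr
    nlinarith
  obtain ⟨t, ht, ht0⟩ := intermediate_value_Icc (by linarith : -S ≤ S) hcont ⟨hneg, hpos⟩
  exact ⟨y t, hy t ht, rfl, rfl, Complex.ext ht0 (him _)⟩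

omit hP in
theorem Qf_nonneg {x : Cn 3} (hx : ρ x = 0) (u : Fin 2 → ℂ) :
    0 ≤ (∑ i, ∑ j, Qf ρ i j x * u i * starRingEnd ℂ (u j)).re := by
  have hc : ∀ i, D (i, true) ρ x = starRingEnd ℂ (D (i, false) ρ x) := fun i => by
    have e : D (i, true) ρ = SF.conj (D (i, false) ρ) := by rw [conj_D, h.dat.real]; rfl
    rw [e, conj_apply]
  have := h.dat.psc x hx ![D (2, false) ρ x * u 0, D (2, false) ρ x * u 1,
    -(D (0, false) ρ x * u 0 + D (1, false) ρ x * u 1)] (by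
      simp only [Fin.sum_univ_three, Matrix.cons_val_zero, Matrix.cons_val_one, Matrix.cons_val]
      ring)
  refine this.trans_eq (congrArg Complex.re ?_)
  simp only [Fin.sum_univ_three, Fin.sum_univ_two, Matrix.cons_val_zero, Matrix.cons_val_one,
    Matrix.cons_val, Qf, emb, Fin.castSucc_zero, Fin.castSucc_one, SF.sub_apply, SF.add_apply, mul_apply,
    hc, map_mul, map_neg, map_add]
  ring

theorem psd : Psd P := by
  intro a b s r
  obtain ⟨R, δ, hδ, hy⟩ := h.exists_points hP a b
  have hQ : ∀ i j, ∃ C : ℝ, 0 ≤ C ∧ ∀ ε : ℝ, 0 < ε → ε ≤ 1 → ∀ y : Cn 3, ‖y‖ ≤ R →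
      ‖(ε : ℂ) ^ (W m N (emb (i, true)).1 + W m N (emb (j, true)).1) * Qf ρ i j (dil (W m N) ε y)
        - (ε : ℂ) ^ N * ev (y 0) (y 1) (pderiv (i, false) (pderiv (j, true) P))‖
        ≤ C * ε ^ N * ε := by
    intro i j
    obtain ⟨C, hC, hb⟩ := Ld.bound h.posW (h.Ld_Qf hP i j) R
    refine ⟨C, hC, fun ε h0 h1 y hy => ?_⟩
    have h2 := hb ε h0 h1 y hy
    set w := W m N (emb (i, true)).1 + W m N (emb (j, true)).1 with hw
    have e : (N : ℤ) - W m N (emb (j, true)).1 - W m N (emb (i, true)).1 = N - w := by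
      rw [hw]; push_cast; ring
    rw [e] at h2
    have hε : (ε : ℂ) ≠ 0 := by exact_mod_cast h0.ne'
    have e1 : (ε : ℂ) ^ w * (ε : ℂ) ^ ((N : ℤ) - w) = (ε : ℂ) ^ N := by
      rw [← zpow_natCast, ← zpow_add₀ hε, ← zpow_natCast]; congr 1; ring
    have e2 : ε ^ w * ε ^ ((N : ℤ) - w + 1) = ε ^ N * ε := by
      rw [← zpow_natCast, ← zpow_add₀ h0.ne', ← zpow_natCast, ← zpow_add_one₀ h0.ne']
      congr 1; ring
    rw [← e1, mul_assoc, ← mul_sub, norm_mul, norm_pow, Complex.norm_real, Real.norm_eq_abs,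
      abs_of_pos h0]
    calc _ ≤ ε ^ w * (C * ε ^ ((N : ℤ) - w + 1)) := by gcongr
      _ = C * (ε ^ w * ε ^ ((N : ℤ) - w + 1)) := by ring
      _ = _ := by rw [e2]; ring
  choose C hC hb using hQ
  let v : Fin 2 → ℂ := ![s, r]
  let K : ℝ := ∑ i, ∑ j, C i j * ‖v i‖ * ‖v j‖
  have hK : 0 ≤ K := Finset.sum_nonneg fun i _ => Finset.sum_nonneg fun j _ => by
    have := hC i j; positivity
  set F : ℂ := ∑ i, ∑ j, ev a b (pderiv (i, false) (pderiv (j, true) P)) * v i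
    * starRingEnd ℂ (v j) with hF
  have main : ∀ ε : ℝ, 0 < ε → ε < δ → ε ≤ 1 → -(K * ε) ≤ F.re := by
    intro ε h0 h1 h2
    obtain ⟨y, hyR, rfl, rfl, hρ⟩ := hy ε h0 h1 h2
    have hn := h.Qf_nonneg hρ fun i => (ε : ℂ) ^ (W m N (emb (i, true)).1) * v i
    set E := ∑ i, ∑ j, Qf ρ i j (dil (W m N) ε y) * ((ε : ℂ) ^ (W m N (emb (i, true)).1) * v i)
      * starRingEnd ℂ ((ε : ℂ) ^ (W m N (emb (j, true)).1) * v j) with hE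
    have hd : ‖E - (ε : ℂ) ^ N * F‖ ≤ K * ε ^ N * ε := by
      have e : E - (ε : ℂ) ^ N * F = ∑ i, ∑ j,
          ((ε : ℂ) ^ (W m N (emb (i, true)).1 + W m N (emb (j, true)).1)
            * Qf ρ i j (dil (W m N) ε y)
            - (ε : ℂ) ^ N * ev (y 0) (y 1) (pderiv (i, false) (pderiv (j, true) P)))
            * v i * starRingEnd ℂ (v j) := by
        rw [hE, hF, Finset.mul_sum, ← Finset.sum_sub_distrib]
        refine Finset.sum_congr rfl fun i _ => ?_
        rw [Finset.mul_sum, ← Finset.sum_sub_distrib]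
        refine Finset.sum_congr rfl fun j _ => ?_
        rw [map_mul, map_pow, Complex.conj_ofReal]
        ring
      rw [e]
      have e' : K * ε ^ N * ε = ∑ i, ∑ j, C i j * ε ^ N * ε * ‖v i‖ * ‖v j‖ := by
        simp only [K, Finset.sum_mul]
        refine Finset.sum_congr rfl fun i _ => Finset.sum_congr rfl fun j _ => ?_
        ring
      rw [e']
      refine norm_sum_le_of_le _ fun i _ => norm_sum_le_of_le _ fun j _ => ?_
      rw [norm_mul, norm_mul, RCLike.norm_conj]
      have := hb i j ε h0 h2 y hyR
      gcongr
    have h3 := (abs_le.1 ((Complex.abs_re_le_norm _).trans hd)).2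
    rw [← Complex.ofReal_pow, Complex.sub_re, Complex.re_ofReal_mul] at h3
    have hεN : 0 < ε ^ N := by positivity
    by_contra hlt
    rw [not_le] at hlt
    nlinarith [mul_lt_mul_of_pos_left hlt hεN]
  have hF0 : 0 ≤ F.re := by
    by_contra hlt
    rw [not_le] at hlt
    have hx : 0 < -F.re / (K + 1) := by apply div_pos <;> linarith
    have h1 := main (min (min (δ / 2) 1) (-F.re / (K + 1) / 2)) (by positivity)
      (lt_of_le_of_lt ((min_le_left _ _).trans (min_le_left _ _)) (by linarith))
      ((min_le_left _ _).trans (min_le_right _ _))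
    have h2 : K * min (min (δ / 2) 1) (-F.re / (K + 1) / 2) ≤ K * (-F.re / (K + 1) / 2) := by
      gcongr; exact min_le_right _ _
    have h3 : -F.re / (K + 1) * (K + 1) = -F.re := div_mul_cancel₀ _ (by positivity)
    nlinarith
  refine hF0.trans_eq (congrArg Complex.re ?_)
  simp only [hF, Fin.sum_univ_two, v, Matrix.cons_val_zero, Matrix.cons_val_one]
  ring

omit hP in
theorem exists_hyp (hN : N < k) : ∃ P, Hyp m N A P ∧
    Ld m N N (ρ - SF.X (2, false) - SF.X (2, true)) P := by
  obtain ⟨P, hP, hl, hr⟩ := h.exists_P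
  exact ⟨P, ⟨h.hm, h.hmN, h.hA, hP, hr, h.psd hl, h.van hl hN⟩, hl⟩

end St

end Mdl

namespace SF

open MvPolynomial SF

variable {n : ℕ}

theorem apply_update {i : Fin n} {f : SF n} (h : ∀ b, D (i, b) f = 0) (x : Cn n) (s t : ℂ) :
    f (Function.update x i s) = f (Function.update x i t) := by
  have hd : ∀ t : ℂ, HasFDerivAt (fun t => f (Function.update x i t))
      ((fderiv ℝ f (Function.update x i t)).comp
        (ContinuousLinearMap.pi (Pi.single i (ContinuousLinearMap.id ℝ ℂ)))) t := fun t =>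
    (f.diffAt _).hasFDerivAt.comp t (hasFDerivAt_update x t)
  refine is_const_of_fderiv_eq_zero (𝕜 := ℝ) (fun t => (hd t).differentiableAt) (fun t => ?_) s t
  rw [(hd t).fderiv]
  ext u
  rw [ContinuousLinearMap.comp_apply, fderiv_eq]
  refine Finset.sum_eq_zero fun j _ => ?_
  by_cases hj : j = i
  · subst hj
    simp [h]
  · simp [hj]

/-- The components of the shear `z_i ↦ z_i + g`. -/
noncomputable def shc (i : Fin n) (g : SF n) (j : Fin n) : SF n :=
  X (j, false) + if j = i then g else 0

theorem tup_shc (i : Fin n) (g : SF n) (x : Cn n) :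
    tup (shc i g) x = Function.update x i (x i + g x) := by
  ext j
  by_cases hj : j = i
  · subst hj; simp [tup, shc]
  · simp [tup, shc, hj]

theorem pull_shc {i : Fin n} {f : SF n} (h : ∀ b, D (i, b) f = 0) (g : SF n) :
    pull (shc i g) f = f := by
  ext x
  rw [pull_apply, tup_shc, apply_update h x _ (x i), Function.update_eq_self]

/-- A shear as a biholomorphic map. -/
noncomputable def BiHol.shear (i : Fin n) (g : SF n) (hg : ∀ j, D (j, true) g = 0)
    (hi : D (i, false) g = 0) : BiHol n :=
  have h : ∀ b, D (i, b) g = 0 := fun b => by cases b; exacts [hi, hg i]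
  { c := shc i g
    d := shc i (-g)
    hc := fun j k => by
      rw [shc, map_add, D_X]; split_ifs <;> simp_all
    hd := fun j k => by
      rw [shc, map_add, D_X]; split_ifs <;> simp_all
    cd := fun j => by
      rw [shc, map_add, pull_X_false, shc]
      split_ifs
      · rw [map_neg, pull_shc h]; ring
      · simp
    dc := fun j => by
      rw [shc, map_add, pull_X_false, shc]
      split_ifs
      · rw [pull_shc h]; ring
      · simp }

section

variable {i : Fin n} {g : SF n} (hg : ∀ j, D (j, true) g = 0) (hi : D (i, false) g = 0)

theorem BiHol.shear_c : (BiHol.shear i g hg hi).c = shc i g := rfl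

theorem BiHol.shear_coef (α : Fin n → SF n) (j : Fin n) : (BiHol.shear i g hg hi).coef α j
    = pull (shc i g) (α j - if j = i then fld α false g else 0) := by
  change pull (shc i g) (fld α false (shc i (-g) j)) = _
  rw [shc, map_add, fld_ff]
  split_ifs
  · rw [map_neg, sub_eq_add_neg]
  · rw [map_zero, sub_zero, add_zero]

include hg in
theorem D_pull_shc (f : SF n) (k : Fin n) : D (k, false) (pull (shc i g) f)
    = pull (shc i g) (D (k, false) f) + pull (shc i g) (D (i, false) f) * D (k, false) g := by
  have hg' : ∀ j, D (j, false) (conj g) = 0 := fun j => by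
    have := congrArg conj (hg j)
    rwa [conj_D, map_zero] at this
  rw [D_pull, Fintype.sum_prod_type]
  have e : ∀ j, D (k, false) (pull (shc i g) (X (j, true))) = 0 := fun j => by
    rw [pull_X_true, shc, map_add, map_add, conj_X, D_X]
    split_ifs <;> simp_all [bar]
  have e' : ∀ j, D (k, false) (pull (shc i g) (X (j, false)))
      = (if j = k then 1 else 0) + if j = i then D (k, false) g else 0 := fun j => by
    rw [pull_X_false, shc, map_add, D_X]
    split_ifs <;> simp_all
  simp only [Fintype.sum_bool, e, e', mul_zero, zero_add, mul_add, Finset.sum_add_distrib,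
    mul_ite, mul_one, Finset.sum_ite_eq', Finset.mem_univ, if_true]

theorem O_shc {w : Fin n → ℕ} (hO : O w (w i) g) (j : Fin n) : O w (w j) (shc i g j) := by
  rw [shc]
  refine (O_X w (j, false)).add ?_
  split_ifs with h
  · rwa [h]
  · exact O_zero _

end

/-- A holomorphic curve with contact of order at least `k`. -/
def Curve (k : ℕ) (ρ : SF n) (p : Cn n) : Prop :=
  ∃ c : Fin n → SF 1, (∀ j, D (0, true) (c j) = 0) ∧ tup c 0 = p ∧
    (∃ j, D (0, false) (c j) 0 ≠ 0) ∧ O (fun _ => 1) k (pull c ρ)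

theorem Curve.of_pull {k : ℕ} {ρ : SF n} {σ : BiHol n} {p q : Cn n}
    (h : Curve k (pull σ.c ρ) q) (hq : tup σ.c q = p) : Curve k ρ p := by
  obtain ⟨c, hc, rfl, ⟨j, hj⟩, hO⟩ := h
  have hc' : ∀ i, D (0, false) (conj (c i)) = 0 := fun i => by
    have := congrArg conj (hc i)
    rwa [conj_D, map_zero] at this
  refine ⟨fun j => pull c (σ.c j), fun j => ?_, hq, ?_, hO⟩
  · rw [D_pull, Fintype.sum_prod_type]
    simp [hc, σ.hc]
  · by_contra hcon
    push Not at hcon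
    apply hj
    have e : c j = pull (fun j => pull c (σ.c j)) (σ.d j) := by
      rw [← pull_X_false c j, ← σ.cd j]; rfl
    have hz : ∀ i, D (0, false) (conj (pull c (σ.c i))) = 0 := fun i => by
      rw [← pull_conj, D_pull, Fintype.sum_prod_type]
      simp [hc', σ.D_conj_c]
    rw [e, D_pull, Fintype.sum_prod_type]
    simp [hcon, hz]

end SF

namespace Mdl

open MvPolynomial SF

theorem W_mono {m N m' N' : ℕ} (hm : m ≤ m') (hN : N ≤ N') (i : Fin 3) : W m N i ≤ W m' N' i := by
  fin_cases i
  · exact le_rfl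
  · exact hm
  · exact hN

theorem D_two_hat_up (b : Bool) (q : R2) : D (2, b) (hat (up q)) = 0 := by
  rw [D_hat, pderiv_two_up, map_zero]

theorem D_true_hat_up {q : R2} (h1 : dy q = 0) (h2 : dt q = 0) (j : Fin 3) :
    D (j, true) (hat (up q)) = 0 := by
  fin_cases j
  · exact (D_hat (emb (0, true)) (up q)).trans (by rw [pderiv_up, h1, map_zero, map_zero])
  · exact (D_hat (emb (1, true)) (up q)).trans (by rw [pderiv_up, h2, map_zero, map_zero])
  · exact D_two_hat_up _ _

variable {k m N : ℕ} {ρ : SF 3} {α : Fin 3 → SF 3} {A P : R2}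

theorem St.curve (h : St k m N ρ α A) (hk : k ≤ N) : Curve k ρ 0 := by
  refine ⟨![SF.X (0, false), 0, 0], fun j => ?_, ?_, ⟨0, ?_⟩, ?_⟩
  · fin_cases j <;> simp [D_X]
  · ext j
    fin_cases j <;> simp [tup]
  · simp [D_X]
  · have hc : ∀ j, O (fun _ => 1) (W m N j) ((![SF.X (0, false), 0, 0] : Fin 3 → SF 1) j) := by
      intro j
      fin_cases j
      · exact O_X (fun _ => 1) ((0, false) : Fin 1 × Bool)
      · exact O_zero (w := fun _ : Fin 1 => 1) _
      · exact O_zero (w := fun _ : Fin 1 => 1) _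
    have := O.pull h.posW hc h.r
    simp only [map_sub, pull_X_false, pull_X_true, Matrix.cons_val, map_zero, sub_zero] at this
    exact this.mono (by exact_mod_cast hk)

theorem St.shear_two (h : St k m N ρ α A) (hN : N < k) (hA : m < N → dy A ≠ 0) :
    ∃ (σ : BiHol 3) (ρ' : SF 3) (α' : Fin 3 → SF 3), ρ' = pull σ.c ρ ∧ tup σ.c 0 = 0 ∧
      St k m (N + 1) ρ' α' A := by
  obtain ⟨P, hyp, hP⟩ := h.exists_hyp hN
  have hm := h.hm
  have hmN := h.hmN
  obtain ⟨q, hq, hy, ht, rfl⟩ := (hyp.flat hA).exists_holomorphic (by omega) (by omega)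
    hyp.hP hyp.real
  have hg : ∀ j, D (j, true) (-hat (up q)) = 0 := fun j => by
    rw [map_neg, D_true_hat_up hy ht, neg_zero]
  have hi : D (2, false) (-hat (up q)) = 0 := by rw [map_neg, D_two_hat_up, neg_zero]
  have hgO : O (W m N) (W m N 2) (-hat (up q)) := (WH_up hq).O.neg
  have hg0 : (-hat (up q)) (0 : Cn 3) = 0 := hgO.apply_zero (by exact_mod_cast h.posW 2)
  have ht0 : tup (shc 2 (-hat (up q))) 0 = 0 := by
    rw [tup_shc, hg0, add_zero, Function.update_eq_self]
  have hOW : ∀ {s : ℤ} {f : SF 3}, O (W m N) s f →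
      O (W m (N + 1)) s (pull (shc 2 (-hat (up q))) f) := fun hf =>
    (O.pull h.posW (O_shc hgO) hf).weaken (W_mono le_rfl (Nat.le_succ N))
  refine ⟨BiHol.shear 2 _ hg hi, _, _, rfl, ht0, ⟨h.dat.pull _ ht0, hm, by omega, ?_, ?_, ?_,
    h.hA, ?_⟩⟩
  · rw [BiHol.shear_coef, if_neg (by decide), sub_zero, pull_apply, ht0, h.a0]
  · rw [BiHol.shear_c, D_pull_shc hg, hi, mul_zero, add_zero, pull_apply, ht0, h.d2]
  · have := hOW hP.2
    push_cast
    convert this using 1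
    rw [map_add, map_add, ← cjp_up, ← conj_hat, BiHol.shear_c]
    simp only [map_sub, map_add, pull_X_false, pull_X_true, pull_conj,
      pull_shc (fun b => D_two_hat_up b q)]
    simp only [shc, if_true, map_add, map_neg, conj_X, bar_mk, Bool.not_false]
    ring
  · have := hOW h.a1
    rw [map_sub, pull_shc (fun b => D_two_hat_up b A)] at this
    rw [BiHol.shear_coef, if_neg (by decide), sub_zero]
    exact this

theorem St.shear_one (h : St k m (m + 1) ρ α A) (hA : dy A = 0) :
    ∃ (σ : BiHol 3) (ρ' : SF 3) (α' : Fin 3 → SF 3) (A' : R2), ρ' = pull σ.c ρ ∧ tup σ.c 0 = 0 ∧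
      St k (m + 1) (m + 1) ρ' α' A' := by
  have hm := h.hm
  have hq : anti (0, false) A ∈ H m m := by
    have := anti_mem (i := (0, false)) h.hA
    rwa [wm_zero, Nat.cast_one, sub_add_cancel] at this
  set q := anti (0, false) A with hqdef
  have qx : dx q = A := pderiv_anti _ _
  have qy : dy q = 0 := by rw [hqdef, pderiv_anti_ne (by decide), hA, map_zero]
  have qz : dz q = 0 := by rw [hqdef, pderiv_anti_ne (by decide), dz_A h.hA, map_zero]
  have qt : dt q = 0 := by rw [hqdef, pderiv_anti_ne (by decide), dt_A h.hA, map_zero]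
  have D1 : D (1, false) (hat (up q)) = 0 :=
    (D_hat (emb (1, false)) (up q)).trans (by rw [pderiv_up, qz, map_zero, map_zero])
  have D0 : D (0, false) (hat (up q)) = hat (up A) :=
    (D_hat (emb (0, false)) (up q)).trans (by rw [pderiv_up, qx])
  have hg := D_true_hat_up qy qt
  have hgO : O (W m (m + 1)) (W m (m + 1) 1) (hat (up q)) := (WH_up hq).O
  have hg0 : (hat (up q)) (0 : Cn 3) = 0 := hgO.apply_zero (by exact_mod_cast h.posW 1)
  have ht0 : tup (shc 1 (hat (up q))) 0 = 0 := by
    rw [tup_shc, hg0, add_zero, Function.update_eq_self]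
  have hOW : ∀ {s : ℤ} {f : SF 3}, O (W m (m + 1)) s f →
      O (W (m + 1) (m + 1)) s (pull (shc 1 (hat (up q))) f) := fun hf =>
    (O.pull h.posW (O_shc hgO) hf).weaken (W_mono (Nat.le_succ m) le_rfl)
  have hW : ∀ i, 0 < W (m + 1) (m + 1) i := W_pos (by omega) (by omega)
  have ha1 : O (W (m + 1) (m + 1)) m ((BiHol.shear 1 _ hg D1).coef α 1) := by
    rw [BiHol.shear_coef, if_pos rfl]
    refine hOW ?_
    rw [fld_false, Fin.sum_univ_three, D0, D1, D_two_hat_up, mul_zero, mul_zero, add_zero,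
      add_zero, show α 1 - α 0 * hat (up A)
        = (α 1 - hat (up A)) - (α 0 - 1) * hat (up A) by ring]
    refine h.a1.sub (((O_one ?_ h.posW).mul (WH_up h.hA).O).mono (by omega))
    rw [SF.sub_apply, h.a0, one_apply, sub_self]
  obtain ⟨p, hp⟩ := exists_lead hW ha1
  obtain ⟨A', hA', rfl⟩ := exists_up hp.1 fun b => (hp.1.D (2, b)).eq_zero_of_neg (by
    rw [W_two]; push_cast; omega)
  refine ⟨BiHol.shear 1 _ hg D1, _, _, A', rfl, ht0, ⟨h.dat.pull _ ht0, by omega, le_rfl, ?_, ?_,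
    ?_, ?_, ?_⟩⟩
  · rw [BiHol.shear_coef, if_neg (by decide), sub_zero, pull_apply, ht0, h.a0]
  · rw [BiHol.shear_c, D_pull_shc hg, D_two_hat_up, mul_zero, add_zero, pull_apply, ht0, h.d2]
  · have := hOW h.r
    rw [map_sub, map_sub, pull_X_false, pull_X_true, shc, if_neg (by decide), add_zero,
      conj_X] at this
    exact this
  · convert hA' using 2
    push_cast; ring
  · have := hp.2
    push_cast
    exact this

theorem St.curve_of_ne (h : St k m N ρ α A) (hA : dy A ≠ 0) : Curve k ρ 0 := by
  obtain ⟨d, hd⟩ : ∃ d, k ≤ N + d := ⟨k, by omega⟩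
  induction d generalizing N ρ α with
  | zero => exact h.curve hd
  | succ d ih =>
    by_cases hk : k ≤ N
    · exact h.curve hk
    · obtain ⟨σ, _, _, rfl, h0, h'⟩ := h.shear_two (not_le.1 hk) fun _ => hA
      exact (ih h' (by omega)).of_pull h0

theorem St.curve_of_eq (h : St k m m ρ α A) : Curve k ρ 0 := by
  obtain ⟨d, hd⟩ : ∃ d, k ≤ m + d := ⟨k, by omega⟩
  induction d generalizing m ρ α A with
  | zero => exact h.curve hd
  | succ d ih =>
    by_cases hk : k ≤ m
    · exact h.curve hk
    · obtain ⟨σ, _, _, rfl, h0, h'⟩ := h.shear_two (not_le.1 hk) fun h => absurd h (lt_irrefl _)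
      refine Curve.of_pull ?_ h0
      by_cases hA : dy A = 0
      · obtain ⟨σ', _, _, _, rfl, h0', h''⟩ := h'.shear_one hA
        exact (ih h'' (by omega)).of_pull h0'
      · exact h'.curve_of_ne hA

theorem curve_of_normal (h : Dat k ρ α 0) (h0 : α 0 0 = 1) (h1 : α 1 0 = 0) (h2 : α 2 0 = 0)
    (hd : D (2, false) ρ 0 = 1) : Curve k ρ 0 := by
  have hW : ∀ i, 0 < W 2 2 i := W_pos two_pos two_pos
  have hd0 : D (0, false) ρ 0 = 0 := by
    have := congrArg (fun f : SF 3 => f 0) h.tan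
    simpa [fld_false, Fin.sum_univ_three, h0, h1, h2] using this
  have hd0' : D (0, true) ρ 0 = 0 := by
    have e : D (0, true) ρ = SF.conj (D (0, false) ρ) := by rw [conj_D, h.real]; rfl
    rw [e, conj_apply, hd0, map_zero]
  obtain ⟨p, hp⟩ := exists_lead hW (O_one h1 hW)
  obtain ⟨A, hA, rfl⟩ := exists_up hp.1 fun b => (hp.1.D (2, b)).eq_zero_of_neg (by
    rw [W_two]; norm_num)
  refine St.curve_of_eq (m := 2) (A := A) (α := α) ⟨h, le_rfl, le_rfl, h0, hd, ?_, ?_, ?_⟩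
  · rw [O_iff]
    refine ⟨fun _ => by simp [h.zero], fun ⟨i, b⟩ => ?_⟩
    fin_cases i
    · refine O_one ?_ hW
      cases b <;> simp [D_X, hd0, hd0']
    · exact O_of_nonpos (by simp) _
    · exact O_of_nonpos (by simp) _
  · convert hA using 2
    norm_num
  · exact hp.2

end Mdl

namespace SF

open MvPolynomial SF

variable {n : ℕ}

/-- The components of an affine map. -/
noncomputable def afc (e : Cn n →ₗ[ℂ] Cn n) (p : Cn n) (j : Fin n) : SF n :=
  algebraMap ℂ (SF n) (p j) + ∑ i, e (Pi.single i 1) j • X (i, false)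

theorem linearMap_apply_eq_sum (e : Cn n →ₗ[ℂ] Cn n) (x : Cn n) :
    e x = ∑ i, x i • e (Pi.single i 1) := by
  conv_lhs => rw [pi_eq_sum_univ' x]
  rw [map_sum]
  refine Finset.sum_congr rfl fun i _ => ?_
  rw [map_smul]

theorem tup_afc (e : Cn n →ₗ[ℂ] Cn n) (p x : Cn n) : tup (afc e p) x = p + e x := by
  ext j
  simp [tup, afc, linearMap_apply_eq_sum e x, mul_comm]

theorem D_afc (e : Cn n →ₗ[ℂ] Cn n) (p : Cn n) (i j : Fin n) (b : Bool) :
    D (i, b) (afc e p j) = if b then 0 else algebraMap ℂ (SF n) (e (Pi.single i 1) j) := by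
  cases b <;> simp [afc, D_X, Algebra.algebraMap_eq_smul_one]

/-- An invertible affine map as a biholomorphic map. -/
noncomputable def BiHol.affine (e : Cn n ≃ₗ[ℂ] Cn n) (p : Cn n) : BiHol n where
  c := afc e p
  d := afc e.symm (-e.symm p)
  hc i j := by simp [D_afc]
  hd i j := by simp [D_afc]
  cd j := by
    ext x
    rw [pull_apply, tup_afc, X_false]
    refine (congrFun (tup_afc (e.symm : Cn n →ₗ[ℂ] Cn n) (-e.symm p) (p + e x)) j).trans ?_
    simp
  dc j := by
    ext x
    rw [pull_apply, tup_afc, X_false]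
    refine (congrFun (tup_afc (e : Cn n →ₗ[ℂ] Cn n) p (-e.symm p + e.symm x)) j).trans ?_
    simp

end SF

theorem exists_adapted_equiv {u r : Cn 3} (hu : u ≠ 0) (hr : r ≠ 0) (h : ∑ j, u j * r j = 0) :
    ∃ e : Cn 3 ≃ₗ[ℂ] Cn 3, e (Pi.single 0 1) = u ∧ ∑ j, e (Pi.single 2 1) j * r j = 1 := by
  obtain ⟨j0, hj0⟩ := Function.ne_iff.1 hr
  let w : Cn 3 := Pi.single j0 (r j0)⁻¹
  have hw : ∑ j, w j * r j = 1 := by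
    simp [w, Pi.single_apply, inv_mul_cancel₀ hj0]
  have hind : LinearIndependent ℂ ![u, w] := by
    rw [LinearIndependent.pair_iff]
    intro s t hst
    have ht : t = 0 := by
      have e : ∑ j, (s • u + t • w) j * r j = s * ∑ j, u j * r j + t * ∑ j, w j * r j := by
        simp only [Finset.mul_sum, ← Finset.sum_add_distrib, Pi.add_apply, Pi.smul_apply,
          smul_eq_mul]
        exact Finset.sum_congr rfl fun j _ => by ring
      rw [hst, h, hw] at e
      simpa using e.symm
    subst ht
    rw [zero_smul, add_zero] at hst
    exact ⟨(smul_eq_zero.1 hst).resolve_right hu, rfl⟩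
  obtain ⟨v, hv⟩ := exists_linearIndependent_cons_of_lt_finrank (n := 2) hind (by simp)
  let b := (basisOfLinearIndependentOfCardEqFinrank hv (by simp)).reindex (Equiv.swap 0 1)
  have hb : ∀ i, b.equivFun.symm (Pi.single i 1) = b i := fun i => by
    rw [Module.Basis.equivFun_symm_apply]
    simp [Pi.single_apply]
  refine ⟨b.equivFun.symm, ?_, ?_⟩
  · rw [hb]; simp [b]
  · rw [hb]
    have : b 2 = w := by simp [b, Equiv.swap_apply_of_ne_of_ne]
    rw [this, hw]

namespace SF

open MvPolynomial SF

theorem Dat.curve {k : ℕ} {ρ : SF 3} {α : Fin 3 → SF 3} {p : Cn 3} (h : Dat k ρ α p)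
    (hα : ∃ j, α j p ≠ 0) (hρ : ∃ j, D (j, false) ρ p ≠ 0) : Curve k ρ p := by
  have ht : ∑ j, α j p * D (j, false) ρ p = 0 := by
    have := congrArg (fun f : SF 3 => f p) h.tan
    simpa [fld_false] using this
  obtain ⟨e, he, he2⟩ := exists_adapted_equiv (u := fun j => α j p)
    (r := fun j => D (j, false) ρ p) (Function.ne_iff.2 hα) (Function.ne_iff.2 hρ) ht
  have h0 : tup (BiHol.affine e p).c 0 = p := by
    refine (tup_afc (e : Cn 3 →ₗ[ℂ] Cn 3) p 0).trans ?_
    simp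
  refine Curve.of_pull (σ := BiHol.affine e p) (q := 0) ?_ h0
  have hc : ∀ j, (BiHol.affine e p).coef α j 0 = (Pi.single 0 1 : Cn 3) j := by
    intro j
    rw [BiHol.coef, pull_apply, h0, fld_false]
    have e1 : ∀ i, D (i, false) ((BiHol.affine e p).d j)
        = algebraMap ℂ (SF 3) (e.symm (Pi.single i 1) j) := fun i => by
      refine (D_afc _ _ i j false).trans ?_
      simp
    have e2 := congrFun (linearMap_apply_eq_sum (e.symm : Cn 3 →ₗ[ℂ] Cn 3) fun i => α i p) j
    have e3 : e.symm (fun i => α i p) = Pi.single 0 1 := by rw [← he, LinearEquiv.symm_apply_apply]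
    rw [← e3]
    simp only [e1, sum_apply, mul_apply, algebraMap_apply]
    refine Eq.symm (Eq.trans e2 ?_)
    simp
  refine Mdl.curve_of_normal (h.pull _ h0) ?_ ?_ ?_ ?_
  · simpa using hc 0
  · simpa using hc 1
  · simpa using hc 2
  · rw [D_pull, Fintype.sum_prod_type]
    simp [BiHol.D_conj_c]
    rw [← he2]
    refine Finset.sum_congr rfl fun j _ => ?_
    rw [h0]
    have : D (2, false) ((BiHol.affine e p).c j) = algebraMap ℂ (SF 3) (e (Pi.single 2 1) j) := by
      refine (D_afc _ _ 2 j false).trans ?_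
      simp
    rw [this, algebraMap_apply, mul_comm]

end SF

namespace SF

variable {n : ℕ}

/-- The ideal of smooth functions vanishing on `M` near `p`. -/
def zeroOn (M : Set (Cn n)) (p : Cn n) : Ideal (SF n) where
  carrier := {f | ∀ᶠ x in 𝓝 p, x ∈ M → f x = 0}
  zero_mem' := by simp
  add_mem' {f g} hf hg := by
    filter_upwards [hf, hg] with x h1 h2 hx
    simp [h1 hx, h2 hx]
  smul_mem' h f hf := by
    filter_upwards [hf] with x h1 hx
    simp [h1 hx]

variable {M : Set (Cn n)} {p : Cn n}

theorem conj_mem_zeroOn {f : SF n} (hf : f ∈ zeroOn M p) : conj f ∈ zeroOn M p := by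
  filter_upwards [hf] with x h1 hx
  simp [h1 hx]

theorem apply_eq_of_sub_mem (hp : p ∈ M) {f g : SF n} (h : f - g ∈ zeroOn M p) : f p = g p := by
  have := Filter.Eventually.self_of_nhds h hp
  rwa [SF.sub_apply, sub_eq_zero] at this

theorem exists_fderiv_eq_smul {ρ g : Cn n → ℝ} {x : Cn n} (hx : ρ x = 0)
    (hρ : HasStrictFDerivAt ρ (fderiv ℝ ρ x) x) (hd : fderiv ℝ ρ x ≠ 0)
    (hg : HasStrictFDerivAt g (fderiv ℝ g x) x) (h : ∀ᶠ y in 𝓝 x, ρ y = 0 → g y = 0) :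
    ∃ c : ℝ, fderiv ℝ g x = c • fderiv ℝ ρ x := by
  have hext : IsLocalExtrOn g {y | ρ y = ρ x} x := by
    left
    filter_upwards [nhdsWithin_le_nhds h, self_mem_nhdsWithin] with y hy hy'
    rw [h.self_of_nhds hx, hy (Eq.trans hy' hx)]
  obtain ⟨a, b, hab, e⟩ := hext.exists_multipliers_of_hasStrictFDerivAt_1d hρ hg
  have hb : b ≠ 0 := by
    rintro rfl
    rw [zero_smul, add_zero] at e
    exact hab (by simp [(smul_eq_zero.1 e).resolve_right hd])
  refine ⟨-(b⁻¹ * a), ?_⟩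
  ext u
  have e' : a * fderiv ℝ ρ x u + b * fderiv ℝ g x u = 0 := congrArg (fun T => T u) e
  change fderiv ℝ g x u = -(b⁻¹ * a) * fderiv ℝ ρ x u
  field_simp
  linarith

/-- A smooth real function, viewed as a complex-valued one. -/
noncomputable def ofReal (ρ : Cn n → ℝ) (hρ : ContDiff ℝ (⊤ : ℕ∞) ρ) : SF n :=
  mk (cx ρ) (Complex.ofRealCLM.contDiff.comp hρ)

section

variable {ρ : Cn n → ℝ} (hρ : ContDiff ℝ (⊤ : ℕ∞) ρ)

theorem ofReal_apply (x : Cn n) : ofReal ρ hρ x = ρ x := rfl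

theorem coe_ofReal : (ofReal ρ hρ : Cn n → ℂ) = cx ρ := rfl

theorem conj_ofReal : conj (ofReal ρ hρ) = ofReal ρ hρ := by
  ext x
  simp [ofReal_apply]

theorem fderiv_ofReal (x u : Cn n) : fderiv ℝ (ofReal ρ hρ) x u = fderiv ℝ ρ x u := by
  have h := (Complex.ofRealCLM.hasFDerivAt.comp x
    ((hρ.differentiable (by simp)) x).hasFDerivAt).fderiv
  exact congrArg (fun T => T u) h

theorem D_apply_of_fderiv {f : SF n} {x : Cn n} {c : ℂ}
    (h : ∀ u, fderiv ℝ f x u = c * fderiv ℝ ρ x u) (i : Fin n × Bool) :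
    D i f x = c * D i (ofReal ρ hρ) x := by
  simp only [D_eq, smul_apply, add_apply, dir_apply, h, fderiv_ofReal]
  ring

theorem exists_D_ne_zero (hd : fderiv ℝ ρ p ≠ 0) : ∃ j, D (j, false) (ofReal ρ hρ) p ≠ 0 := by
  by_contra hcon
  push Not at hcon
  apply hd
  ext u
  have h2 : ∀ j, D (j, true) (ofReal ρ hρ) p = 0 := fun j => by
    have := conj_D (j, false) (ofReal ρ hρ)
    rw [conj_ofReal, bar_mk] at this
    rw [← Bool.not_false, ← this, conj_apply, hcon, map_zero]
  have := fderiv_eq (ofReal ρ hρ) p u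
  rw [fderiv_ofReal] at this
  simpa [hcon, h2] using this

theorem field_mem_zeroOn (hreg : ∀ x, ρ x = 0 → fderiv ℝ ρ x ≠ 0)
    {V : Derivation ℂ (SF n) (SF n)} (hV : IsField V) (hVρ : V (ofReal ρ hρ) = 0) {f : SF n}
    (hf : f ∈ zeroOn {x | ρ x = 0} p) : V f ∈ zeroOn {x | ρ x = 0} p := by
  filter_upwards [eventually_eventually_nhds.2 hf] with x hx h0
  have h0' : ρ x = 0 := h0
  have hs : HasStrictFDerivAt ρ (fderiv ℝ ρ x) x :=
    hρ.contDiffAt.hasStrictFDerivAt (by simp)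
  have hf1 : HasFDerivAt (f : Cn n → ℂ) (fderiv ℝ f x) x := (f.diffAt x).hasFDerivAt
  have hre : ContDiff ℝ (⊤ : ℕ∞) (fun y => (f y).re) := Complex.reCLM.contDiff.comp f.smooth
  have him : ContDiff ℝ (⊤ : ℕ∞) (fun y => (f y).im) := Complex.imCLM.contDiff.comp f.smooth
  obtain ⟨a, ha⟩ := exists_fderiv_eq_smul (g := fun y => (f y).re) h0' hs (hreg x h0')
    (hre.contDiffAt.hasStrictFDerivAt (by simp))
    (hx.mono fun y hy h => by simp [hy h])
  obtain ⟨b, hb⟩ := exists_fderiv_eq_smul (g := fun y => (f y).im) h0' hs (hreg x h0')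
    (him.contDiffAt.hasStrictFDerivAt (by simp))
    (hx.mono fun y hy h => by simp [hy h])
  have e1 : ∀ u, (fderiv ℝ f x u).re = a * fderiv ℝ ρ x u := fun u => by
    have h1 := (Complex.reCLM.hasFDerivAt.comp x hf1).fderiv
    have h2 : fderiv ℝ (fun y => (f y).re) x u = (fderiv ℝ f x u).re :=
      congrArg (fun T => T u) h1
    rw [← h2, ha]; rfl
  have e2 : ∀ u, (fderiv ℝ f x u).im = b * fderiv ℝ ρ x u := fun u => by
    have h1 := (Complex.imCLM.hasFDerivAt.comp x hf1).fderiv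
    have h2 : fderiv ℝ (fun y => (f y).im) x u = (fderiv ℝ f x u).im :=
      congrArg (fun T => T u) h1
    rw [← h2, hb]; rfl
  have e3 : ∀ u, fderiv ℝ f x u = (⟨a, b⟩ : ℂ) * fderiv ℝ ρ x u := fun u => by
    apply Complex.ext <;> simp [e1, e2]
  have h3 := congrArg (fun g : SF n => g x) hVρ
  simp only [hV (ofReal ρ hρ), sum_apply, mul_apply, zero_apply] at h3
  rw [hV]
  simp only [sum_apply, mul_apply, D_apply_of_fderiv hρ e3]
  have : ∀ i, V (X i) x * ((⟨a, b⟩ : ℂ) * D i (ofReal ρ hρ) x)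
      = (⟨a, b⟩ : ℂ) * (V (X i) x * D i (ofReal ρ hρ) x) := fun i => by ring
  simp only [this, ← Finset.mul_sum, h3, mul_zero]

end

/-- All words of length less than `s` in operators from `S` vanish at `p`. -/
def WordsVanish (S : Set (Derivation ℂ (SF n) (SF n))) (p : Cn n) (s : ℕ) (f : SF n) : Prop :=
  ∀ l : List (Derivation ℂ (SF n) (SF n)), l.length < s → (∀ V ∈ l, V ∈ S) →
    l.foldl (fun g V => V g) f p = 0

theorem foldl_add (l : List (Derivation ℂ (SF n) (SF n))) (f g : SF n) :
    l.foldl (fun g V => V g) (f + g) = l.foldl (fun g V => V g) f + l.foldl (fun g V => V g) g := by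
  induction l generalizing f g with
  | nil => rfl
  | cons V l ih => simp [ih]

theorem WordsVanish.mul {S : Set (Derivation ℂ (SF n) (SF n))} {s : ℕ} {f : SF n}
    (hf : WordsVanish S p s f) (h : SF n) : WordsVanish S p s (h * f) := by
  induction s generalizing f h with
  | zero => intro l hl; omega
  | succ s ih =>
    intro l hl hS
    cases l with
    | nil =>
      have := hf [] (by simp) (by simp)
      simp at this
      simp [this]
    | cons V l =>
      rw [List.foldl_cons, Derivation.leibniz, foldl_add, add_apply, smul_eq_mul, smul_eq_mul,
        mul_comm f]
      simp only [List.length_cons, List.mem_cons, forall_eq_or_imp] at hl hS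
      have h1 : WordsVanish S p s (V f) := fun l' hl' hS' =>
        hf (V :: l') (by simp; omega) (by simpa using ⟨hS.1, hS'⟩)
      have h2 : WordsVanish S p s f := fun l' hl' hS' => hf l' (by omega) hS'
      rw [ih h1 h l (by omega) hS.2, ih h2 _ l (by omega) hS.2, add_zero]

theorem lw_eq_foldl (l : Bool → Derivation ℂ (SF n) (SF n)) (w : List Bool) (f : SF n) :
    lw l w f = (w.reverse.map l).foldl (fun g V => V g) f := by
  induction w with
  | nil => rfl
  | cons b w ih => simp [lw, ih]

end SF

namespace SF

variable {n : ℕ}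

/-- The complex vector field with the coefficients of a derivation. -/
noncomputable def toCVF (V : Derivation ℂ (SF n) (SF n)) : CVF n where
  hol j := V (X (j, false))
  anti j := V (X (j, true))

theorem toCVF_act {V : Derivation ℂ (SF n) (SF n)} (hV : IsField V) (f : SF n) :
    (toCVF V).act f = V f := by
  funext x
  rw [hV, sum_apply, Fintype.sum_prod_type]
  simp only [Fintype.sum_bool, mul_apply, CVF.act, toCVF, D_false, D_true,
    Finset.sum_add_distrib]
  ring

theorem toCVF_lie {V W : Derivation ℂ (SF n) (SF n)} (hV : IsField V) (hW : IsField W) :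
    toCVF ⁅V, W⁆ = (toCVF V).bracket (toCVF W) := by
  simp only [CVF.bracket]
  rw [toCVF, CVF.mk.injEq]
  constructor <;> funext j x
  · change _ = (toCVF V).act (W (X (j, false))) x - (toCVF W).act (V (X (j, false))) x
    rw [toCVF_act hV, toCVF_act hW]; rfl
  · change _ = (toCVF V).act (W (X (j, true))) x - (toCVF W).act (V (X (j, true))) x
    rw [toCVF_act hV, toCVF_act hW]; rfl

theorem pairDRho_toCVF {ρ : Cn n → ℝ} (hρ : ContDiff ℝ (⊤ : ℕ∞) ρ)
    (V : Derivation ℂ (SF n) (SF n)) (p : Cn n) :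
    pairDRho ρ (toCVF V) p = pair (ofReal ρ hρ) V p := by
  simp only [pairDRho, pair, sum_apply, mul_apply, D_false]; rfl

theorem inM1_fld (a : Fin n → SF n) (h : SF n) (b : Bool) :
    InM1 (fun j => (a j : Cn n → ℂ)) (toCVF (fld (fun j => h * a j) b)) := by
  cases b
  · refine ⟨h, fun _ => 0, h.smooth, contDiff_const, fun j x => ?_, fun j x => ?_⟩
    · simp [toCVF]
    · simp [toCVF]
  · refine ⟨fun _ => 0, conj h, contDiff_const, (conj h).smooth, fun j x => ?_, fun j x => ?_⟩
    · simp [toCVF]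
    · simp [toCVF]

theorem isCommOf_Zw (a : Fin n → SF n) (h : SF n) (w : List Bool) :
    IsCommOf (fun j => (a j : Cn n → ℂ)) (w.length + 2) (toCVF (Zw (fun j => h * a j) w)) := by
  induction w with
  | nil =>
    rw [Zw, toCVF_lie (isField_fld _ _) (isField_fld _ _)]
    exact .succ _ _ (inM1_fld a h _) (.one _ (inM1_fld a h _))
  | cons b w ih =>
    rw [Zw, toCVF_lie (isField_fld _ _) (isField_Zw _ _)]
    exact .succ _ _ (inM1_fld a h _) ih

theorem foldl_act (l : List (Derivation ℂ (SF n) (SF n))) (hl : ∀ V ∈ l, IsField V) (f : SF n) :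
    (l.map toCVF).foldl (fun g W => W.act g) (f : Cn n → ℂ) = l.foldl (fun g V => V g) f := by
  induction l generalizing f with
  | nil => rfl
  | cons V l ih =>
    simp only [List.mem_cons, forall_eq_or_imp] at hl
    rw [List.map_cons, List.foldl_cons, toCVF_act hl.1, ih hl.2]; rfl

theorem le_tType_iff {ρ : Cn n → ℝ} {a : Fin n → Cn n → ℂ} {p : Cn n} {k : ℕ} :
    (k : ℕ∞) ≤ tType ρ a p ↔ ∀ μ < k, ∀ G, IsCommOf a μ G → pairDRho ρ G p = 0 := by
  rw [tType, le_sInf_iff]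
  constructor
  · intro h μ hμ G hG
    by_contra hne
    have := h μ ⟨μ, rfl, G, hG, hne⟩
    exact absurd (Nat.cast_le.1 this) (by omega)
  · rintro h m ⟨μ, rfl, G, hG, hne⟩
    by_contra hlt
    exact hne (h μ (by simpa using hlt) G hG)

theorem le_cType_iff {ρ : Cn n → ℝ} {a : Fin n → Cn n → ℂ} {p : Cn n} {k : ℕ} :
    (k : ℕ∞) ≤ cType ρ a p ↔ ∀ Ws : List (CVF n), Ws.length + 3 ≤ k → (∀ W ∈ Ws, InM1 a W) →
      Ws.foldl (fun g W => W.act g) (levi ρ a a) p = 0 := by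
  rw [cType, nuL]
  constructor
  · intro h Ws hl hW
    by_contra hne
    have h1 : sInf {m : ℕ∞ | ∃ Ws : List (CVF n), (Ws.length : ℕ∞) = m ∧ (∀ W ∈ Ws, InM1 a W) ∧
      (Ws.foldl (fun g W => W.act g) (levi ρ a a)) p ≠ 0} ≤ Ws.length :=
      sInf_le ⟨Ws, rfl, hW, hne⟩
    have h2 := h.trans (add_le_add le_rfl h1)
    have h3 : ((k : ℕ) : ℕ∞) ≤ ((2 + Ws.length : ℕ) : ℕ∞) := by exact_mod_cast h2
    exact absurd (Nat.cast_le.1 h3) (by omega)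
  · intro h
    set S := {m : ℕ∞ | ∃ Ws : List (CVF n), (Ws.length : ℕ∞) = m ∧ (∀ W ∈ Ws, InM1 a W) ∧
      (Ws.foldl (fun g W => W.act g) (levi ρ a a)) p ≠ 0} with hS
    by_contra hlt
    rcases S.eq_empty_or_nonempty with he | hne
    · rw [he, sInf_empty] at hlt
      exact hlt (by simp)
    · obtain ⟨Ws, hl, hW, hne⟩ := csInf_mem hne
      refine hne (h Ws ?_ hW)
      rw [← hl] at hlt
      have h4 : ((2 + Ws.length : ℕ) : ℕ∞) < k := by
        push_cast
        exact not_le.1 hlt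
      have := Nat.cast_lt.1 h4
      omega

theorem leviCoeff_eq {ρ : Cn n → ℝ} (hρ : ContDiff ℝ (⊤ : ℕ∞) ρ) (j l : Fin n) (x : Cn n) :
    leviCoeff ρ j l x = D (j, false) (D (l, true) (ofReal ρ hρ)) x := by
  have : wzb l (cx ρ) = D (l, true) (ofReal ρ hρ) := by
    funext y; rw [D_true]; rfl
  rw [leviCoeff, this, D_false]

/-- The Levi form of a field, as a smooth function. -/
noncomputable def levi (ρ : SF n) (a : Fin n → SF n) : SF n :=
  ∑ j, ∑ l, D (j, false) (D (l, true) ρ) * (a j * conj (a l))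

theorem coe_levi {ρ : Cn n → ℝ} (hρ : ContDiff ℝ (⊤ : ℕ∞) ρ) (a : Fin n → SF n) :
    _root_.levi ρ (fun j => a j) (fun j => a j) = levi (ofReal ρ hρ) a := by
  funext x
  simp [_root_.levi, levi, leviCoeff_eq hρ, mul_assoc]

theorem fld_sub_mem {I : Ideal (SF n)} {α β : Fin n → SF n}
    (h : ∀ j, α j - β j ∈ I) (hc : ∀ j, conj (α j) - conj (β j) ∈ I) (b : Bool) (f : SF n) :
    fld α b f - fld β b f ∈ I := by
  cases b
  · rw [fld_false, fld_false, ← Finset.sum_sub_distrib]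
    refine sum_mem fun j _ => ?_
    rw [← sub_mul]
    exact I.mul_mem_right _ (h j)
  · rw [fld_true, fld_true, ← Finset.sum_sub_distrib]
    refine sum_mem fun j _ => ?_
    rw [← sub_mul]
    exact I.mul_mem_right _ (hc j)

section

variable {I : Ideal (SF n)} {α β : Fin n → SF n} {ρ : SF n}
  (hI : ∀ V : Derivation ℂ (SF n) (SF n), IsField V → V ρ = 0 → ∀ f ∈ I, V f ∈ I)
  (h : ∀ j, α j - β j ∈ I) (hc : ∀ j, conj (α j) - conj (β j) ∈ I) (ht : ∀ b, fld α b ρ = 0)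
include hI h hc ht

theorem lw_sub_mem (w : List Bool) {f g : SF n} (hfg : f - g ∈ I) :
    lw (fld α) w f - lw (fld β) w g ∈ I := by
  induction w with
  | nil => exact hfg
  | cons b w ih =>
    have h1 := hI _ (isField_fld α b) (ht b) _ ih
    have h2 := fld_sub_mem h hc b (lw (fld β) w g)
    rw [map_sub] at h1
    simpa [lw] using add_mem h1 h2

omit h hc ht in
theorem lie_sub_mem {V V' W W' : Derivation ℂ (SF n) (SF n)} (hV : IsField V) (hV' : IsField V')
    (hW : IsField W) (hW' : IsField W') (hVρ : V ρ = 0) (hWρ : W ρ = 0)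
    (h1 : ∀ i, V (X i) - V' (X i) ∈ I) (h2 : ∀ i, W (X i) - W' (X i) ∈ I) (i : Fin n × Bool) :
    ⁅V, W⁆ (X i) - ⁅V', W'⁆ (X i) ∈ I := by
  have key : ∀ {A B : Derivation ℂ (SF n) (SF n)}, IsField A → IsField B →
      (∀ i, A (X i) - B (X i) ∈ I) → ∀ f, A f - B f ∈ I := fun hA hB hAB f => by
    rw [hA f, hB f, ← Finset.sum_sub_distrib]
    refine sum_mem fun j _ => ?_
    rw [← sub_mul]
    exact I.mul_mem_right _ (hAB j)
  have e1 := hI V hV hVρ _ (h2 i)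
  have e2 := hI W hW hWρ _ (h1 i)
  have e3 := key hV hV' h1 (W' (X i))
  have e4 := key hW hW' h2 (V' (X i))
  rw [map_sub] at e1 e2
  rw [Derivation.commutator_apply, Derivation.commutator_apply]
  have := sub_mem (add_mem e1 e3) (add_mem e2 e4)
  convert this using 1
  ring

theorem Zw_sub_mem (w : List Bool) : Zw α w ρ = 0 ∧ ∀ i, Zw α w (X i) - Zw β w (X i) ∈ I := by
  induction w with
  | nil =>
    refine ⟨by rw [Zw, Derivation.commutator_apply, ht, ht, map_zero, map_zero, sub_zero], ?_⟩
    exact lie_sub_mem hI (isField_fld _ _) (isField_fld _ _) (isField_fld _ _)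
      (isField_fld _ _) (ht _) (ht _) (fun i => fld_sub_mem h hc _ _)
      fun i => fld_sub_mem h hc _ _
  | cons b w ih =>
    refine ⟨by rw [Zw, Derivation.commutator_apply, ht, ih.1, map_zero, map_zero, sub_zero], ?_⟩
    exact lie_sub_mem hI (isField_fld _ _) (isField_fld _ _) (isField_Zw _ _)
      (isField_Zw _ _) (ht _) ih.1 (fun i => fld_sub_mem h hc _ _) ih.2

end

theorem curve_of_type {k : ℕ} {ρ : Cn 3 → ℝ} (hρ : ContDiff ℝ (⊤ : ℕ∞) ρ)
    (hreg : ∀ x, ρ x = 0 → fderiv ℝ ρ x ≠ 0) (hpsc : Pseudoconvex ρ {x | ρ x = 0})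
    {p : Cn 3} (hp : ρ p = 0) {a : Fin 3 → Cn 3 → ℂ} (ha : ∀ j, ContDiff ℝ (⊤ : ℕ∞) (a j))
    (hat : ∀ᶠ x in 𝓝 p, x ∈ {x | ρ x = 0} → ∑ j, a j x * wz j (cx ρ) x = 0)
    (ha0 : (fun j => a j p) ≠ 0) (hk : k ≤ tType ρ a p ∨ k ≤ cType ρ a p) :
    Curve k (ofReal ρ hρ) p := by
  classical
  set r := ofReal ρ hρ with hr
  obtain ⟨a', rfl⟩ : ∃ a' : Fin 3 → SF 3, a = fun j => ⇑(a' j) := ⟨fun j => mk (a j) (ha j), rfl⟩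
  obtain ⟨i, hi⟩ := exists_D_ne_zero hρ (hreg p hp)
  let β : Fin 3 → SF 3 := fun j => D (i, false) r * a' j
  let α : Fin 3 → SF 3 := fun j => β j - if j = i then ∑ l, a' l * D (l, false) r else 0
  have hs : ∑ l, a' l * D (l, false) r ∈ zeroOn {x | ρ x = 0} p := by
    filter_upwards [hat] with x hx h0
    simpa [D_false, hr, coe_ofReal] using hx h0
  have h1 : ∀ j, α j - β j ∈ zeroOn {x | ρ x = 0} p := fun j => by
    have : α j - β j = -(if j = i then ∑ l, a' l * D (l, false) r else 0) := by simp [α]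
    rw [this]
    refine neg_mem ?_
    split_ifs
    · exact hs
    · exact zero_mem _
  have hc : ∀ j, conj (α j) - conj (β j) ∈ zeroOn {x | ρ x = 0} p := fun j => by
    rw [← map_sub]; exact conj_mem_zeroOn (h1 j)
  have htan : fld α false r = 0 := by
    rw [fld_false]
    simp only [α, β, sub_mul, Finset.sum_sub_distrib, ite_mul, zero_mul, Finset.sum_ite_eq',
      Finset.mem_univ, if_true, mul_assoc, ← Finset.mul_sum]
    ring
  have ht : ∀ b, fld α b r = 0 := by
    intro b
    cases b
    · exact htan
    · have := conj_fld α false r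
      rw [htan, map_zero, hr, conj_ofReal] at this
      exact this.symm
  have hI : ∀ V : Derivation ℂ (SF 3) (SF 3), IsField V → V r = 0 →
      ∀ f ∈ zeroOn {x | ρ x = 0} p, V f ∈ zeroOn {x | ρ x = 0} p :=
    fun V hV hV0 f hf => field_mem_zeroOn hρ hreg hV hV0 hf
  have hdat : Dat k r α p := by
    refine ⟨conj_ofReal hρ, by rw [hr, ofReal_apply, hp, Complex.ofReal_zero], ?_, htan, ?_⟩
    · intro x hx ξ hξ
      have hx' : ρ x = 0 := by rw [hr, ofReal_apply] at hx; exact_mod_cast hx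
      have := hpsc x hx' ξ (by simpa [D_false, hr, coe_ofReal] using hξ)
      simpa only [leviCoeff_eq hρ] using this
    · rcases hk with hk | hk
      · left
        intro w hw
        have h2 := le_tType_iff.1 hk (w.length + 2) (by omega) _ (isCommOf_Zw a' (D (i, false) r) w)
        rw [pairDRho_toCVF hρ] at h2
        refine Eq.trans (apply_eq_of_sub_mem (M := {x | ρ x = 0}) hp ?_) h2
        simp only [pair]
        rw [← Finset.sum_sub_distrib]
        refine sum_mem fun j _ => ?_
        rw [← sub_mul]
        exact Ideal.mul_mem_right _ _ ((Zw_sub_mem hI h1 hc ht w).2 _)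
      · right
        intro w hw
        have h2 := le_cType_iff.1 hk
        rw [coe_levi hρ] at h2
        have h3 : WordsVanish (Set.range (fld β)) p (k - 2) (levi r a') := by
          intro l hl hS
          have := h2 (l.map toCVF) (by simp; omega) ?_
          · rwa [foldl_act] at this
            intro V hV
            obtain ⟨b, rfl⟩ := hS V hV
            exact isField_fld _ _
          · intro W hW
            obtain ⟨V, hV, rfl⟩ := List.mem_map.1 hW
            obtain ⟨b, rfl⟩ := hS V hV
            exact inM1_fld a' _ b
        have h4 := h3.mul (D (i, false) r * conj (D (i, false) r)) (w.reverse.map (fld β))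
          (by simp; omega) (fun V hV => by
            obtain ⟨b, -, rfl⟩ := List.mem_map.1 hV
            exact ⟨b, rfl⟩)
        rw [← lw_eq_foldl] at h4
        refine Eq.trans (apply_eq_of_sub_mem (M := {x | ρ x = 0}) hp (lw_sub_mem hI h1 hc ht w ?_)) h4
        rw [pair_Zw_nil htan]
        have : D (i, false) r * conj (D (i, false) r) * levi r a' = levi r β := by
          simp only [levi, β, Finset.mul_sum, map_mul]
          refine Finset.sum_congr rfl fun j _ => Finset.sum_congr rfl fun l _ => ?_
          ring
        rw [this, levi, ← Finset.sum_sub_distrib]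
        refine sum_mem fun j _ => ?_
        rw [← Finset.sum_sub_distrib]
        refine sum_mem fun l _ => ?_
        rw [← mul_sub]
        refine Ideal.mul_mem_left _ _ ?_
        have := add_mem (Ideal.mul_mem_right (conj (α l)) _ (h1 j)) (Ideal.mul_mem_left _ (β j) (hc l))
        convert this using 1
        ring
  refine hdat.curve ?_ ⟨i, hi⟩
  obtain ⟨j, hj⟩ := Function.ne_iff.1 ha0
  refine ⟨j, ?_⟩
  rw [apply_eq_of_sub_mem (M := {x | ρ x = 0}) hp (h1 j)]
  exact mul_ne_zero hi hj

end SF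

namespace SF

variable {n : ℕ}

/-- The plane as one-dimensional complex space. -/
noncomputable def isoOne : Cn 1 ≃ₗᵢ[ℝ] ℂ where
  toLinearEquiv := LinearEquiv.funUnique (Fin 1) ℝ ℂ
  norm_map' x := by simp [Pi.norm_def, LinearEquiv.funUnique]

theorem le_ordAt_iff {g : ℂ → ℝ} {k : ℕ} :
    (k : ℕ∞) ≤ ordAt g ↔ ∀ i < k, iteratedFDeriv ℝ i g 0 = 0 := by
  rw [ordAt, le_sInf_iff]
  constructor
  · intro h i hi
    by_contra hne
    have := h i ⟨i, rfl, hne⟩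
    exact absurd (Nat.cast_le.1 this) (by omega)
  · rintro h m ⟨i, rfl, hne⟩
    by_contra hlt
    exact hne (h i (by simpa using hlt))

theorem O_one_iff_ordAt {f : SF 1} {g : ℂ → ℝ} (hg : ContDiffAt ℝ (⊤ : ℕ∞) g 0)
    (h : ∀ᶠ x in 𝓝 0, f x = g (x 0)) {k : ℕ} :
    O (fun _ => 1) k f ↔ (k : ℕ∞) ≤ ordAt g := by
  rw [O_one_iff, le_ordAt_iff]
  refine forall₂_congr fun i _ => ?_
  have e : (f : Cn 1 → ℂ) =ᶠ[𝓝 0] Complex.ofRealLI ∘ (g ∘ isoOne) := h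
  have h1 : ContDiffAt ℝ (⊤ : ℕ∞) (g ∘ isoOne) 0 :=
    ContDiffAt.comp (0 : Cn 1) (by simpa using hg) isoOne.contDiff.contDiffAt
  rw [(e.iteratedFDeriv ℝ i).self_of_nhds, ← norm_eq_zero,
    LinearIsometry.norm_iteratedFDeriv_comp_left _ h1 (by exact_mod_cast le_top),
    LinearIsometryEquiv.norm_iteratedFDeriv_comp_right, map_zero, norm_eq_zero]

theorem hasDerivAt_of_holomorphic {c : SF 1} (hc : D (0, true) c = 0) (ζ : ℂ) :
    HasDerivAt (fun ζ => c fun _ => ζ) (D (0, false) c fun _ => ζ) ζ := by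
  have h1 : HasFDerivAt (fun ζ : ℂ => c (isoOne.symm ζ))
      ((fderiv ℝ c (isoOne.symm ζ)).comp
        (isoOne.symm.toContinuousLinearEquiv : ℂ →L[ℝ] Cn 1)) ζ :=
    (c.diffAt _).hasFDerivAt.comp ζ isoOne.symm.toContinuousLinearEquiv.hasFDerivAt
  have h2 := hasFDerivAt_of_restrictScalars (f' := ContinuousLinearMap.toSpanSingleton ℂ
    (D (0, false) c (isoOne.symm ζ))) ℝ h1 (by
      ext1 u
      change u * _ = fderiv ℝ c (isoOne.symm ζ) (isoOne.symm u)
      rw [fderiv_eq]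
      simp only [Finset.univ_unique, Fin.default_eq_zero, Finset.sum_singleton, hc, zero_apply,
        mul_zero, add_zero]
      rfl)
  exact hasDerivAt_iff_hasFDerivAt.2 h2

theorem Curve.exists_analytic {k : ℕ} {ρ : Cn n → ℝ} (hρ : ContDiff ℝ (⊤ : ℕ∞) ρ) {p : Cn n}
    (h : Curve k (ofReal ρ hρ) p) : ∃ φ : ℂ → Cn n, AnalyticAt ℂ φ 0 ∧ φ 0 = p ∧
      fderiv ℂ φ 0 ≠ 0 ∧ (k : ℕ∞) ≤ ordAt (fun ξ => ρ (φ ξ)) := by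
  obtain ⟨c, hc, hp, ⟨j, hj⟩, hO⟩ := h
  have hd : ∀ ζ, HasDerivAt (fun ζ => tup c fun _ => ζ) (fun i => D (0, false) (c i) fun _ => ζ) ζ :=
    fun ζ => hasDerivAt_pi.2 fun i => hasDerivAt_of_holomorphic (hc i) ζ
  have ha : AnalyticAt ℂ (fun ζ => tup c fun _ => ζ) 0 :=
    Differentiable.analyticAt (fun ζ => (hd ζ).differentiableAt) 0
  refine ⟨_, ha, hp, fun h0 => hj ?_, ?_⟩
  · have h1 := (hd 0).hasFDerivAt.fderiv
    rw [h0] at h1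
    have := congrFun (congrArg (fun T => T 1) h1) j
    simp only [ContinuousLinearMap.toSpanSingleton_apply, one_smul] at this
    exact this.symm
  · refine (O_one_iff_ordAt (f := pull c (ofReal ρ hρ)) ?_ (Filter.Eventually.of_forall fun x => ?_)).1 hO
    · exact hρ.contDiffAt.comp _ (ha.contDiffAt.restrict_scalars ℝ)
    · have : (fun _ => x 0) = x := by ext i; fin_cases i; rfl
      rw [pull_apply, this]; rfl

theorem exists_eventuallyEq {f : Cn n → ℂ} {p : Cn n}
    (hf : ∀ᶠ x in 𝓝 p, ContDiffAt ℝ (⊤ : ℕ∞) f x) : ∃ F : SF n, ∀ᶠ x in 𝓝 p, F x = f x := by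
  obtain ⟨r, hr, h⟩ := Metric.eventually_nhds_iff_ball.1 hf
  let χ : ContDiffBump p := ⟨r / 3, r / 2, by positivity, by linarith⟩
  refine ⟨mk (fun x => (χ x : ℂ) * f x) ?_, ?_⟩
  · refine contDiff_iff_contDiffAt.2 fun x => ?_
    by_cases hx : x ∈ Metric.ball p r
    · exact (Complex.ofRealCLM.contDiff.contDiffAt.comp x χ.contDiffAt).mul (h x hx)
    · have h0 : x ∉ tsupport χ := by
        rw [χ.tsupport_eq]
        intro hx'
        refine hx (Metric.closedBall_subset_ball ?_ hx')
        change r / 2 < r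
        linarith
      have h1 : (fun x => (χ x : ℂ) * f x) =ᶠ[𝓝 x] fun _ => 0 := by
        filter_upwards [notMem_tsupport_iff_eventuallyEq.1 h0] with y hy
        simp [hy]
      exact contDiffAt_const.congr_of_eventuallyEq h1
  · filter_upwards [χ.eventuallyEq_one] with x hx
    simp [hx]

theorem D_eventuallyEq {f g : SF n} {p : Cn n} (h : ∀ᶠ x in 𝓝 p, f x = g x) (i : Fin n × Bool) :
    ∀ᶠ x in 𝓝 p, D i f x = D i g x := by
  filter_upwards [Filter.EventuallyEq.fderiv (𝕜 := ℝ) h] with x hx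
  simp only [D_eq, smul_apply, add_apply, dir_apply, hx]

theorem O_of_eventually_eq_zero {w : Fin n → ℕ} {f : SF n} (h : ∀ᶠ x in 𝓝 0, f x = 0) (s : ℤ) :
    O w s f := by
  intro l hl
  clear hl
  induction l generalizing f with
  | nil => exact h.self_of_nhds
  | cons i l ih =>
    refine ih ?_
    have := D_eventuallyEq (g := 0) h i
    simpa using this

end SF

namespace SF

variable {n : ℕ}

/-- Vanishing order at the origin of `ℂ`. -/
abbrev O₁ (s : ℤ) (f : SF 1) : Prop := O (fun _ => 1) s f

theorem O.D₁ {s : ℤ} {f : SF 1} (h : O₁ s f) (b : Bool) : O₁ (s - 1) (SF.D (0, b) f) := by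
  simpa using O.D h (0, b)

theorem IsField.O₁ {P : Derivation ℂ (SF 1) (SF 1)} (hP : IsField P) {s : ℤ} {f : SF 1}
    (h : O₁ s f) : O₁ (s - 1) (P f) := by
  rw [hP]
  exact O_sum fun i _ => ((by simpa using O.D h i : SF.O₁ (s - 1) (SF.D i f))).mul_left _

theorem IsField.add {V W : Derivation ℂ (SF n) (SF n)} (hV : IsField V) (hW : IsField W) :
    IsField (V + W) := fun f => by
  simp only [Derivation.add_apply, add_mul, Finset.sum_add_distrib]
  rw [hV f, hW f]

theorem IsField.smul {V : Derivation ℂ (SF n) (SF n)} (hV : IsField V) (g : SF n) :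
    IsField (g • V) := fun f => by
  simp only [Derivation.smul_apply, smul_eq_mul]
  rw [hV f, Finset.mul_sum]
  simp only [mul_assoc]

theorem isField_D (i : Fin n × Bool) : IsField (D i) := fun f => by
  simp [D_X]

/-- The field `V` is, along the curve `c`, tangent to order `s` to the curve, where it induces `P`. -/
def Rel (c : Fin n → SF 1) (s : ℤ) (V : Derivation ℂ (SF n) (SF n))
    (P : Derivation ℂ (SF 1) (SF 1)) : Prop :=
  ∀ f, O₁ s (pull c (V f) - P (pull c f))

section

variable {c : Fin n → SF 1} {s t : ℤ} {V W : Derivation ℂ (SF n) (SF n)}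
  {P Q : Derivation ℂ (SF 1) (SF 1)}

theorem Rel.mono (h : Rel c s V P) (hts : t ≤ s) : Rel c t V P := fun f => (h f).mono hts

theorem Rel.add (hV : Rel c s V P) (hW : Rel c s W Q) : Rel c s (V + W) (P + Q) := fun f => by
  have := (hV f).add (hW f)
  convert this using 1
  simp only [Derivation.add_apply, map_add]
  ring

theorem Rel.smul (hV : Rel c s V P) (g : SF n) : Rel c s (g • V) (pull c g • P) := fun f => by
  have := (hV f).mul_left (pull c g)
  convert this using 1
  simp only [Derivation.smul_apply, smul_eq_mul, map_mul]
  ring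

theorem Rel.lie (hP : IsField P) (hQ : IsField Q) (hV : Rel c s V P) (hW : Rel c t W Q)
    (hts : t ≤ s) : Rel c (t - 1) ⁅V, W⁆ ⁅P, Q⁆ := fun f => by
  have h1 := (hV (W f)).mono (show t - 1 ≤ s by omega)
  have h2 := hP.O₁ (hW f)
  have h3 := (hW (V f)).mono (show t - 1 ≤ t by omega)
  have h4 := (hQ.O₁ (hV f)).mono (show t - 1 ≤ s - 1 by omega)
  have := (h1.add h2).sub (h3.add h4)
  convert this using 1
  simp only [Derivation.commutator_apply, map_sub]
  ring

theorem Rel.conj {α : Fin n → SF n} {u : SF 1} (h : Rel c s (fld α false) (u • D (0, false))) :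
    Rel c s (fld α true) (SF.conj u • D (0, true)) := fun f => by
  have := (h (SF.conj f)).conj
  convert this using 1
  simp only [map_sub, Derivation.smul_apply, smul_eq_mul, map_mul, conj_D, pull_conj, conj_conj,
    bar_mk, Bool.not_false]
  rw [← pull_conj, conj_fld]
  simp

theorem Rel.foldl {l : List (Derivation ℂ (SF n) (SF n))}
    (hl : ∀ V ∈ l, ∃ P, IsField P ∧ Rel c s V P) {f : SF n} (hts : t ≤ s + 1)
    (hf : O₁ t (pull c f)) :
    O₁ (t - l.length) (pull c (l.foldl (fun g V => V g) f)) := by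
  induction l generalizing f t with
  | nil => simpa using hf
  | cons V l ih =>
    simp only [List.mem_cons, forall_eq_or_imp] at hl
    obtain ⟨⟨P, hP, hV⟩, hl⟩ := hl
    have h1 : O₁ (t - 1) (pull c (V f)) := by
      have := ((hV f).mono (show t - 1 ≤ s by omega)).add (hP.O₁ hf)
      simpa using this
    refine (ih hl (by omega) h1).mono ?_
    simp only [List.length_cons]
    push_cast
    omega

end

/-- A formal holomorphic curve `c` through `p` with order of contact `k`, together with an
extension `v` of its velocity. -/
structure Param (k : ℤ) (r : SF n) (c : Fin n → SF 1) (v : Fin n → SF n) (p : Cn n) : Prop where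
  holo : ∀ j, O₁ k (D (0, true) (c j))
  base : tup c 0 = p
  ne : ∃ j, D (0, false) (c j) 0 ≠ 0
  velocity : ∀ j, O₁ k (pull c (v j) - D (0, false) (c j))
  contact : O₁ k (pull c r)

/-- The projection of `v` to the tangent space of `r = 0` along the `j₁` coordinate direction. -/
noncomputable def tang (r : SF n) (v : Fin n → SF n) (j₁ : Fin n) (i : Fin n) : SF n :=
  D (j₁, false) r * v i - if i = j₁ then ∑ l, v l * D (l, false) r else 0

theorem fld_tang (r : SF n) (v : Fin n → SF n) (j₁ : Fin n) : fld (tang r v j₁) false r = 0 := by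
  simp only [fld_false, tang, sub_mul, ite_mul, zero_mul, Finset.sum_sub_distrib,
    Finset.sum_ite_eq', Finset.mem_univ, if_true, Finset.sum_mul]
  rw [sub_eq_zero]
  exact Finset.sum_congr rfl fun i _ => by ring

namespace Param

variable {k : ℤ} {r : SF n} {c : Fin n → SF 1} {v : Fin n → SF n} {p : Cn n}

theorem D_pull_sub (h : Param k r c v p) (f : SF n) :
    O₁ k (D (0, false) (pull c f) - ∑ j, pull c (D (j, false) f) * D (0, false) (c j)) := by
  rw [D_pull, Fintype.sum_prod_type]
  simp only [Fintype.sum_bool, pull_X_false, pull_X_true, Finset.sum_add_distrib, add_sub_cancel_right]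
  refine O_sum fun j _ => O.mul_left ?_ _
  simpa [conj_D] using (h.holo j).conj

theorem sum_velocity (h : Param k r c v p) :
    O₁ (k - 1) (∑ j, pull c (D (j, false) r) * D (0, false) (c j)) := by
  have := (h.contact.D₁ false).sub ((h.D_pull_sub r).mono (show k - 1 ≤ k by omega))
  simpa using this

theorem pull_sum (h : Param k r c v p) :
    O₁ (k - 1) (pull c (∑ l, v l * D (l, false) r)) := by
  have h1 : O₁ (k - 1) (∑ l, pull c (D (l, false) r) * (pull c (v l) - D (0, false) (c l))) :=
    O_sum fun l _ => ((h.velocity l).mono (by omega)).mul_left _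
  convert h1.add h.sum_velocity using 1
  rw [map_sum, ← Finset.sum_add_distrib]
  refine Finset.sum_congr rfl fun l _ => ?_
  rw [map_mul]
  ring

theorem pull_tang (h : Param k r c v p) (j₁ i : Fin n) :
    O₁ (k - 1) (pull c (tang r v j₁ i) - pull c (D (j₁, false) r) * D (0, false) (c i)) := by
  have h1 := ((h.velocity i).mono (show k - 1 ≤ k by omega)).mul_left (pull c (D (j₁, false) r))
  have h2 : O₁ (k - 1) (pull c (if i = j₁ then ∑ l, v l * D (l, false) r else 0)) := by
    split_ifs
    · exact h.pull_sum
    · rw [map_zero]; exact O_zero _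
  convert h1.sub h2 using 1
  simp only [tang, map_sub, map_mul]
  ring

theorem rel_false (h : Param k r c v p) (j₁ : Fin n) :
    Rel c (k - 1) (fld (tang r v j₁) false) (pull c (D (j₁, false) r) • D (0, false)) := by
  intro f
  have h1 : O₁ (k - 1) (∑ i, pull c (D (i, false) f) * (pull c (tang r v j₁ i) -
      pull c (D (j₁, false) r) * D (0, false) (c i))) :=
    O_sum fun i _ => (h.pull_tang j₁ i).mul_left _
  have h2 := ((h.D_pull_sub f).mono (show k - 1 ≤ k by omega)).mul_left (pull c (D (j₁, false) r))
  convert h1.sub h2 using 1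
  simp only [fld_false, map_sum, map_mul, Derivation.smul_apply, smul_eq_mul, mul_sub,
    Finset.sum_sub_distrib, Finset.mul_sum]
  have : ∀ i, pull c (D (i, false) f) * (pull c (D (j₁, false) r) * D (0, false) (c i)) =
    pull c (D (j₁, false) r) * (pull c (D (i, false) f) * D (0, false) (c i)) := fun i => by ring
  simp only [this, mul_comm (pull c (tang r v j₁ _))]
  ring

theorem levi_eq {α : Fin n → SF n} (hr : conj r = r) (hα : fld α false r = 0) :
    levi r α = -∑ l, fld α false (conj (α l)) * D (l, true) r := by
  have h0 : fld α true r = 0 := by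
    have := conj_fld α false r
    rw [hα, hr, map_zero] at this
    exact this.symm
  have h1 := congrArg (fld α false) h0
  rw [fld_true, map_zero, map_sum] at h1
  simp only [Derivation.leibniz, smul_eq_mul, Finset.sum_add_distrib] at h1
  rw [eq_neg_iff_add_eq_zero, ← h1, levi, Finset.sum_comm]
  congr 1
  · refine Finset.sum_congr rfl fun l _ => ?_
    rw [fld_false, Finset.mul_sum]
    exact Finset.sum_congr rfl fun j _ => by ring
  · exact Finset.sum_congr rfl fun l _ => by ring

theorem O_levi (h : Param k r c v p) (hr : conj r = r) (j₁ : Fin n) :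
    O₁ (k - 2) (pull c (levi r (tang r v j₁))) := by
  set u := pull c (D (j₁, false) r) with hu
  set α := tang r v j₁ with hα
  rw [levi_eq hr (fld_tang r v j₁), map_neg, map_sum]
  refine O.neg ?_
  have h1 : ∀ l, O₁ (k - 2) (pull c (fld α false (conj (α l))) -
      u * (D (0, false) (conj u) * conj (D (0, false) (c l)))) := by
    intro l
    have e1 := (h.rel_false j₁ (conj (α l))).mono (show k - 2 ≤ k - 1 by omega)
    have e2 := ((((h.pull_tang j₁ l).conj).D₁ false).mono
      (show k - 2 ≤ k - 1 - 1 by omega)).mul_left u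
    have e3 := (((((h.holo l).D₁ false).conj).mul_left (conj u)).mul_left u).mono
      (show k - 2 ≤ k - 1 by omega)
    convert (e1.add e2).add e3 using 1
    rw [D_comm (0, false) (0, true), conj_D (0, true) (D (0, false) (c l))]
    simp only [← hu, ← hα, map_sub, map_mul, Derivation.leibniz, Derivation.smul_apply,
      smul_eq_mul, pull_conj, bar_mk, Bool.not_true]
    ring
  have h2 : O₁ (k - 2) (∑ l, (pull c (fld α false (conj (α l))) -
      u * (D (0, false) (conj u) * conj (D (0, false) (c l)))) * pull c (D (l, true) r)) :=
    O_sum fun l _ => by rw [mul_comm]; exact (h1 l).mul_left _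
  have h3 := (h.sum_velocity.conj.mul_left (u * D (0, false) (conj u))).mono
    (show k - 2 ≤ k - 1 by omega)
  convert h2.add h3 using 1
  rw [map_sum, Finset.mul_sum, ← Finset.sum_add_distrib]
  refine Finset.sum_congr rfl fun l _ => ?_
  have key : conj (pull c (D (l, false) r)) = pull c (D (l, true) r) := by
    rw [← pull_conj, conj_D, hr]; rfl
  rw [map_mul, map_mul, key]
  ring

theorem exists_toCVF_of_inM1 {a : Fin n → SF n} {W : CVF n}
    (hW : InM1 (fun j => (a j : Cn n → ℂ)) W) :
    ∃ c₁ c₂ : SF n, W = toCVF (c₁ • fld a false + c₂ • fld a true) := by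
  obtain ⟨c₁, c₂, h1, h2, h3, h4⟩ := hW
  refine ⟨SF.mk c₁ h1, SF.mk c₂ h2, ?_⟩
  obtain ⟨hol, anti⟩ := W
  rw [toCVF, CVF.mk.injEq]
  constructor <;> funext j x
  · refine (h3 j x).trans ?_; simp
  · refine (h4 j x).trans ?_; simp

theorem exists_rel (h : Param k r c v p) (j₁ : Fin n) {W : CVF n}
    (hW : InM1 (fun j => (tang r v j₁ j : Cn n → ℂ)) W) :
    ∃ V P, W = toCVF V ∧ IsField V ∧ IsField P ∧ Rel c (k - 1) V P := by
  obtain ⟨c₁, c₂, rfl⟩ := exists_toCVF_of_inM1 hW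
  exact ⟨_, _, rfl, ((isField_fld _ _).smul _).add ((isField_fld _ _).smul _),
    (((isField_D _).smul _).smul _).add (((isField_D _).smul _).smul _),
    ((h.rel_false j₁).smul c₁).add ((h.rel_false j₁).conj.smul c₂)⟩

theorem exists_rel_comm (h : Param k r c v p) (j₁ : Fin n) {μ : ℕ} {G : CVF n}
    (hG : IsCommOf (fun j => (tang r v j₁ j : Cn n → ℂ)) μ G) :
    1 ≤ μ ∧ ∃ V P, G = toCVF V ∧ IsField V ∧ IsField P ∧ Rel c (k - μ) V P := by
  induction hG with
  | one W hW =>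
    refine ⟨le_rfl, ?_⟩
    simpa using h.exists_rel j₁ hW
  | @succ μ Y W hY hW ih =>
    obtain ⟨hμ, W, Q, rfl, hW', hQ, hr⟩ := ih
    obtain ⟨Y, P, rfl, hY', hP, hs⟩ := h.exists_rel j₁ hY
    refine ⟨by omega, ⁅Y, W⁆, ⁅P, Q⁆, (toCVF_lie hY' hW').symm, hY'.lie hW', hP.lie hQ, ?_⟩
    have := hs.lie hP hQ hr (by omega)
    convert this using 1
    push_cast
    ring

theorem pair_apply_eq_zero (h : Param k r c v p) (hk : 2 ≤ k) {V : Derivation ℂ (SF n) (SF n)}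
    {P : Derivation ℂ (SF 1) (SF 1)} (hP : IsField P) (hV : Rel c 1 V P) : pair r V p = 0 := by
  have h1 : ∀ j, V (X (j, false)) p = P (X (0, false)) 0 * D (0, false) (c j) 0 := by
    intro j
    have e := (hV (X (j, false))).apply_zero one_pos
    rw [sub_apply, pull_apply, h.base, sub_eq_zero] at e
    rw [e, pull_X_false, hP, Fintype.sum_prod_type]
    simp [(h.holo j).apply_zero (by omega)]
  have h2 := h.sum_velocity.apply_zero (by omega)
  simp only [sum_apply, mul_apply, pull_apply, h.base] at h2
  simp only [pair, sum_apply, mul_apply, h1]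
  calc _ = P (X (0, false)) 0 * ∑ j, D (j, false) r p * D (0, false) (c j) 0 := by
        rw [Finset.mul_sum]; exact Finset.sum_congr rfl fun j _ => by ring
    _ = 0 := by rw [h2, mul_zero]

theorem tang_apply (h : Param k r c v p) (hk : 2 ≤ k) (j₁ j : Fin n) :
    tang r v j₁ j p = D (j₁, false) r p * D (0, false) (c j) 0 := by
  have := (h.pull_tang j₁ j).apply_zero (by omega)
  rwa [sub_apply, mul_apply, pull_apply, pull_apply, h.base, sub_eq_zero] at this

end Param

theorem Param.exists_field {k : ℕ} {ρ : Cn n → ℝ} (hρ : ContDiff ℝ (⊤ : ℕ∞) ρ) {p : Cn n}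
    {c : Fin n → SF 1} {v : Fin n → SF n} (h : Param k (ofReal ρ hρ) c v p) (hk : 2 ≤ k)
    (hd : fderiv ℝ ρ p ≠ 0) : ∃ a : Fin n → Cn n → ℂ, (∀ j, ContDiff ℝ (⊤ : ℕ∞) (a j)) ∧
      (∀ x, ∑ j, a j x * wz j (cx ρ) x = 0) ∧ (∀ᶠ x in 𝓝 p, (fun j => a j x) ≠ 0) ∧
      (k : ℕ∞) ≤ tType ρ a p ∧ (k : ℕ∞) ≤ cType ρ a p := by
  have hk' : (2 : ℤ) ≤ k := by exact_mod_cast hk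
  obtain ⟨j₁, hj₁⟩ := exists_D_ne_zero hρ hd
  set α := tang (ofReal ρ hρ) v j₁ with hα
  refine ⟨fun j => α j, fun j => (α j).smooth, fun x => ?_, ?_, ?_, ?_⟩
  · have := congrArg (fun f : SF n => f x) (fld_tang (ofReal ρ hρ) v j₁)
    simpa only [fld_false, sum_apply, mul_apply, D_false, zero_apply, coe_ofReal] using this
  · obtain ⟨j, hj⟩ := h.ne
    have h0 : α j p ≠ 0 := by
      rw [hα, h.tang_apply hk']
      exact mul_ne_zero hj₁ hj
    filter_upwards [(α j).smooth.continuous.continuousAt.eventually_ne h0] with x hx he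
    exact hx (congrFun he j)
  · refine le_tType_iff.2 fun μ hμ G hG => ?_
    obtain ⟨hμ1, V, P, rfl, hV, hP, hr⟩ := h.exists_rel_comm j₁ hG
    rw [pairDRho_toCVF hρ]
    exact h.pair_apply_eq_zero hk' hP (hr.mono (by omega))
  · refine le_cType_iff.2 fun Ws hl hW => ?_
    have hlist : ∀ Ws : List (CVF n), (∀ W ∈ Ws, InM1 (fun j => (α j : Cn n → ℂ)) W) →
        ∃ l : List (Derivation ℂ (SF n) (SF n)), Ws = l.map toCVF ∧
          ∀ V ∈ l, IsField V ∧ ∃ P, IsField P ∧ Rel c (k - 1) V P := by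
      intro Ws
      induction Ws with
      | nil => exact fun _ => ⟨[], rfl, by simp⟩
      | cons W Ws ih =>
        intro hW
        simp only [List.mem_cons, forall_eq_or_imp] at hW
        obtain ⟨V, P, rfl, hV, hP, hr⟩ := h.exists_rel j₁ hW.1
        obtain ⟨l, rfl, hl⟩ := ih hW.2
        exact ⟨V :: l, rfl, by simpa using ⟨⟨hV, P, hP, hr⟩, hl⟩⟩
    obtain ⟨l, rfl, hl'⟩ := hlist Ws hW
    rw [coe_levi hρ, foldl_act l fun V hV => (hl' V hV).1]
    have h1 := Rel.foldl (fun V hV => (hl' V hV).2) (show (k : ℤ) - 2 ≤ k - 1 + 1 by omega)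
      (h.O_levi (conj_ofReal hρ) j₁)
    rw [List.length_map] at hl
    have := h1.apply_zero (by omega)
    rwa [pull_apply, h.base] at this

end SF

namespace SF

variable {n : ℕ}

theorem D_apply_of_analytic {F : SF 1} {g : ℂ → ℂ} {x : Cn 1}
    (h : ∀ᶠ y in 𝓝 x, F y = g (y 0)) (hg : AnalyticAt ℂ g (x 0)) :
    D (0, true) F x = 0 ∧ D (0, false) F x = deriv g (x 0) := by
  have h1 : HasFDerivAt (F : Cn 1 → ℂ) (((ContinuousLinearMap.toSpanSingleton ℂ
      (deriv g (x 0))).restrictScalars ℝ).comp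
        (ContinuousLinearMap.proj (R := ℝ) (φ := fun _ : Fin 1 => ℂ) 0)) x := by
    refine HasFDerivAt.congr_of_eventuallyEq ?_ h
    exact HasFDerivAt.comp (g := g) x
      (hg.differentiableAt.hasDerivAt.hasFDerivAt.restrictScalars ℝ)
      (ContinuousLinearMap.proj (R := ℝ) (φ := fun _ : Fin 1 => ℂ) 0).hasFDerivAt
  rw [D_eq, D_eq]
  simp only [smul_apply, add_apply, dir_apply, h1.fderiv, sgnI_true, sgnI_false]
  simp only [ContinuousLinearMap.comp_apply, ContinuousLinearMap.proj_apply, Pi.single_eq_same,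
    ContinuousLinearMap.coe_restrictScalars', ContinuousLinearMap.toSpanSingleton_apply,
    smul_eq_mul]
  constructor
  · linear_combination (deriv g (x 0) / 2) * Complex.I_sq
  · linear_combination (-deriv g (x 0) / 2) * Complex.I_sq

theorem exists_of_analyticAt {g : ℂ → ℂ} {p : Cn n} (j : Fin n) (hg : AnalyticAt ℂ g (p j)) :
    ∃ F : SF n, ∀ᶠ x in 𝓝 p, F x = g (x j) := by
  refine exists_eventuallyEq (f := fun x => g (x j)) ?_
  have hc : ContinuousAt (fun x : Cn n => x j) p := (continuous_apply j).continuousAt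
  filter_upwards [hc.eventually hg.eventually_analyticAt] with x hx
  exact (hx.contDiffAt.restrict_scalars ℝ).comp x (contDiff_apply ℝ ℂ j).contDiffAt

theorem exists_param {k : ℕ} {ρ : Cn n → ℝ} (hρ : ContDiff ℝ (⊤ : ℕ∞) ρ) {φ : ℂ → Cn n}
    (hφ : AnalyticAt ℂ φ 0) (hd : fderiv ℂ φ 0 ≠ 0)
    (hk : (k : ℕ∞) ≤ ordAt (fun ξ => ρ (φ ξ))) :
    ∃ c v, Param k (ofReal ρ hρ) c v (φ 0) := by
  have hφj : ∀ j, AnalyticAt ℂ (fun ζ => φ ζ j) 0 := fun j => analyticAt_pi_iff.1 hφ j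
  obtain ⟨j₀, hj₀⟩ : ∃ j, deriv (fun ζ => φ ζ j) 0 ≠ 0 := by
    by_contra! hall
    refine hd ?_
    have h1 : HasDerivAt φ 0 0 := hasDerivAt_pi.2 fun j => by
      have := (hφj j).differentiableAt.hasDerivAt
      rwa [hall j] at this
    simpa using h1.hasFDerivAt.fderiv
  choose c hc using fun j => exists_of_analyticAt (n := 1) (p := 0) 0 (hφj j)
  set ψ := (hφj j₀).hasStrictDerivAt.localInverse _ _ _ hj₀ with hψ
  have hψa : AnalyticAt ℂ ψ (φ 0 j₀) := (hφj j₀).analyticAt_localInverse hj₀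
  have hψl : ∀ᶠ ζ in 𝓝 0, ψ (φ ζ j₀) = ζ := (hφj j₀).hasStrictDerivAt.eventually_left_inverse hj₀
  have hψ0 : ψ (φ 0 j₀) = 0 := hψl.self_of_nhds
  have hva : ∀ j, AnalyticAt ℂ (fun z => deriv (fun ζ => φ ζ j) (ψ z)) (φ 0 j₀) := fun j =>
    AnalyticAt.comp (g := deriv fun ζ => φ ζ j) (by rw [hψ0]; exact (hφj j).deriv) hψa
  choose v hv using fun j => exists_of_analyticAt (p := φ 0) j₀ (hva j)
  have hev : ∀ {q : ℂ → Prop}, (∀ᶠ ζ in 𝓝 0, q ζ) → ∀ᶠ x : Cn 1 in 𝓝 0, q (x 0) := fun h =>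
    (continuous_apply (0 : Fin 1)).continuousAt.eventually (by simpa using h)
  have hD : ∀ j, ∀ᶠ x in 𝓝 (0 : Cn 1), D (0, true) (c j) x = 0 ∧
      D (0, false) (c j) x = deriv (fun ζ => φ ζ j) (x 0) := fun j => by
    filter_upwards [(hc j).eventually_nhds, hev (hφj j).eventually_analyticAt] with x h1 h2
    exact D_apply_of_analytic h1 h2
  have htup : ∀ᶠ x in 𝓝 (0 : Cn 1), tup c x = φ (x 0) := by
    filter_upwards [Filter.eventually_all.2 hc] with x hx
    funext j
    exact hx j
  have htup0 : tup c 0 = φ 0 := htup.self_of_nhds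
  refine ⟨c, v, fun j => O_of_eventually_eq_zero ((hD j).mono fun x hx => hx.1) _, htup0,
    ⟨j₀, ?_⟩, fun j => O_of_eventually_eq_zero ?_ _, ?_⟩
  · rw [(hD j₀).self_of_nhds.2]
    exact hj₀
  · have hcont : ContinuousAt (tup c) 0 := (tup_smooth c).continuous.continuousAt
    have h1 : ∀ᶠ x in 𝓝 (0 : Cn 1), v j (tup c x) =
        deriv (fun ζ => φ ζ j) (ψ (tup c x j₀)) := by
      refine hcont.eventually (p := fun y => v j y = deriv (fun ζ => φ ζ j) (ψ (y j₀))) ?_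
      rw [htup0]
      exact hv j
    filter_upwards [h1, htup, hD j, hev hψl] with x h1 h2 h3 h4
    rw [sub_apply, pull_apply, h1, h2, h3.2, h4, sub_self]
  · refine (O_one_iff_ordAt (g := fun ξ => ρ (φ ξ)) ?_ ?_).2 hk
    · exact hρ.contDiffAt.comp _ (hφ.contDiffAt.restrict_scalars ℝ)
    · filter_upwards [htup] with x hx
      rw [pull_apply, hx, ofReal_apply]

theorem exists_param_two {ρ : Cn 3 → ℝ} (hρ : ContDiff ℝ (⊤ : ℕ∞) ρ) {p : Cn 3} (hp : ρ p = 0) :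
    ∃ c v, Param 2 (ofReal ρ hρ) c v p := by
  obtain ⟨u, hu, j, hj⟩ : ∃ u : Fin 3 → ℂ, ∑ j, u j * D (j, false) (ofReal ρ hρ) p = 0 ∧
      ∃ j, u j ≠ 0 := by
    by_cases h0 : D (0, false) (ofReal ρ hρ) p = 0
    · exact ⟨Pi.single 0 1, by simp [Fin.sum_univ_three, h0], 0, by simp⟩
    · refine ⟨![-D (1, false) (ofReal ρ hρ) p, D (0, false) (ofReal ρ hρ) p, 0], ?_, 1, by simpa⟩
      simp [Fin.sum_univ_three]
      ring
  set c : Fin 3 → SF 1 := fun j => algebraMap ℂ _ (p j) + u j • X (0, false) with hc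
  have hDf : ∀ j, D (0, false) (c j) = algebraMap ℂ _ (u j) := fun j => by
    simp [hc, D_X, Algebra.algebraMap_eq_smul_one]
  have hDt : ∀ j, D (0, true) (c j) = 0 := fun j => by simp [hc, D_X]
  have hbase : tup c 0 = p := by
    funext j
    simp [tup, hc]
  refine ⟨c, fun j => algebraMap ℂ _ (u j), fun j => by rw [hDt]; exact O_zero _, hbase,
    ⟨j, by simpa [hDf] using hj⟩, fun j => ?_, ?_⟩
  · rw [hDf, AlgHom.commutes, sub_self]
    exact O_zero _
  · refine O_iff.2 ⟨fun _ => by rw [pull_apply, hbase, ofReal_apply, hp, Complex.ofReal_zero],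
      fun i => ?_⟩
    have h1 : D (0, false) (pull c (ofReal ρ hρ)) 0 = 0 := by
      rw [D_pull, Fintype.sum_prod_type]
      simp only [Fintype.sum_bool, pull_X_false, pull_X_true, hDf, sum_apply, add_apply,
        mul_apply, pull_apply, hbase, algebraMap_apply]
      rw [← hu]
      refine Finset.sum_congr rfl fun j _ => ?_
      have : D (0, false) (conj (c j)) = 0 := by
        have := conj_D (0, true) (c j)
        rw [hDt, map_zero] at this
        exact this.symm
      rw [this, zero_apply]
      ring
    refine (O_one (w := fun _ : Fin 1 => 1) ?_ fun _ => one_pos).mono (by simp)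
    obtain ⟨i, b⟩ := i
    obtain rfl : i = 0 := Subsingleton.elim _ _
    cases b
    · exact h1
    · have := congrArg (fun f : SF 1 => f 0) (conj_D (0, false) (pull c (ofReal ρ hρ)))
      rw [← pull_conj, conj_ofReal] at this
      simp only [conj_apply, h1, map_zero] at this
      exact this.symm

theorem sSup_eq_of_forall_nat {S T : Set ℕ∞}
    (h : ∀ k : ℕ, (∃ s ∈ S, (k : ℕ∞) ≤ s) ↔ ∃ t ∈ T, (k : ℕ∞) ≤ t) : sSup S = sSup T := by
  have key : ∀ {S T : Set ℕ∞}, (∀ k : ℕ, (∃ s ∈ S, (k : ℕ∞) ≤ s) → ∃ t ∈ T, (k : ℕ∞) ≤ t) →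
      sSup S ≤ sSup T := by
    intro S T h
    refine sSup_le fun s hs => ENat.forall_natCast_le_iff_le.1 fun k hk => ?_
    obtain ⟨t, ht, hkt⟩ := h k ⟨s, hs, hk⟩
    exact hkt.trans (le_sSup ht)
  exact le_antisymm (key fun k => (h k).1) (key fun k => (h k).2)

end SF

/-- Bloom conjecture in ℂ³, Huang–Yin. For a smooth pseudoconvex real
hypersurface `M ⊂ ℂ³` and `p ∈ M`, the three regular 1-types agree:
`t^{(1)}(M,p) = c^{(1)}(M,p) = a^{(1)}(M,p)`. -/
theorem bloom_dim3 (ρ : Cn 3 → ℝ) (hρ : ContDiff ℝ (⊤ : ℕ∞) ρ)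
    (M : Set (Cn 3)) (hM : M = {x | ρ x = 0}) (hreg : ∀ x ∈ M, fderiv ℝ ρ x ≠ 0)
    (hpsc : Pseudoconvex ρ M)
    (p : Cn 3) (hp : p ∈ M) :
    tOne ρ M p = cOne ρ M p ∧ cOne ρ M p = aOne ρ p := by
  subst hM
  have hp : ρ p = 0 := hp
  have hreg : ∀ x, ρ x = 0 → fderiv ℝ ρ x ≠ 0 := hreg
  have curve : ∀ {k : ℕ} {a : Fin 3 → Cn 3 → ℂ}, (∀ j, ContDiff ℝ (⊤ : ℕ∞) (a j)) →
      (∀ᶠ x in 𝓝 p, x ∈ {x | ρ x = 0} → ∑ j, a j x * wz j (cx ρ) x = 0) →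
      (∀ᶠ x in 𝓝 p, (fun j => a j x) ≠ 0) → ((k : ℕ∞) ≤ tType ρ a p ∨ (k : ℕ∞) ≤ cType ρ a p) →
      ∃ φ : ℂ → Cn 3, AnalyticAt ℂ φ 0 ∧ φ 0 = p ∧ fderiv ℂ φ 0 ≠ 0 ∧
        (k : ℕ∞) ≤ ordAt (fun ξ => ρ (φ ξ)) := fun ha hat ha0 hk =>
    (SF.curve_of_type hρ hreg hpsc hp ha hat ha0.self_of_nhds hk).exists_analytic hρ
  have field : ∀ {k : ℕ} {φ : ℂ → Cn 3}, AnalyticAt ℂ φ 0 → φ 0 = p → fderiv ℂ φ 0 ≠ 0 →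
      (k : ℕ∞) ≤ ordAt (fun ξ => ρ (φ ξ)) → ∃ a : Fin 3 → Cn 3 → ℂ,
        (∀ j, ContDiff ℝ (⊤ : ℕ∞) (a j)) ∧ (∀ x, ∑ j, a j x * wz j (cx ρ) x = 0) ∧
        (∀ᶠ x in 𝓝 p, (fun j => a j x) ≠ 0) ∧
        (k : ℕ∞) ≤ tType ρ a p ∧ (k : ℕ∞) ≤ cType ρ a p := by
    intro k φ hφ h0 hd hk
    rcases lt_or_ge k 2 with h2 | h2
    · obtain ⟨c, v, h⟩ := SF.exists_param_two hρ hp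
      obtain ⟨a, h1, h3, h4, h5, h6⟩ := SF.Param.exists_field (k := 2) hρ h le_rfl (hreg p hp)
      have hk2 : (k : ℕ∞) ≤ (2 : ℕ) := Nat.cast_le.2 h2.le
      exact ⟨a, h1, h3, h4, hk2.trans h5, hk2.trans h6⟩
    · obtain ⟨c, v, h⟩ := SF.exists_param hρ hφ hd hk
      rw [h0] at h
      exact SF.Param.exists_field hρ h h2 (hreg p hp)
  constructor
  · refine SF.sSup_eq_of_forall_nat fun k => ⟨?_, ?_⟩
    · rintro ⟨_, ⟨a, ha, hat, ha0, rfl⟩, hk⟩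
      obtain ⟨φ, h1, h2, h3, h4⟩ := curve ha hat ha0 (.inl hk)
      obtain ⟨a, h5, h6, h7, -, h8⟩ := field h1 h2 h3 h4
      exact ⟨_, ⟨a, h5, .of_forall fun x _ => h6 x, h7, rfl⟩, h8⟩
    · rintro ⟨_, ⟨a, ha, hat, ha0, rfl⟩, hk⟩
      obtain ⟨φ, h1, h2, h3, h4⟩ := curve ha hat ha0 (.inr hk)
      obtain ⟨a, h5, h6, h7, h8, -⟩ := field h1 h2 h3 h4
      exact ⟨_, ⟨a, h5, .of_forall fun x _ => h6 x, h7, rfl⟩, h8⟩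
  · refine SF.sSup_eq_of_forall_nat fun k => ⟨?_, ?_⟩
    · rintro ⟨_, ⟨a, ha, hat, ha0, rfl⟩, hk⟩
      obtain ⟨φ, h1, h2, h3, h4⟩ := curve ha hat ha0 (.inr hk)
      exact ⟨_, ⟨φ, h1, h2, h3, rfl⟩, h4⟩
    · rintro ⟨_, ⟨φ, h1, h2, h3, rfl⟩, h4⟩
      obtain ⟨a, h5, h6, h7, -, h8⟩ := field h1 h2 h3 h4
      exact ⟨_, ⟨a, h5, .of_forall fun x _ => h6 x, h7, rfl⟩, h8⟩
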